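/- Let n ≥ 2. Every continuous, translation invariant, SU(n)-invariant valuation μ on ℂⁿ is even, i.e. μ(−K) = μ(K) for every convex body K ⊆ ℂⁿ. -/

import Mathlib

open MeasureTheory
open scoped ENNReal

noncomputable section

/-- `ℂⁿ`, regarded as a real inner product space via `Re⟨z,w⟫`. -/
abbrev Cn (n : ℕ) := EuclideanSpace ℂ (Fin n)

/-- `μ` is a valuation: it is finitely additive on convex bodies of `ℂⁿ`. -/
def IsValuation {n : ℕ} (μ : ConvexBody (Cn n) → ℂ) : Prop :=
  ∀ K L U I : ConvexBody (Cn n),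
    (U : Set (Cn n)) = (K : Set (Cn n)) ∪ (L : Set (Cn n)) →
    (I : Set (Cn n)) = (K : Set (Cn n)) ∩ (L : Set (Cn n)) →
    μ U + μ I = μ K + μ L

/-- `μ` is translation invariant. -/
def TranslationInvariant {n : ℕ} (μ : ConvexBody (Cn n) → ℂ) : Prop :=
  ∀ (x : Cn n) (K L : ConvexBody (Cn n)),
    (L : Set (Cn n)) = (fun y => x + y) '' (K : Set (Cn n)) → μ L = μ K

/-- `μ` is invariant under the special unitary group `SU(n)` acting on `ℂⁿ`. -/
def SUInvariant {n : ℕ} (μ : ConvexBody (Cn n) → ℂ) : Prop :=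
  ∀ g ∈ Matrix.specialUnitaryGroup (Fin n) ℂ, ∀ K L : ConvexBody (Cn n),
    (L : Set (Cn n)) = (Matrix.toEuclideanLin g) '' (K : Set (Cn n)) → μ L = μ K

namespace SUVal

open scoped RealInnerProductSpace
open Filter Topology

section Supp
variable {X : Type*} [NormedAddCommGroup X] [InnerProductSpace ℝ X]

/-- The unit sphere of `X`. -/
abbrev Sph (X : Type*) [NormedAddCommGroup X] := Metric.sphere (0 : X) 1

/-- Continuous functions on the unit sphere. -/
abbrev CS (X : Type*) [NormedAddCommGroup X] := C(Sph X, ℝ)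

/-- `h` is the restriction to the sphere of a support function. -/
def IsSupp (h : CS X) : Prop :=
  ∀ x : Sph X, ∃ y : X, ⟪y, (x : X)⟫ = h x ∧ ∀ u : Sph X, ⟪y, (u : X)⟫ ≤ h u

/-- The linear function `x ↦ ⟪a, x⟫` on the sphere. -/
def lin (a : X) : CS X := ⟨fun x => ⟪a, (x : X)⟫, by fun_prop⟩

@[simp] theorem lin_apply (a : X) (x : Sph X) : lin a x = ⟪a, (x : X)⟫ := rfl

/-- The support function of the segment `[-v, v]`. -/
def seg (v : X) : CS X := |lin v|

@[simp] theorem seg_apply (v : X) (x : Sph X) : seg v x = |⟪v, (x : X)⟫| := rfl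

theorem lin_neg (a : X) : lin (-a) = -lin a := by
  ext x; simp

theorem lin_zero : lin (0 : X) = 0 := by ext x; simp

theorem seg_smul (c : ℝ) (a : X) : seg (c • a) = |c| • seg a := by
  ext x; simp [inner_smul_left, abs_mul]

theorem seg_neg (a : X) : seg (-a) = seg a := by
  ext x; simp

theorem IsSupp.add {h k : CS X} (hh : IsSupp h) (hk : IsSupp k) : IsSupp (h + k) := by
  intro x
  obtain ⟨y, hy, hy'⟩ := hh x
  obtain ⟨z, hz, hz'⟩ := hk x
  refine ⟨y + z, by simp [inner_add_left, hy, hz], fun u => ?_⟩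
  simpa [inner_add_left] using add_le_add (hy' u) (hz' u)

theorem IsSupp.smul {h : CS X} (hh : IsSupp h) {c : ℝ} (hc : 0 ≤ c) : IsSupp (c • h) := by
  intro x
  obtain ⟨y, hy, hy'⟩ := hh x
  refine ⟨c • y, by simp [inner_smul_left, hy], fun u => ?_⟩
  simpa [inner_smul_left] using mul_le_mul_of_nonneg_left (hy' u) hc

theorem IsSupp.sup {h k : CS X} (hh : IsSupp h) (hk : IsSupp k) : IsSupp (h ⊔ k) := by
  intro x
  rcases le_total (h x) (k x) with hx | hx
  · obtain ⟨z, hz, hz'⟩ := hk x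
    exact ⟨z, by simp [hz, hx], fun u => (hz' u).trans (by simp)⟩
  · obtain ⟨z, hz, hz'⟩ := hh x
    exact ⟨z, by simp [hz, hx], fun u => (hz' u).trans (by simp)⟩

theorem isSupp_lin (a : X) : IsSupp (lin a) := fun _ => ⟨a, rfl, fun _ => le_rfl⟩

theorem isSupp_zero : IsSupp (0 : CS X) := by
  have := isSupp_lin (0 : X); rwa [lin_zero] at this

theorem seg_eq (v : X) : seg v = lin v ⊔ lin (-v) := by
  rw [lin_neg]; rfl

theorem isSupp_seg (a : X) : IsSupp (seg a) := by
  rw [seg_eq]; exact (isSupp_lin a).sup (isSupp_lin _)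

theorem norm_sph (x : Sph X) : ‖(x : X)‖ = 1 := by
  simpa using x.2

theorem inner_self_sph (x : Sph X) : ⟪(x : X), (x : X)⟫ = 1 := by
  rw [real_inner_self_eq_norm_sq, norm_sph]; norm_num

theorem isSupp_const {c : ℝ} (hc : 0 ≤ c) : IsSupp (ContinuousMap.const (Sph X) c) := by
  intro x
  refine ⟨c • (x : X), ?_, fun u => ?_⟩
  · simp [inner_smul_left, norm_sph]
  · simp only [inner_smul_left, ContinuousMap.const_apply]
    have := real_inner_le_norm (x : X) u
    rw [norm_sph, norm_sph] at this
    simpa using mul_le_mul_of_nonneg_left this hc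

theorem isSupp_one : IsSupp (1 : CS X) := isSupp_const zero_le_one

theorem IsSupp.sum {ι : Type*} (s : Finset ι) {f : ι → CS X} (hf : ∀ i ∈ s, IsSupp (f i)) :
    IsSupp (∑ i ∈ s, f i) := by
  classical
  induction s using Finset.induction_on with
  | empty => simpa using isSupp_zero
  | insert i s hi ih =>
    rw [Finset.sum_insert hi]
    exact (hf i (by simp)).add (ih fun j hj => hf j (by simp [hj]))

/-- Normalisation of a nonzero vector. -/
def nrm (y : X) (hy : y ≠ 0) : Sph X := ⟨‖y‖⁻¹ • y, by simp [norm_smul, hy]⟩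

theorem smul_nrm (y : X) (hy : y ≠ 0) : ‖y‖ • (nrm y hy : X) = y := by
  simp [nrm, smul_smul, hy]

theorem inner_nrm (z y : X) (hy : y ≠ 0) : ⟪z, y⟫ = ‖y‖ * ⟪z, (nrm y hy : X)⟫ := by
  conv_lhs => rw [← smul_nrm y hy, inner_smul_right]

theorem norm_le_of_forall_inner_le {y : X} {c : ℝ} (hc : 0 ≤ c)
    (h : ∀ u : Sph X, ⟪y, (u : X)⟫ ≤ c) : ‖y‖ ≤ c := by
  by_cases hy : y = 0
  · simpa [hy]
  · have h1 := h (nrm y hy)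
    have h2 := inner_nrm y y hy
    rw [real_inner_self_eq_norm_sq] at h2
    have h3 : 0 < ‖y‖ := norm_pos_iff.2 hy
    nlinarith

theorem norm_le_of_mem {h : CS X} {y : X} [FiniteDimensional ℝ X]
    (hy : ∀ u : Sph X, ⟪y, (u : X)⟫ ≤ h u) : ‖y‖ ≤ ‖h‖ :=
  norm_le_of_forall_inner_le (norm_nonneg _) fun u => (hy u).trans
    ((le_abs_self _).trans (h.norm_coe_le_norm u))

variable [FiniteDimensional ℝ X]

theorem isClosed_isSupp : IsClosed {h : CS X | IsSupp h} := by
  haveI := FiniteDimensional.proper ℝ X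
  rw [← isSeqClosed_iff_isClosed]
  intro hs h hmem hlim x
  choose y hy hy' using fun n => hmem n x
  obtain ⟨C, hC⟩ := hlim.norm.bddAbove_range
  have hb : ∀ n, y n ∈ Metric.closedBall (0 : X) C := fun n => by
    simpa using (norm_le_of_mem (hy' n)).trans (hC ⟨n, rfl⟩)
  obtain ⟨z, -, φ, hφ, hz⟩ := (isCompact_closedBall (0 : X) C).tendsto_subseq hb
  have hev : ∀ u : Sph X, Tendsto (fun n => hs (φ n) u) atTop (𝓝 (h u)) := fun u =>
    ((show Continuous fun k : CS X => k u by fun_prop).tendsto h).comp (hlim.comp hφ.tendsto_atTop)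
  have hin : ∀ u : X, Tendsto (fun n => ⟪y (φ n), u⟫) atTop (𝓝 ⟪z, u⟫) := fun u =>
    hz.inner tendsto_const_nhds
  refine ⟨z, tendsto_nhds_unique (hin x) ((hev x).congr fun n => (hy _).symm), fun u => ?_⟩
  exact le_of_tendsto_of_tendsto' (hin u) (hev u) fun n => hy' _ u

theorem convex_isSupp : Convex ℝ {h : CS X | IsSupp h} := fun _ hh _ hk _ _ ha hb _ =>
  (IsSupp.smul hh ha).add (IsSupp.smul hk hb)

/-- The points supported by `h`. -/
def bodySet (h : CS X) : Set X := {y | ∀ u : Sph X, ⟪y, (u : X)⟫ ≤ h u}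

theorem convex_bodySet (h : CS X) : Convex ℝ (bodySet h) := by
  intro y hy z hz a b ha hb hab u
  simp only [inner_add_left, inner_smul_left]
  have := mul_le_mul_of_nonneg_left (hy u) ha
  have := mul_le_mul_of_nonneg_left (hz u) hb
  have : h u = a * h u + b * h u := by rw [← add_mul, hab, one_mul]
  simp only [conj_trivial]
  linarith

theorem isCompact_bodySet (h : CS X) : IsCompact (bodySet h) := by
  haveI := FiniteDimensional.proper ℝ X
  refine Metric.isCompact_of_isClosed_isBounded ?_ ?_
  · simp only [bodySet, Set.ofPred_forall]
    exact isClosed_iInter fun u => isClosed_le (by fun_prop) continuous_const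
  · exact (Metric.isBounded_closedBall (x := (0 : X)) (r := ‖h‖)).subset fun y hy => by
      simpa using norm_le_of_mem hy

instance [Nontrivial X] : Nonempty (Sph X) := by
  obtain ⟨y, hy⟩ := exists_ne (0 : X)
  exact ⟨nrm y hy⟩

variable [Nontrivial X]

theorem IsSupp.nonempty {h : CS X} (hh : IsSupp h) : (bodySet h).Nonempty := by
  obtain ⟨y, -, hy⟩ := hh (Classical.arbitrary _)
  exact ⟨y, hy⟩

open Classical in
/-- The convex body with support function `h`. -/
def body (h : CS X) : ConvexBody X :=
  if hh : IsSupp h then ⟨bodySet h, convex_bodySet h, isCompact_bodySet h, hh.nonempty⟩ else 0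

theorem coe_body {h : CS X} (hh : IsSupp h) : (body h : Set X) = bodySet h := by
  simp [body, hh]

theorem bodySet_inf (h k : CS X) : bodySet (h ⊓ k) = bodySet h ∩ bodySet k := by
  ext y; simp [bodySet, forall_and]

theorem bodySet_sup {h k : CS X} (hm : IsSupp (h ⊓ k)) :
    bodySet (h ⊔ k) = bodySet h ∪ bodySet k := by
  apply subset_antisymm
  · intro y hy
    by_contra hcon
    simp only [bodySet, Set.mem_union, Set.mem_ofPred_eq, not_or, not_forall, not_le] at hcon hy
    obtain ⟨⟨u₁, h₁⟩, u₂, h₂⟩ := hcon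
    have hz : ∀ z ∈ bodySet (h ⊓ k), ⟪z, (u₁ : X)⟫ < ⟪y, (u₁ : X)⟫ ∧ ⟪z, (u₂ : X)⟫ < ⟪y, (u₂ : X)⟫ :=
      fun z hz => ⟨((hz u₁).trans (by simp)).trans_lt h₁, ((hz u₂).trans (by simp)).trans_lt h₂⟩
    by_cases hopp : ∃ t ∈ Set.Icc (0 : ℝ) 1, (1 - t) • (u₁ : X) + t • (u₂ : X) = 0
    · obtain ⟨t, ⟨ht0, ht1⟩, ht⟩ := hopp
      obtain ⟨z, hz'⟩ := hm.nonempty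
      obtain ⟨ha, hb⟩ := hz z hz'
      have e : ∀ w : X, (1 - t) * ⟪w, (u₁ : X)⟫ + t * ⟪w, (u₂ : X)⟫ = 0 := fun w => by
        have := congrArg (fun v => ⟪w, v⟫) ht
        simpa [inner_add_right, inner_smul_right] using this
      have e1 := e z
      have e2 := e y
      rcases ht0.eq_or_lt with h0 | h0
      · subst h0; simp at e1 e2; linarith
      · nlinarith
    · push Not at hopp
      let γ : Set.Icc (0 : ℝ) 1 → Sph X := fun t =>
        nrm ((1 - (t : ℝ)) • (u₁ : X) + (t : ℝ) • (u₂ : X)) (hopp t t.2)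
      have hγ : Continuous γ := by
        refine Continuous.subtype_mk ?_ _
        refine Continuous.smul (Continuous.inv₀ (by fun_prop) fun t => ?_) (by fun_prop)
        exact norm_ne_zero_iff.2 (hopp t t.2)
      have hγ0 : γ ⟨0, by simp⟩ = u₁ := by
        apply Subtype.ext; simp [γ, nrm]
      have hγ1 : γ ⟨1, by simp⟩ = u₂ := by
        apply Subtype.ext; simp [γ, nrm]
      have hcont : Continuous fun t => h (γ t) - k (γ t) := by fun_prop
      haveI : PreconnectedSpace (Set.Icc (0 : ℝ) 1) :=
        Subtype.preconnectedSpace isPreconnected_Icc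
      have hd1 : h u₁ < k u₁ := by
        have := hy u₁; simp at this; rcases this with h' | h' <;> linarith
      have hd2 : k u₂ < h u₂ := by
        have := hy u₂; simp at this; rcases this with h' | h' <;> linarith
      obtain ⟨t, ht⟩ := mem_range_of_exists_le_of_exists_ge hcont (c := 0)
        ⟨⟨0, by simp⟩, by rw [hγ0]; linarith⟩ ⟨⟨1, by simp⟩, by rw [hγ1]; linarith⟩
      obtain ⟨z, hzx, hz'⟩ := hm (γ t)
      obtain ⟨ha, hb⟩ := hz z hz'
      have heq : h (γ t) = k (γ t) := by simpa [sub_eq_zero] using ht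
      have hyx := hy (γ t)
      simp [heq] at hzx hyx
      rw [← hzx] at hyx
      have hle := mul_le_mul_of_nonneg_left hyx
        (norm_nonneg ((1 - (t : ℝ)) • (u₁ : X) + (t : ℝ) • (u₂ : X)))
      rw [← inner_nrm, ← inner_nrm] at hle
      simp only [inner_add_right, inner_smul_right] at hle
      have h0 := t.2.1
      have h1 := t.2.2
      rcases h0.eq_or_lt with h0' | h0'
      · rw [← h0'] at hle; simp at hle; linarith
      · nlinarith
  · rintro y (hy | hy) u
    · exact (hy u).trans (by simp)
    · exact (hy u).trans (by simp)

theorem bodySet_add_lin (h : CS X) (a : X) : bodySet (h + lin a) = (fun y => a + y) '' bodySet h := by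
  ext y
  simp only [bodySet, Set.mem_ofPred_eq, Set.mem_image]
  constructor
  · intro hy
    exact ⟨y - a, fun u => by simpa [inner_sub_left] using hy u, by simp⟩
  · rintro ⟨z, hz, rfl⟩ u
    have := hz u
    simp [inner_add_left]; linarith

theorem dist_body_le {h k : CS X} (hh : IsSupp h) (hk : IsSupp k) :
    dist (body h) (body k) ≤ dist h k := by
  have key : ∀ {h k : CS X}, IsSupp h → IsSupp k → ∀ y ∈ bodySet h, ∃ z ∈ bodySet k,
      dist y z ≤ dist h k := by
    intro h k hh hk y hy
    obtain ⟨z, hz, hzmin⟩ := (isCompact_bodySet k).exists_isMinOn hk.nonempty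
      (f := fun z => ‖y - z‖) (by fun_prop)
    refine ⟨z, hz, ?_⟩
    by_cases hyz : y - z = 0
    · rw [dist_eq_norm, hyz]; simp
    have hinf : ‖y - z‖ = ⨅ w : bodySet k, ‖y - w‖ := by
      haveI : Nonempty (bodySet k) := ⟨⟨z, hz⟩⟩
      exact le_antisymm (le_ciInf fun w => hzmin w.2)
        (ciInf_le ⟨0, by rintro _ ⟨w, rfl⟩; positivity⟩ (⟨z, hz⟩ : bodySet k))
    have hproj := (norm_eq_iInf_iff_real_inner_le_zero (convex_bodySet k) hz).1 hinf
    obtain ⟨w, hw, hw'⟩ := hk (nrm (y - z) hyz)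
    have h1 := hproj w hw'
    have h2 := hy (nrm (y - z) hyz)
    rw [inner_sub_right, real_inner_comm, real_inner_comm z, inner_nrm _ _ hyz,
      inner_nrm z _ hyz, hw] at h1
    have hn : 0 < ‖y - z‖ := norm_pos_iff.2 hyz
    have h3 := inner_nrm (y - z) (y - z) hyz
    rw [real_inner_self_eq_norm_sq, inner_sub_left] at h3
    have h4 : |h (nrm (y - z) hyz) - k (nrm (y - z) hyz)| ≤ dist h k :=
      ContinuousMap.dist_apply_le_dist (f := h) (g := k) _
    rw [dist_eq_norm]
    have h5 : k (nrm (y - z) hyz) ≤ ⟪z, (nrm (y - z) hyz : X)⟫ := by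
      by_contra hcc; push Not at hcc; nlinarith
    have h6 := le_abs_self (h (nrm (y - z) hyz) - k (nrm (y - z) hyz))
    have h7 : ‖y - z‖ = ⟪y, (nrm (y - z) hyz : X)⟫ - ⟪z, (nrm (y - z) hyz : X)⟫ := by
      apply mul_left_cancel₀ hn.ne'; rw [← h3]; ring
    linarith
  rw [← ConvexBody.hausdorffDist_coe, coe_body hh, coe_body hk]
  refine Metric.hausdorffDist_le_of_mem_dist dist_nonneg (key hh hk) fun y hy => ?_
  obtain ⟨z, hz, hyz⟩ := key hk hh y hy
  exact ⟨z, hz, by rwa [dist_comm h]⟩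

/-- The support function of a convex body. -/
def suppFn (K : ConvexBody X) : CS X :=
  ⟨fun u => sSup ((fun y : X => ⟪y, (u : X)⟫) '' (K : Set X)),
    K.isCompact.continuous_sSup (f := fun (u : Sph X) (y : X) => ⟪y, (u : X)⟫) (by
      simp only [Function.HasUncurry.uncurry]; fun_prop)⟩

theorem suppFn_spec (K : ConvexBody X) (u : Sph X) :
    (∃ y ∈ K, ⟪y, (u : X)⟫ = suppFn K u) ∧ ∀ y ∈ K, ⟪y, (u : X)⟫ ≤ suppFn K u := by
  have hc : ContinuousOn (fun y : X => ⟪y, (u : X)⟫) K := by fun_prop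
  refine ⟨?_, fun y hy => le_csSup (K.isCompact.bddAbove_image hc) ⟨y, hy, rfl⟩⟩
  obtain ⟨y, hy, h⟩ := K.isCompact.exists_sSup_image_eq K.nonempty hc
  exact ⟨y, hy, h.symm⟩

theorem isSupp_suppFn (K : ConvexBody X) : IsSupp (suppFn K) := fun u => by
  obtain ⟨y, hy, h⟩ := (suppFn_spec K u).1
  exact ⟨y, h, fun v => (suppFn_spec K v).2 y hy⟩

theorem bodySet_suppFn (K : ConvexBody X) : bodySet (suppFn K) = K := by
  apply subset_antisymm
  · intro y hy
    by_contra hyK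
    obtain ⟨f, s, hs, hs'⟩ := geometric_hahn_banach_closed_point K.convex K.isClosed hyK
    obtain ⟨a, rfl⟩ := (InnerProductSpace.toDual ℝ X).surjective f
    simp only [InnerProductSpace.toDual_apply_apply] at hs hs'
    have ha : a ≠ 0 := by
      rintro rfl
      obtain ⟨z, hz⟩ := K.nonempty
      have := hs z hz
      simp at this hs'; linarith
    obtain ⟨z, hz, hzu⟩ := (suppFn_spec K (nrm a ha)).1
    have h1 := hy (nrm a ha)
    rw [← hzu] at h1
    have h2 := hs z hz
    rw [real_inner_comm, inner_nrm _ _ ha] at h2 hs'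
    have := mul_le_mul_of_nonneg_left h1 (norm_nonneg a)
    linarith
  · exact fun y hy u => (suppFn_spec K u).2 y hy

theorem body_suppFn (K : ConvexBody X) : body (suppFn K) = K :=
  ConvexBody.ext (by rw [coe_body (isSupp_suppFn K), bodySet_suppFn])

end Supp

section Val
variable {X : Type*} [NormedAddCommGroup X] [InnerProductSpace ℝ X]

/-- Continuous translation invariant valuations, in terms of support functions. -/
structure IsVal (ν : CS X → ℂ) : Prop where
  cont : ContinuousOn ν {h | IsSupp h}
  trans : ∀ h a, IsSupp h → ν (h + lin a) = ν h
  val : ∀ h k, IsSupp h → IsSupp k → IsSupp (h ⊓ k) → ν (h ⊔ k) + ν (h ⊓ k) = ν h + ν k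

/-- The difference operator in the direction `Z`. -/
def dl (Z : CS X) (ν : CS X → ℂ) : CS X → ℂ := fun h => ν (h + Z) - ν h

theorem sup_add_fn (h k Z : CS X) : (h + Z) ⊔ (k + Z) = h ⊔ k + Z := by
  ext x; simp [max_add_add_right]

theorem inf_add_fn (h k Z : CS X) : (h + Z) ⊓ (k + Z) = h ⊓ k + Z := by
  ext x; simp [min_add_add_right]

theorem IsVal.dl {ν : CS X → ℂ} (hν : IsVal ν) {Z : CS X} (hZ : IsSupp Z) : IsVal (dl Z ν) where
  cont := by
    refine ContinuousOn.sub (hν.cont.comp (by fun_prop) fun h hh => ?_) hν.cont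
    exact IsSupp.add hh hZ
  trans h a hh := by
    simp only [SUVal.dl]
    rw [add_right_comm, hν.trans _ _ (hh.add hZ), hν.trans _ _ hh]
  val h k hh hk hi := by
    have h1 := hν.val h k hh hk hi
    have h2 := hν.val (h + Z) (k + Z) (hh.add hZ) (hk.add hZ) (by
      rw [inf_add_fn]; exact hi.add hZ)
    rw [sup_add_fn, inf_add_fn] at h2
    simp only [SUVal.dl]
    linear_combination h2 - h1

theorem IsVal.locality {ν : CS X → ℂ} (hν : IsVal ν) {M M' Z Z' : CS X} (hM : IsSupp M)
    (hM' : IsSupp M') (hZ : IsSupp Z) (hZ' : IsSupp Z') (hMM : M' ≤ M) (hZZ : Z' ≤ Z)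
    (hd : ∀ x, M x = M' x ∨ Z x = Z' x) :
    ν (M + Z) + ν (M' + Z') = ν (M + Z') + ν (M' + Z) := by
  have e1 : (M + Z') ⊔ (M' + Z) = M + Z := by
    ext x
    have h1 : M' x ≤ M x := hMM x
    have h2 : Z' x ≤ Z x := hZZ x
    simp only [ContinuousMap.sup_apply, ContinuousMap.add_apply]
    rcases hd x with h | h
    · rw [max_eq_right (by linarith), h]
    · rw [max_eq_left (by linarith), h]
  have e2 : (M + Z') ⊓ (M' + Z) = M' + Z' := by
    ext x
    have h1 : M' x ≤ M x := hMM x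
    have h2 : Z' x ≤ Z x := hZZ x
    simp only [ContinuousMap.inf_apply, ContinuousMap.add_apply]
    rcases hd x with h | h
    · rw [min_eq_left (by linarith), h]
    · rw [min_eq_right (by linarith), h]
  have := hν.val (M + Z') (M' + Z) (hM.add hZ') (hM'.add hZ) (by rw [e2]; exact hM'.add hZ')
  rwa [e1, e2] at this

theorem IsVal.diff_congr {ν : CS X → ℂ} (hν : IsVal ν) {M M' Y Y' : CS X} (hM : IsSupp M)
    (hM' : IsSupp M') (hY : IsSupp Y) (hY' : IsSupp Y') (hMM : M' ≤ M)
    (hd : ∀ x, M x ≠ M' x → Y x = Y' x) :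
    ν (Y + M) - ν (Y + M') = ν (Y' + M) - ν (Y' + M') := by
  have h1 := hν.locality hM hM' (hY.sup hY') hY hMM le_sup_left fun x => by
    by_cases h : M x = M' x
    · exact Or.inl h
    · right; simp [hd x h]
  have h2 := hν.locality hM hM' (hY.sup hY') hY' hMM le_sup_right fun x => by
    by_cases h : M x = M' x
    · exact Or.inl h
    · right; simp [hd x h]
  simp only [add_comm M, add_comm M'] at h1 h2
  linear_combination h2 - h1

theorem IsVal.dl_seg_half {ν : CS X → ℂ} (hν : IsVal ν) {Y Y' : CS X} (v : X) (hY : IsSupp Y)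
    (hY' : IsSupp Y') (h : ∀ x : Sph X, 0 < ⟪v, (x : X)⟫ → Y x = Y' x) :
    SUVal.dl (seg v) ν Y = SUVal.dl (seg v) ν Y' := by
  have hM : IsSupp (seg v + lin v) := (isSupp_seg v).add (isSupp_lin v)
  have := hν.diff_congr hM isSupp_zero hY hY' (fun x => by
    have := neg_abs_le ⟪v, (x : X)⟫
    simp; linarith) fun x hx => h x (by
      by_contra hc; push Not at hc
      apply hx; simp [abs_of_nonpos hc])
  rw [← add_assoc, ← add_assoc, hν.trans _ _ (hY.add (isSupp_seg v)),
    hν.trans _ _ (hY'.add (isSupp_seg v)), add_zero, add_zero] at this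
  exact this

theorem IsSupp.lipschitz {h : CS X} [FiniteDimensional ℝ X] (hh : IsSupp h) (x u : Sph X) :
    |h x - h u| ≤ ‖h‖ * ‖(x : X) - u‖ := by
  have key : ∀ x u : Sph X, h x - h u ≤ ‖h‖ * ‖(x : X) - u‖ := fun x u => by
    obtain ⟨y, hy, hy'⟩ := hh x
    have h1 := hy' u
    have h2 := real_inner_le_norm y ((x : X) - u)
    have h3 := mul_le_mul_of_nonneg_right (norm_le_of_mem hy') (norm_nonneg ((x : X) - u))
    rw [inner_sub_right] at h2
    linarith
  rw [abs_le]
  have h1 := key x u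
  have h2 := key u x
  rw [norm_sub_rev] at h2
  constructor <;> linarith

theorem IsSupp.abs_sub_le [FiniteDimensional ℝ X] {K L : CS X} (hK : IsSupp K) (hL : IsSupp L)
    {v : X} (hv : v ≠ 0) (h : ∀ x : Sph X, ⟪v, (x : X)⟫ = 0 → K x = L x) (x : Sph X) :
    |L x - K x| ≤ 2 * (‖L‖ + ‖K‖) / ‖v‖ * |⟪v, (x : X)⟫| := by
  have hv' : 0 < ‖v‖ := norm_pos_iff.2 hv
  set p : X := x - (⟪v, (x : X)⟫ / ‖v‖ ^ 2) • v with hp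
  have hpv : ⟪v, p⟫ = 0 := by
    rw [hp, inner_sub_right, inner_smul_right, real_inner_self_eq_norm_sq]
    field_simp; ring
  have hxp : ‖(x : X) - p‖ = |⟪v, (x : X)⟫| / ‖v‖ := by
    rw [hp, sub_sub_cancel, norm_smul, Real.norm_eq_abs, abs_div, abs_of_pos (pow_pos hv' 2)]
    field_simp
  have hLK : 0 ≤ ‖L‖ + ‖K‖ := by positivity
  rw [div_mul_eq_mul_div, mul_div_assoc, ← hxp]
  by_cases hp0 : p = 0
  · rw [hp0, sub_zero, norm_sph]
    have h1 := L.norm_coe_le_norm x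
    have h2 := K.norm_coe_le_norm x
    have := abs_sub (L x) (K x)
    simp only [Real.norm_eq_abs] at h1 h2
    linarith
  · have hpp : 0 < ‖p‖ := norm_pos_iff.2 hp0
    set u := nrm p hp0
    have hu0 : ⟪v, (u : X)⟫ = 0 := by
      have := inner_nrm v p hp0
      rw [hpv] at this
      rcases mul_eq_zero.1 this.symm with h | h
      · exact absurd h hpp.ne'
      · exact h
    have hKL := h u hu0
    have hpu : ‖p - u‖ = |‖p‖ - 1| := by
      have : p - u = (‖p‖ - 1) • (u : X) := by rw [sub_smul, one_smul, smul_nrm]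
      rw [this, norm_smul, norm_sph, mul_one, Real.norm_eq_abs]
    have hle : |‖p‖ - 1| ≤ ‖(x : X) - p‖ := by
      have := abs_norm_sub_norm_le p (x : X)
      rwa [norm_sph, norm_sub_rev p] at this
    have hxu : ‖(x : X) - u‖ ≤ 2 * ‖(x : X) - p‖ := by
      have := norm_sub_le_norm_sub_add_norm_sub (x : X) p u
      linarith
    have a1 := hL.lipschitz x u
    have a2 := hK.lipschitz x u
    have e : L x - K x = (L x - L u) - (K x - K u) := by rw [hKL]; ring
    rw [e]
    have := abs_sub (L x - L u) (K x - K u)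
    have := mul_le_mul_of_nonneg_left hxu hLK
    linarith

theorem IsVal.dl_seg_add_smul {ν : CS X → ℂ} (hν : IsVal ν) {K : CS X} (hK : IsSupp K) (v : X)
    {t : ℝ} (ht : 0 ≤ t) : SUVal.dl (seg v) ν (K + t • seg v) = SUVal.dl (seg v) ν K := by
  have hs : IsSupp (K + t • seg v) := hK.add ((isSupp_seg v).smul ht)
  rw [← (hν.dl (isSupp_seg v)).trans _ (t • -v) hs]
  refine hν.dl_seg_half v (hs.add (isSupp_lin _)) hK fun x hx => ?_
  simp [abs_of_pos hx, inner_smul_left]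

theorem IsVal.dl_seg_congr [FiniteDimensional ℝ X] {ν : CS X → ℂ} (hν : IsVal ν) {Y Y' : CS X}
    (v : X) (hY : IsSupp Y) (hY' : IsSupp Y') (h : ∀ x : Sph X, ⟪v, (x : X)⟫ = 0 → Y x = Y' x) :
    SUVal.dl (seg v) ν Y = SUVal.dl (seg v) ν Y' := by
  have key : ∀ K L : CS X, IsSupp K → IsSupp L → K ≤ L →
      (∀ x : Sph X, ⟪v, (x : X)⟫ = 0 → K x = L x) →
      SUVal.dl (seg v) ν K = SUVal.dl (seg v) ν L := by
    intro K L hK hL hKL hE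
    by_cases hv : v = 0
    · have : seg v = 0 := by ext x; simp [hv]
      simp [SUVal.dl, this]
    have hb := hK.abs_sub_le hL hv hE
    set t : ℝ := (‖L‖ + ‖K‖) / ‖v‖ with ht
    have ht0 : 0 ≤ t := by positivity
    have hb' : ∀ x, L x - K x ≤ 2 * t * |⟪v, (x : X)⟫| := fun x =>
      (le_abs_self _).trans ((hb x).trans_eq (by rw [ht]; ring))
    have hP : IsSupp ((L + lin (t • v)) ⊔ (K + lin (t • -v))) :=
      (hL.add (isSupp_lin _)).sup (hK.add (isSupp_lin _))
    have hKt := hK.add ((isSupp_seg v).smul ht0)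
    have hLt := hL.add ((isSupp_seg v).smul ht0)
    have e1 := hν.dl_seg_half v hP hLt fun x hx => by
      have : K x ≤ L x := hKL x
      have : 0 ≤ t * ⟪v, (x : X)⟫ := by positivity
      simp [abs_of_pos hx, inner_smul_left]; linarith
    have e2 := hν.dl_seg_half (-v) hP hKt fun x hx => by
      simp only [inner_neg_left, Left.neg_pos_iff] at hx
      have := hb' x
      rw [abs_of_neg hx] at this
      simp [abs_of_neg hx, inner_smul_left]; linarith
    rw [seg_neg] at e2
    rw [← hν.dl_seg_add_smul hK v ht0, ← hν.dl_seg_add_smul hL v ht0, ← e1, e2]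
  rw [key Y (Y ⊔ Y') hY (hY.sup hY') le_sup_left fun x hx => by simp [h x hx],
    key Y' (Y ⊔ Y') hY' (hY.sup hY') le_sup_right fun x hx => by simp [h x hx]]

/-- Iterated differences. -/
def Td {ι : Type*} (ν : CS X → ℂ) (s : Finset ι) (Z : ι → CS X) (h : CS X) : ℂ :=
  ∑ A ∈ s.powerset, (-1) ^ (s.card - A.card) * ν (h + ∑ i ∈ A, Z i)

section Td
variable {ι : Type*}

theorem Td_empty (ν : CS X → ℂ) (Z : ι → CS X) : Td ν ∅ Z = ν := by
  ext h; simp [Td]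

theorem Td_insert [DecidableEq ι] (ν : CS X → ℂ) {s : Finset ι} {i : ι} (hi : i ∉ s)
    (Z : ι → CS X) : Td ν (insert i s) Z = SUVal.dl (Z i) (Td ν s Z) := by
  ext h
  simp only [Td, SUVal.dl]
  rw [Finset.sum_powerset_insert hi, add_comm, sub_eq_add_neg, ← Finset.sum_neg_distrib]
  congr 1
  · refine Finset.sum_congr rfl fun A hA => ?_
    have hiA : i ∉ A := fun h => hi (Finset.mem_powerset.1 hA h)
    rw [Finset.card_insert_of_notMem hi, Finset.card_insert_of_notMem hiA,
      Finset.sum_insert hiA, add_assoc, Nat.add_sub_add_right]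
  · refine Finset.sum_congr rfl fun A hA => ?_
    have := Finset.card_le_card (Finset.mem_powerset.1 hA)
    rw [Finset.card_insert_of_notMem hi, Nat.sub_add_comm this, pow_succ]
    ring

theorem Td_eq_erase [DecidableEq ι] (ν : CS X → ℂ) {s : Finset ι} {i : ι} (hi : i ∈ s)
    (Z : ι → CS X) : Td ν s Z = SUVal.dl (Z i) (Td ν (s.erase i) Z) := by
  conv_lhs => rw [← Finset.insert_erase hi, Td_insert ν (s.notMem_erase i)]

theorem Td_congr (ν : CS X → ℂ) {s : Finset ι} {Z Z' : ι → CS X} (h : ∀ i ∈ s, Z i = Z' i) :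
    Td ν s Z = Td ν s Z' := by
  ext k
  refine Finset.sum_congr rfl fun A hA => ?_
  rw [Finset.sum_congr rfl fun i hi => h i (Finset.mem_powerset.1 hA hi)]

theorem IsVal.td {ν : CS X → ℂ} (hν : IsVal ν) (s : Finset ι) {Z : ι → CS X}
    (hZ : ∀ i ∈ s, IsSupp (Z i)) : IsVal (Td ν s Z) := by
  classical
  induction s using Finset.induction_on with
  | empty => rwa [Td_empty]
  | insert i s hi ih =>
    rw [Td_insert ν hi]
    exact (ih fun j hj => hZ j (by simp [hj])).dl (hZ i (by simp))

variable [FiniteDimensional ℝ X]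

theorem IsVal.td_seg_congr {ν : CS X → ℂ} (hν : IsVal ν) {s : Finset ι} {Z : ι → CS X} {i : ι}
    (hi : i ∈ s) {v : X} (hv : Z i = seg v) (hZ : ∀ i ∈ s, IsSupp (Z i)) {Y Y' : CS X}
    (hY : IsSupp Y) (hY' : IsSupp Y') (h : ∀ x : Sph X, ⟪v, (x : X)⟫ = 0 → Y x = Y' x) :
    Td ν s Z Y = Td ν s Z Y' := by
  classical
  rw [Td_eq_erase ν hi, hv]
  exact (hν.td _ fun j hj => hZ j (Finset.mem_of_mem_erase hj)).dl_seg_congr v hY hY' h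

theorem IsVal.td_shear [DecidableEq ι] {ν : CS X → ℂ} (hν : IsVal ν) {s : Finset ι} {v : ι → X}
    {i j : ι} (hi : i ∈ s) (hj : j ∈ s) (hij : i ≠ j) (c : ℝ) {Y : CS X} (hY : IsSupp Y) :
    Td ν s (fun k => seg (Function.update v j (v j + c • v i) k)) Y =
      Td ν s (fun k => seg (v k)) Y := by
  rw [Td_eq_erase ν hj, Td_eq_erase ν hj]
  have e : Td ν (s.erase j) (fun k => seg (Function.update v j (v j + c • v i) k)) =
      Td ν (s.erase j) fun k => seg (v k) :=
    Td_congr ν fun k hk => by rw [Function.update_of_ne (Finset.ne_of_mem_erase hk)]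
  rw [e]
  simp only [SUVal.dl, Function.update_self]
  rw [hν.td_seg_congr (Finset.mem_erase.2 ⟨hij, hi⟩) rfl (fun _ _ => isSupp_seg _)
    (hY.add (isSupp_seg _)) (hY.add (isSupp_seg (v j))) fun x hx => ?_]
  simp [inner_add_left, inner_smul_left, hx]

theorem IsVal.td_eq_zero_of_dependent [Fintype ι] {ν : CS X → ℂ} (hν : IsVal ν) {v : ι → X}
    (hd : ¬ LinearIndependent ℝ v) {Y : CS X} (hY : IsSupp Y) :
    Td ν Finset.univ (fun k => seg (v k)) Y = 0 := by
  classical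
  rw [Fintype.linearIndependent_iff] at hd
  push Not at hd
  obtain ⟨c, hc, j, hj⟩ := hd
  have key : ∀ A : Finset ι, j ∉ A →
      Td ν Finset.univ (fun k => seg (Function.update v j (v j + ∑ i ∈ A, (c i / c j) • v i) k)) Y =
        Td ν Finset.univ (fun k => seg (v k)) Y := by
    intro A
    induction A using Finset.induction_on with
    | empty => intro _; simp
    | insert i A hi ih =>
      intro hjA
      simp only [Finset.mem_insert, not_or] at hjA
      rw [← ih hjA.2]
      have := hν.td_shear (v := Function.update v j (v j + ∑ i ∈ A, (c i / c j) • v i))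
        (Finset.mem_univ i) (Finset.mem_univ j) (Ne.symm hjA.1) (c i / c j) hY
      rw [← this]
      simp only [Function.update_self, Function.update_idem, Function.update_of_ne (Ne.symm hjA.1)]
      rw [Finset.sum_insert hi, add_assoc, add_comm (∑ i ∈ A, (c i / c j) • v i)]
  rw [← key (Finset.univ.erase j) (by simp), Td_eq_erase ν (Finset.mem_univ j)]
  have : v j + ∑ i ∈ Finset.univ.erase j, (c i / c j) • v i = 0 := by
    have h1 := Finset.add_sum_erase Finset.univ (fun i => (c i / c j) • v i) (Finset.mem_univ j)
    simp only [div_self hj, one_smul] at h1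
    rw [h1]
    have : ∑ i, (c i / c j) • v i = (c j)⁻¹ • ∑ i, c i • v i := by
      rw [Finset.smul_sum]; refine Finset.sum_congr rfl fun i _ => ?_
      rw [smul_smul]; congr 1; ring
    rw [this, hc, smul_zero]
  have h0 : seg (0 : X) = 0 := by ext x; simp
  simp only [SUVal.dl, Function.update_self, this, h0, add_zero, sub_self]

end Td
end Val

section Body
variable {X : Type*} [NormedAddCommGroup X] [InnerProductSpace ℝ X] [FiniteDimensional ℝ X]
  [Nontrivial X]

theorem isVal_comp_body {μ : ConvexBody X → ℂ}
    (h1 : ∀ K L U I : ConvexBody X, (U : Set X) = (K : Set X) ∪ (L : Set X) →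
      (I : Set X) = (K : Set X) ∩ (L : Set X) → μ U + μ I = μ K + μ L)
    (h2 : Continuous μ)
    (h3 : ∀ (x : X) (K L : ConvexBody X),
      (L : Set X) = (fun y => x + y) '' (K : Set X) → μ L = μ K) :
    IsVal fun h => μ (body h) where
  cont := by
    refine h2.comp_continuousOn ?_
    rw [continuousOn_iff_continuous_restrict]
    refine (LipschitzWith.of_dist_le_mul (K := 1) fun h k => ?_).continuous
    rw [NNReal.coe_one, one_mul]
    exact dist_body_le h.2 k.2
  trans h a hh := h3 a _ _ (by
    rw [coe_body (hh.add (isSupp_lin a)), coe_body hh, bodySet_add_lin])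
  val h k hh hk hi := h1 _ _ _ _ (by
    rw [coe_body (hh.sup hk), coe_body hh, coe_body hk, bodySet_sup hi]) (by
    rw [coe_body hi, coe_body hh, coe_body hk, bodySet_inf])

end Body

section Cone

/-- A closed convex set contains the averages of its elements, and a continuous affine function on
it commutes with averages. -/
theorem integral_mem_of_affine {Ω E : Type*} [MeasurableSpace Ω] {m : Measure Ω}
    [IsProbabilityMeasure m] [NormedAddCommGroup E] [NormedSpace ℝ E] [CompleteSpace E]
    {C : Set E} (hC : Convex ℝ C) (hCc : IsClosed C) {A : E → ℂ} (hA : ContinuousOn A C)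
    (haff : ∀ x ∈ C, ∀ y ∈ C, ∀ a b : ℝ, 0 ≤ a → 0 ≤ b → a + b = 1 →
      A (a • x + b • y) = a • A x + b • A y)
    {F : Ω → E} (hF : Integrable F m) (hFC : ∀ ω, F ω ∈ C)
    (hAF : Integrable (fun ω => A (F ω)) m) :
    ∫ ω, F ω ∂m ∈ C ∧ A (∫ ω, F ω ∂m) = ∫ ω, A (F ω) ∂m := by
  have hgr : IsClosed {p : E × ℂ | p.1 ∈ C ∧ p.2 = A p.1} := by
    have h1 : IsClosed (Prod.fst ⁻¹' C : Set (E × ℂ)) := hCc.preimage continuous_fst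
    have h2 : ContinuousOn (fun p : E × ℂ => p.2 - A p.1) (Prod.fst ⁻¹' C) :=
      continuous_snd.continuousOn.sub (hA.comp continuous_fst.continuousOn fun p hp => hp)
    have := h2.preimage_isClosed_of_isClosed h1 (isClosed_singleton (x := (0 : ℂ)))
    convert this using 1
    ext p
    simp [sub_eq_zero]
  have hcv : Convex ℝ {p : E × ℂ | p.1 ∈ C ∧ p.2 = A p.1} := by
    rintro ⟨x, c⟩ ⟨hx, hc⟩ ⟨y, d⟩ ⟨hy, hd⟩ a b ha hb hab
    dsimp only at hx hc hy hd
    subst hc hd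
    exact ⟨hC hx hy ha hb hab, (haff x hx y hy a b ha hb hab).symm⟩
  have := hcv.integral_mem (f := fun ω => (F ω, A (F ω))) (μ := m) hgr
    (Eventually.of_forall fun ω => ⟨hFC ω, rfl⟩) (hF.prodMk hAF)
  rw [integral_pair hF hAF] at this
  exact ⟨this.1, this.2.symm⟩

variable {E : Type*} [AddCommGroup E] [Module ℝ E]

/-- An additive and positively homogeneous function on a convex cone extends to a linear map. -/
theorem exists_linear_extension {C : Set E} (h0 : (0 : E) ∈ C)
    (hadd : ∀ x ∈ C, ∀ y ∈ C, x + y ∈ C)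
    (hsmul : ∀ c : ℝ, 0 ≤ c → ∀ x ∈ C, c • x ∈ C) {f : E → ℂ}
    (fadd : ∀ x ∈ C, ∀ y ∈ C, f (x + y) = f x + f y)
    (fsmul : ∀ c : ℝ, 0 ≤ c → ∀ x ∈ C, f (c • x) = c • f x) :
    ∃ L : E →ₗ[ℝ] ℂ, ∀ x ∈ C, L x = f x := by
  let D : Submodule ℝ E :=
    { carrier := {z | ∃ x ∈ C, ∃ y ∈ C, z = x - y}
      zero_mem' := ⟨0, h0, 0, h0, by simp⟩
      add_mem' := by
        rintro _ _ ⟨x, hx, y, hy, rfl⟩ ⟨x', hx', y', hy', rfl⟩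
        exact ⟨x + x', hadd _ hx _ hx', y + y', hadd _ hy _ hy', by abel⟩
      smul_mem' := by
        rintro c _ ⟨x, hx, y, hy, rfl⟩
        rcases le_total 0 c with hc | hc
        · exact ⟨c • x, hsmul _ hc _ hx, c • y, hsmul _ hc _ hy, smul_sub _ _ _⟩
        · exact ⟨(-c) • y, hsmul _ (by linarith) _ hy, (-c) • x, hsmul _ (by linarith) _ hx, by
            rw [smul_sub, neg_smul, neg_smul]; abel⟩ }
  have hD : ∀ z : D, ∃ x ∈ C, ∃ y ∈ C, (z : E) = x - y := fun z => z.2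
  choose p hp q hq hpq using hD
  have key : ∀ (z : D) (x y : E), x ∈ C → y ∈ C → (z : E) = x - y → f (p z) - f (q z) = f x - f y := by
    intro z x y hx hy hz
    have : p z + y = x + q z := by
      have := hpq z; rw [hz] at this
      rw [← sub_eq_sub_iff_add_eq_add]; exact this.symm
    have h := congrArg f this
    rw [fadd _ (hp z) _ hy, fadd _ hx _ (hq z)] at h
    linear_combination h
  let L : D →ₗ[ℝ] ℂ :=
    { toFun := fun z => f (p z) - f (q z)
      map_add' := fun z w => by
        rw [key (z + w) (p z + p w) (q z + q w) (hadd _ (hp z) _ (hp w)) (hadd _ (hq z) _ (hq w))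
          (by rw [Submodule.coe_add, hpq z, hpq w]; abel), fadd _ (hp z) _ (hp w),
          fadd _ (hq z) _ (hq w)]
        ring
      map_smul' := fun c z => by
        rcases le_total 0 c with hc | hc
        · rw [key (c • z) (c • p z) (c • q z) (hsmul _ hc _ (hp z)) (hsmul _ hc _ (hq z))
            (by rw [Submodule.coe_smul, hpq z, smul_sub]), fsmul _ hc _ (hp z), fsmul _ hc _ (hq z)]
          simp [smul_sub]
        · have hc' : 0 ≤ -c := by linarith
          rw [key (c • z) ((-c) • q z) ((-c) • p z) (hsmul _ hc' _ (hq z)) (hsmul _ hc' _ (hp z))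
            (by rw [Submodule.coe_smul, hpq z, smul_sub, neg_smul, neg_smul]; abel),
            fsmul _ hc' _ (hp z), fsmul _ hc' _ (hq z)]
          simp only [RingHom.id_apply, smul_sub, neg_smul]; abel }
  obtain ⟨L', hL'⟩ := L.exists_extend
  refine ⟨L', fun x hx => ?_⟩
  have hx' : x ∈ D := ⟨x, hx, 0, h0, by simp⟩
  have h1 : L' x = L ⟨x, hx'⟩ := by rw [← hL']; rfl
  rw [h1]
  change f (p _) - f (q _) = _
  have hf0 : f 0 = 0 := by simpa using fsmul 0 le_rfl 0 h0
  rw [key ⟨x, hx'⟩ x 0 hx h0 (by simp), hf0, sub_zero]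

/-- An additive function on a cone which is continuous along rays is positively homogeneous. -/
theorem posHomogeneous_of_additive [TopologicalSpace E] [ContinuousSMul ℝ E] {C : Set E}
    (hsmul : ∀ c : ℝ, 0 ≤ c → ∀ x ∈ C, c • x ∈ C) {f : E → ℂ} (hf : ContinuousOn f C)
    (fadd : ∀ x ∈ C, ∀ y ∈ C, f (x + y) = f x + f y) (c : ℝ) (hc : 0 ≤ c) (x : E) (hx : x ∈ C) :
    f (c • x) = c • f x := by
  have h0 : f 0 = 0 := by
    have h0C : (0 : E) ∈ C := by simpa using hsmul 0 le_rfl x hx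
    have := fadd 0 h0C 0 h0C
    simpa using this
  have hr : ∀ a b : ℝ, 0 ≤ a → 0 ≤ b → f ((a + b) • x) = f (a • x) + f (b • x) := fun a b ha hb => by
    rw [add_smul, fadd _ (hsmul a ha x hx) _ (hsmul b hb x hx)]
  have hcont : Continuous fun t : ℝ => f (max t 0 • x) :=
    hf.comp_continuous (by fun_prop) fun t => hsmul _ (le_max_right _ _) x hx
  let g : ℝ →+ ℂ :=
    { toFun := fun t => f (max t 0 • x) - f (max (-t) 0 • x)
      map_zero' := by simp
      map_add' := fun a b => by
        have h1 := hr (max (a + b) 0) (max (-a) 0 + max (-b) 0) (by positivity) (by positivity)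
        have h2 := hr (max (-(a + b)) 0) (max a 0 + max b 0) (by positivity) (by positivity)
        rw [hr (max (-a) 0) _ (by positivity) (by positivity)] at h1
        rw [hr (max a 0) _ (by positivity) (by positivity)] at h2
        have e : max (a + b) 0 + (max (-a) 0 + max (-b) 0) =
            max (-(a + b)) 0 + (max a 0 + max b 0) := by
          have k : ∀ s : ℝ, max s 0 = max (-s) 0 + s := fun s => by
            rcases le_total 0 s with h | h
            · rw [max_eq_left h, max_eq_right (by linarith)]; ring
            · rw [max_eq_right h, max_eq_left (by linarith)]; ring
          rw [k (a + b), k a, k b]; ring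
        rw [e] at h1
        linear_combination h2 - h1 }
  have hg : Continuous g := by
    change Continuous fun t : ℝ => f (max t 0 • x) - f (max (-t) 0 • x)
    exact hcont.sub (hcont.comp continuous_neg)
  have := map_real_smul g hg c 1
  simp only [smul_eq_mul, mul_one] at this
  change f (max c 0 • x) - f (max (-c) 0 • x) = c • (f (max 1 0 • x) - f (max (-1) 0 • x)) at this
  simpa [max_eq_left hc, max_eq_right (neg_nonpos.2 hc), h0] using this

end Cone

section Zonoid
variable {X : Type*} [NormedAddCommGroup X] [InnerProductSpace ℝ X]

/-- The closed cone of support functions of centred zonoids. -/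
def ZC (X : Type*) [NormedAddCommGroup X] [InnerProductSpace ℝ X] : AddSubmonoid (CS X) :=
  (AddSubmonoid.closure (Set.range (seg : X → CS X))).topologicalClosure

theorem isClosed_ZC : IsClosed (ZC X : Set (CS X)) :=
  AddSubmonoid.isClosed_topologicalClosure _

theorem seg_mem_ZC (v : X) : seg v ∈ ZC X :=
  AddSubmonoid.le_topologicalClosure _ (AddSubmonoid.subset_closure ⟨v, rfl⟩)

theorem ZC_induction {p : CS X → Prop} (hc : IsClosed {h | p h}) (h0 : p 0)
    (hseg : ∀ v, p (seg v)) (hadd : ∀ h k, p h → p k → p (h + k)) {h : CS X} (hh : h ∈ ZC X) :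
    p h := by
  refine closure_minimal (s := (AddSubmonoid.closure (Set.range (seg : X → CS X)) : Set (CS X)))
    (t := {h | p h}) ?_ hc hh
  intro k hk
  induction hk using AddSubmonoid.closure_induction with
  | mem x hx => obtain ⟨v, rfl⟩ := hx; exact hseg v
  | zero => exact h0
  | add x y _ _ hx hy => exact hadd x y hx hy

theorem smul_mem_ZC {c : ℝ} (hc : 0 ≤ c) {h : CS X} (hh : h ∈ ZC X) : c • h ∈ ZC X := by
  refine ZC_induction (p := fun h => c • h ∈ ZC X)
    (isClosed_ZC.preimage (continuous_const_smul c)) ?_ (fun v => ?_) (fun h k h1 h2 => ?_) hh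
  · simp [(ZC X).zero_mem]
  · rw [← abs_of_nonneg hc, ← seg_smul]; exact seg_mem_ZC _
  · rw [smul_add]; exact (ZC X).add_mem h1 h2

theorem convex_ZC : Convex ℝ (ZC X : Set (CS X)) := fun _ hh _ hk _ _ ha hb _ =>
  (ZC X).add_mem (smul_mem_ZC ha hh) (smul_mem_ZC hb hk)

theorem isSupp_of_mem_ZC [FiniteDimensional ℝ X] {h : CS X} (hh : h ∈ ZC X) : IsSupp h :=
  ZC_induction isClosed_isSupp isSupp_zero isSupp_seg (fun _ _ => IsSupp.add) hh

/-- The action of an isometry on functions on the sphere. -/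
def act (A : X ≃ₗᵢ[ℝ] X) (h : CS X) : CS X :=
  h.comp ⟨fun x => ⟨A.symm x, by simp⟩, by fun_prop⟩

/-- The action of an isometry on the sphere. -/
def sAct (A : X ≃ₗᵢ[ℝ] X) (x : Sph X) : Sph X := ⟨A x, by simp⟩

@[simp] theorem coe_sAct (A : X ≃ₗᵢ[ℝ] X) (x : Sph X) : (sAct A x : X) = A x := rfl

theorem act_apply (A : X ≃ₗᵢ[ℝ] X) (h : CS X) (x : Sph X) : act A h x = h (sAct A.symm x) := rfl

theorem act_add (A : X ≃ₗᵢ[ℝ] X) (h k : CS X) : act A (h + k) = act A h + act A k := rfl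
theorem act_sub (A : X ≃ₗᵢ[ℝ] X) (h k : CS X) : act A (h - k) = act A h - act A k := rfl
theorem act_smul (A : X ≃ₗᵢ[ℝ] X) (c : ℝ) (h : CS X) : act A (c • h) = c • act A h := rfl
theorem act_sup (A : X ≃ₗᵢ[ℝ] X) (h k : CS X) : act A (h ⊔ k) = act A h ⊔ act A k := rfl
theorem act_one (A : X ≃ₗᵢ[ℝ] X) : act A (1 : CS X) = 1 := rfl
theorem act_zero (A : X ≃ₗᵢ[ℝ] X) : act A (0 : CS X) = 0 := rfl

theorem act_lin (A : X ≃ₗᵢ[ℝ] X) (a : X) : act A (lin a) = lin (A a) := by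
  ext x
  simp only [act_apply, lin_apply, coe_sAct]
  rw [← A.inner_map_map a, A.apply_symm_apply]

theorem act_seg (A : X ≃ₗᵢ[ℝ] X) (a : X) : act A (seg a) = seg (A a) := by
  have := act_lin A a
  ext x
  exact congrArg abs (DFunLike.congr_fun this x)

theorem act_sum {ι : Type*} (A : X ≃ₗᵢ[ℝ] X) (s : Finset ι) (f : ι → CS X) :
    act A (∑ i ∈ s, f i) = ∑ i ∈ s, act A (f i) := by
  ext x
  simp [act_apply]

theorem act_mul_apply (A B : X ≃ₗᵢ[ℝ] X) (h : CS X) : act (A * B) h = act A (act B h) := rfl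

theorem act_one_apply (h : CS X) : act 1 h = h := by
  ext x; rfl

theorem act_act_inv (A : X ≃ₗᵢ[ℝ] X) (h : CS X) : act A (act A⁻¹ h) = h := by
  rw [← act_mul_apply, mul_inv_cancel, act_one_apply]

theorem IsSupp.act {h : CS X} (hh : IsSupp h) (A : X ≃ₗᵢ[ℝ] X) : IsSupp (act A h) := by
  intro x
  obtain ⟨y, hy, hy'⟩ := hh (sAct A.symm x)
  have e : ∀ u : Sph X, ⟪A y, (u : X)⟫ = ⟪y, (sAct A.symm u : X)⟫ := fun u => by
    rw [coe_sAct, ← A.inner_map_map y, A.apply_symm_apply]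
  exact ⟨A y, by rw [e, hy]; rfl, fun u => by rw [e]; exact hy' _⟩

theorem continuous_act [FiniteDimensional ℝ X] (A : X ≃ₗᵢ[ℝ] X) : Continuous (SUVal.act A : CS X → CS X) :=
  ContinuousMap.continuous_precomp _

theorem continuous_seg [FiniteDimensional ℝ X] : Continuous (seg : X → CS X) := by
  have : Continuous fun p : X × Sph X => |⟪p.1, (p.2 : X)⟫| := by fun_prop
  exact (ContinuousMap.curry ⟨_, this⟩).continuous

theorem continuous_lin [FiniteDimensional ℝ X] : Continuous (lin : X → CS X) := by
  have : Continuous fun p : X × Sph X => ⟪p.1, (p.2 : X)⟫ := by fun_prop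
  exact (ContinuousMap.curry ⟨_, this⟩).continuous

end Zonoid

section Haar
variable (G : Type*) [Group G] [TopologicalSpace G] [IsTopologicalGroup G] [CompactSpace G]
  [SecondCountableTopology G] [MeasurableSpace G] [BorelSpace G]

/-- The normalised Haar measure of a compact group. -/
def hG : Measure G := Measure.haarMeasure ⊤

instance : (hG G).IsHaarMeasure := inferInstanceAs (Measure.haarMeasure _).IsHaarMeasure

instance : IsProbabilityMeasure (hG G) := ⟨by
  have := Measure.haarMeasure_self (K₀ := (⊤ : TopologicalSpace.PositiveCompacts G))
  simpa [hG] using this⟩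

instance : (hG G).IsMulRightInvariant := ⟨fun g => by
  haveI : IsProbabilityMeasure ((hG G).map (· * g)) :=
    Measure.isProbabilityMeasure_map (by fun_prop)
  haveI : ((hG G).map (· * g)).IsOpenPosMeasure :=
    (continuous_mul_right g).isOpenPosMeasure_map (mul_right_surjective g)
  haveI : ((hG G).map (· * g)).IsHaarMeasure := {}
  exact Measure.isHaarMeasure_eq_of_isProbabilityMeasure _ _⟩

variable {G}

theorem integrable_hG {E : Type*} [NormedAddCommGroup E] {f : G → E} (hf : Continuous f) :
    Integrable f (hG G) :=
  hf.integrable_of_hasCompactSupport (HasCompactSupport.of_compactSpace f)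

/-- A faithful continuous isometric representation, transitive on the unit sphere. -/
class SphRep (G X : Type*) [NormedAddCommGroup X] [InnerProductSpace ℝ X] [Group G]
    [TopologicalSpace G] where
  hom : G →* (X ≃ₗᵢ[ℝ] X)
  cont : Continuous fun p : G × X => hom p.1 p.2
  trans : ∀ x y : Sph X, ∃ g, hom g x = y
  inj : Function.Injective hom

variable {X : Type*} [NormedAddCommGroup X] [InnerProductSpace ℝ X] [FiniteDimensional ℝ X]
  [SphRep G X]

/-- The isometry given by a group element. -/
def rho (X : Type*) [NormedAddCommGroup X] [InnerProductSpace ℝ X] [SphRep G X] :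
    G →* (X ≃ₗᵢ[ℝ] X) := SphRep.hom

theorem continuous_rho : Continuous fun p : G × X => rho X p.1 p.2 := SphRep.cont

@[fun_prop]
theorem Continuous.rho {Y : Type*} [TopologicalSpace Y] {f : Y → G} {x : Y → X} (hf : Continuous f)
    (hx : Continuous x) : Continuous fun y => rho X (f y) (x y) :=
  continuous_rho.comp (hf.prodMk hx)

/-- The action of the group on the sphere. -/
def sg (g : G) (x : Sph X) : Sph X := sAct (rho X g) x

@[simp] theorem coe_sg (g : G) (x : Sph X) : (sg g x : X) = rho X g x := rfl

theorem sg_mul (g h : G) (x : Sph X) : sg (g * h) x = sg g (sg h x) := by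
  apply Subtype.ext; simp

theorem sg_one (x : Sph X) : sg (1 : G) x = x := by
  apply Subtype.ext; simp

@[fun_prop]
theorem Continuous.sg {Y : Type*} [TopologicalSpace Y] {f : Y → G} {x : Y → Sph X}
    (hf : Continuous f) (hx : Continuous x) : Continuous fun y => sg (f y) (x y) :=
  Continuous.subtype_mk (Continuous.rho hf (continuous_subtype_val.comp hx)) _

variable (G) in
theorem exists_sg (x y : Sph X) : ∃ g : G, sg g x = y := by
  obtain ⟨g, hg⟩ := SphRep.trans (G := G) x y
  exact ⟨g, Subtype.ext hg⟩

theorem rho_inv (g : G) (x : X) : rho X g⁻¹ x = (rho X g).symm x := by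
  rw [map_inv]; rfl

theorem act_rho_apply (g : G) (h : CS X) (x : Sph X) : act (rho X g) h x = h (sg g⁻¹ x) := by
  rw [act_apply]; congr 1; apply Subtype.ext; simp [rho_inv]

theorem continuous_act_rho (h : CS X) : Continuous fun g : G => act (rho X g) h := by
  have : Continuous fun p : G × Sph X => h (sg p.1⁻¹ p.2) := by fun_prop
  convert (ContinuousMap.curry ⟨_, this⟩).continuous using 2 with g
  ext x
  rw [act_rho_apply]; rfl

theorem integral_apply_CS {Ω : Type*} [MeasurableSpace Ω] {m : Measure Ω} {F : Ω → CS X}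
    (hF : Integrable F m) (x : Sph X) : (∫ ω, F ω ∂m) x = ∫ ω, F ω x ∂m := by
  have := ((ContinuousMap.evalCLM ℝ x).integral_comp_comm hF)
  simpa using this.symm

/-- Averages over the group do not depend on the base point. -/
theorem integral_sg {E : Type*} [NormedAddCommGroup E] [NormedSpace ℝ E] (f : Sph X → E)
    (x y : Sph X) : ∫ g, f (sg g x) ∂hG G = ∫ g, f (sg g y) ∂hG G := by
  obtain ⟨k, rfl⟩ := exists_sg G y x
  simp_rw [← sg_mul]
  exact integral_mul_right_eq_self (fun g => f (sg g y)) k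

variable (G) in
theorem exists_integral_abs_inner (e : Sph X) :
    ∃ c : ℝ, 0 < c ∧ ∀ y : X, ∫ g : G, |⟪rho X g e, y⟫| ∂hG G = c * ‖y‖ := by
  refine ⟨∫ g : G, |⟪rho X g e, (e : X)⟫| ∂hG G, ?_, fun y => ?_⟩
  · refine (continuous_abs.comp (by fun_prop : Continuous fun g : G =>
      ⟪rho X g e, (e : X)⟫)).integral_pos_of_hasCompactSupport_nonneg_nonzero
      (HasCompactSupport.of_compactSpace _) (fun g => abs_nonneg _) (x := 1) ?_
    simp
  · by_cases hy : y = 0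
    · simp [hy]
    obtain ⟨k, hk⟩ := exists_sg G e (nrm y hy)
    have h1 : ∀ g : G, |⟪rho X g e, y⟫| = ‖y‖ * |⟪rho X (k⁻¹ * g) e, (e : X)⟫| := fun g => by
      rw [inner_nrm _ _ hy, abs_mul, abs_norm, ← hk, coe_sg, map_mul, map_inv]
      congr 2
      rw [← LinearIsometryEquiv.inner_map_map (rho X k) _ (e : X)]
      congr 1
      change _ = ((rho X k * ((rho X k)⁻¹ * rho X g)) (e : X))
      rw [mul_inv_cancel_left]
    simp_rw [h1]
    rw [integral_const_mul, integral_mul_left_eq_self (fun g : G => |⟪rho X g e, (e : X)⟫|) k⁻¹,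
      mul_comm]

variable (G) in
include G in
theorem norm_comp_mem_ZC [Nontrivial X] (A : X →ₗ[ℝ] X) {h : CS X} (hh : ∀ x, h x = ‖A x‖) :
    h ∈ ZC X := by
  obtain ⟨c, hc, hcy⟩ := exists_integral_abs_inner G (Classical.arbitrary (Sph X))
  set e := Classical.arbitrary (Sph X)
  have hcont : Continuous fun g : G => seg (LinearMap.adjoint A (rho X g e)) := by
    have : Continuous (LinearMap.adjoint A) := LinearMap.continuous_of_finiteDimensional _
    exact continuous_seg.comp (this.comp (by fun_prop))
  have hmem : ∫ g : G, seg (LinearMap.adjoint A (rho X g e)) ∂hG G ∈ ZC X :=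
    convex_ZC.integral_mem isClosed_ZC (Eventually.of_forall fun g => seg_mem_ZC _)
      (integrable_hG hcont)
  have : h = c⁻¹ • ∫ g : G, seg (LinearMap.adjoint A (rho X g e)) ∂hG G := by
    ext x
    rw [ContinuousMap.smul_apply, integral_apply_CS (integrable_hG hcont)]
    simp only [seg_apply, LinearMap.adjoint_inner_left]
    rw [hcy, hh, smul_eq_mul, inv_mul_cancel_left₀ hc.ne']
  rw [this]
  exact smul_mem_ZC (by positivity) hmem

variable (G) in
include G in
theorem one_mem_ZC [Nontrivial X] : (1 : CS X) ∈ ZC X :=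
  norm_comp_mem_ZC G LinearMap.id fun x => by simp

end Haar

section HH
variable {X : Type*} [NormedAddCommGroup X] [InnerProductSpace ℝ X] [FiniteDimensional ℝ X]

theorem IsSupp.sq_add_one {f : CS X} (hf : IsSupp f) (h0 : 0 ≤ f) (h1 : f ≤ 1) :
    IsSupp (f ^ 2 + 1) := by
  intro x
  obtain ⟨y, hy, hy'⟩ := hf x
  set a := f x with ha
  have ha0 : 0 ≤ a := h0 x
  have ha1 : a ≤ 1 := h1 x
  refine ⟨(1 - a ^ 2) • (x : X) + (2 * a) • y, ?_, fun u => ?_⟩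
  · simp only [inner_add_left, inner_smul_left, inner_self_sph, hy, ContinuousMap.add_apply,
      ContinuousMap.pow_apply, ContinuousMap.one_apply, ← ha]
    simp; ring
  · have hp : ⟪(x : X), (u : X)⟫ ≤ 1 := by
      simpa [norm_sph] using real_inner_le_norm (x : X) (u : X)
    have hb := hy' u
    have hu : 0 ≤ f u := h0 u
    simp only [inner_add_left, inner_smul_left, ContinuousMap.add_apply,
      ContinuousMap.pow_apply, ContinuousMap.one_apply, RCLike.conj_to_real]
    have h3 : (1 - a ^ 2) * ⟪(x : X), (u : X)⟫ ≤ 1 - a ^ 2 :=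
      mul_le_of_le_one_right (by nlinarith) hp
    nlinarith [mul_le_mul_of_nonneg_left hb ha0, sq_nonneg (a - f u)]

/-- The algebra spanned by support functions. -/
def HH (X : Type*) [NormedAddCommGroup X] [InnerProductSpace ℝ X] : Submodule ℝ (CS X) :=
  Submodule.span ℝ {h | IsSupp h}

theorem IsSupp.mem_HH {h : CS X} (hh : IsSupp h) : h ∈ HH X := Submodule.subset_span hh

theorem mem_HH_iff {f : CS X} : f ∈ HH X ↔ ∃ h k, IsSupp h ∧ IsSupp k ∧ f = h - k := by
  constructor
  · intro hf
    induction hf using Submodule.span_induction with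
    | mem h hh => exact ⟨h, 0, hh, isSupp_zero, by simp⟩
    | zero => exact ⟨0, 0, isSupp_zero, isSupp_zero, by simp⟩
    | add f g _ _ h1 h2 =>
      obtain ⟨h, k, hh, hk, rfl⟩ := h1
      obtain ⟨h', k', hh', hk', rfl⟩ := h2
      exact ⟨h + h', k + k', hh.add hh', hk.add hk', by abel⟩
    | smul c f _ h1 =>
      obtain ⟨h, k, hh, hk, rfl⟩ := h1
      rcases le_total 0 c with hc | hc
      · exact ⟨c • h, c • k, hh.smul hc, hk.smul hc, by rw [smul_sub]⟩
      · refine ⟨(-c) • k, (-c) • h, hk.smul (neg_nonneg.2 hc), hh.smul (neg_nonneg.2 hc), ?_⟩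
        simp only [neg_smul, smul_sub]; abel
  · rintro ⟨h, k, hh, hk, rfl⟩
    exact sub_mem hh.mem_HH hk.mem_HH

theorem one_mem_HH : (1 : CS X) ∈ HH X := isSupp_one.mem_HH
theorem lin_mem_HH (a : X) : lin a ∈ HH X := (isSupp_lin a).mem_HH

theorem IsSupp.sq_mem_HH {f : CS X} (hf : IsSupp f) : f ^ 2 ∈ HH X := by
  set c := ‖f‖ + 1 with hc
  have hc0 : 0 < c := by positivity
  have hb : ∀ x, |f x| ≤ ‖f‖ := f.norm_coe_le_norm
  have h1 : IsSupp ((2 * c)⁻¹ • (f + ContinuousMap.const _ c)) :=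
    (hf.add (isSupp_const hc0.le)).smul (by positivity)
  have h2 := h1.sq_add_one (fun x => by
      have := abs_le.1 (hb x)
      change 0 ≤ (2 * c)⁻¹ * (f x + c)
      exact mul_nonneg (by positivity) (by linarith)) (fun x => by
      have := abs_le.1 (hb x)
      change (2 * c)⁻¹ * (f x + c) ≤ 1
      rw [inv_mul_le_iff₀ (by positivity)]; linarith)
  have e : f ^ 2 = (2 * c) ^ 2 • (((2 * c)⁻¹ • (f + ContinuousMap.const _ c)) ^ 2 + 1)
      - ((2 * c) ^ 2 + c ^ 2) • 1 - (2 * c) • f := by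
    ext x
    simp only [ContinuousMap.pow_apply, ContinuousMap.sub_apply, ContinuousMap.smul_apply,
      ContinuousMap.add_apply, ContinuousMap.const_apply, ContinuousMap.one_apply, smul_eq_mul]
    field_simp
    ring
  rw [e]
  exact sub_mem (sub_mem (Submodule.smul_mem _ _ h2.mem_HH) (Submodule.smul_mem _ _ one_mem_HH))
    (Submodule.smul_mem _ _ hf.mem_HH)

theorem mul_mem_HH {f g : CS X} (hf : f ∈ HH X) (hg : g ∈ HH X) : f * g ∈ HH X := by
  have key : ∀ h k : CS X, IsSupp h → IsSupp k → h * k ∈ HH X := fun h k hh hk => by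
    have : h * k = (2⁻¹ : ℝ) • ((h + k) ^ 2 - h ^ 2 - k ^ 2) := by
      ext x; simp; ring
    rw [this]
    exact Submodule.smul_mem _ _ (sub_mem (sub_mem (hh.add hk).sq_mem_HH hh.sq_mem_HH) hk.sq_mem_HH)
  obtain ⟨h, k, hh, hk, rfl⟩ := mem_HH_iff.1 hf
  obtain ⟨h', k', hh', hk', rfl⟩ := mem_HH_iff.1 hg
  rw [sub_mul, mul_sub, mul_sub]
  exact sub_mem (sub_mem (key _ _ hh hh') (key _ _ hh hk')) (sub_mem (key _ _ hk hh') (key _ _ hk hk'))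

theorem act_mem_HH {f : CS X} (hf : f ∈ HH X) (A : X ≃ₗᵢ[ℝ] X) : act A f ∈ HH X := by
  obtain ⟨h, k, hh, hk, rfl⟩ := mem_HH_iff.1 hf
  exact sub_mem (hh.act A).mem_HH (hk.act A).mem_HH

end HH

section Rep
variable {G : Type*} [Group G] [TopologicalSpace G] [IsTopologicalGroup G] [CompactSpace G]

/-- Right translation by inverses. -/
def rtr (a : C(G, ℝ)) (g : G) : C(G, ℝ) := ⟨fun k => a (g * k⁻¹), by fun_prop⟩

@[simp] theorem rtr_apply (a : C(G, ℝ)) (g k : G) : rtr a g k = a (g * k⁻¹) := rfl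

theorem continuous_rtr (a : C(G, ℝ)) : Continuous (rtr a) := by
  have : Continuous fun p : G × G => a (p.1 * p.2⁻¹) := by fun_prop
  exact (ContinuousMap.curry ⟨_, this⟩).continuous

/-- Representative functions. -/
def RepFn (a : C(G, ℝ)) : Prop :=
  ∃ W : Submodule ℝ C(G, ℝ), FiniteDimensional ℝ W ∧ ∀ g, rtr a g ∈ W

theorem RepFn.add {a b : C(G, ℝ)} (ha : RepFn a) (hb : RepFn b) : RepFn (a + b) := by
  obtain ⟨V, hV, h1⟩ := ha
  obtain ⟨W, hW, h2⟩ := hb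
  exact ⟨V ⊔ W, inferInstance, fun g => Submodule.add_mem_sup (h1 g) (h2 g)⟩

theorem RepFn.mul {a b : C(G, ℝ)} (ha : RepFn a) (hb : RepFn b) : RepFn (a * b) := by
  obtain ⟨V, hV, h1⟩ := ha
  obtain ⟨W, hW, h2⟩ := hb
  refine ⟨V * W, ?_, fun g => Submodule.mul_mem_mul (h1 g) (h2 g)⟩
  exact Module.Finite.iff_fg.2 ((Module.Finite.iff_fg.1 hV).mul (Module.Finite.iff_fg.1 hW))

theorem repFn_const (c : ℝ) : RepFn (ContinuousMap.const G c) :=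
  ⟨Submodule.span ℝ {ContinuousMap.const G c}, inferInstance,
    fun _ => Submodule.subset_span rfl⟩

theorem RepFn.pow {a : C(G, ℝ)} (ha : RepFn a) (N : ℕ) : RepFn (a ^ N) := by
  induction N with
  | zero => rw [pow_zero]; exact repFn_const 1
  | succ N ih => rw [pow_succ]; exact ih.mul ha

theorem RepFn.sum {ι : Type*} (s : Finset ι) {a : ι → C(G, ℝ)} (ha : ∀ i ∈ s, RepFn (a i)) :
    RepFn (∑ i ∈ s, a i) := by
  classical
  induction s using Finset.induction_on with
  | empty => exact repFn_const 0
  | insert i s hi ih =>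
    rw [Finset.sum_insert hi]
    exact (ha i (by simp)).add (ih fun j hj => ha j (by simp [hj]))

variable [SecondCountableTopology G] [MeasurableSpace G] [BorelSpace G]
  {X : Type*} [NormedAddCommGroup X] [InnerProductSpace ℝ X] [FiniteDimensional ℝ X]
  [SphRep G X]

variable (G) in
/-- Matrix entries of the representation. -/
def entry (x y : X) : C(G, ℝ) :=
  ⟨fun g => ⟪rho X g x, y⟫, by fun_prop⟩

@[simp] theorem entry_apply (x y : X) (g : G) : entry G x y g = ⟪rho X g x, y⟫ := rfl

theorem repFn_entry (x y : X) : RepFn (entry G x y) := by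
  let L : X →ₗ[ℝ] C(G, ℝ) :=
    { toFun := fun z => ⟨fun k => ⟪rho X k⁻¹ x, z⟫, by fun_prop⟩
      map_add' := fun z w => by ext k; simp [inner_add_right]
      map_smul' := fun c z => by ext k; simp [inner_smul_right] }
  refine ⟨LinearMap.range L, inferInstance, fun g => ⟨rho X g⁻¹ y, ?_⟩⟩
  ext k
  change ⟪rho X k⁻¹ x, rho X g⁻¹ y⟫ = ⟪rho X (g * k⁻¹) x, y⟫
  rw [← LinearIsometryEquiv.inner_map_map (rho X g), map_mul]
  congr 1
  change (rho X g * rho X g⁻¹) y = y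
  rw [← map_mul, mul_inv_cancel, map_one]; rfl

/-- The average of the translates of `f` against `a`. -/
def avg (a : C(G, ℝ)) (f : CS X) : CS X := ∫ g, a g • act (rho X g⁻¹) f ∂hG G

theorem continuous_avg_integrand (a : C(G, ℝ)) (f : CS X) :
    Continuous fun g : G => a g • act (rho X g⁻¹) f :=
  a.continuous.smul ((continuous_act_rho f).comp continuous_inv)

theorem avg_apply (a : C(G, ℝ)) (f : CS X) (x : Sph X) :
    avg a f x = ∫ g, a g * f (sg g x) ∂hG G := by
  rw [avg, integral_apply_CS (integrable_hG (continuous_avg_integrand a f))]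
  simp only [ContinuousMap.smul_apply, act_rho_apply, inv_inv, smul_eq_mul]

theorem avg_add (a : C(G, ℝ)) (f f' : CS X) : avg a (f + f') = avg a f + avg a f' := by
  simp only [avg, act_add, smul_add]
  exact integral_add (integrable_hG (continuous_avg_integrand a f))
    (integrable_hG (continuous_avg_integrand a f'))

theorem avg_smul (a : C(G, ℝ)) (c : ℝ) (f : CS X) : avg a (c • f) = c • avg a f := by
  simp only [avg, act_smul, smul_comm _ c]
  exact integral_smul _ _

theorem norm_avg_le (a : C(G, ℝ)) (f : CS X) (e : Sph X) :
    ‖avg a f‖ ≤ ‖a‖ * ∫ g : G, |f (sg g e)| ∂hG G := by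
  refine (ContinuousMap.norm_le _ (mul_nonneg (norm_nonneg _)
    (integral_nonneg fun g => abs_nonneg _))).2 fun x => ?_
  rw [avg_apply, ← integral_sg (fun x => |f x|) x e, ← integral_const_mul]
  refine norm_integral_le_of_norm_le (integrable_hG (by fun_prop)) (Eventually.of_forall fun g => ?_)
  rw [norm_mul]
  exact mul_le_mul_of_nonneg_right (a.norm_coe_le_norm g) (norm_nonneg _)

theorem norm_avg_le' [Nontrivial X] (a : C(G, ℝ)) (f : CS X) : ‖avg a f‖ ≤ ‖a‖ * ‖f‖ := by
  refine (norm_avg_le a f (Classical.arbitrary _)).trans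
    (mul_le_mul_of_nonneg_left ?_ (norm_nonneg _))
  refine (integral_mono (integrable_hG (by fun_prop)) (integrable_const ‖f‖)
    fun g => f.norm_coe_le_norm _).trans (by simp)

/-- `avg` as a continuous linear map. -/
def avgL [Nontrivial X] (a : C(G, ℝ)) : CS X →L[ℝ] CS X :=
  LinearMap.mkContinuous { toFun := avg a, map_add' := avg_add a, map_smul' := avg_smul a } ‖a‖
    (norm_avg_le' a)

@[simp] theorem avgL_apply [Nontrivial X] (a : C(G, ℝ)) (f : CS X) : avgL a f = avg a f := rfl

theorem RepFn.exists_finiteDimensional [Nontrivial X] {a : C(G, ℝ)} (ha : RepFn a) :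
    ∃ U : Submodule ℝ (CS X), FiniteDimensional ℝ U ∧ ∀ f, avg a f ∈ U := by
  obtain ⟨W, hW, h⟩ := ha
  set e := Classical.arbitrary (Sph X)
  let P : CS X →ₗ[ℝ] C(G, ℝ) :=
    { toFun := fun u => ⟨fun k => u (sg k e), by fun_prop⟩
      map_add' := fun _ _ => rfl
      map_smul' := fun _ _ => rfl }
  have hP : Function.Injective P := fun u v huv => by
    ext x
    obtain ⟨k, rfl⟩ := exists_sg G e x
    exact DFunLike.congr_fun huv k
  refine ⟨W.comap P, ?_, fun f => ?_⟩
  · let Q : W.comap P →ₗ[ℝ] W := P.restrict fun _ hu => hu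
    have hQ : Function.Injective Q := fun u v huv =>
      Subtype.ext (hP (congrArg Subtype.val huv))
    exact Module.Finite.of_injective Q hQ
  · have hc : Continuous fun g : G => f (sg g e) • rtr a g :=
      (show Continuous fun g : G => f (sg g e) by fun_prop).smul (continuous_rtr a)
    have h1 : ∫ g : G, f (sg g e) • rtr a g ∂hG G ∈ W :=
      W.convex.integral_mem W.closed_of_finiteDimensional
        (Eventually.of_forall fun g => W.smul_mem _ (h g)) (integrable_hG hc)
    have h2 : P (avg a f) = ∫ g : G, f (sg g e) • rtr a g ∂hG G := by
      ext k
      have := ((ContinuousMap.evalCLM ℝ k).integral_comp_comm (integrable_hG hc)).symm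
      simp only [ContinuousMap.evalCLM_apply] at this
      rw [this]
      change avg a f (sg k e) = _
      rw [avg_apply, ← integral_mul_right_eq_self _ k⁻¹]
      simp [← sg_mul, mul_comm]
    change P (avg a f) ∈ W
    rwa [h2]

end Rep

section Density
variable {X : Type*} [NormedAddCommGroup X] [InnerProductSpace ℝ X] [FiniteDimensional ℝ X]

theorem exists_sqrt_of_isPositive {S : X →ₗ[ℝ] X} (hS : S.IsPositive) :
    ∃ B : X →ₗ[ℝ] X, ∀ x, ‖B x‖ ^ 2 = ⟪S x, x⟫ := by
  set b := hS.isSymmetric.eigenvectorBasis rfl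
  set l := hS.isSymmetric.eigenvalues rfl
  have hl : ∀ i, 0 ≤ l i := fun i => hS.nonneg_eigenvalues rfl i
  refine ⟨∑ i, (√(l i)) • (innerₛₗ ℝ (b i)).smulRight (b i), fun x => ?_⟩
  have h1 : ∀ i, ⟪b i, (∑ i, (√(l i)) • (innerₛₗ ℝ (b i)).smulRight (b i)) x⟫ =
      √(l i) * ⟪b i, x⟫ := fun i => by
    simp only [LinearMap.sum_apply, LinearMap.smul_apply, LinearMap.smulRight_apply, inner_sum,
      inner_smul_right, orthonormal_iff_ite.1 b.orthonormal, innerₛₗ_apply_apply]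
    simp
  rw [← b.sum_sq_norm_inner_right, ← b.sum_inner_mul_inner]
  refine Finset.sum_congr rfl fun i _ => ?_
  rw [h1, Real.norm_eq_abs, sq_abs, mul_pow, Real.sq_sqrt (hl i), hS.isSymmetric,
    hS.isSymmetric.apply_eigenvectorBasis]
  simp only [inner_smul_right, real_inner_comm x]
  simp; ring

/-- `q` is the restriction of a positive quadratic form. -/
def IsQ (q : CS X) : Prop := ∃ S : X →ₗ[ℝ] X, S.IsPositive ∧ ∀ x : Sph X, q x = ⟪S x, (x : X)⟫

theorem IsQ.add {p q : CS X} (hp : IsQ p) (hq : IsQ q) : IsQ (p + q) := by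
  obtain ⟨S, hS, h1⟩ := hp
  obtain ⟨T, hT, h2⟩ := hq
  exact ⟨S + T, hS.add hT, fun x => by simp [h1, h2, inner_add_left]⟩

theorem isQ_zero : IsQ (0 : CS X) := ⟨0, LinearMap.isPositive_zero, by simp⟩

theorem isQ_lin_sq (a : X) : IsQ (lin a ^ 2) := by
  refine ⟨(innerₛₗ ℝ a).smulRight a, ⟨fun x y => ?_, fun x => ?_⟩, fun x => ?_⟩
  · simp [inner_smul_left, inner_smul_right, real_inner_comm]; ring
  · simp [inner_smul_left]; exact mul_self_nonneg _
  · simp [inner_smul_left, sq]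

theorem IsQ.nonneg {q : CS X} (hq : IsQ q) (x : Sph X) : 0 ≤ q x := by
  obtain ⟨S, hS, h⟩ := hq
  rw [h]; simpa using hS.re_inner_nonneg_left (x : X)

theorem mem_of_hasDerivAt {V : Submodule ℝ (CS X)} (hV : IsClosed (V : Set (CS X)))
    {γ γ' : ℝ → CS X} (hγ' : Continuous γ')
    (hd : ∀ x w, HasDerivAt (fun w => γ w x) (γ' w x) w) (hm : ∀ w, γ w ∈ V) (w : ℝ) :
    γ' w ∈ V := by
  have h1 : γ = fun w => γ 0 + ∫ t in (0 : ℝ)..w, γ' t := by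
    ext w x
    have h2 := (ContinuousMap.evalCLM (M := ℝ) ℝ x).intervalIntegral_comp_comm
      (hγ'.intervalIntegrable (μ := volume) 0 w)
    simp only [ContinuousMap.evalCLM_apply] at h2
    rw [ContinuousMap.add_apply, ← h2,
      intervalIntegral.integral_eq_sub_of_hasDerivAt (fun t _ => hd x t)
        (Continuous.intervalIntegrable (by fun_prop) _ _)]
    ring
  have h3 : HasDerivAt γ (γ' w) w := by
    rw [h1]
    exact (intervalIntegral.integral_hasDerivAt_right (hγ'.intervalIntegrable 0 w)
      hγ'.aestronglyMeasurable.stronglyMeasurableAtFilter hγ'.continuousAt).const_add _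
  refine hV.mem_of_tendsto (hasDerivAt_iff_tendsto_slope.1 h3) (Eventually.of_forall fun t => ?_)
  exact V.smul_mem _ (V.sub_mem (hm t) (hm w))

/-- An auxiliary family of functions interpolating between `√(1 + w² q)` and `q ^ j`. -/
def qfam (q : CS X) (hq : ∀ x, 0 ≤ q x) (j : ℕ) (w : ℝ) : CS X :=
  ⟨fun x => q x ^ j * (1 + w ^ 2 * q x) ^ (1 / 2 - j : ℝ), by
    refine Continuous.mul (by fun_prop) (Continuous.rpow_const (by fun_prop) fun x => Or.inl ?_)
    have := hq x
    positivity⟩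

theorem continuous_qfam (q : CS X) (hq : ∀ x, 0 ≤ q x) (j : ℕ) : Continuous (qfam q hq j) := by
  have : Continuous fun p : ℝ × Sph X => q p.2 ^ j * (1 + p.1 ^ 2 * q p.2) ^ (1 / 2 - j : ℝ) := by
    refine Continuous.mul (by fun_prop) (Continuous.rpow_const (by fun_prop) fun x => Or.inl ?_)
    have := hq x.2
    positivity
  exact (ContinuousMap.curry ⟨_, this⟩).continuous

theorem qfam_mem {V : Submodule ℝ (CS X)} (hV : IsClosed (V : Set (CS X))) {q : CS X}
    (hq : ∀ x, 0 ≤ q x) (h0 : ∀ w, qfam q hq 0 w ∈ V) (j : ℕ) : ∀ w, qfam q hq j w ∈ V := by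
  induction j with
  | zero => exact h0
  | succ j ih =>
    have h1 : ∀ w : ℝ, ((1 - 2 * j : ℝ) * w) • qfam q hq (j + 1) w ∈ V := by
      refine mem_of_hasDerivAt hV ((continuous_const.mul continuous_id).smul
        (continuous_qfam q hq _))
        (fun x w => ?_) ih
      have hpos : 1 + w ^ 2 * q x ≠ 0 := by have := hq x; positivity
      have hb : HasDerivAt (fun w : ℝ => 1 + w ^ 2 * q x) (2 * w * q x) w := by
        simpa using ((hasDerivAt_pow 2 w).mul_const (q x)).const_add 1
      refine HasDerivAt.congr_deriv
        ((hb.rpow_const (p := (1 / 2 - j : ℝ)) (Or.inl hpos)).const_mul (q x ^ j)) ?_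
      change _ = (1 - 2 * j) * w * (q x ^ (j + 1) * (1 + w ^ 2 * q x) ^ (1 / 2 - ((j + 1 : ℕ) : ℝ)))
      have : (1 / 2 - ((j + 1 : ℕ) : ℝ)) = 1 / 2 - j - 1 := by push_cast; ring
      rw [this]
      ring
    have h2 : ∀ w : ℝ, w ≠ 0 → qfam q hq (j + 1) w ∈ V := fun w hw => by
      have hj : (1 - 2 * j : ℝ) ≠ 0 := by
        intro h
        have : (1 : ℝ) = ((2 * j : ℕ) : ℝ) := by push_cast; linarith
        have : 1 = 2 * j := by exact_mod_cast this
        omega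
      have h3 := V.smul_mem ((1 - 2 * j : ℝ) * w)⁻¹ (h1 w)
      rwa [smul_smul, inv_mul_cancel₀ (mul_ne_zero hj hw), one_smul] at h3
    intro w
    have h3 : IsClosed (qfam q hq (j + 1) ⁻¹' V) := hV.preimage (continuous_qfam q hq _)
    have h4 : closure ({0}ᶜ : Set ℝ) ⊆ qfam q hq (j + 1) ⁻¹' V :=
      closure_minimal (fun w hw => h2 w hw) h3
    rw [(dense_compl_singleton (0 : ℝ)).closure_eq] at h4
    exact h4 (Set.mem_univ w)

theorem exp_apply (q : CS X) (x : Sph X) : NormedSpace.exp q x = Real.exp (q x) := by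
  have := NormedSpace.map_exp (ContinuousMap.evalStarAlgHom ℝ ℝ x) (ContinuousMap.evalCLM (M := ℝ) ℝ x).continuous q
  rw [Real.exp_eq_exp_ℝ]
  exact this

theorem exp_mem {V : Submodule ℝ (CS X)} (hV : IsClosed (V : Set (CS X))) {q : CS X}
    (hq : ∀ x, 0 ≤ q x) (h0 : ∀ w, qfam q hq 0 w ∈ V) : NormedSpace.exp q ∈ V := by
  have h1 : ∀ j, q ^ j ∈ V := fun j => by
    have e : qfam q hq j 0 = q ^ j := by
      ext x; change q x ^ j * (1 + 0 ^ 2 * q x) ^ (1 / 2 - j : ℝ) = q x ^ j; simp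
    rw [← e]; exact qfam_mem hV hq h0 j 0
  refine hV.mem_of_tendsto (NormedSpace.exp_series_hasSum_exp' (𝕂 := ℝ) q)
    (Eventually.of_forall fun s => ?_)
  exact V.sum_mem fun j _ => V.smul_mem _ (h1 j)

/-- Exponentials of positive quadratic forms. -/
def expQ (X : Type*) [NormedAddCommGroup X] [InnerProductSpace ℝ X] [FiniteDimensional ℝ X] :
    Submonoid (CS X) where
  carrier := {f | ∃ q, IsQ q ∧ f = NormedSpace.exp q}
  one_mem' := ⟨0, isQ_zero, by simp⟩
  mul_mem' := by
    rintro _ _ ⟨p, hp, rfl⟩ ⟨q, hq, rfl⟩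
    exact ⟨p + q, hp.add hq, by rw [NormedSpace.exp_add]⟩

theorem even_mem_closure_adjoin {f : CS X} (hf : ∀ x, f (-x) = f x) :
    f ∈ (Algebra.adjoin ℝ (expQ X : Set (CS X))).topologicalClosure := by
  set 𝒜 := Algebra.adjoin ℝ (expQ X : Set (CS X))
  let p : C(Sph X, CS X) := ⟨fun x => lin (x : X) ^ 2,
    (continuous_lin.comp continuous_subtype_val).pow 2⟩
  let p' : C(Sph X, Set.range p) := ⟨Set.rangeFactorization p, by fun_prop⟩
  haveI : CompactSpace (Set.range p) := isCompact_iff_compactSpace.1 (isCompact_range p.continuous)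
  have hp' : IsQuotientMap p' := IsQuotientMap.of_surjective_continuous
    Set.rangeFactorization_surjective p'.continuous
  have hpm : ∀ x y : Sph X, p' x = p' y → x = y ∨ x = -y := fun x y h => by
    have h1 : p x = p y := congrArg Subtype.val h
    have h2 := DFunLike.congr_fun h1 x
    change ⟪(x : X), (x : X)⟫ ^ 2 = ⟪(y : X), (x : X)⟫ ^ 2 at h2
    rw [inner_self_sph, one_pow] at h2
    rcases sq_eq_one_iff.1 h2.symm with h3 | h3
    · left
      exact Subtype.ext ((inner_eq_one_iff_of_norm_eq_one (norm_sph _) (norm_sph _)).1 h3).symm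
    · right
      apply Subtype.ext
      have h4 : ⟪-(y : X), (x : X)⟫ = 1 := by rw [inner_neg_left, h3]; norm_num
      exact ((inner_eq_one_iff_of_norm_eq_one (by rw [norm_neg, norm_sph]) (norm_sph _)).1 h4).symm
  let L : C(Set.range p, ℝ) →ₐ[ℝ] CS X := ContinuousMap.compRightAlgHom ℝ ℝ p'
  have hL : Continuous L := ContinuousMap.continuous_precomp p'
  have hlift : ∀ g : CS X, (∀ x, g (-x) = g x) → ∃ φ, L φ = g := fun g hg =>
    ⟨hp'.lift g fun x y h => by rcases hpm x y h with rfl | rfl <;> simp [hg], hp'.lift_comp _ _⟩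
  have hsep : (𝒜.comap L).SeparatesPoints := by
    rintro ⟨_, x, rfl⟩ ⟨_, y, rfl⟩ hxy
    have hxy' : p x ≠ p y := fun h => hxy (Subtype.ext h)
    obtain ⟨a, ha⟩ := DFunLike.ne_iff.1 hxy'
    obtain ⟨φ, hφ⟩ := hlift (NormedSpace.exp (lin (a : X) ^ 2)) fun x => by
      rw [exp_apply, exp_apply]; simp
    refine ⟨φ, ⟨φ, ?_, rfl⟩, ?_⟩
    · change L φ ∈ 𝒜
      rw [hφ]
      exact Algebra.subset_adjoin ⟨_, isQ_lin_sq _, rfl⟩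
    · have e : ∀ z : Sph X, φ ⟨p z, z, rfl⟩ = Real.exp (⟪(a : X), (z : X)⟫ ^ 2) := fun z => by
        have := DFunLike.congr_fun hφ z
        rw [exp_apply] at this
        exact this
      rw [e, e]
      intro h
      apply ha
      change ⟪(x : X), (a : X)⟫ ^ 2 = ⟪(y : X), (a : X)⟫ ^ 2
      rw [real_inner_comm, real_inner_comm (a : X)]
      exact Real.exp_injective h
  have htop := ContinuousMap.subalgebra_topologicalClosure_eq_top_of_separatesPoints _ hsep
  obtain ⟨φ, rfl⟩ := hlift f hf
  have hφ : φ ∈ (𝒜.comap L).topologicalClosure := htop ▸ Algebra.mem_top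
  exact map_mem_closure hL hφ fun ψ hψ => hψ

end Density

theorem act_mem_ZC {X : Type*} [NormedAddCommGroup X] [InnerProductSpace ℝ X]
    [FiniteDimensional ℝ X] {h : CS X} (hh : h ∈ ZC X) (A : X ≃ₗᵢ[ℝ] X) : act A h ∈ ZC X := by
  refine ZC_induction (p := fun h => act A h ∈ ZC X) (isClosed_ZC.preimage (continuous_act A))
    (ZC X).zero_mem (fun v => ?_) (fun h k h1 h2 => (ZC X).add_mem h1 h2) hh
  rw [act_seg]; exact seg_mem_ZC _

section Dense
variable {G : Type*} [Group G] [TopologicalSpace G] [IsTopologicalGroup G] [CompactSpace G]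
  [SecondCountableTopology G] [MeasurableSpace G] [BorelSpace G]
  {X : Type*} [NormedAddCommGroup X] [InnerProductSpace ℝ X] [FiniteDimensional ℝ X]
  [Nontrivial X] [SphRep G X]

variable (G) in
include G in
theorem even_mem_closure_span_ZC {f : CS X} (hf : ∀ x, f (-x) = f x) :
    f ∈ (Submodule.span ℝ (ZC X : Set (CS X))).topologicalClosure := by
  set V := (Submodule.span ℝ (ZC X : Set (CS X))).topologicalClosure
  have hV : IsClosed (V : Set (CS X)) := Submodule.isClosed_topologicalClosure _
  have h1 : ∀ g ∈ expQ X, g ∈ V := by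
    rintro _ ⟨q, hq, rfl⟩
    refine exp_mem hV hq.nonneg fun w => ?_
    obtain ⟨S, hS, hSq⟩ := hq
    obtain ⟨B, hB⟩ := exists_sqrt_of_isPositive (S := LinearMap.id + w ^ 2 • S)
      (LinearMap.isPositive_id.add (hS.smul_of_nonneg (by positivity)))
    refine Submodule.le_topologicalClosure _ (Submodule.subset_span ?_)
    refine norm_comp_mem_ZC G B fun x => ?_
    change q x ^ 0 * (1 + w ^ 2 * q x) ^ (1 / 2 - (0 : ℕ) : ℝ) = _
    have := hB x
    simp only [LinearMap.add_apply, LinearMap.id_apply, LinearMap.smul_apply, inner_add_left,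
      inner_smul_left, ← hSq, inner_self_sph] at this
    rw [pow_zero, one_mul, Nat.cast_zero, sub_zero, ← Real.sqrt_eq_rpow,
      ← Real.sqrt_sq (norm_nonneg (B x)), this]
    simp
  have h2 : ((Algebra.adjoin ℝ (expQ X : Set (CS X))) : Set (CS X)) ⊆ V := by
    intro g hg
    have hg' : g ∈ Subalgebra.toSubmodule (Algebra.adjoin ℝ (expQ X : Set (CS X))) := hg
    rw [Algebra.adjoin_eq_span, Submonoid.closure_eq] at hg'
    exact Submodule.span_le.2 h1 hg'
  exact closure_minimal h2 hV (even_mem_closure_adjoin hf)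

variable (G) in
include G in
theorem exists_even_approx [T2Space G] {Y : CS X} (hY : IsSupp Y) (he : ∀ x, Y (-x) = Y x) :
    ∃ F : ℕ → CS X, Tendsto F atTop (𝓝 Y) ∧ ∀ N, IsSupp (F N) ∧
      F N ∈ Submodule.span ℝ (ZC X : Set (CS X)) := by
  set b := stdOrthonormalBasis ℝ X
  set β : C(G, ℝ) := ∑ i, (ContinuousMap.const G 1 + entry G (b i) (b i)) with hβ
  have hβ' : ∀ g, β g = ∑ i, (1 + ⟪rho X g (b i), b i⟫) := fun g => by
    simp [hβ, ContinuousMap.sum_apply]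
  have hle : ∀ (g : G) i, |⟪rho X g (b i), b i⟫| ≤ 1 := fun g i => by
    simpa using abs_real_inner_le_norm (rho X g (b i)) (b i)
  have hrep : RepFn β := RepFn.sum _ fun i _ => (repFn_const 1).add (repFn_entry _ _)
  have hβ0 : ∀ g, 0 ≤ β g := fun g => by
    rw [hβ']
    exact Finset.sum_nonneg fun i _ => by have := abs_le.1 (hle g i); linarith
  have hmax : ∀ g, g ≠ 1 → β g < β 1 := fun g hg => by
    rw [hβ', hβ']
    have hle1 : ∀ i, 1 + ⟪rho X g (b i), b i⟫ ≤ 1 + ⟪rho X (1 : G) (b i), b i⟫ := fun i => by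
      have := abs_le.1 (hle g i)
      simpa using this.2
    refine lt_of_le_of_ne (Finset.sum_le_sum fun i _ => hle1 i) fun heq => hg ?_
    have h2 := (Finset.sum_eq_sum_iff_of_le fun i _ => hle1 i).1 heq
    apply SphRep.inj (X := X)
    rw [map_one]
    refine LinearIsometryEquiv.toLinearEquiv_injective (b.toBasis.ext' fun i => ?_)
    have h3 := h2 i (Finset.mem_univ i)
    have h4 : ⟪rho X g (b i), b i⟫ = 1 := by simpa using h3
    exact (inner_eq_one_iff_of_norm_eq_one (by simp) (by simp)).1 h4
  have hpos : 0 < β 1 := by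
    rw [hβ']
    have : Nonempty (Fin (Module.finrank ℝ X)) := ⟨⟨0, Module.finrank_pos⟩⟩
    exact Finset.sum_pos (fun i _ => by simp) Finset.univ_nonempty
  have hpeak := tendsto_setIntegral_pow_smul_of_unique_maximum_of_isCompact_of_continuousOn
    (μ := hG G) (x₀ := (1 : G)) (s := Set.univ) (c := β) (g := fun g : G => act (rho X g⁻¹) Y)
    isCompact_univ β.continuous.continuousOn (fun g _ hg => hmax g hg) (fun g _ => hβ0 g) hpos
    (by simp) ((continuous_act_rho Y).comp continuous_inv).continuousOn
  simp only [Measure.restrict_univ, inv_one, map_one, act_one_apply] at hpeak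
  have hmem : ∀ N, ∀ C : Set (CS X), Convex ℝ C → IsClosed C → (∀ c : ℝ, 0 ≤ c → ∀ f ∈ C, c • f ∈ C) →
      ∀ f : CS X, (∀ g, act (rho X (g : G)⁻¹) f ∈ C) → avg (β ^ N) f ∈ C := fun N C h1 h2 h3 f h4 =>
    h1.integral_mem h2 (Eventually.of_forall fun g => h3 _ (pow_nonneg (hβ0 g) N) _ (h4 g))
      (integrable_hG (continuous_avg_integrand _ _))
  refine ⟨fun N => (∫ g, β g ^ N ∂hG G)⁻¹ • avg (β ^ N) Y, hpeak, fun N => ⟨?_, ?_⟩⟩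
  · refine IsSupp.smul ?_ (inv_nonneg.2 (integral_nonneg fun g => pow_nonneg (hβ0 g) N))
    exact hmem N {h | IsSupp h} convex_isSupp isClosed_isSupp (fun c hc f hf => IsSupp.smul hf hc) Y
      fun g => hY.act _
  · refine Submodule.smul_mem _ _ ?_
    set S := Submodule.span ℝ (ZC X : Set (CS X)) with hS
    obtain ⟨U, hU, hUm⟩ := (hrep.pow N).exists_finiteDimensional (X := X)
    have h1 : ∀ f ∈ S, avgL (β ^ N) f ∈ S := fun f hf => by
      refine (Submodule.span_le (p := S.comap (avgL (X := X) (β ^ N)).toLinearMap)).2 ?_ hf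
      intro z hz
      refine Submodule.subset_span ?_
      refine hmem N _ convex_ZC isClosed_ZC (fun c hc f hf => smul_mem_ZC hc hf) z fun g => ?_
      exact act_mem_ZC hz _
    have h2 : avgL (β ^ N) Y ∈ closure ((S ⊓ U : Submodule ℝ (CS X)) : Set (CS X)) :=
      map_mem_closure (avgL (X := X) (β ^ N)).continuous (even_mem_closure_span_ZC G he)
        fun f hf => ⟨h1 f hf, hUm f⟩
    rw [(Submodule.closed_of_finiteDimensional (S ⊓ U)).closure_eq] at h2
    exact h2.1

end Dense

section Even
variable {X : Type*} [NormedAddCommGroup X] [InnerProductSpace ℝ X] [FiniteDimensional ℝ X]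
  [Nontrivial X]

theorem IsSupp.exists_even_eq_on_cap {h : CS X} (hh : IsSupp h) (ξ : X) {c : ℝ} (hc : 0 < c) :
    ∃ R : ℝ, 0 ≤ R ∧ ∃ Y : CS X, IsSupp Y ∧ (∀ x, Y (-x) = Y x) ∧
      ∀ x : Sph X, c ≤ ⟪ξ, (x : X)⟫ → Y x = h x + R := by
  set R := ‖h‖ * ‖ξ‖ ^ 2 / c ^ 2 + ‖h‖ with hR
  have hb : ∀ x, |h x| ≤ ‖h‖ := h.norm_coe_le_norm
  have hRh : ‖h‖ ≤ R := le_add_of_nonneg_left (by positivity)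
  have hR0 : 0 ≤ R := (norm_nonneg _).trans hRh
  let S : Set X := {z | (∀ u : Sph X, c ≤ ⟪ξ, (u : X)⟫ → |⟪z, (u : X)⟫| ≤ h u + R)} ∩
    Metric.closedBall 0 (‖h‖ + R)
  have hScl : IsClosed {z : X | ∀ u : Sph X, c ≤ ⟪ξ, (u : X)⟫ → |⟪z, (u : X)⟫| ≤ h u + R} := by
    simp only [Set.ofPred_forall]
    refine isClosed_iInter fun u => isClosed_iInter fun _ => isClosed_le (by fun_prop) continuous_const
  haveI := FiniteDimensional.proper ℝ X
  have hSc : Convex ℝ S := by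
    refine Convex.inter ?_ (convex_closedBall _ _)
    intro z hz w hw a b ha hb hab u hu
    simp only [inner_add_left, inner_smul_left, RCLike.conj_to_real]
    calc |a * ⟪z, (u : X)⟫ + b * ⟪w, (u : X)⟫| ≤ a * |⟪z, (u : X)⟫| + b * |⟪w, (u : X)⟫| := by
          refine (abs_add_le _ _).trans (le_of_eq ?_)
          rw [abs_mul, abs_mul, abs_of_nonneg ha, abs_of_nonneg hb]
      _ ≤ a * (h u + R) + b * (h u + R) := by gcongr; exacts [hz u hu, hw u hu]
      _ = h u + R := by rw [← add_mul, hab, one_mul]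
  let K : ConvexBody X := ⟨S, hSc, (isCompact_closedBall _ _).inter_left hScl, 0, fun u _ => by
    simp only [inner_zero_left, abs_zero]
    have := abs_le.1 (hb u)
    linarith, by simp; positivity⟩
  have hKneg : ∀ z, z ∈ K → -z ∈ K := fun z hz => by
    refine ⟨fun u hu => ?_, ?_⟩
    · rw [inner_neg_left, abs_neg]; exact hz.1 u hu
    · have := hz.2
      simpa using this
  refine ⟨R, hR0, suppFn K, isSupp_suppFn K, ?_, fun x hx => ?_⟩
  · have key : ∀ x, suppFn K (-x) ≤ suppFn K x := fun x => by
      obtain ⟨y, hy, h1⟩ := (suppFn_spec K (-x)).1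
      rw [← h1]
      have := (suppFn_spec K x).2 _ (hKneg y hy)
      simpa using this
    exact fun x => le_antisymm (key x) (by simpa using key (-x))
  · apply le_antisymm
    · obtain ⟨z, hz, h1⟩ := (suppFn_spec K x).1
      rw [← h1]
      exact (le_abs_self _).trans (hz.1 x hx)
    · obtain ⟨y, hy, hy'⟩ := hh x
      have hyn : ‖y‖ ≤ ‖h‖ := norm_le_of_mem hy'
      have hmem : y + R • (x : X) ∈ K := by
        refine ⟨fun u hu => ?_, ?_⟩
        · simp only [inner_add_left, inner_smul_left, RCLike.conj_to_real]
          have h1 : ⟪(x : X), (u : X)⟫ ≤ 1 := by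
            simpa [norm_sph] using real_inner_le_norm (x : X) (u : X)
          have h2 : 2 * c ≤ ‖ξ‖ * ‖(x : X) + u‖ := by
            refine le_trans ?_ (real_inner_le_norm _ _)
            rw [inner_add_right]; linarith
          have h3 : ‖(x : X) + u‖ ^ 2 = 2 + 2 * ⟪(x : X), (u : X)⟫ := by
            rw [norm_add_sq_real, norm_sph, norm_sph]; ring
          have h4 : (2 * c) ^ 2 ≤ ‖ξ‖ ^ 2 * (2 + 2 * ⟪(x : X), (u : X)⟫) := by
            rw [← h3, ← mul_pow]; gcongr
          have h5 : 2 * ‖h‖ ≤ R * (1 + ⟪(x : X), (u : X)⟫) := by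
            have h6 : ‖h‖ * ‖ξ‖ ^ 2 / c ^ 2 * (1 + ⟪(x : X), (u : X)⟫) =
              ‖h‖ * (‖ξ‖ ^ 2 * (2 + 2 * ⟪(x : X), (u : X)⟫)) / (2 * c ^ 2) := by
              field_simp
            have h7 : 2 * ‖h‖ ≤ ‖h‖ * ‖ξ‖ ^ 2 / c ^ 2 * (1 + ⟪(x : X), (u : X)⟫) := by
              rw [h6, le_div_iff₀ (by positivity)]
              nlinarith [mul_le_mul_of_nonneg_left h4 (norm_nonneg h)]
            have h8 : 0 ≤ 1 + ⟪(x : X), (u : X)⟫ := by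
              nlinarith [sq_nonneg ‖(x : X) + u‖]
            rw [hR, add_mul]
            nlinarith [mul_nonneg (norm_nonneg h) h8]
          rw [abs_le]
          constructor
          · have h9 : -⟪y, (u : X)⟫ ≤ ‖h‖ := by
              have := neg_le_abs ⟪y, (u : X)⟫
              have h10 := abs_real_inner_le_norm y (u : X)
              rw [norm_sph, mul_one] at h10
              linarith
            have := abs_le.1 (hb u)
            linarith
          · have := hy' u
            nlinarith
        · rw [mem_closedBall_zero_iff]
          refine (norm_add_le _ _).trans (add_le_add hyn ?_)
          rw [norm_smul, norm_sph, Real.norm_of_nonneg hR0, mul_one]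
      have := (suppFn_spec K x).2 _ hmem
      simpa [inner_add_left, inner_smul_left, hy, norm_sph] using this

theorem IsSupp.exists_finset {M : CS X} (hM : IsSupp M) {ε : ℝ} (hε : 0 < ε) :
    ∃ s : Finset X, (∀ y ∈ s, lin y ≤ M) ∧ ∀ x, ∃ y ∈ s, M x - ε < lin y x := by
  choose y hy hy' using hM
  obtain ⟨t, -, ht⟩ := isCompact_univ.elim_nhds_subcover (fun x => {z | M z - ε < lin (y x) z})
    fun x _ => IsOpen.mem_nhds (isOpen_lt (by fun_prop) (by fun_prop)) (by
      change M x - ε < ⟪y x, (x : X)⟫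
      rw [hy]; linarith)
  classical
  refine ⟨t.image y, fun z hz => ?_, fun x => ?_⟩
  · obtain ⟨x, -, rfl⟩ := Finset.mem_image.1 hz
    exact hy' x
  · have := ht (Set.mem_univ x)
    simp only [Set.mem_iUnion] at this
    obtain ⟨z, hz, h⟩ := this
    exact ⟨y z, Finset.mem_image_of_mem _ hz, h⟩

theorem sub_of_mem_span_ZC {f : CS X} (hf : f ∈ Submodule.span ℝ (ZC X : Set (CS X))) :
    ∃ Z₁ ∈ ZC X, ∃ Z₂ ∈ ZC X, f + Z₁ = Z₂ := by
  induction hf using Submodule.span_induction with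
  | mem h hh => exact ⟨0, (ZC X).zero_mem, h, hh, by simp⟩
  | zero => exact ⟨0, (ZC X).zero_mem, 0, (ZC X).zero_mem, by simp⟩
  | add f g _ _ h1 h2 =>
    obtain ⟨a, ha, b, hb, h⟩ := h1
    obtain ⟨a', ha', b', hb', h'⟩ := h2
    exact ⟨a + a', (ZC X).add_mem ha ha', b + b', (ZC X).add_mem hb hb', by rw [← h, ← h']; abel⟩
  | smul c f _ h1 =>
    obtain ⟨a, ha, b, hb, rfl⟩ := h1
    rcases le_total 0 c with hc | hc
    · exact ⟨c • a, smul_mem_ZC hc ha, _, smul_mem_ZC hc hb, by rw [smul_add]⟩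
    · refine ⟨(-c) • (f + a), smul_mem_ZC (neg_nonneg.2 hc) hb, (-c) • a,
        smul_mem_ZC (neg_nonneg.2 hc) ha, ?_⟩
      simp only [neg_smul, smul_add]; abel

end Even

section CL
variable {G : Type*} [Group G] [TopologicalSpace G] [IsTopologicalGroup G] [CompactSpace G]
  [SecondCountableTopology G] [MeasurableSpace G] [BorelSpace G] [T2Space G]
  {X : Type*} [NormedAddCommGroup X] [InnerProductSpace ℝ X] [FiniteDimensional ℝ X]
  [Nontrivial X] [SphRep G X]

theorem IsVal.isClosed_add_eq {ν : CS X → ℂ} (hν : IsVal ν) {W : CS X} (hW : IsSupp W) (c : ℂ) :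
    IsClosed {Y | IsSupp Y ∧ ν (W + Y) = c} := by
  have h1 : ContinuousOn (fun Y => ν (W + Y)) {Y | IsSupp Y} :=
    hν.cont.comp (by fun_prop) fun Y hY => hW.add hY
  exact h1.preimage_isClosed_of_isClosed isClosed_isSupp isClosed_singleton

variable (G) in
include G in
theorem IsVal.add_even {ν : CS X → ℂ} (hν : IsVal ν)
    (h0 : ∀ v h, IsSupp h → SUVal.dl (seg v) ν h = 0) {W Y : CS X} (hW : IsSupp W) (hY : IsSupp Y)
    (he : ∀ x, Y (-x) = Y x) : ν (W + Y) = ν W := by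
  have h1 : ∀ Z ∈ ZC X, ∀ W, IsSupp W → ν (W + Z) = ν W := fun Z hZ W hW => by
    refine (ZC_induction (p := fun Z => IsSupp Z ∧ ∀ W, IsSupp W → ν (W + Z) = ν W) ?_ ?_ ?_ ?_
      hZ).2 W hW
    · have : {Z : CS X | IsSupp Z ∧ ∀ W, IsSupp W → ν (W + Z) = ν W} =
          {Z | IsSupp Z} ∩ ⋂ W : {W : CS X // IsSupp W}, {Z | IsSupp Z ∧ ν (W.1 + Z) = ν W.1} := by
        ext Z
        simp only [Set.mem_ofPred_eq, Set.mem_inter_iff, Set.mem_iInter, Subtype.forall]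
        exact ⟨fun h => ⟨h.1, fun W hW => ⟨h.1, h.2 W hW⟩⟩, fun h => ⟨h.1, fun W hW => (h.2 W hW).2⟩⟩
      rw [this]
      exact isClosed_isSupp.inter (isClosed_iInter fun W => hν.isClosed_add_eq W.2 _)
    · exact ⟨isSupp_zero, fun W _ => by simp⟩
    · exact fun v => ⟨isSupp_seg v, fun W hW => sub_eq_zero.1 (h0 v W hW)⟩
    · rintro h k ⟨h1, h2⟩ ⟨h3, h4⟩
      exact ⟨h1.add h3, fun W hW => by rw [← add_assoc, h4 _ (hW.add h1), h2 _ hW]⟩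
  obtain ⟨F, hF, hF'⟩ := exists_even_approx G hY he
  refine ((hν.isClosed_add_eq hW (ν W)).mem_of_tendsto hF (Eventually.of_forall fun N => ?_)).2
  obtain ⟨hs, hm⟩ := hF' N
  obtain ⟨Z₁, hZ₁, Z₂, hZ₂, h⟩ := sub_of_mem_span_ZC hm
  refine ⟨hs, ?_⟩
  rw [← h1 Z₁ hZ₁ _ (hW.add hs), add_assoc, h, h1 Z₂ hZ₂ _ hW]

variable (G) in
include G in
/-- A valuation killed by all second order differences in directions of segments is additive. -/
theorem IsVal.add_of_dl_seg {ν : CS X → ℂ} (hν : IsVal ν)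
    (h0 : ∀ v h, IsSupp h → SUVal.dl (seg v) ν h = 0) {Y M : CS X} (hY : IsSupp Y) (hM : IsSupp M) :
    ν (Y + M) - ν M = ν Y - ν 0 := by
  have hconst : ∀ R : ℝ, 0 ≤ R → ∀ W, IsSupp W → ν (W + ContinuousMap.const _ R) = ν W :=
    fun R hR W hW => hν.add_even G h0 hW (isSupp_const hR) fun x => rfl
  have hcap : ∀ (ξ : X) (c : ℝ), 0 < c → ∀ M M', IsSupp M → IsSupp M' → M' ≤ M →
      (∀ x, M x ≠ M' x → c ≤ ⟪ξ, (x : X)⟫) → ν (Y + M) - ν M = ν (Y + M') - ν M' := by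
    intro ξ c hc M M' hM hM' hMM hd
    obtain ⟨R, hR, E, hE, he, hEY⟩ := hY.exists_even_eq_on_cap ξ hc
    have h1 := hν.diff_congr hM hM' hE (hY.add (isSupp_const hR)) hMM
      fun x hx => hEY x (hd x hx)
    rw [add_comm E, add_comm E, hν.add_even G h0 hM hE he, hν.add_even G h0 hM' hE he,
      add_right_comm Y _ M, add_right_comm Y _ M', hconst R hR _ (hY.add hM), hconst R hR _ (hY.add hM')] at h1
    linear_combination -h1
  set c := ContinuousMap.const (Sph X) (1 : ℝ) with hc
  have hcs : IsSupp c := isSupp_const zero_le_one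
  have hfin : ∀ M : CS X, c ≤ M → ∀ s : Finset X, (∀ y ∈ s, lin y ≤ M) →
      ∃ M' : CS X, IsSupp M' ∧ c ≤ M' ∧ M' ≤ M ∧ (∀ y ∈ s, lin y ≤ M') ∧
        ν (Y + M') - ν M' = ν (Y + c) - ν c := by
    intro M hcM s
    classical
    induction s using Finset.induction_on with
    | empty => exact fun _ => ⟨c, hcs, le_rfl, hcM, by simp, rfl⟩
    | insert y s hy ih =>
      intro hs
      obtain ⟨M', h1, h2, h3, h4, h5⟩ := ih fun z hz => hs z (Finset.mem_insert_of_mem hz)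
      refine ⟨M' ⊔ lin y, h1.sup (isSupp_lin y), h2.trans le_sup_left,
        sup_le h3 (hs y (Finset.mem_insert_self _ _)), fun z hz => ?_, ?_⟩
      · rcases Finset.mem_insert.1 hz with rfl | hz
        · exact le_sup_right
        · exact (h4 z hz).trans le_sup_left
      · rw [← h5]
        refine hcap y 1 one_pos _ _ (h1.sup (isSupp_lin y)) h1 le_sup_left fun x hx => ?_
        have h6 : (1 : ℝ) ≤ M' x := h2 x
        by_contra hcon
        refine hx (max_eq_left (α := ℝ) ?_)
        change ⟪y, (x : X)⟫ ≤ _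
        linarith
  have hlim : ∀ M, IsSupp M → c ≤ M → ν (Y + M) - ν M = ν (Y + c) - ν c := by
    intro M hM hcM
    have hcl : IsClosed {M | IsSupp M ∧ ν (Y + M) - ν M = ν (Y + c) - ν c} := by
      have h1 : ContinuousOn (fun M => ν (Y + M) - ν M) {M | IsSupp M} :=
        (hν.cont.comp (by fun_prop) fun M hM => hY.add hM).sub hν.cont
      exact h1.preimage_isClosed_of_isClosed isClosed_isSupp isClosed_singleton
    refine (hcl.closure_subset (Metric.mem_closure_iff.2 fun ε hε => ?_)).2
    obtain ⟨s, hs, hs'⟩ := hM.exists_finset hε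
    obtain ⟨M', h1, h2, h3, h4, h5⟩ := hfin M hcM s hs
    refine ⟨M', ⟨h1, h5⟩, (ContinuousMap.dist_lt_iff hε).2 fun x => ?_⟩
    obtain ⟨y, hy, h6⟩ := hs' x
    have h7 : lin y x ≤ M' x := h4 y hy x
    have h8 : M' x ≤ M x := h3 x
    rw [Real.dist_eq, abs_lt]
    constructor <;> linarith
  have h1 := hlim (M + ContinuousMap.const _ (‖M‖ + 1)) (hM.add (isSupp_const (by positivity)))
    fun x => by
      change 1 ≤ M x + (‖M‖ + 1)
      have := neg_le_of_abs_le (M.norm_coe_le_norm x)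
      linarith
  rw [← add_assoc, hconst _ (by positivity) _ (hY.add hM), hconst _ (by positivity) _ hM,
    hconst _ zero_le_one _ hY] at h1
  rw [h1, ← zero_add c, hconst _ zero_le_one _ isSupp_zero]

end CL

section Slots
variable {X : Type*} [NormedAddCommGroup X] [InnerProductSpace ℝ X] {ι : Type*}

theorem dl_comm (W Z : CS X) (ν : CS X → ℂ) : dl W (dl Z ν) = dl Z (dl W ν) := by
  ext h
  simp only [dl, add_right_comm h W Z]
  ring

theorem Td_dl (W : CS X) (ν : CS X → ℂ) (s : Finset ι) (Z : ι → CS X) :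
    Td (dl W ν) s Z = dl W (Td ν s Z) := by
  classical
  induction s using Finset.induction_on with
  | empty => simp only [Td_empty]
  | insert i s hi ih => rw [Td_insert _ hi, Td_insert _ hi, ih, dl_comm]

theorem Td_map {κ : Type*} (ν : CS X → ℂ) (s : Finset κ) (e : κ ↪ ι) (Z : ι → CS X) :
    Td ν (s.map e) Z = Td ν s (Z ∘ e) := by
  classical
  induction s using Finset.induction_on with
  | empty => simp only [Finset.map_empty, Td_empty]
  | insert i s hi ih =>
    rw [Finset.map_insert, Td_insert _ (by simpa using hi), Td_insert _ hi, ih]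
    rfl

theorem Td_cons {r : ℕ} (ν : CS X → ℂ) (W : CS X) (Z : Fin r → CS X) :
    Td ν Finset.univ (Fin.cons W Z : Fin (r + 1) → CS X) = dl W (Td ν Finset.univ Z) := by
  classical
  rw [Fin.univ_succ, Finset.cons_eq_insert, Td_insert _ (by simp), Td_map]
  rfl

theorem isSupp_sum_slots {s : Finset ι} {Z : ι → CS X} (hZ : ∀ i ∈ s, IsSupp (Z i)) {h : CS X}
    (hh : IsSupp h) {A : Finset ι} (hA : A ∈ s.powerset) : IsSupp (h + ∑ i ∈ A, Z i) :=
  hh.add (IsSupp.sum _ fun i hi => hZ i (Finset.mem_powerset.1 hA hi))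

theorem Td_eq_zero {ν : CS X → ℂ} (hν : ∀ h, IsSupp h → ν h = 0) {s : Finset ι} {Z : ι → CS X}
    (hZ : ∀ i ∈ s, IsSupp (Z i)) {h : CS X} (hh : IsSupp h) : Td ν s Z h = 0 :=
  Finset.sum_eq_zero fun A hA => by rw [hν _ (isSupp_sum_slots hZ hh hA), mul_zero]

theorem Td_act {ν : CS X → ℂ} {A : X ≃ₗᵢ[ℝ] X} {c : ℂ} (hν : ∀ h, IsSupp h → ν (act A h) = c * ν h)
    {s : Finset ι} {Z : ι → CS X} (hZ : ∀ i ∈ s, IsSupp (Z i)) {h : CS X} (hh : IsSupp h) :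
    Td ν s (fun i => act A (Z i)) (act A h) = c * Td ν s Z h := by
  rw [Td, Td, Finset.mul_sum]
  refine Finset.sum_congr rfl fun B hB => ?_
  rw [← act_sum, ← act_add, hν _ (isSupp_sum_slots hZ hh hB)]
  ring

variable [FiniteDimensional ℝ X]

theorem act_neg_of_mem_ZC {Z : CS X} (hZ : Z ∈ ZC X) : act (LinearIsometryEquiv.neg ℝ) Z = Z := by
  refine ZC_induction (p := fun Z => act (LinearIsometryEquiv.neg ℝ) Z = Z)
    (isClosed_eq (continuous_act _) continuous_id) rfl (fun v => ?_) (fun h k h1 h2 => ?_) hZ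
  · rw [act_seg]
    ext x; simp
  · rw [act_add, h1, h2]

theorem IsVal.continuousOn_td {ν : CS X → ℂ} (hν : IsVal ν) (s : Finset ι) :
    ContinuousOn (fun p : (ι → CS X) × CS X => Td ν s p.1 p.2)
      {p | (∀ i ∈ s, IsSupp (p.1 i)) ∧ IsSupp p.2} := by
  unfold Td
  refine continuousOn_finset_sum _ fun A hA => continuousOn_const.mul ?_
  refine hν.cont.comp (by fun_prop) fun p hp => ?_
  exact isSupp_sum_slots hp.1 hp.2 hA

end Slots

section Kill
variable {X : Type*} [NormedAddCommGroup X] [InnerProductSpace ℝ X] [FiniteDimensional ℝ X]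

/-- All differences of order `r` in directions of segments vanish. -/
def Ann (ν : CS X → ℂ) (r : ℕ) : Prop :=
  ∀ (v : Fin r → X) (h : CS X), IsSupp h → Td ν Finset.univ (fun i => seg (v i)) h = 0

theorem Td_update_add {ι : Type*} [DecidableEq ι] (ν : CS X → ℂ) {s : Finset ι}
    {i : ι} (hi : i ∈ s) (Z : ι → CS X) (W W' h : CS X) :
    Td ν s (Function.update Z i (W + W')) h =
      Td ν s (Function.update Z i W) (h + W') + Td ν s (Function.update Z i W') h := by
  have key : ∀ W, Td ν s (Function.update Z i W) = dl W (Td ν (s.erase i) Z) := fun W => by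
    rw [Td_eq_erase _ hi, Function.update_self, Td_congr ν (Z' := Z)]
    exact fun j hj => Function.update_of_ne (Finset.ne_of_mem_erase hj) _ _
  simp only [key, dl]
  rw [add_comm W, ← add_assoc]
  ring

theorem Ann.td_eq_zero {ν : CS X → ℂ} (hν : IsVal ν) {r : ℕ} (h0 : Ann ν r) {Z : Fin r → CS X}
    (hZ : ∀ i, Z i ∈ ZC X) {h : CS X} (hh : IsSupp h) : Td ν Finset.univ Z h = 0 := by
  have key : ∀ s : Finset (Fin r), ∀ Z : Fin r → CS X, (∀ i ∈ s, Z i ∈ ZC X) →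
      (∀ i ∉ s, ∃ v, Z i = seg v) → ∀ h, IsSupp h → Td ν Finset.univ Z h = 0 := by
    intro s
    induction s using Finset.induction_on with
    | empty =>
      intro Z _ hZ h hh
      choose v hv using fun i => hZ i (Finset.notMem_empty i)
      obtain rfl : Z = fun i => seg (v i) := funext hv
      exact h0 v h hh
    | insert i s hi ih =>
      intro Z hZ hZ' h hh
      have hsupp : ∀ j ≠ i, IsSupp (Z j) := fun j hj => by
        by_cases hjs : j ∈ s
        · exact isSupp_of_mem_ZC (hZ j (Finset.mem_insert_of_mem hjs))
        · obtain ⟨v, hv⟩ := hZ' j (by simp [hj, hjs])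
          rw [hv]; exact isSupp_seg v
      have hup : ∀ W, IsSupp W → ∀ j ∈ Finset.univ, IsSupp (Function.update Z i W j) :=
        fun W hW j _ => by
          rcases eq_or_ne j i with rfl | hj
          · simpa using hW
          · rw [Function.update_of_ne hj]; exact hsupp j hj
      have hcl : ∀ h, IsSupp h →
          IsClosed {W | IsSupp W ∧ Td ν Finset.univ (Function.update Z i W) h = 0} := by
        intro h hh
        have h1 : ContinuousOn (fun W => Td ν Finset.univ (Function.update Z i W) h)
            {W | IsSupp W} :=
          (hν.continuousOn_td Finset.univ).comp (f := fun W => (Function.update Z i W, h))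
            (by fun_prop) fun W hW => ⟨hup W hW, hh⟩
        exact h1.preimage_isClosed_of_isClosed isClosed_isSupp isClosed_singleton
      have := ZC_induction (p := fun W => IsSupp W ∧
        ∀ h, IsSupp h → Td ν Finset.univ (Function.update Z i W) h = 0) ?_ ?_ ?_ ?_
        (hZ i (Finset.mem_insert_self _ _))
      · simpa using this.2 h hh
      · have : {W : CS X | IsSupp W ∧ ∀ h, IsSupp h →
            Td ν Finset.univ (Function.update Z i W) h = 0} = {W | IsSupp W} ∩
            ⋂ h : {h : CS X // IsSupp h},
              {W | IsSupp W ∧ Td ν Finset.univ (Function.update Z i W) h.1 = 0} := by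
          ext W
          simp only [Set.mem_ofPred_eq, Set.mem_inter_iff, Set.mem_iInter, Subtype.forall]
          exact ⟨fun h => ⟨h.1, fun k hk => ⟨h.1, h.2 k hk⟩⟩,
            fun h => ⟨h.1, fun k hk => (h.2 k hk).2⟩⟩
        rw [this]
        exact isClosed_isSupp.inter (isClosed_iInter fun h => hcl h.1 h.2)
      · refine ⟨isSupp_zero, fun h hh => ?_⟩
        rw [Td_eq_erase _ (Finset.mem_univ i), Function.update_self]
        simp [dl]
      · refine fun v => ⟨isSupp_seg v, fun h hh => ih _ (fun j hj => ?_) (fun j hj => ?_) h hh⟩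
        · rw [Function.update_of_ne (ne_of_mem_of_not_mem hj hi)]
          exact hZ j (Finset.mem_insert_of_mem hj)
        · rcases eq_or_ne j i with rfl | hji
          · exact ⟨v, Function.update_self _ _ _⟩
          · rw [Function.update_of_ne hji]
            exact hZ' j (by simp [hji, hj])
      · rintro W W' ⟨h1, h2⟩ ⟨h3, h4⟩
        refine ⟨h1.add h3, fun h hh => ?_⟩
        rw [Td_update_add _ (Finset.mem_univ i), h2 _ (hh.add h3), h4 h hh, add_zero]
  exact key Finset.univ Z (fun i _ => hZ i) (fun i hi => absurd (Finset.mem_univ i) hi) h hh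

theorem Ann.dl_td_eq_zero {ν : CS X → ℂ} (hν : IsVal ν) {r : ℕ} (h0 : Ann ν (r + 1))
    {Z : Fin r → CS X} (hZ : ∀ i, Z i ∈ ZC X) {W h : CS X} (hW : W ∈ ZC X) (hh : IsSupp h) :
    SUVal.dl W (Td ν Finset.univ Z) h = 0 := by
  rw [← Td_cons]
  exact h0.td_eq_zero hν (fun i => Fin.cases hW hZ i) hh

theorem Ann.td_update_add {ν : CS X → ℂ} (hν : IsVal ν) {r : ℕ} (h0 : Ann ν (r + 1))
    {Z : Fin r → CS X} (hZ : ∀ i, Z i ∈ ZC X) (i : Fin r) {W W' h : CS X} (hW : W ∈ ZC X)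
    (hW' : W' ∈ ZC X) (hh : IsSupp h) :
    Td ν Finset.univ (Function.update Z i (W + W')) h =
      Td ν Finset.univ (Function.update Z i W) h + Td ν Finset.univ (Function.update Z i W') h := by
  rw [Td_update_add _ (Finset.mem_univ i)]
  congr 1
  refine sub_eq_zero.1 (h0.dl_td_eq_zero hν (fun j => ?_) hW' hh)
  rcases eq_or_ne j i with rfl | hj
  · simpa using hW
  · rw [Function.update_of_ne hj]; exact hZ j

end Kill

section Frame
variable {X : Type*} [NormedAddCommGroup X] [InnerProductSpace ℝ X] [FiniteDimensional ℝ X]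

/-- A multilinear function of `r` zonoids and of a difference of support functions, as obtained
from the differences of order `r` of a valuation which is killed by differences of order `r + 1`. -/
structure Frame {r : ℕ} (E : (X ≃ₗᵢ[ℝ] X) → ℂ → Prop)
    (T : (Fin r → CS X) → CS X →ₗ[ℝ] ℂ) : Prop where
  update_add : ∀ Z : Fin r → CS X, (∀ i, Z i ∈ ZC X) → ∀ i, ∀ W ∈ ZC X, ∀ W' ∈ ZC X, ∀ f ∈ HH X,
    T (Function.update Z i (W + W')) f = T (Function.update Z i W) f + T (Function.update Z i W') f
  cont : ∀ f ∈ HH X, ContinuousOn (fun Z => T Z f) {Z | ∀ i, Z i ∈ ZC X}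
  equiv : ∀ A c, E A c → ∀ Z : Fin r → CS X, (∀ i, Z i ∈ ZC X) → ∀ f ∈ HH X,
    T (fun i => act A (Z i)) (act A f) = c * T Z f
  perp : ∀ Z : Fin r → CS X, (∀ i, Z i ∈ ZC X) → ∀ i v, Z i = seg v → ∀ f ∈ HH X,
    (∀ x : Sph X, ⟪v, (x : X)⟫ = 0 → f x = 0) → T Z f = 0
  lin : ∀ Z : Fin r → CS X, (∀ i, Z i ∈ ZC X) → ∀ a, T Z (lin a) = 0
  loc : ∀ Z : Fin r → CS X, (∀ i, Z i ∈ ZC X) → ∀ i, ∀ W ∈ ZC X, ∀ W' ∈ ZC X, ∀ (a : X) (M M' : CS X),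
    IsSupp M → IsSupp M' → M' ≤ M → (∀ x, M x ≠ M' x → W x = W' x + ⟪a, (x : X)⟫) →
    T (Function.update Z i W) (M - M') = T (Function.update Z i W') (M - M')
  shear : ∀ (v : Fin r → X) (i j : Fin r), i ≠ j → ∀ c : ℝ, ∀ f ∈ HH X,
    T (fun k => seg (Function.update v j (v j + c • v i) k)) f = T (fun k => seg (v k)) f
  cont_supp : ContinuousOn (fun p : (Fin r → X) × CS X => T (fun k => seg (p.1 k)) p.2)
    {p | IsSupp p.2}
  one : ∀ Z : Fin r → CS X, (∀ i, Z i ∈ ZC X) → ∀ i, Z i = 1 → ∀ f ∈ HH X, T Z f = 0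

variable {r : ℕ} {E : (X ≃ₗᵢ[ℝ] X) → ℂ → Prop} {T : (Fin r → CS X) → CS X →ₗ[ℝ] ℂ}

theorem update_mem_ZC {Z : Fin r → CS X} (hZ : ∀ i, Z i ∈ ZC X) {i : Fin r} {W : CS X}
    (hW : W ∈ ZC X) (j : Fin r) : Function.update Z i W j ∈ ZC X := by
  rcases eq_or_ne j i with rfl | hj
  · simpa using hW
  · rw [Function.update_of_ne hj]; exact hZ j

theorem Frame.update_smul (hT : Frame E T) {Z : Fin r → CS X} (hZ : ∀ i, Z i ∈ ZC X) (i : Fin r)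
    {c : ℝ} (hc : 0 ≤ c) {W : CS X} (hW : W ∈ ZC X) {f : CS X} (hf : f ∈ HH X) :
    T (Function.update Z i (c • W)) f = c * T (Function.update Z i W) f := by
  rw [← Complex.real_smul]
  refine posHomogeneous_of_additive (C := (ZC X : Set (CS X)))
    (f := fun W => T (Function.update Z i W) f) (fun c hc x hx => smul_mem_ZC hc hx) ?_
    (fun x hx y hy => hT.update_add Z hZ i x hx y hy f hf) c hc W hW
  exact (hT.cont f hf).comp (f := fun W => Function.update Z i W) (by fun_prop)
    fun W hW => update_mem_ZC hZ hW

theorem Frame.smul_prod (hT : Frame E T) {Z : Fin r → CS X} (hZ : ∀ i, Z i ∈ ZC X) {c : Fin r → ℝ}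
    (hc : ∀ i, 0 ≤ c i) {f : CS X} (hf : f ∈ HH X) :
    T (fun i => c i • Z i) f = (∏ i, c i : ℝ) * T Z f := by
  have key : ∀ s : Finset (Fin r),
      T (fun i => if i ∈ s then c i • Z i else Z i) f = (∏ i ∈ s, c i : ℝ) * T Z f := by
    intro s
    induction s using Finset.induction_on with
    | empty => simp
    | insert i s hi ih =>
      have h1 : (fun j => if j ∈ insert i s then c j • Z j else Z j) =
          Function.update (fun j => if j ∈ s then c j • Z j else Z j) i (c i • Z i) := by
        ext1 j
        rcases eq_or_ne j i with rfl | hj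
        · simp
        · simp [hj]
      have h2 : Function.update (fun j => if j ∈ s then c j • Z j else Z j) i (Z i) =
          fun j => if j ∈ s then c j • Z j else Z j := by
        conv_rhs => rw [← Function.update_eq_self i (fun j => if j ∈ s then c j • Z j else Z j)]
        simp [hi]
      rw [h1, hT.update_smul _ i (hc i) (hZ i) hf, h2, ih, Finset.prod_insert hi]
      · push_cast; ring
      · intro j
        split_ifs
        · exact smul_mem_ZC (hc j) (hZ j)
        · exact hZ j
  simpa using key Finset.univ

theorem Frame.exists_bound (hT : Frame E T) : ∃ C, 0 ≤ C ∧ ∀ (v : Fin r → X) (h : CS X), IsSupp h →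
    ‖T (fun k => seg (v k)) h‖ ≤ C * (∏ i, ‖v i‖) * ‖h‖ := by
  obtain ⟨O, hO, hO'⟩ := (continuousOn_iff'.1 hT.cont_supp) _ (Metric.isOpen_ball (x := (0 : ℂ)) (ε := 1))
  have hK : IsCompact (Metric.closedBall (0 : Fin r → X) 1) := isCompact_closedBall _ _
  have hsub : Metric.closedBall (0 : Fin r → X) 1 ×ˢ {(0 : CS X)} ⊆ O := by
    rintro ⟨v, h⟩ ⟨-, rfl⟩
    have : (v, (0 : CS X)) ∈ O ∩ {p | IsSupp p.2} := hO' ▸ ⟨by simp, isSupp_zero⟩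
    exact this.1
  obtain ⟨U, V, -, hV, hKU, h0V, hUV⟩ := generalized_tube_lemma hK isCompact_singleton hO hsub
  obtain ⟨δ, hδ, hδV⟩ := Metric.isOpen_iff.1 hV 0 (h0V rfl)
  refine ⟨2 / δ, by positivity, fun v h hh => ?_⟩
  have h1 : ∀ k, v k = ‖v k‖ • (‖v k‖⁻¹ • v k) := fun k => by
    rcases eq_or_ne (v k) 0 with h0 | h0
    · simp [h0]
    · rw [smul_smul, mul_inv_cancel₀ (norm_ne_zero_iff.2 h0), one_smul]
  have h2 : (fun k => seg (v k)) = fun k => ‖v k‖ • seg (‖v k‖⁻¹ • v k) := by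
    ext1 k
    conv_lhs => rw [h1 k]
    rw [seg_smul, abs_of_nonneg (norm_nonneg _)]
  rw [h2, hT.smul_prod (fun i => seg_mem_ZC _) (fun i => norm_nonneg _) hh.mem_HH, norm_mul,
    Complex.norm_real, Real.norm_of_nonneg (Finset.prod_nonneg fun i _ => norm_nonneg _)]
  rcases eq_or_ne h 0 with rfl | hne
  · simp
  have hn : 0 < ‖h‖ := norm_pos_iff.2 hne
  have h3 : h = (2 * ‖h‖ / δ) • ((δ / (2 * ‖h‖)) • h) := by
    rw [smul_smul, show 2 * ‖h‖ / δ * (δ / (2 * ‖h‖)) = 1 by field_simp, one_smul]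
  have h4 : ‖T (fun k => seg (‖v k‖⁻¹ • v k)) ((δ / (2 * ‖h‖)) • h)‖ ≤ 1 := by
    have h5 : ((fun k => ‖v k‖⁻¹ • v k, (δ / (2 * ‖h‖)) • h) : (Fin r → X) × CS X) ∈
        O ∩ {p | IsSupp p.2} := by
      refine ⟨hUV ⟨hKU ?_, hδV ?_⟩, hh.smul (by positivity)⟩
      · rw [mem_closedBall_zero_iff, pi_norm_le_iff_of_nonneg zero_le_one]
        intro k
        rw [norm_smul, norm_inv, norm_norm]
        exact inv_mul_le_one
      · rw [mem_ball_zero_iff, norm_smul, Real.norm_of_nonneg (by positivity)]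
        rw [show δ / (2 * ‖h‖) * ‖h‖ = δ / 2 by field_simp]
        linarith
    rw [← hO'] at h5
    exact (mem_ball_zero_iff.1 h5.1).le
  calc _ = (∏ i, ‖v i‖) * ((2 * ‖h‖ / δ) * ‖T (fun k => seg (‖v k‖⁻¹ • v k))
        ((δ / (2 * ‖h‖)) • h)‖) := by
        conv_lhs => rw [h3]
        rw [map_smul, norm_smul, Real.norm_of_nonneg (by positivity)]
    _ ≤ (∏ i, ‖v i‖) * ((2 * ‖h‖ / δ) * 1) := by gcongr
    _ = _ := by ring

theorem Frame.continuous_left (hT : Frame E T) {f : CS X} (hf : f ∈ HH X) :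
    Continuous fun v : Fin r → X => T (fun k => seg (v k)) f := by
  rw [← continuousOn_univ]
  have := continuous_seg (X := X)
  exact (hT.cont f hf).comp (f := fun (v : Fin r → X) k => seg (v k)) (by fun_prop) fun v _ k => seg_mem_ZC _

theorem Frame.exists_bound_HH (hT : Frame E T) {f : CS X} (hf : f ∈ HH X) :
    ∃ C, 0 ≤ C ∧ ∀ v : Fin r → X, ‖T (fun k => seg (v k)) f‖ ≤ C * ∏ i, ‖v i‖ := by
  obtain ⟨C, hC, h1⟩ := hT.exists_bound
  obtain ⟨h, k, hh, hk, rfl⟩ := mem_HH_iff.1 hf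
  refine ⟨C * ‖h‖ + C * ‖k‖, by positivity, fun v => ?_⟩
  rw [map_sub]
  refine (norm_sub_le _ _).trans ((add_le_add (h1 v h hh) (h1 v k hk)).trans_eq ?_)
  ring

end Frame

section Build
variable {G : Type*} [Group G] [TopologicalSpace G] [IsTopologicalGroup G] [CompactSpace G]
  [SecondCountableTopology G] [MeasurableSpace G] [BorelSpace G] [T2Space G]
  {X : Type*} [NormedAddCommGroup X] [InnerProductSpace ℝ X] [FiniteDimensional ℝ X]
  [Nontrivial X] [SphRep G X]

/-- A linear functional agreeing with the `r`-th difference on support functions. -/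
def TL (ν : CS X → ℂ) {r : ℕ} (Z : Fin r → CS X) : CS X →ₗ[ℝ] ℂ :=
  open Classical in
  if h : ∃ L : CS X →ₗ[ℝ] ℂ, ∀ f ∈ {f | IsSupp f}, L f = Td ν Finset.univ Z f then h.choose else 0

variable (G) in
include G in
theorem TL_apply {ν : CS X → ℂ} (hν : IsVal ν) {r : ℕ} (h0 : Ann ν (r + 1))
    (hneg : ∀ h, IsSupp h → ν (act (LinearIsometryEquiv.neg ℝ) h) = -1 * ν h) {Z : Fin r → CS X}
    (hZ : ∀ i, Z i ∈ ZC X) {h : CS X} (hh : IsSupp h) : TL ν Z h = Td ν Finset.univ Z h := by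
  have hZs : ∀ i ∈ Finset.univ, IsSupp (Z i) := fun i _ => isSupp_of_mem_ZC (hZ i)
  have hval := hν.td Finset.univ hZs
  have hz : Td ν Finset.univ Z 0 = 0 := by
    have := Td_act (s := Finset.univ) hneg hZs isSupp_zero
    simp only [act_neg_of_mem_ZC (hZ _), act_zero] at this
    linear_combination this / 2
  have hadd : ∀ x ∈ {f : CS X | IsSupp f}, ∀ y ∈ {f : CS X | IsSupp f},
      Td ν Finset.univ Z (x + y) = Td ν Finset.univ Z x + Td ν Finset.univ Z y := by
    intro x hx y hy
    have := hval.add_of_dl_seg G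
      (fun v h hh => h0.dl_td_eq_zero hν hZ (seg_mem_ZC v) hh) hx hy
    rw [hz] at this
    linear_combination this
  have hex := exists_linear_extension (C := {f : CS X | IsSupp f}) isSupp_zero
    (fun x hx y hy => hx.add hy) (fun c hc x hx => hx.smul hc) hadd
    (posHomogeneous_of_additive (fun c hc x hx => hx.smul hc) hval.cont hadd)
  rw [TL, dif_pos hex]
  exact hex.choose_spec h hh

variable (G) in
include G in
theorem IsVal.frame {ν : CS X → ℂ} (hν : IsVal ν) {r : ℕ} (h0 : Ann ν (r + 1))
    {E : (X ≃ₗᵢ[ℝ] X) → ℂ → Prop} (hE : ∀ A c, E A c → ∀ h, IsSupp h → ν (act A h) = c * ν h)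
    (hneg : E (LinearIsometryEquiv.neg ℝ) (-1)) (hone : ∀ h, IsSupp h → SUVal.dl 1 ν h = 0) :
    Frame E (TL ν : (Fin r → CS X) → CS X →ₗ[ℝ] ℂ) := by
  have hTL : ∀ {Z : Fin r → CS X}, (∀ i, Z i ∈ ZC X) → ∀ {h : CS X}, IsSupp h →
      TL ν Z h = Td ν Finset.univ Z h := fun hZ _ hh => TL_apply G hν h0 (hE _ _ hneg) hZ hh
  have hseg : ∀ (v : Fin r → X) i, seg (v i) ∈ ZC X := fun v i => seg_mem_ZC _
  have hs : ∀ {Z : Fin r → CS X}, (∀ i, Z i ∈ ZC X) → ∀ i ∈ Finset.univ, IsSupp (Z i) :=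
    fun hZ i _ => isSupp_of_mem_ZC (hZ i)
  refine ⟨?_, ?_, ?_, ?_, ?_, ?_, ?_, ?_, ?_⟩
  · intro Z hZ i W hW W' hW' f hf
    obtain ⟨h, k, hh, hk, rfl⟩ := mem_HH_iff.1 hf
    simp only [map_sub]
    rw [hTL (update_mem_ZC hZ ((ZC X).add_mem hW hW')) hh, hTL (update_mem_ZC hZ hW) hh,
      hTL (update_mem_ZC hZ hW') hh, hTL (update_mem_ZC hZ ((ZC X).add_mem hW hW')) hk,
      hTL (update_mem_ZC hZ hW) hk, hTL (update_mem_ZC hZ hW') hk,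
      h0.td_update_add hν hZ i hW hW' hh, h0.td_update_add hν hZ i hW hW' hk]
    ring
  · intro f hf
    obtain ⟨h, k, hh, hk, rfl⟩ := mem_HH_iff.1 hf
    have key : ∀ h : CS X, IsSupp h →
        ContinuousOn (fun Z : Fin r → CS X => TL ν Z h) {Z | ∀ i, Z i ∈ ZC X} := fun h hh => by
      refine ContinuousOn.congr (f := fun Z => Td ν Finset.univ Z h) ?_ fun Z hZ => hTL hZ hh
      exact (hν.continuousOn_td Finset.univ).comp (f := fun Z => (Z, h)) (by fun_prop)
        fun Z hZ => ⟨hs hZ, hh⟩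
    simp only [map_sub]
    exact (key h hh).sub (key k hk)
  · intro A c hA Z hZ f hf
    obtain ⟨h, k, hh, hk, rfl⟩ := mem_HH_iff.1 hf
    have hZ' : ∀ i, act A (Z i) ∈ ZC X := fun i => act_mem_ZC (hZ i) A
    rw [act_sub, map_sub, map_sub, hTL hZ' (hh.act A), hTL hZ' (hk.act A), hTL hZ hh, hTL hZ hk,
      Td_act (hE A c hA) (hs hZ) hh, Td_act (hE A c hA) (hs hZ) hk]
    ring
  · intro Z hZ i v hv f hf h1
    obtain ⟨h, k, hh, hk, rfl⟩ := mem_HH_iff.1 hf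
    rw [map_sub, hTL hZ hh, hTL hZ hk, sub_eq_zero]
    exact hν.td_seg_congr (Finset.mem_univ i) hv (hs hZ) hh hk fun x hx => sub_eq_zero.1 (h1 x hx)
  · intro Z hZ a
    have := (hν.td Finset.univ (hs hZ)).trans 0 a isSupp_zero
    rw [hTL hZ (isSupp_lin a), ← zero_add (lin a), this, ← hTL hZ isSupp_zero, map_zero]
  · intro Z hZ i W hW W' hW' a M M' hM hM' hMM hd
    have key : ∀ W ∈ ZC X, ∀ M, IsSupp M → TL ν (Function.update Z i W) M =
        Td ν (Finset.univ.erase i) Z (M + W) - Td ν (Finset.univ.erase i) Z M := by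
      intro W hW M hM
      rw [hTL (update_mem_ZC hZ hW) hM, Td_eq_erase _ (Finset.mem_univ i), Function.update_self,
        Td_congr ν (Z' := Z)]
      · rfl
      · exact fun j hj => Function.update_of_ne (Finset.ne_of_mem_erase hj) _ _
    have hval := hν.td (Finset.univ.erase i) (Z := Z) fun i _ => isSupp_of_mem_ZC (hZ i)
    have hW1 := isSupp_of_mem_ZC hW
    have hW2 := isSupp_of_mem_ZC hW'
    have h1 := hval.diff_congr hM hM' hW1 (hW2.add (isSupp_lin a)) hMM fun x hx => by
      rw [hd x hx]; rfl
    rw [add_right_comm W' _ M, add_right_comm W' _ M', hval.trans _ _ (hW2.add hM),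
      hval.trans _ _ (hW2.add hM')] at h1
    rw [map_sub, map_sub, key W hW M hM, key W hW M' hM', key W' hW' M hM, key W' hW' M' hM',
      add_comm M, add_comm M', add_comm M, add_comm M']
    linear_combination h1
  · intro v i j hij c f hf
    obtain ⟨h, k, hh, hk, rfl⟩ := mem_HH_iff.1 hf
    rw [map_sub, map_sub, hTL (hseg _) hh, hTL (hseg _) hk, hTL (hseg _) hh, hTL (hseg _) hk,
      hν.td_shear (Finset.mem_univ i) (Finset.mem_univ j) hij c hh,
      hν.td_shear (Finset.mem_univ i) (Finset.mem_univ j) hij c hk]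
  · refine ContinuousOn.congr (f := fun p : (Fin r → X) × CS X =>
      Td ν Finset.univ (fun k => seg (p.1 k)) p.2) ?_ fun p hp => hTL (hseg _) hp
    refine (hν.continuousOn_td Finset.univ).comp
      (f := fun p : (Fin r → X) × CS X => (fun k => seg (p.1 k), p.2)) ?_
        fun p hp => ⟨fun i _ => isSupp_seg _, hp⟩
    have := continuous_seg (X := X)
    exact Continuous.continuousOn (by fun_prop)
  · intro Z hZ i hi f hf
    have key : ∀ h : CS X, IsSupp h → TL ν Z h = 0 := fun h hh => by
      rw [hTL hZ hh, Td_eq_erase _ (Finset.mem_univ i), hi, ← Td_dl]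
      exact Td_eq_zero hone (fun i _ => isSupp_of_mem_ZC (hZ i)) hh
    obtain ⟨h, k, hh, hk, rfl⟩ := mem_HH_iff.1 hf
    rw [map_sub, key h hh, key k hk, sub_zero]

end Build

section Poly
variable {X : Type*} [NormedAddCommGroup X] [InnerProductSpace ℝ X]

/-- Real polynomial functions of `r` vectors. -/
def PolyFn (r : ℕ) (X : Type*) [NormedAddCommGroup X] [InnerProductSpace ℝ X] :
    Subalgebra ℝ ((Fin r → X) → ℝ) :=
  Algebra.adjoin ℝ (Set.range fun p : Fin r × X => fun v => ⟪p.2, v p.1⟫)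

variable {r : ℕ}

theorem inner_mem_PolyFn (q : X) (i : Fin r) : (fun v => ⟪q, v i⟫) ∈ PolyFn r X :=
  Algebra.subset_adjoin ⟨(i, q), rfl⟩

theorem const_mem_PolyFn (c : ℝ) : (fun _ => c) ∈ PolyFn r X :=
  (PolyFn r X).algebraMap_mem c

theorem prod_mem_PolyFn {ι : Type*} (s : Finset ι) {f : ι → (Fin r → X) → ℝ}
    (hf : ∀ i ∈ s, f i ∈ PolyFn r X) : (fun v => ∏ i ∈ s, f i v) ∈ PolyFn r X := by
  have := prod_mem hf
  convert this using 1
  ext v; simp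

theorem sum_mem_PolyFn {ι : Type*} (s : Finset ι) {f : ι → (Fin r → X) → ℝ}
    (hf : ∀ i ∈ s, f i ∈ PolyFn r X) : (fun v => ∑ i ∈ s, f i v) ∈ PolyFn r X := by
  have := sum_mem hf
  convert this using 1
  ext v; simp

theorem PolyFn_induction {p : ((Fin r → X) → ℝ) → Prop}
    (inner : ∀ q i, p fun v => ⟪q, v i⟫) (const : ∀ c : ℝ, p fun _ => c)
    (add : ∀ f ∈ PolyFn r X, ∀ g ∈ PolyFn r X, p f → p g → p (fun v => f v + g v))
    (mul : ∀ f ∈ PolyFn r X, ∀ g ∈ PolyFn r X, p f → p g → p (fun v => f v * g v))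
    {f : (Fin r → X) → ℝ} (hf : f ∈ PolyFn r X) : p f := by
  refine Algebra.adjoin_induction (p := fun f _ => p f) ?_ (fun c => const c)
    (fun f g hf hg => add f hf g hg) (fun f g hf hg => mul f hf g hg) hf
  rintro _ ⟨⟨i, q⟩, rfl⟩
  exact inner q i

theorem continuous_of_mem_PolyFn {f : (Fin r → X) → ℝ} (hf : f ∈ PolyFn r X) : Continuous f := by
  refine PolyFn_induction (fun q i => by fun_prop) (fun c => by fun_prop)
    (fun f _ g _ hf hg => hf.add hg) (fun f _ g _ hf hg => hf.mul hg) hf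

theorem PolyFn_comp [FiniteDimensional ℝ X] {Y : Type*} [NormedAddCommGroup Y]
    [InnerProductSpace ℝ Y] [FiniteDimensional ℝ Y] (A : Y →ₗ[ℝ] X)
    {f : (Fin r → X) → ℝ} (hf : f ∈ PolyFn r X) : (fun v => f fun i => A (v i)) ∈ PolyFn r Y := by
  refine PolyFn_induction (p := fun f => (fun v => f fun i => A (v i)) ∈ PolyFn r Y)
    (fun q i => ?_) (fun c => const_mem_PolyFn c) (fun f _ g _ hf hg => add_mem hf hg) (fun f _ g _ hf hg => mul_mem hf hg) hf
  simp_rw [← LinearMap.adjoint_inner_left]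
  exact inner_mem_PolyFn _ i

/-- Functions of polynomial growth. -/
def PolyBdd {E F : Type*} [Norm E] [Norm F] (f : E → F) : Prop :=
  ∃ C : ℝ, ∃ k : ℕ, 0 ≤ C ∧ ∀ v, ‖f v‖ ≤ C * (1 + ‖v‖) ^ k

section PolyBdd
variable {V : Type*} [SeminormedAddCommGroup V] {F : Type*} [NormedRing F]

theorem PolyBdd.add {E : Type*} [SeminormedAddCommGroup E] {f g : V → E} (hf : PolyBdd f)
    (hg : PolyBdd g) : PolyBdd fun v => f v + g v := by
  obtain ⟨C, k, hC, h1⟩ := hf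
  obtain ⟨D, l, hD, h2⟩ := hg
  refine ⟨C + D, k + l, by positivity, fun v => (norm_add_le _ _).trans ?_⟩
  have h3 : (1 + ‖v‖) ^ k ≤ (1 + ‖v‖) ^ (k + l) :=
    pow_le_pow_right₀ (by linarith [norm_nonneg v]) (by omega)
  have h4 : (1 + ‖v‖) ^ l ≤ (1 + ‖v‖) ^ (k + l) :=
    pow_le_pow_right₀ (by linarith [norm_nonneg v]) (by omega)
  nlinarith [h1 v, h2 v]

theorem PolyBdd.mul {f g : V → F} (hf : PolyBdd f) (hg : PolyBdd g) :
    PolyBdd fun v => f v * g v := by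
  obtain ⟨C, k, hC, h1⟩ := hf
  obtain ⟨D, l, hD, h2⟩ := hg
  refine ⟨C * D, k + l, by positivity, fun v => (norm_mul_le _ _).trans ?_⟩
  calc ‖f v‖ * ‖g v‖ ≤ (C * (1 + ‖v‖) ^ k) * (D * (1 + ‖v‖) ^ l) :=
        mul_le_mul (h1 v) (h2 v) (norm_nonneg _) (by positivity)
    _ = _ := by ring

theorem polyBdd_of_mem_PolyFn {f : (Fin r → X) → ℝ} (hf : f ∈ PolyFn r X) : PolyBdd f := by
  refine PolyFn_induction (fun q i => ⟨‖q‖, 1, norm_nonneg _, fun v => ?_⟩)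
    (fun c => ⟨|c|, 0, abs_nonneg c, fun v => by simp⟩)
    (fun f _ g _ hf hg => hf.add hg) (fun f _ g _ hf hg => hf.mul hg) hf
  refine (norm_inner_le_norm _ _).trans (mul_le_mul_of_nonneg_left ?_ (norm_nonneg _))
  have := norm_le_pi_norm v i
  simp; linarith

theorem PolyBdd.ofReal {f : V → ℝ} (hf : PolyBdd f) : PolyBdd fun v => (f v : ℂ) := by
  obtain ⟨C, k, hC, h⟩ := hf
  exact ⟨C, k, hC, fun v => by simpa using h v⟩

theorem polyBdd_of_le_prod {f : (Fin r → X) → ℂ} {C : ℝ} (hC : 0 ≤ C)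
    (hf : ∀ v, ‖f v‖ ≤ C * ∏ i, ‖v i‖) : PolyBdd f := by
  refine ⟨C, r, hC, fun v => (hf v).trans (mul_le_mul_of_nonneg_left ?_ hC)⟩
  calc ∏ i, ‖v i‖ ≤ ∏ _i : Fin r, (1 + ‖v‖) :=
        Finset.prod_le_prod (fun i _ => norm_nonneg _) fun i _ => by
          have := norm_le_pi_norm v i; linarith
    _ = _ := by simp

end PolyBdd

/-- The Gaussian weight. -/
def gw (v : Fin r → X) : ℝ := Real.exp (-∑ i, ‖v i‖ ^ 2)

theorem gw_pos (v : Fin r → X) : 0 < gw v := Real.exp_pos _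

@[fun_prop]
theorem continuous_gw : Continuous (gw : (Fin r → X) → ℝ) := by
  unfold gw; fun_prop

theorem gw_comp {Y : Type*} [NormedAddCommGroup Y] [InnerProductSpace ℝ Y] (A : X →ₗᵢ[ℝ] Y)
    (v : Fin r → X) : gw (fun i => A (v i)) = gw v := by
  simp [gw]

variable [FiniteDimensional ℝ X] [MeasurableSpace X] [BorelSpace X]

theorem integrable_exp_neg_norm_sq {b : ℝ} (hb : 0 < b) :
    Integrable fun x : X => Real.exp (-(b * ‖x‖ ^ 2)) := by
  have := (GaussianFourier.integrable_cexp_neg_mul_sq_norm_add (V := X) (b := (b : ℂ))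
    (by simpa using hb) 0 0).norm
  refine this.congr (Eventually.of_forall fun x => ?_)
  simp [Complex.norm_exp, ← Complex.ofReal_pow]

theorem integrable_gw_half : Integrable fun v : Fin r → X => Real.exp (-((1 / 2) * ∑ i, ‖v i‖ ^ 2)) := by
  have := Integrable.fintype_prod (ι := Fin r) (μ := fun _ => (volume : Measure X))
    (f := fun _ x => Real.exp (-((1 / 2) * ‖x‖ ^ 2)))
    fun i => integrable_exp_neg_norm_sq (by norm_num)
  refine this.congr (Eventually.of_forall fun v => ?_)
  simp only [← Real.exp_sum, Finset.mul_sum, Finset.sum_neg_distrib]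

theorem norm_sq_le_sum (v : Fin r → X) : ‖v‖ ^ 2 ≤ ∑ i, ‖v i‖ ^ 2 := by
  have h0 : 0 ≤ ∑ i, ‖v i‖ ^ 2 := Finset.sum_nonneg fun i _ => sq_nonneg _
  have : ‖v‖ ≤ √(∑ i, ‖v i‖ ^ 2) := by
    refine (pi_norm_le_iff_of_nonneg (Real.sqrt_nonneg _)).2 fun i => Real.le_sqrt_of_sq_le ?_
    exact Finset.single_le_sum (f := fun i => ‖v i‖ ^ 2) (fun i _ => sq_nonneg _) (Finset.mem_univ i)
  calc ‖v‖ ^ 2 ≤ √(∑ i, ‖v i‖ ^ 2) ^ 2 := by gcongr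
    _ = _ := Real.sq_sqrt h0

theorem one_add_pow_mul_gw_le (k : ℕ) (v : Fin r → X) : (1 + ‖v‖) ^ k * gw v ≤
    Real.exp (k ^ 2 / 2) * Real.exp (-((1 / 2) * ∑ i, ‖v i‖ ^ 2)) := by
  have h1 : (1 + ‖v‖) ^ k ≤ Real.exp (k * ‖v‖) := by
    rw [Real.exp_nat_mul]
    exact pow_le_pow_left₀ (by positivity) (by linarith [Real.add_one_le_exp ‖v‖]) _
  refine (mul_le_mul_of_nonneg_right h1 (gw_pos v).le).trans ?_
  rw [gw, ← Real.exp_add, ← Real.exp_add, Real.exp_le_exp]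
  nlinarith [norm_sq_le_sum v, sq_nonneg ((k : ℝ) - ‖v‖)]

theorem PolyBdd.integrable_gw_mul {f : (Fin r → X) → ℂ} (hf : PolyBdd f) (hc : Continuous f) :
    Integrable fun v => (gw v : ℂ) * f v := by
  obtain ⟨C, k, hC, h⟩ := hf
  refine Integrable.mono' (g := fun v => C * (Real.exp (k ^ 2 / 2) *
    Real.exp (-((1 / 2) * ∑ i, ‖v i‖ ^ 2)))) ((integrable_gw_half.const_mul _).const_mul _)
    (by fun_prop) (Eventually.of_forall fun v => ?_)
  rw [norm_mul, Complex.norm_real, Real.norm_of_nonneg (gw_pos v).le]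
  calc gw v * ‖f v‖ ≤ gw v * (C * (1 + ‖v‖) ^ k) := mul_le_mul_of_nonneg_left (h v) (gw_pos v).le
    _ = C * ((1 + ‖v‖) ^ k * gw v) := by ring
    _ ≤ _ := mul_le_mul_of_nonneg_left (one_add_pow_mul_gw_le k v) hC

end Poly

section Finite
variable {G : Type*} [Group G] [TopologicalSpace G] [IsTopologicalGroup G] [CompactSpace G]
  [SecondCountableTopology G] [MeasurableSpace G] [BorelSpace G]
  {X : Type*} [NormedAddCommGroup X] [InnerProductSpace ℝ X] [FiniteDimensional ℝ X]
  [SphRep G X] {r : ℕ}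

variable (G) in
include G in
theorem exists_repFn_of_mem_PolyFn {f : (Fin r → X) → ℝ} (hf : f ∈ PolyFn r X) :
    ∃ (ι : Type) (_ : Fintype ι) (a : ι → C(G, ℝ)) (p : ι → (Fin r → X) → ℝ),
      (∀ j, RepFn (a j)) ∧ (∀ j, p j ∈ PolyFn r X) ∧
      ∀ (g : G) v, f (fun i => rho X g (v i)) = ∑ j, a j g * p j v := by
  refine PolyFn_induction (p := fun f => ∃ (ι : Type) (_ : Fintype ι) (a : ι → C(G, ℝ))
      (p : ι → (Fin r → X) → ℝ), (∀ j, RepFn (a j)) ∧ (∀ j, p j ∈ PolyFn r X) ∧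
      ∀ (g : G) v, f (fun i => rho X g (v i)) = ∑ j, a j g * p j v)
    (fun q i => ?_) (fun c => ?_) (fun f hf g hg => ?_) (fun f hf g hg => ?_) hf
  · let b := stdOrthonormalBasis ℝ X
    refine ⟨_, inferInstance, fun j => entry G (b j) q, fun j v => ⟪b j, v i⟫,
      fun j => repFn_entry _ _, fun j => inner_mem_PolyFn _ _, fun g v => ?_⟩
    change ⟪q, rho X g (v i)⟫ = _
    conv_lhs => rw [← b.sum_repr (v i)]
    simp only [map_sum, map_smul, inner_sum, inner_smul_right, entry_apply, b.repr_apply_apply,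
      real_inner_comm q]
    exact Finset.sum_congr rfl fun j _ => mul_comm _ _
  · exact ⟨Unit, inferInstance, fun _ => ContinuousMap.const G c, fun _ _ => 1,
      fun _ => repFn_const c, fun _ => const_mem_PolyFn 1, fun g v => by simp⟩
  · rintro ⟨ι, _, a, p, ha, hp, h⟩ ⟨κ, _, a', p', ha', hp', h'⟩
    refine ⟨ι ⊕ κ, inferInstance, Sum.elim a a', Sum.elim p p', ?_, ?_, fun g v => by simp [h, h']⟩
    · rintro (j | j)
      exacts [ha j, ha' j]
    · rintro (j | j)
      exacts [hp j, hp' j]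
  · rintro ⟨ι, _, a, p, ha, hp, h⟩ ⟨κ, _, a', p', ha', hp', h'⟩
    refine ⟨ι × κ, inferInstance, fun j => a j.1 * a' j.2, fun j => p j.1 * p' j.2,
      fun j => (ha _).mul (ha' _), fun j => mul_mem (hp _) (hp' _), fun g v => ?_⟩
    beta_reduce
    rw [h, h', Finset.sum_mul_sum, Fintype.sum_prod_type]
    refine Finset.sum_congr rfl fun j _ => Finset.sum_congr rfl fun k _ => ?_
    simp only [ContinuousMap.mul_apply, Pi.mul_apply]; ring

end Finite

section Phi
variable {X : Type*} [NormedAddCommGroup X] [InnerProductSpace ℝ X] [FiniteDimensional ℝ X]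
  [MeasurableSpace X] [BorelSpace X] {r : ℕ} {E : (X ≃ₗᵢ[ℝ] X) → ℂ → Prop}
  {T : (Fin r → CS X) → CS X →ₗ[ℝ] ℂ}

/-- Gaussian averages over the segments in the slots of `T`. -/
def Phi (T : (Fin r → CS X) → CS X →ₗ[ℝ] ℂ) (p : (Fin r → X) → ℝ) (f : CS X) : ℂ :=
  ∫ v, (gw v : ℂ) * (p v * T (fun k => seg (v k)) f)

theorem Frame.polyBdd (hT : Frame E T) {f : CS X} (hf : f ∈ HH X) :
    PolyBdd fun v : Fin r → X => T (fun k => seg (v k)) f := by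
  obtain ⟨C, hC, h⟩ := hT.exists_bound_HH hf
  exact polyBdd_of_le_prod hC h

theorem Frame.integrable (hT : Frame E T) {p : (Fin r → X) → ℝ} (hp : p ∈ PolyFn r X) {f : CS X}
    (hf : f ∈ HH X) : Integrable fun v => (gw v : ℂ) * (p v * T (fun k => seg (v k)) f) :=
  ((polyBdd_of_mem_PolyFn hp).ofReal.mul (hT.polyBdd hf)).integrable_gw_mul
    ((Complex.continuous_ofReal.comp (continuous_of_mem_PolyFn hp)).mul (hT.continuous_left hf))

theorem Frame.Phi_add_left (hT : Frame E T) {p q : (Fin r → X) → ℝ} (hp : p ∈ PolyFn r X)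
    (hq : q ∈ PolyFn r X) {f : CS X} (hf : f ∈ HH X) :
    Phi T (fun v => p v + q v) f = Phi T p f + Phi T q f := by
  rw [Phi, Phi, Phi, ← integral_add (hT.integrable hp hf) (hT.integrable hq hf)]
  congr 1; ext v; push_cast; ring

theorem Phi_smul_left (c : ℝ) (p : (Fin r → X) → ℝ) (f : CS X) :
    Phi T (fun v => c * p v) f = c * Phi T p f := by
  rw [Phi, Phi, ← integral_const_mul]
  congr 1; ext v; push_cast; ring

theorem Frame.Phi_sum_left (hT : Frame E T) {ι : Type*} (s : Finset ι) {p : ι → (Fin r → X) → ℝ}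
    (hp : ∀ j ∈ s, p j ∈ PolyFn r X) {f : CS X} (hf : f ∈ HH X) :
    Phi T (fun v => ∑ j ∈ s, p j v) f = ∑ j ∈ s, Phi T (p j) f := by
  simp only [Phi]
  rw [← integral_finsetSum _ fun j hj => hT.integrable (hp j hj) hf]
  congr 1; ext v; push_cast; rw [Finset.sum_mul, Finset.mul_sum]

theorem Frame.Phi_add (hT : Frame E T) {p : (Fin r → X) → ℝ} (hp : p ∈ PolyFn r X) {f f' : CS X}
    (hf : f ∈ HH X) (hf' : f' ∈ HH X) : Phi T p (f + f') = Phi T p f + Phi T p f' := by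
  rw [Phi, Phi, Phi, ← integral_add (hT.integrable hp hf) (hT.integrable hp hf')]
  congr 1; ext v; rw [map_add]; ring

theorem Phi_smul (p : (Fin r → X) → ℝ) (c : ℝ) (f : CS X) : Phi T p (c • f) = c * Phi T p f := by
  rw [Phi, Phi, ← integral_const_mul]
  congr 1; ext v; rw [map_smul, Complex.real_smul]; ring

theorem Frame.Phi_sub (hT : Frame E T) {p : (Fin r → X) → ℝ} (hp : p ∈ PolyFn r X) {f f' : CS X}
    (hf : f ∈ HH X) (hf' : f' ∈ HH X) : Phi T p (f - f') = Phi T p f - Phi T p f' := by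
  rw [Phi, Phi, Phi, ← integral_sub (hT.integrable hp hf) (hT.integrable hp hf')]
  congr 1; ext v; rw [map_sub]; ring

theorem Frame.equiv_seg (hT : Frame E T) {A : X ≃ₗᵢ[ℝ] X} {c : ℂ} (hA : E A c) (v : Fin r → X)
    {f : CS X} (hf : f ∈ HH X) :
    T (fun k => seg (A (v k))) (act A f) = c * T (fun k => seg (v k)) f := by
  have := hT.equiv A c hA (fun k => seg (v k)) (fun k => seg_mem_ZC _) f hf
  simpa only [act_seg] using this

theorem measurePreserving_pi_map (A : X ≃ₗᵢ[ℝ] X) :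
    MeasurePreserving (fun (v : Fin r → X) (i : Fin r) => A (v i)) volume volume :=
  volume_preserving_pi (f := fun _ => A) fun _ => A.measurePreserving

theorem integral_pi_map (A : X ≃ₗᵢ[ℝ] X) (F : (Fin r → X) → ℂ) :
    ∫ v : Fin r → X, F (fun i => A (v i)) = ∫ v, F v := by
  refine (measurePreserving_pi_map A).integral_comp ?_ F
  exact ((Homeomorph.piCongrRight fun _ : Fin r => A.toHomeomorph).measurableEmbedding)

theorem Frame.Phi_act (hT : Frame E T) {A : X ≃ₗᵢ[ℝ] X} {c : ℂ} (hA : E A c)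
    (p : (Fin r → X) → ℝ) {f : CS X} (hf : f ∈ HH X) :
    Phi T p (act A f) = c * Phi T (fun v => p fun i => A (v i)) f := by
  rw [Phi, ← integral_pi_map A, Phi, ← integral_const_mul]
  congr 1; ext v
  rw [hT.equiv_seg hA v hf, show gw (fun i => A (v i)) = gw v from gw_comp A.toLinearIsometry v]
  ring

theorem Frame.continuousOn_Phi (hT : Frame E T) {p : (Fin r → X) → ℝ} (hp : p ∈ PolyFn r X) :
    ContinuousOn (Phi T p) {h | IsSupp h} := by
  intro h0 hh0
  obtain ⟨C, hC, hb⟩ := hT.exists_bound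
  have hnear : ∀ᶠ h in 𝓝[{h | IsSupp h}] h0, IsSupp h ∧ ‖h‖ ≤ ‖h0‖ + 1 := by
    refine (eventually_mem_nhdsWithin.and (mem_nhdsWithin_of_mem_nhds
      ((continuous_norm.tendsto h0).eventually (ge_mem_nhds (by linarith)))))
  refine continuousWithinAt_of_dominated
    (bound := fun v => ‖(gw v : ℂ) * (p v * ((C * (∏ i, ‖v i‖) * (‖h0‖ + 1) : ℝ) : ℂ))‖) ?_ ?_ ?_ ?_
  · filter_upwards [hnear] with h hh
    exact (hT.integrable hp hh.1.mem_HH).aestronglyMeasurable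
  · filter_upwards [hnear] with h hh
    refine Eventually.of_forall fun v => ?_
    rw [norm_mul, norm_mul, norm_mul, norm_mul]
    gcongr
    refine (hb v h hh.1).trans ?_
    rw [Complex.norm_real]
    refine le_trans ?_ (Real.le_norm_self _)
    have : 0 ≤ ∏ i, ‖v i‖ := Finset.prod_nonneg fun i _ => norm_nonneg _
    gcongr
    exact hh.2
  · refine Integrable.norm (PolyBdd.integrable_gw_mul ((polyBdd_of_mem_PolyFn hp).ofReal.mul
      (polyBdd_of_le_prod (C := C * (‖h0‖ + 1)) (by positivity) fun v => ?_)) ?_)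
    · rw [Complex.norm_real, Real.norm_of_nonneg (by positivity)]
      exact le_of_eq (by ring)
    · have := continuous_of_mem_PolyFn hp
      fun_prop
  · refine Eventually.of_forall fun v => ?_
    refine ContinuousWithinAt.mul continuousWithinAt_const
      (ContinuousWithinAt.mul continuousWithinAt_const ?_)
    exact (hT.cont_supp (v, h0) hh0).comp (f := fun h : CS X => (v, h))
      (by fun_prop) fun h hh => hh

end Phi

theorem exists_bound_of_finiteDimensional {F : Type*} [NormedAddCommGroup F] [NormedSpace ℝ F]
    {U : Submodule ℝ F} [FiniteDimensional ℝ U] (L : U →ₗ[ℝ] ℂ) :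
    ∃ C, 0 < C ∧ ∀ x : U, ‖L x‖ ≤ C * ‖(x : F)‖ :=
  (L.toContinuousLinearMap : U →L[ℝ] ℂ).bound

section Avg
variable {G : Type*} [Group G] [TopologicalSpace G] [IsTopologicalGroup G] [CompactSpace G]
  [SecondCountableTopology G] [MeasurableSpace G] [BorelSpace G]
  {X : Type*} [NormedAddCommGroup X] [InnerProductSpace ℝ X] [FiniteDimensional ℝ X]
  [SphRep G X]

/-- Functionals which are continuous and additive on support functions commute with averages. -/
theorem avg_comm_of_supp {L : CS X → ℂ} (hL : ContinuousOn L {h | IsSupp h})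
    (hadd : ∀ f ∈ HH X, ∀ f' ∈ HH X, L (f + f') = L f + L f')
    (hsmul : ∀ (c : ℝ), ∀ f ∈ HH X, L (c • f) = c * L f) (a : C(G, ℝ)) {f : CS X} (hf : f ∈ HH X) :
    avg a f ∈ HH X ∧ L (avg a f) = ∫ g, a g * L (act (rho X g⁻¹) f) ∂hG G ∧
      Continuous fun g : G => L (act (rho X g⁻¹) f) := by
  have hcont : ∀ h : CS X, IsSupp h → Continuous fun g : G => L (act (rho X g⁻¹) h) := fun h hh =>
    hL.comp_continuous ((continuous_act_rho h).comp continuous_inv) fun g => hh.act _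
  have key : ∀ b : C(G, ℝ), 0 ≤ b → ∀ h : CS X, IsSupp h → IsSupp (avg b h) ∧
      L (avg b h) = ∫ g, b g * L (act (rho X g⁻¹) h) ∂hG G := by
    intro b hb h hh
    have h1 : ∀ g : G, L (b g • act (rho X g⁻¹) h) = b g * L (act (rho X g⁻¹) h) := fun g =>
      hsmul _ _ (hh.act _).mem_HH
    have := integral_mem_of_affine (m := hG G) convex_isSupp isClosed_isSupp hL (fun x hx y hy a b ha hb hab => by
        rw [hadd _ (Submodule.smul_mem _ _ (IsSupp.mem_HH hx)) _ (Submodule.smul_mem _ _ (IsSupp.mem_HH hy)),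
          hsmul _ _ (IsSupp.mem_HH hx), hsmul _ _ (IsSupp.mem_HH hy)]; simp)
      (F := fun g : G => b g • act (rho X g⁻¹) h) (integrable_hG (continuous_avg_integrand b h))
      (fun g => (hh.act _).smul (hb g)) (by
        simp_rw [h1]
        exact integrable_hG ((Complex.continuous_ofReal.comp b.continuous).mul (hcont h hh)))
    simp_rw [h1] at this
    exact this
  have hsub : ∀ f ∈ HH X, ∀ f' ∈ HH X, L (f - f') = L f - L f' := fun f hf f' hf' => by
    rw [sub_eq_add_neg, ← neg_one_smul ℝ f', hadd _ hf _ (Submodule.smul_mem _ _ hf'), hsmul _ _ hf']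
    push_cast; ring
  obtain ⟨h, k, hh, hk, rfl⟩ := mem_HH_iff.1 hf
  have hp : (0 : C(G, ℝ)) ≤ a ⊔ 0 := le_sup_right
  have hn : (0 : C(G, ℝ)) ≤ (-a) ⊔ 0 := le_sup_right
  have ha : ∀ g, a g = (a ⊔ 0) g - ((-a) ⊔ 0) g := fun g => by
    simp only [ContinuousMap.sup_apply, ContinuousMap.neg_apply, ContinuousMap.zero_apply]
    exact (max_zero_sub_max_neg_zero_eq_self (a g)).symm
  obtain ⟨m1, e1⟩ := key _ hp h hh
  obtain ⟨m2, e2⟩ := key _ hn h hh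
  obtain ⟨m3, e3⟩ := key _ hp k hk
  obtain ⟨m4, e4⟩ := key _ hn k hk
  have hd : avg a (h - k) = (avg (a ⊔ 0) h - avg ((-a) ⊔ 0) h) -
      (avg (a ⊔ 0) k - avg ((-a) ⊔ 0) k) := by
    have h5 : ∀ f : CS X, avg a f = avg (a ⊔ 0) f - avg ((-a) ⊔ 0) f := fun f => by
      simp only [avg]
      rw [← integral_sub (integrable_hG (continuous_avg_integrand _ f))
        (integrable_hG (continuous_avg_integrand _ f))]
      congr 1; ext1 g
      rw [ha g, sub_smul]
    rw [← h5, ← h5, sub_eq_add_neg, ← neg_one_smul ℝ k, avg_add, avg_smul, neg_one_smul, sub_eq_add_neg]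
  have hLs : ∀ g : G, L (act (rho X g⁻¹) (h - k)) = L (act (rho X g⁻¹) h) - L (act (rho X g⁻¹) k) :=
    fun g => by rw [act_sub, hsub _ (hh.act _).mem_HH _ (hk.act _).mem_HH]
  have c1 := hcont h hh
  have c2 := hcont k hk
  refine ⟨hd ▸ sub_mem (sub_mem m1.mem_HH m2.mem_HH) (sub_mem m3.mem_HH m4.mem_HH), ?_, ?_⟩
  · rw [hd, hsub _ (sub_mem m1.mem_HH m2.mem_HH) _ (sub_mem m3.mem_HH m4.mem_HH),
      hsub _ m1.mem_HH _ m2.mem_HH, hsub _ m3.mem_HH _ m4.mem_HH, e1, e2, e3, e4]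
    have hi : ∀ (b : C(G, ℝ)) (u : G → ℂ), Continuous u → Integrable (fun g => b g * u g) (hG G) :=
      fun b u hu => integrable_hG ((Complex.continuous_ofReal.comp b.continuous).mul hu)
    rw [← integral_sub (hi _ _ c1) (hi _ _ c1), ← integral_sub (hi _ _ c2) (hi _ _ c2)]
    refine (integral_sub ((hi (a ⊔ 0) _ c1).sub (hi ((-a) ⊔ 0) _ c1))
      ((hi (a ⊔ 0) _ c2).sub (hi ((-a) ⊔ 0) _ c2))).symm.trans ?_
    congr 1; ext g
    simp only [Pi.sub_apply]
    rw [hLs, ha g]; push_cast; ring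
  · simp_rw [hLs]; exact c1.sub c2

variable [Nontrivial X] [MeasurableSpace X] [BorelSpace X] {r : ℕ} {E : (X ≃ₗᵢ[ℝ] X) → ℂ → Prop}
  {T : (Fin r → CS X) → CS X →ₗ[ℝ] ℂ}

theorem Frame.Phi_avg (hT : Frame E T) {p : (Fin r → X) → ℝ} (hp : p ∈ PolyFn r X)
    (a : C(G, ℝ)) {f : CS X} (hf : f ∈ HH X) :
    avg a f ∈ HH X ∧ Phi T p (avg a f) = ∫ g, a g * Phi T p (act (rho X g⁻¹) f) ∂hG G ∧
      Continuous fun g : G => Phi T p (act (rho X g⁻¹) f) :=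
  avg_comm_of_supp (hT.continuousOn_Phi hp) (fun _ hf _ hf' => hT.Phi_add hp hf hf')
    (fun c f _ => Phi_smul p c f) a hf

variable (G) in
include G in
theorem Frame.exists_Phi_bound (hT : Frame E T) (hE : ∀ g : G, E (rho X g) 1) {p : (Fin r → X) → ℝ}
    (hp : p ∈ PolyFn r X) (e : Sph X) :
    ∃ C, 0 ≤ C ∧ ∀ f ∈ HH X, ‖Phi T p f‖ ≤ C * ∫ g : G, |f (sg g e)| ∂hG G := by
  obtain ⟨ι, _, a, q, ha, hq, hpq⟩ := exists_repFn_of_mem_PolyFn G hp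
  have h1 : ∀ f ∈ HH X, Phi T p f = ∑ j, Phi T (q j) (avg (a j) f) := by
    intro f hf
    have h2 : ∀ g : G, Phi T p f = ∑ j, a j g * Phi T (q j) (act (rho X g⁻¹) f) := by
      intro g
      have h3 : f = act (rho X g) (act (rho X g⁻¹) f) := by
        rw [map_inv]; exact (act_act_inv _ _).symm
      conv_lhs => rw [h3]
      rw [hT.Phi_act (hE g) p (act_mem_HH hf _), one_mul]
      simp_rw [hpq g]
      rw [hT.Phi_sum_left (p := fun j v => a j g * q j v) _ (fun j _ => Subalgebra.smul_mem _ (hq j) (a j g)) (act_mem_HH hf _)]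
      exact Finset.sum_congr rfl fun j _ => Phi_smul_left _ _ _
    have h4 : Phi T p f = ∫ _ : G, Phi T p f ∂hG G := by simp
    rw [h4]
    simp_rw [fun j => (hT.Phi_avg (hq j) (a j) hf).2.1]
    rw [← integral_finsetSum]
    · exact integral_congr_ae (Eventually.of_forall h2)
    · intro j _
      exact integrable_hG ((Complex.continuous_ofReal.comp (a j).continuous).mul
        (hT.Phi_avg (hq j) (a j) hf).2.2)
  have h5 : ∀ j, ∃ C, 0 ≤ C ∧ ∀ f ∈ HH X, ‖Phi T (q j) (avg (a j) f)‖ ≤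
      C * ∫ g : G, |f (sg g e)| ∂hG G := by
    intro j
    obtain ⟨U, hU, hUa⟩ := (ha j).exists_finiteDimensional (X := X)
    let L : ↥(U ⊓ HH X) →ₗ[ℝ] ℂ :=
      { toFun := fun f => Phi T (q j) f
        map_add' := fun f f' => hT.Phi_add (hq j) f.2.2 f'.2.2
        map_smul' := fun c f => by simp [Phi_smul] }
    have : FiniteDimensional ℝ ↥(U ⊓ HH X) := Submodule.finiteDimensional_inf_left _ _
    obtain ⟨C, hC, hCb⟩ := exists_bound_of_finiteDimensional L
    refine ⟨C * ‖a j‖, by positivity, fun f hf => ?_⟩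
    refine (hCb ⟨avg (a j) f, hUa f, (hT.Phi_avg (hq j) (a j) hf).1⟩).trans ?_
    rw [mul_assoc]
    exact mul_le_mul_of_nonneg_left (norm_avg_le _ _ _) hC.le
  choose C hC hb using h5
  refine ⟨∑ j, C j, Finset.sum_nonneg fun j _ => hC j, fun f hf => ?_⟩
  rw [h1 f hf, Finset.sum_mul]
  exact (norm_sum_le _ _).trans (Finset.sum_le_sum fun j _ => hb j f hf)

end Avg

section Radial
variable {G : Type*} [Group G] [TopologicalSpace G] [IsTopologicalGroup G] [CompactSpace G]
  [SecondCountableTopology G] [MeasurableSpace G] [BorelSpace G]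
  {X : Type*} [NormedAddCommGroup X] [InnerProductSpace ℝ X] [FiniteDimensional ℝ X]
  [SphRep G X] {r : ℕ} {E : (X ≃ₗᵢ[ℝ] X) → ℂ → Prop}
  {T : (Fin r → CS X) → CS X →ₗ[ℝ] ℂ}

variable (G) in
include G in
theorem exists_integral_seg (w : X) :
    ∃ c : ℝ, 0 ≤ c ∧ ∫ g : G, seg (rho X g w) ∂hG G = c • (1 : CS X) := by
  rcases eq_or_ne w 0 with rfl | hw
  · exact ⟨0, le_rfl, by simp [show seg (0 : X) = 0 by ext; simp]⟩
  let e : Sph X := nrm w hw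
  obtain ⟨c, hc, h⟩ := exists_integral_abs_inner G e
  have hcont : Continuous fun g : G => seg (rho X g w) := continuous_seg.comp (by fun_prop)
  refine ⟨‖w‖ * c, by positivity, ?_⟩
  ext x
  have hw' : w = ‖w‖ • (e : X) := (smul_nrm w hw).symm
  rw [integral_apply_CS (integrable_hG hcont)]
  have h2 : ∀ g : G, seg (rho X g w) x = ‖w‖ * |⟪rho X g e, (x : X)⟫| := fun g => by
    conv_lhs => rw [hw']
    rw [seg_apply, map_smul, inner_smul_left, abs_mul]; simp
  simp_rw [h2]
  rw [integral_const_mul, h x, norm_sph]; simp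

variable (G) in
include G in
theorem Frame.integral_slot (hT : Frame E T) {Z : Fin r → CS X} (hZ : ∀ i, Z i ∈ ZC X) (i : Fin r)
    (w : X) {f : CS X} (hf : f ∈ HH X) :
    ∫ g : G, T (Function.update Z i (seg (rho X g w))) f ∂hG G = 0 := by
  have hcont : Continuous fun g : G => seg (rho X g w) := continuous_seg.comp (by fun_prop)
  have hAc : ContinuousOn (fun W => T (Function.update Z i W) f) (ZC X : Set (CS X)) :=
    (hT.cont f hf).comp (f := fun W => Function.update Z i W) (by fun_prop)
      fun W hW => update_mem_ZC hZ hW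
  have := integral_mem_of_affine (m := hG G) (C := (ZC X : Set (CS X)))
    (A := fun W => T (Function.update Z i W) f) (F := fun g : G => seg (rho X g w))
    convex_ZC isClosed_ZC hAc (fun x hx y hy a b ha hb _ => by
      beta_reduce
      rw [hT.update_add Z hZ i _ (smul_mem_ZC ha hx) _ (smul_mem_ZC hb hy) f hf,
        hT.update_smul hZ i ha hx hf, hT.update_smul hZ i hb hy hf, Complex.real_smul,
        Complex.real_smul])
    (integrable_hG hcont) (fun g => seg_mem_ZC _)
    (integrable_hG (hAc.comp_continuous hcont fun g => seg_mem_ZC _))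
  rw [← this.2]
  obtain ⟨c, hc, h⟩ := exists_integral_seg G w
  rw [h]
  beta_reduce
  have h1 : (1 : CS X) ∈ ZC X := by
    rcases subsingleton_or_nontrivial X with hX | hX
    · have : (1 : CS X) = 0 := by
        ext x
        have := norm_sph x
        rw [Subsingleton.elim (x : X) 0] at this
        simp at this
      rw [this]; exact zero_mem _
    · exact one_mem_ZC G
  rw [hT.update_smul hZ i hc h1 hf, hT.one _ (update_mem_ZC hZ h1) i (by simp) f hf, mul_zero]

variable [MeasurableSpace X] [BorelSpace X]

theorem measurePreserving_update (i : Fin r) (A : X ≃ₗᵢ[ℝ] X) (F : (Fin r → X) → ℂ) :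
    ∫ v : Fin r → X, F (Function.update v i (A (v i))) = ∫ v, F v := by
  let B : Fin r → (X ≃ₗᵢ[ℝ] X) := fun j => if j = i then A else LinearIsometryEquiv.refl ℝ X
  have h1 : MeasurePreserving (fun (v : Fin r → X) (j : Fin r) => B j (v j)) volume volume :=
    volume_preserving_pi (f := fun j => B j) fun j => (B j).measurePreserving
  rw [← h1.integral_comp (Homeomorph.piCongrRight fun j => (B j).toHomeomorph).measurableEmbedding F]
  congr 1; ext v; congr 1; ext1 j
  rcases eq_or_ne j i with rfl | hj
  · simp [B]
  · simp [B, hj]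

theorem gw_update_isometry (v : Fin r → X) (i : Fin r) (A : X ≃ₗᵢ[ℝ] X) :
    gw (Function.update v i (A (v i))) = gw v := by
  unfold gw
  congr 2
  refine Finset.sum_congr rfl fun j _ => ?_
  rcases eq_or_ne j i with rfl | hj
  · simp
  · simp [hj]

variable (G) in
include G in
theorem Frame.Phi_eq_zero_of_radial (hT : Frame E T) {p : (Fin r → X) → ℝ} (hp : p ∈ PolyFn r X)
    (i : Fin r) (hpi : ∀ (v : Fin r → X) (A : X ≃ₗᵢ[ℝ] X), p (Function.update v i (A (v i))) = p v)
    {f : CS X} (hf : f ∈ HH X) : Phi T p f = 0 := by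
  let F : G → (Fin r → X) → ℂ := fun g v =>
    (gw v : ℂ) * (p v * T (Function.update (fun k => seg (v k)) i (seg (rho X g (v i)))) f)
  have hupd : ∀ (g : G) (v : Fin r → X), Function.update (fun k => seg (v k)) i (seg (rho X g (v i))) =
      fun k => seg (Function.update v i (rho X g (v i)) k) := fun g v => by
    ext1 k
    rcases eq_or_ne k i with rfl | hk
    · simp
    · simp [hk]
  have h1 : ∀ g, Phi T p f = ∫ v, F g v := by
    intro g
    rw [Phi, ← measurePreserving_update i (rho X g)]
    congr 1; ext v
    rw [gw_update_isometry, hpi]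
    simp only [F, hupd]
  have hpc := continuous_of_mem_PolyFn hp
  have hcont : Continuous (Function.uncurry F) := by
    refine (Complex.continuous_ofReal.comp (continuous_gw.comp continuous_snd)).mul
      ((Complex.continuous_ofReal.comp (hpc.comp continuous_snd)).mul ?_)
    refine (hT.continuous_left hf).comp (g := fun v => T (fun k => seg (v k)) f)
      (f := fun q : G × (Fin r → X) => Function.update q.2 i (rho X q.1 (q.2 i))) (by fun_prop) |>.congr ?_
    intro q
    simp only [Function.comp, hupd]
  obtain ⟨C, hC, hb⟩ := hT.exists_bound_HH hf
  have hint : Integrable (Function.uncurry F) ((hG G).prod volume) := by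
    have hi : Integrable fun v : Fin r → X => (gw v : ℂ) * (p v * ((C * ∏ i, ‖v i‖ : ℝ) : ℂ)) := by
      refine PolyBdd.integrable_gw_mul ((polyBdd_of_mem_PolyFn hp).ofReal.mul
        (polyBdd_of_le_prod hC fun v => ?_)) (by fun_prop)
      rw [Complex.norm_real, Real.norm_of_nonneg]
      exact mul_nonneg hC (Finset.prod_nonneg fun _ _ => norm_nonneg _)
    refine (hi.comp_snd (hG G)).mono hcont.aestronglyMeasurable (Eventually.of_forall fun q => ?_)
    simp only [Function.uncurry, F, norm_mul, hupd]
    gcongr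
    refine (hb _).trans (le_trans (le_of_eq ?_) ((Real.le_norm_self _).trans_eq (Complex.norm_real _).symm))
    congr 1
    refine Finset.prod_congr rfl fun j _ => ?_
    rcases eq_or_ne j i with rfl | hj
    · simp
    · simp [hj]
  have h2 : Phi T p f = ∫ g, ∫ v, F g v ∂volume ∂hG G := by
    simp_rw [← h1]; simp
  rw [h2, integral_integral_swap hint]
  have h3 : ∀ v, ∫ g, F g v ∂hG G = 0 := fun v => by
    simp only [F]
    rw [integral_const_mul, integral_const_mul, hT.integral_slot G (fun k => seg_mem_ZC _) i _ hf]
    simp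
  simp [h3]

end Radial

section Cap
variable {X : Type*} [NormedAddCommGroup X] [InnerProductSpace ℝ X]

/-- A function supported on a small spherical cap around `e`. -/
def cap (e : Sph X) (s : ℝ) : CS X := (1 ⊔ (1 + s) • lin (e : X)) - 1

theorem cap_apply (e : Sph X) (s : ℝ) (x : Sph X) :
    cap e s x = max 1 ((1 + s) * ⟪(e : X), (x : X)⟫) - 1 := by
  simp [cap]

theorem isSupp_cap_fst (e : Sph X) {s : ℝ} (hs : 0 ≤ s) : IsSupp (1 ⊔ (1 + s) • lin (e : X)) :=
  isSupp_one.sup ((isSupp_lin _).smul (by linarith))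

theorem cap_mem_HH [FiniteDimensional ℝ X] (e : Sph X) {s : ℝ} (hs : 0 ≤ s) : cap e s ∈ HH X :=
  sub_mem (isSupp_cap_fst e hs).mem_HH one_mem_HH

theorem cap_nonneg (e : Sph X) (s : ℝ) (x : Sph X) : 0 ≤ cap e s x := by
  rw [cap_apply]; linarith [le_max_left 1 ((1 + s) * ⟪(e : X), (x : X)⟫)]

theorem inner_sph_le_one (x y : Sph X) : ⟪(x : X), (y : X)⟫ ≤ 1 := by
  have := real_inner_le_norm (x : X) y
  simpa using this

theorem lt_of_cap_ne_zero {e : Sph X} {s : ℝ} {x : Sph X} (h : cap e s x ≠ 0) :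
    1 < (1 + s) * ⟪(e : X), (x : X)⟫ := by
  by_contra! h'
  exact h (by rw [cap_apply, max_eq_left h', sub_self])

theorem norm_sub_sq_sph (x y : Sph X) : ‖(x : X) - y‖ ^ 2 = 2 - 2 * ⟪(x : X), (y : X)⟫ := by
  rw [@norm_sub_sq_real]; simp; ring

theorem norm_sub_sq_le_of_cap {e : Sph X} {s : ℝ} (hs : 0 ≤ s) {x : Sph X} (h : cap e s x ≠ 0) :
    ‖(x : X) - e‖ ^ 2 ≤ 2 * s := by
  have h1 := lt_of_cap_ne_zero h
  have h2 := inner_sph_le_one e x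
  rw [norm_sub_rev, norm_sub_sq_sph]
  nlinarith

theorem act_cap {e : Sph X} (s : ℝ) {A : X ≃ₗᵢ[ℝ] X} (hA : A e = e) : act A (cap e s) = cap e s := by
  rw [cap, act_sub, act_sup, act_one, act_smul, act_lin, hA]

end Cap

section CapInt
variable {G : Type*} [Group G] [TopologicalSpace G] [IsTopologicalGroup G] [CompactSpace G]
  [SecondCountableTopology G] [MeasurableSpace G] [BorelSpace G]
  {X : Type*} [NormedAddCommGroup X] [InnerProductSpace ℝ X] [FiniteDimensional ℝ X]
  [SphRep G X]

theorem exists_large_near_set (e : Sph X) {m : ℕ} (hm : 0 < m) :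
    ((2 * m + 1 : ℕ) ^ Module.finrank ℝ X : ℝ)⁻¹ ≤
      (hG G).real {g : G | ‖(sg g e : X) - e‖ ^ 2 ≤ Module.finrank ℝ X / (m : ℝ) ^ 2} := by
  set d := Module.finrank ℝ X
  let b := stdOrthonormalBasis ℝ X
  have hle : ∀ (x : Sph X) a, |⟪b a, (x : X)⟫| ≤ 1 := fun x a => by
    have := abs_real_inner_le_norm (b a) (x : X)
    simpa using this
  have hm' : (0 : ℝ) < m := by exact_mod_cast hm
  let cell : Sph X → (Fin d → Fin (2 * m + 1)) := fun x a =>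
    ⟨⌊(⟪b a, (x : X)⟫ + 1) * m⌋₊, by
      have h1 := (abs_le.1 (hle x a)).2
      rw [Nat.floor_lt' (by omega)]
      push_cast; nlinarith⟩
  have hcell : ∀ x y, cell x = cell y → ‖(x : X) - y‖ ^ 2 ≤ d / (m : ℝ) ^ 2 := by
    intro x y hxy
    have h1 : ∀ a, ⟪b a, (x : X) - y⟫ ^ 2 ≤ 1 / (m : ℝ) ^ 2 := by
      intro a
      have h2 : ⌊(⟪b a, (x : X)⟫ + 1) * m⌋₊ = ⌊(⟪b a, (y : X)⟫ + 1) * m⌋₊ :=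
        congrArg Fin.val (congrFun hxy a)
      have hx0 : 0 ≤ (⟪b a, (x : X)⟫ + 1) * m := mul_nonneg (by linarith [(abs_le.1 (hle x a)).1]) hm'.le
      have hy0 : 0 ≤ (⟪b a, (y : X)⟫ + 1) * m := mul_nonneg (by linarith [(abs_le.1 (hle y a)).1]) hm'.le
      have h3 := Nat.floor_le hx0
      have h4 := Nat.lt_floor_add_one ((⟪b a, (x : X)⟫ + 1) * m)
      have h5 := Nat.floor_le hy0
      have h6 := Nat.lt_floor_add_one ((⟪b a, (y : X)⟫ + 1) * m)
      rw [h2] at h3 h4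
      rw [le_div_iff₀ (by positivity), ← mul_pow, inner_sub_right]
      rw [sq_le_one_iff_abs_le_one, abs_le]
      constructor <;> nlinarith
    calc ‖(x : X) - y‖ ^ 2 = ∑ a, ⟪b a, (x : X) - y⟫ ^ 2 := (b.sum_sq_inner_right _).symm
      _ ≤ ∑ _a : Fin d, 1 / (m : ℝ) ^ 2 := Finset.sum_le_sum fun a _ => h1 a
      _ = _ := by simp; ring
  set N : ℝ := ((2 * m + 1 : ℕ) : ℝ) ^ d with hN
  have hN0 : 0 < N := by positivity
  obtain ⟨κ, hκ⟩ : ∃ κ, N⁻¹ ≤ (hG G).real {g : G | cell (sg g e) = κ} := by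
    by_contra! hlt
    have h1 : (hG G).real Set.univ ≤ ∑ κ, (hG G).real {g : G | cell (sg g e) = κ} := by
      have : (Set.univ : Set G) = ⋃ κ, {g : G | cell (sg g e) = κ} := by ext; simp
      rw [this]
      exact measureReal_iUnion_fintype_le _
    have h2 : ∑ κ, (hG G).real {g : G | cell (sg g e) = κ} < ∑ _κ : Fin d → Fin (2 * m + 1), N⁻¹ :=
      Finset.sum_lt_sum_of_nonempty ⟨fun _ => 0, Finset.mem_univ _⟩ fun κ _ => hlt κ
    have h3 : ∑ _κ : Fin d → Fin (2 * m + 1), N⁻¹ = 1 := by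
      rw [Finset.sum_const, nsmul_eq_mul]
      simp only [Finset.card_univ, Fintype.card_pi, Fintype.card_fin, Finset.prod_const]
      rw [Nat.cast_pow, ← hN]
      exact mul_inv_cancel₀ hN0.ne'
    simp at h1
    linarith
  obtain ⟨g₀, hg₀⟩ : {g : G | cell (sg g e) = κ}.Nonempty := by
    rw [Set.nonempty_iff_ne_empty]
    intro h
    rw [h] at hκ
    simp only [measureReal_empty] at hκ
    exact absurd (inv_pos.2 hN0) (not_lt.2 hκ)
  refine hκ.trans ?_
  have h1 : (hG G).real ((fun g => g₀ * g) ⁻¹' {g : G | cell (sg g e) = κ}) =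
      (hG G).real {g : G | cell (sg g e) = κ} := by
    rw [measureReal_def, measure_preimage_mul, ← measureReal_def]
  rw [← h1]
  refine measureReal_mono fun g hg => ?_
  have h2 := hcell _ _ ((hg : cell (sg (g₀ * g) e) = κ).trans hg₀.symm)
  rw [sg_mul, coe_sg, coe_sg g₀ e, ← map_sub, LinearIsometryEquiv.norm_map] at h2
  exact h2

variable (G) in
/-- The integral of `cap e s`. -/
def capInt (e : Sph X) (s : ℝ) : ℝ := ∫ g : G, cap e s (sg g e) ∂hG G

theorem capInt_lower (e : Sph X) {m : ℕ} (hm : 0 < m) {s : ℝ}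
    (hs : s = 4 * Module.finrank ℝ X / (m : ℝ) ^ 2) (hs1 : s ≤ 1) :
    s / 2 * ((2 * m + 1 : ℕ) ^ Module.finrank ℝ X : ℝ)⁻¹ ≤ capInt G e s := by
  have hs0 : 0 ≤ s := by rw [hs]; positivity
  set D := {g : G | ‖(sg g e : X) - e‖ ^ 2 ≤ Module.finrank ℝ X / (m : ℝ) ^ 2} with hD
  have hDm : MeasurableSet D := by
    have : Continuous fun g : G => (sg g e : X) := continuous_subtype_val.comp (by fun_prop)
    exact (isClosed_le (by fun_prop) continuous_const).measurableSet
  refine (mul_le_mul_of_nonneg_left (exists_large_near_set (G := G) e hm) (by positivity)).trans ?_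
  have h1 : ∫ g : G, D.indicator (fun _ => s / 2) g ∂hG G = s / 2 * (hG G).real D := by
    rw [integral_indicator hDm]; simp [mul_comm]
  rw [← h1]
  refine integral_mono ((integrable_const _).indicator hDm) (integrable_hG (by fun_prop)) fun g => ?_
  rw [Set.indicator_apply]
  split_ifs with hg
  · have h2 : ‖(sg g e : X) - e‖ ^ 2 ≤ s / 4 := by rw [hs]; exact (hg : _ ≤ _).trans_eq (by ring)
    rw [norm_sub_sq_sph, real_inner_comm] at h2
    beta_reduce
    rw [cap_apply, le_sub_iff_add_le]
    refine le_trans ?_ (le_max_right _ _)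
    nlinarith
  · exact cap_nonneg _ _ _

variable (G) in
include G in
theorem exists_capSeq [Nontrivial X] (e : Sph X) : ∃ s : ℕ → ℝ, (∀ k, 0 < s k ∧ s k ≤ 1) ∧
    Tendsto s atTop (𝓝 0) ∧ (∀ k, 0 < capInt G e (s k)) ∧
    ∃ R : ℕ, Tendsto (fun k => s k ^ R / capInt G e (s k)) atTop (𝓝 0) := by
  set d := Module.finrank ℝ X with hd
  have hd0 : 0 < d := Module.finrank_pos
  have hd1 : (1 : ℝ) ≤ d := by exact_mod_cast hd0
  let m : ℕ → ℕ := fun k => k + 4 * d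
  have hm : ∀ k, 0 < m k := fun k => by simp only [m]; omega
  have hmd : ∀ k, (4 * d : ℝ) ≤ m k := fun k => by simp [m]
  let s : ℕ → ℝ := fun k => 4 * d / (m k : ℝ) ^ 2
  have hm' : ∀ k, (1 : ℝ) ≤ m k := fun k => by exact_mod_cast hm k
  have hs0 : ∀ k, 0 < s k := fun k => by have := hm' k; positivity
  have hs1 : ∀ k, s k ≤ 1 / m k := fun k => by
    have := hm' k
    simp only [s]
    rw [div_le_div_iff₀ (by positivity) (by positivity)]
    nlinarith [hmd k]
  have hs2 : ∀ k, s k ≤ 1 := fun k => (hs1 k).trans (by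
    rw [div_le_one (by linarith [hm' k])]; exact hm' k)
  have hlow : ∀ k, s k / 2 * ((2 * m k + 1 : ℕ) ^ d : ℝ)⁻¹ ≤ capInt G e (s k) := fun k =>
    capInt_lower e (hm k) rfl (hs2 k)
  have htm : Tendsto (fun k => 1 / (m k : ℝ)) atTop (𝓝 0) := by
    have : Tendsto (fun k => (m k : ℝ)) atTop atTop :=
      tendsto_natCast_atTop_atTop.comp (tendsto_add_atTop_nat (4 * d))
    simp only [one_div]
    exact this.inv_tendsto_atTop
  have hpos : ∀ k, 0 < s k / 2 * ((2 * m k + 1 : ℕ) ^ d : ℝ)⁻¹ := fun k => by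
    have := hs0 k; positivity
  refine ⟨s, fun k => ⟨hs0 k, hs2 k⟩, squeeze_zero (fun k => (hs0 k).le) hs1 htm,
    fun k => (hpos k).trans_le (hlow k), d + 2, ?_⟩
  have hlim : Tendsto (fun k => 2 * 3 ^ d * (1 / (m k : ℝ))) atTop (𝓝 0) := by
    simpa using htm.const_mul (2 * 3 ^ d : ℝ)
  refine squeeze_zero (fun k => div_nonneg (pow_nonneg (hs0 k).le _)
    ((hpos k).trans_le (hlow k)).le) (fun k => ?_) hlim
  have h1 := hs0 k
  have h2 := hm' k
  calc s k ^ (d + 2) / capInt G e (s k)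
      ≤ s k ^ (d + 2) / (s k / 2 * ((2 * m k + 1 : ℕ) ^ d : ℝ)⁻¹) :=
        div_le_div_of_nonneg_left (by positivity) (hpos k) (hlow k)
    _ = 2 * s k ^ (d + 1) * ((2 * m k + 1 : ℕ) ^ d : ℝ) := by field_simp; ring
    _ ≤ 2 * (1 / m k) ^ (d + 1) * (3 * m k) ^ d := by
        gcongr
        · exact hs1 k
        · push_cast; linarith
    _ = 2 * 3 ^ d * (1 / (m k : ℝ)) := by
        rw [mul_pow, div_pow, one_pow]; field_simp; ring

end CapInt

section Gam
variable {X : Type*} [NormedAddCommGroup X] [InnerProductSpace ℝ X]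

/-- The orthogonal projection along the unit vector `e`. -/
def prj (e : Sph X) : X →ₗ[ℝ] X where
  toFun v := v - ⟪(e : X), v⟫ • (e : X)
  map_add' v w := by rw [inner_add_right, add_smul]; abel
  map_smul' c v := by simp [real_inner_smul_right, smul_sub, mul_smul]

theorem prj_apply (e : Sph X) (v : X) : prj e v = v - ⟪(e : X), v⟫ • (e : X) := rfl

theorem inner_prj (e : Sph X) (v : X) : ⟪(e : X), prj e v⟫ = 0 := by
  rw [prj_apply, inner_sub_right, real_inner_smul_right, inner_self_sph]; ring

theorem prj_eq_self {e : Sph X} {v : X} (h : ⟪(e : X), v⟫ = 0) : prj e v = v := by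
  rw [prj_apply, h]; simp

theorem prj_add_smul (e : Sph X) (v : X) (t : ℝ) : prj e (v + t • (e : X)) = prj e v := by
  rw [prj_apply, prj_apply, inner_add_right, real_inner_smul_right, inner_self_sph, mul_one,
    add_smul]
  abel

theorem prj_prj (e : Sph X) (v : X) : prj e (prj e v) = prj e v := prj_eq_self (inner_prj e v)

theorem inner_prj_prj (e : Sph X) (u v : X) : ⟪prj e u, v⟫ = ⟪u, prj e v⟫ := by
  simp only [prj_apply, inner_sub_left, inner_sub_right, real_inner_smul_left,
    real_inner_smul_right]
  rw [real_inner_comm (e : X) u]; ring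

theorem norm_sq_prj (e : Sph X) (v : X) : ‖v‖ ^ 2 = ‖prj e v‖ ^ 2 + ⟪(e : X), v⟫ ^ 2 := by
  rw [prj_apply, @norm_sub_sq_real, norm_smul, mul_pow, real_inner_smul_right, norm_sph,
    real_inner_comm (e : X) v]
  simp; ring

theorem const_mul_mem_PolyFn {r : ℕ} {p : (Fin r → X) → ℝ} (hp : p ∈ PolyFn r X) (c : ℝ) :
    (fun v => c * p v) ∈ PolyFn r X := mul_mem (const_mem_PolyFn c) hp

variable (G : Type*) [Group G] [TopologicalSpace G] [IsTopologicalGroup G] [CompactSpace G]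
  [SecondCountableTopology G] [MeasurableSpace G] [BorelSpace G]
  [FiniteDimensional ℝ X] [Nontrivial X] [MeasurableSpace X] [BorelSpace X] [SphRep G X] {r : ℕ} {E : (X ≃ₗᵢ[ℝ] X) → ℂ → Prop}
  {T : (Fin r → CS X) → CS X →ₗ[ℝ] ℂ}

/-- The heights of a sequence of caps shrinking to `e`. -/
def capS (e : Sph X) : ℕ → ℝ := (exists_capSeq (G := G) e).choose

/-- The sequence of cap functions shrinking to `e`. -/
def cp (e : Sph X) (k : ℕ) : CS X := cap e (capS G e k)

/-- The integrals of the cap functions. -/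
def ci (e : Sph X) (k : ℕ) : ℝ := capInt G e (capS G e k)

theorem capS_pos (e : Sph X) (k : ℕ) : 0 < capS G e k :=
  ((exists_capSeq (G := G) e).choose_spec.1 k).1

theorem capS_le_one (e : Sph X) (k : ℕ) : capS G e k ≤ 1 :=
  ((exists_capSeq (G := G) e).choose_spec.1 k).2

theorem tendsto_capS (e : Sph X) : Tendsto (capS G e) atTop (𝓝 0) :=
  (exists_capSeq (G := G) e).choose_spec.2.1

theorem ci_pos (e : Sph X) (k : ℕ) : 0 < ci G e k :=
  (exists_capSeq (G := G) e).choose_spec.2.2.1 k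

theorem exists_tendsto_capS_pow (e : Sph X) :
    ∃ R : ℕ, Tendsto (fun k => capS G e k ^ R / ci G e k) atTop (𝓝 0) :=
  (exists_capSeq (G := G) e).choose_spec.2.2.2

theorem cp_mem_HH (e : Sph X) (k : ℕ) : cp G e k ∈ HH X := cap_mem_HH e (capS_pos G e k).le

theorem integral_cp (e : Sph X) (k : ℕ) (x : Sph X) : ∫ g : G, cp G e k (sg g x) ∂hG G = ci G e k :=
  integral_sg (fun y => cp G e k y) x e

/-- The germ functional at `e`. -/
def Gam (e : Sph X) (T : (Fin r → CS X) → CS X →ₗ[ℝ] ℂ) (p : (Fin r → X) → ℝ) : ℂ :=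
  limUnder (hyperfilter ℕ : Filter ℕ) fun k => Phi T p (cp G e k) / ci G e k

variable {G}

theorem exists_hyperfilter_lim {u : ℕ → ℂ} {C : ℝ} (h : ∀ k, ‖u k‖ ≤ C) :
    ∃ l, Tendsto u (hyperfilter ℕ : Filter ℕ) (𝓝 l) := by
  obtain ⟨l, -, hl⟩ := (isCompact_closedBall (0 : ℂ) C).ultrafilter_le_nhds
    ((hyperfilter ℕ).map u) (by
      rw [Ultrafilter.coe_map, le_principal_iff]
      exact mem_map.2 (Eventually.of_forall fun k => by simpa using h k))
  exact ⟨l, hl⟩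

variable (hT : Frame E T) (hE : ∀ g : G, E (rho X g) 1)
include hT hE

theorem Frame.norm_Phi_div_le {p : (Fin r → X) → ℝ} (hp : p ∈ PolyFn r X) (e : Sph X) :
    ∃ C, 0 ≤ C ∧ ∀ k c, ∀ f ∈ HH X, (∀ x, |f x| ≤ c * cp G e k x) →
      ‖Phi T p f / ci G e k‖ ≤ C * c := by
  obtain ⟨C, hC, h⟩ := hT.exists_Phi_bound (G := G) hE hp e
  refine ⟨C, hC, fun k c f hf hfc => ?_⟩
  have hci := ci_pos G e k
  rw [norm_div, Complex.norm_real, Real.norm_of_nonneg hci.le, div_le_iff₀ hci, mul_assoc]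
  refine (h f hf).trans (mul_le_mul_of_nonneg_left ?_ hC)
  rw [← integral_cp G e k e, ← integral_const_mul]
  exact integral_mono (integrable_hG (by fun_prop)) (integrable_hG (by fun_prop)) fun g => hfc _

theorem Frame.tendsto_Gam {p : (Fin r → X) → ℝ} (hp : p ∈ PolyFn r X) (e : Sph X) :
    Tendsto (fun k => Phi T p (cp G e k) / ci G e k) (hyperfilter ℕ : Filter ℕ)
      (𝓝 (Gam G e T p)) := by
  obtain ⟨C, hC, h⟩ := hT.norm_Phi_div_le hE hp e
  refine tendsto_nhds_limUnder (exists_hyperfilter_lim (C := C * 1) (fun k : ℕ =>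
    h k 1 (cp G e k) (cp_mem_HH G e k) fun x => ?_))
  rw [one_mul, abs_of_nonneg]
  exact cap_nonneg _ _ _

theorem Frame.Gam_add {p q : (Fin r → X) → ℝ} (hp : p ∈ PolyFn r X) (hq : q ∈ PolyFn r X)
    (e : Sph X) : Gam G e T (fun v => p v + q v) = Gam G e T p + Gam G e T q := by
  refine tendsto_nhds_unique (hT.tendsto_Gam hE (add_mem hp hq) e)
    (((hT.tendsto_Gam hE hp e).add (hT.tendsto_Gam hE hq e)).congr fun k => ?_)
  rw [← add_div, ← hT.Phi_add_left hp hq (cp_mem_HH G e k)]; rfl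

theorem Frame.Gam_smul {p : (Fin r → X) → ℝ} (hp : p ∈ PolyFn r X) (c : ℝ)
    (e : Sph X) : Gam G e T (fun v => c * p v) = c * Gam G e T p := by
  refine tendsto_nhds_unique (hT.tendsto_Gam hE (mul_mem (const_mem_PolyFn c) hp) e)
    (((hT.tendsto_Gam hE hp e).const_mul (c : ℂ)).congr fun k => ?_)
  rw [← mul_div_assoc, ← Phi_smul_left]; rfl

theorem Frame.Gam_sum {ι : Type*} (s : Finset ι) {p : ι → (Fin r → X) → ℝ}
    (hp : ∀ j ∈ s, p j ∈ PolyFn r X) (e : Sph X) :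
    Gam G e T (fun v => ∑ j ∈ s, p j v) = ∑ j ∈ s, Gam G e T (p j) := by
  refine tendsto_nhds_unique (hT.tendsto_Gam hE (sum_mem_PolyFn s hp) e)
    ((tendsto_finsetSum s fun j hj => hT.tendsto_Gam hE (hp j hj) e).congr fun k => ?_)
  rw [hT.Phi_sum_left s hp (cp_mem_HH G e k), Finset.sum_div]

theorem Frame.Gam_radial {p : (Fin r → X) → ℝ} (hp : p ∈ PolyFn r X) (i : Fin r)
    (hpi : ∀ v (A : X ≃ₗᵢ[ℝ] X), p (Function.update v i (A (v i))) = p v) (e : Sph X) :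
    Gam G e T p = 0 := by
  refine tendsto_nhds_unique (hT.tendsto_Gam hE hp e) (tendsto_const_nhds.congr fun k => ?_)
  rw [hT.Phi_eq_zero_of_radial G hp i hpi (cp_mem_HH G e k), zero_div]

theorem Frame.Gam_equiv {p : (Fin r → X) → ℝ} (hp : p ∈ PolyFn r X) {e : Sph X}
    {A : X ≃ₗᵢ[ℝ] X} (hA : A e = e) {c : ℂ} (hc : E A c) :
    Gam G e T p = c * Gam G e T (fun v => p fun i => A (v i)) := by
  refine tendsto_nhds_unique (hT.tendsto_Gam hE hp e)
    (((hT.tendsto_Gam hE (PolyFn_comp A.toLinearEquiv.toLinearMap hp) e).const_mul c).congr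
      fun k => ?_)
  have := hT.Phi_act hc p (cp_mem_HH G e k)
  rw [cp, act_cap _ hA] at this
  rw [cp, this, mul_div_assoc]; rfl

theorem Frame.Gam_inner_mul {p : (Fin r → X) → ℝ} (hp : p ∈ PolyFn r X) (e : Sph X) (i : Fin r) :
    Gam G e T (fun v => ⟪(e : X), v i⟫ * p v) = 0 := by
  let b := stdOrthonormalBasis ℝ X
  let F : _ → ℕ → CS X := fun a k => ⟪b a, (e : X)⟫ • cp G e k - SUVal.lin (b a) * cp G e k
  have hF : ∀ a k, F a k ∈ HH X := fun a k => sub_mem (Submodule.smul_mem _ _ (cp_mem_HH G e k))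
    (mul_mem_HH (lin_mem_HH _) (cp_mem_HH G e k))
  have hq : ∀ a, (fun v : Fin r → X => ⟪b a, v i⟫ * p v) ∈ PolyFn r X := fun a =>
    mul_mem (inner_mem_PolyFn _ _) hp
  have key : ∀ k, Phi T (fun v => ⟪(e : X), v i⟫ * p v) (cp G e k) =
      ∑ a, Phi T (fun v => ⟪b a, v i⟫ * p v) (F a k) := by
    intro k
    simp only [Phi]
    rw [← integral_finsetSum _ fun a _ => hT.integrable (hq a) (hF a k)]
    congr 1; ext v
    have hexp : ∀ y : X, ⟪v i, y⟫ = ∑ a, ⟪b a, v i⟫ * ⟪b a, y⟫ := fun y => by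
      rw [← b.sum_inner_mul_inner]
      simp only [real_inner_comm]
    have h0 : T (fun k => seg (v k)) (SUVal.lin (v i) * cp G e k) = 0 :=
      hT.perp _ (fun _ => seg_mem_ZC _) i (v i) rfl _ (mul_mem_HH (lin_mem_HH _) (cp_mem_HH G e k))
        fun x hx => by simp [hx]
    have h1 : ∑ a, ⟪b a, v i⟫ • F a k = ⟪(e : X), v i⟫ • cp G e k - SUVal.lin (v i) * cp G e k := by
      ext x
      simp only [F, ContinuousMap.coe_sum, Finset.sum_apply, ContinuousMap.smul_apply,
        ContinuousMap.sub_apply, ContinuousMap.mul_apply, lin_apply, smul_eq_mul]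
      rw [real_inner_comm, hexp, hexp, Finset.sum_mul, Finset.sum_mul, ← Finset.sum_sub_distrib]
      exact Finset.sum_congr rfl fun a _ => by ring
    have h2 := congrArg (T fun k => seg (v k)) h1
    simp only [map_sum, map_smul, map_sub, h0, sub_zero, Complex.real_smul] at h2
    push_cast
    rw [mul_right_comm, ← h2, ← Finset.mul_sum, Finset.sum_mul]
    congr 1
    exact Finset.sum_congr rfl fun a _ => by ring
  have hs : Tendsto (fun k => √(2 * capS G e k)) atTop (𝓝 0) := by
    have := ((tendsto_capS G e).const_mul 2).sqrt
    simpa using this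
  refine tendsto_nhds_unique (hT.tendsto_Gam hE (mul_mem (inner_mem_PolyFn _ _) hp) e) ?_
  have hz : ∀ a, Tendsto (fun k => Phi T (fun v => ⟪b a, v i⟫ * p v) (F a k) / ci G e k) atTop
      (𝓝 0) := fun a => by
    obtain ⟨C, hC, h⟩ := hT.norm_Phi_div_le hE (hq a) e
    refine squeeze_zero_norm (fun k => h k (√(2 * capS G e k)) _ (hF a k) fun x => ?_)
      (by simpa using hs.const_mul C)
    have hnn : 0 ≤ cp G e k x := cap_nonneg _ _ _
    simp only [F, ContinuousMap.smul_apply, ContinuousMap.sub_apply, ContinuousMap.mul_apply,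
      lin_apply, smul_eq_mul]
    rw [← sub_mul, abs_mul, abs_of_nonneg hnn]
    by_cases hx : cp G e k x = 0
    · simp [hx]
    · refine mul_le_mul_of_nonneg_right ?_ hnn
      have h1 := norm_sub_sq_le_of_cap (capS_pos G e k).le hx
      rw [← inner_sub_right]
      refine (abs_real_inner_le_norm _ _).trans ?_
      rw [b.norm_eq_one, one_mul, norm_sub_rev]
      exact Real.le_sqrt_of_sq_le h1
  have hsum := tendsto_finsetSum Finset.univ fun a _ => hz a
  simp only [Finset.sum_const_zero] at hsum
  refine (hsum.mono_left Nat.hyperfilter_le_atTop).congr fun k => ?_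
  rw [← Finset.sum_div, ← key]; rfl

theorem Frame.Gam_mul_prj {p : (Fin r → X) → ℝ} (hp : p ∈ PolyFn r X) (e : Sph X) :
    ∀ q ∈ PolyFn r X, Gam G e T (fun v => p v * q v) =
      Gam G e T (fun v => p (fun i => prj e (v i)) * q v) := by
  refine PolyFn_induction (p := fun p => ∀ q ∈ PolyFn r X, Gam G e T (fun v => p v * q v) =
      Gam G e T (fun v => p (fun i => prj e (v i)) * q v)) (fun a i q hq => ?_) (fun c q hq => rfl)
    (fun f hf g hg h1 h2 q hq => ?_) (fun f hf g hg h1 h2 q hq => ?_) hp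
  · have : (fun v : Fin r → X => ⟪a, v i⟫ * q v) = fun v =>
        ⟪a, prj e (v i)⟫ * q v + ⟪(e : X), v i⟫ * (⟪a, (e : X)⟫ * q v) := by
      ext v
      rw [prj_apply, inner_sub_right, real_inner_smul_right]; ring
    have hm : (fun v : Fin r → X => ⟪a, prj e (v i)⟫) ∈ PolyFn r X :=
      PolyFn_comp (prj e) (inner_mem_PolyFn a i)
    have hc : (fun v : Fin r → X => ⟪a, (e : X)⟫ * q v) ∈ PolyFn r X :=
      mul_mem (const_mem_PolyFn _) hq
    rw [this]
    refine (hT.Gam_add hE (mul_mem hm hq) (mul_mem (inner_mem_PolyFn _ _) hc) e).trans ?_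
    have h0 := hT.Gam_inner_mul hE hc e i
    exact (congrArg (_ + ·) h0).trans (add_zero _)
  · simp only [add_mul]
    have hf' := PolyFn_comp (prj e) hf
    have hg' := PolyFn_comp (prj e) hg
    refine (hT.Gam_add hE (mul_mem hf hq) (mul_mem hg hq) e).trans
      (Eq.trans ?_ (hT.Gam_add hE (mul_mem hf' hq) (mul_mem hg' hq) e).symm)
    exact congrArg₂ _ (h1 q hq) (h2 q hq)
  · have hf' := PolyFn_comp (prj e) hf
    have e1 := h1 _ (mul_mem hg hq)
    have e2 := h2 _ (mul_mem hf' hq)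
    simp only [Pi.mul_apply] at e1 e2
    simp only [mul_assoc]
    rw [e1]
    simp only [mul_left_comm (f _)]
    exact e2

theorem Frame.Gam_prj {p : (Fin r → X) → ℝ} (hp : p ∈ PolyFn r X) (e : Sph X) :
    Gam G e T p = Gam G e T (fun v => p (fun i => prj e (v i))) := by
  simpa using hT.Gam_mul_prj hE hp e _ (const_mem_PolyFn 1)

theorem Frame.Phi_eq_integral {p : (Fin r → X) → ℝ} (hp : p ∈ PolyFn r X) (e : Sph X) {f : CS X}
    (hf : f ∈ HH X) : (Continuous fun g : G => Gam G e T (fun v => p fun i => rho X g⁻¹ (v i))) ∧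
      Phi T p f = ∫ g : G, f (sg g⁻¹ e) * Gam G e T (fun v => p fun i => rho X g⁻¹ (v i)) ∂hG G := by
  obtain ⟨ι, _, a, q, ha, hq, hpq⟩ := exists_repFn_of_mem_PolyFn G hp
  have hGam : ∀ g : G, Gam G e T (fun v => p fun i => rho X g⁻¹ (v i)) =
      ∑ j, a j g⁻¹ * Gam G e T (q j) := fun g => by
    simp_rw [hpq]
    rw [hT.Gam_sum hE _ fun j _ => const_mul_mem_PolyFn (hq j) _]
    exact Finset.sum_congr rfl fun j _ => hT.Gam_smul hE (hq j) _ e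
  have hcont : Continuous fun g : G => Gam G e T (fun v => p fun i => rho X g⁻¹ (v i)) := by
    simp_rw [hGam]; fun_prop
  refine ⟨hcont, ?_⟩
  let α : C(G, ℝ) := ⟨fun g => f (sg g⁻¹ e), by fun_prop⟩
  have hPhi : ∀ k, Phi T p (avg α (cp G e k)) =
      ∑ j, (∫ g : G, ((f (sg g⁻¹ e) * a j g⁻¹ : ℝ) : ℂ) ∂hG G) * Phi T (q j) (cp G e k) := by
    intro k
    rw [(hT.Phi_avg hp α (cp_mem_HH G e k)).2.1]
    have : ∀ g : G, (α g : ℂ) * Phi T p (act (rho X g⁻¹) (cp G e k)) =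
        ∑ j, ((f (sg g⁻¹ e) * a j g⁻¹ : ℝ) : ℂ) * Phi T (q j) (cp G e k) := fun g => by
      rw [hT.Phi_act (hE g⁻¹) p (cp_mem_HH G e k), one_mul]
      simp_rw [hpq]
      rw [hT.Phi_sum_left _ (fun j _ => const_mul_mem_PolyFn (hq j) _) (cp_mem_HH G e k),
        Finset.mul_sum]
      refine Finset.sum_congr rfl fun j _ => ?_
      rw [Phi_smul_left]; push_cast; simp only [α, ContinuousMap.coe_mk]; ring
    simp_rw [this]
    rw [integral_finsetSum _ fun j _ => ?_]
    · exact Finset.sum_congr rfl fun j _ => integral_mul_const _ _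
    · exact integrable_hG (by fun_prop)
  have hlim1 : Tendsto (fun k => Phi T p (avg α (cp G e k)) / ci G e k)
      (hyperfilter ℕ : Filter ℕ)
      (𝓝 (∫ g : G, f (sg g⁻¹ e) * Gam G e T (fun v => p fun i => rho X g⁻¹ (v i)) ∂hG G)) := by
    have h1 : ∫ g : G, f (sg g⁻¹ e) * Gam G e T (fun v => p fun i => rho X g⁻¹ (v i)) ∂hG G =
        ∑ j, (∫ g : G, ((f (sg g⁻¹ e) * a j g⁻¹ : ℝ) : ℂ) ∂hG G) * Gam G e T (q j) := by
      simp_rw [hGam, Finset.mul_sum]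
      rw [integral_finsetSum _ fun j _ => integrable_hG (by fun_prop)]
      refine Finset.sum_congr rfl fun j _ => ?_
      rw [← integral_mul_const]
      congr 1; ext g; push_cast; ring
    rw [h1]
    refine (tendsto_finsetSum _ fun j _ => (hT.tendsto_Gam hE (hq j) e).const_mul _).congr
      fun k => ?_
    rw [hPhi, Finset.sum_div]
    exact Finset.sum_congr rfl fun j _ => by rw [mul_div_assoc]
  obtain ⟨C, hC, hb⟩ := hT.exists_Phi_bound (G := G) hE hp e
  have hlim2 : Tendsto (fun k => Phi T p (avg α (cp G e k)) / ci G e k) atTop (𝓝 (Phi T p f)) := by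
    rw [Metric.tendsto_atTop]
    intro δ hδ
    have huc : UniformContinuous f := CompactSpace.uniformContinuous_of_continuous f.continuous
    obtain ⟨η, hη, hfη⟩ := Metric.uniformContinuous_iff.1 huc (δ / (C + 1)) (by positivity)
    have hs : ∀ᶠ k in atTop, 2 * capS G e k < η ^ 2 := by
      have := (tendsto_capS G e).const_mul 2
      rw [mul_zero] at this
      exact this.eventually_lt_const (by positivity)
    obtain ⟨N, hN⟩ := eventually_atTop.1 hs
    refine ⟨N, fun k hk => ?_⟩
    have hci := ci_pos G e k
    have hd : Phi T p (avg α (cp G e k)) / ci G e k - Phi T p f =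
        Phi T p (avg α (cp G e k) - ci G e k • f) / ci G e k := by
      have hne : (ci G e k : ℂ) ≠ 0 := by exact_mod_cast hci.ne'
      rw [hT.Phi_sub hp (hT.Phi_avg hp α (cp_mem_HH G e k)).1 (Submodule.smul_mem _ _ hf), Phi_smul]
      field_simp
    have hpt : ∀ x, |(avg α (cp G e k) - ci G e k • f) x| ≤ δ / (C + 1) * ci G e k := by
      intro x
      simp only [ContinuousMap.sub_apply, ContinuousMap.smul_apply, smul_eq_mul]
      rw [avg_apply, ← integral_cp G e k x, ← integral_mul_const, ← integral_const_mul,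
        ← integral_sub (integrable_hG (by fun_prop)) (integrable_hG (by fun_prop)),
        ← Real.norm_eq_abs]
      have hcg : Continuous fun g : G => δ / (C + 1) * cp G e k (sg g x) := by fun_prop
      refine norm_integral_le_of_norm_le (integrable_hG hcg) (Eventually.of_forall fun g => ?_)
      have hnn : 0 ≤ cp G e k (sg g x) := cap_nonneg _ _ _
      simp only [α, ContinuousMap.coe_mk]
      rw [mul_comm (cp G e k (sg g x)), ← sub_mul, norm_mul, Real.norm_of_nonneg hnn]
      by_cases hx : cp G e k (sg g x) = 0
      · simp [hx]
      · refine mul_le_mul_of_nonneg_right ?_ hnn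
        refine (hfη ?_).le
        have h1 := norm_sub_sq_le_of_cap (capS_pos G e k).le hx
        have h2 : ‖((sg g x : Sph X) : X) - e‖ < η := by
          have := h1.trans_lt (hN k hk)
          exact lt_of_pow_lt_pow_left₀ 2 hη.le this
        rw [Subtype.dist_eq, dist_comm, dist_eq_norm]
        have h3 : ((x : X) - (sg g⁻¹ e : Sph X)) = rho X g⁻¹ ((sg g x : Sph X) - (e : X)) := by
          rw [map_sub, coe_sg, coe_sg]
          congr 1
          rw [rho_inv]; simp
        rw [h3, LinearIsometryEquiv.norm_map]
        exact h2
    rw [dist_eq_norm, hd, norm_div, Complex.norm_real, Real.norm_of_nonneg hci.le,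
      div_lt_iff₀ hci]
    refine (hb _ (sub_mem (hT.Phi_avg hp α (cp_mem_HH G e k)).1
      (Submodule.smul_mem _ _ hf))).trans_lt ?_
    calc C * ∫ g : G, |(avg α (cp G e k) - ci G e k • f) (sg g e)| ∂hG G
        ≤ C * (δ / (C + 1) * ci G e k) := by
          refine mul_le_mul_of_nonneg_left ?_ hC
          refine (integral_mono (integrable_hG (by fun_prop)) (integrable_const
            (δ / (C + 1) * ci G e k)) fun g => hpt _).trans (by simp)
      _ < δ * ci G e k := by
          rw [← mul_assoc]
          refine mul_lt_mul_of_pos_right ?_ hci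
          rw [← mul_div_assoc, div_lt_iff₀ (by linarith)]
          nlinarith
  exact tendsto_nhds_unique (hlim2.mono_left Nat.hyperfilter_le_atTop) hlim1

end Gam

section Gauss
variable {X : Type*} [NormedAddCommGroup X] [InnerProductSpace ℝ X]

theorem PolyBdd.inner (a : X) : PolyBdd fun v : X => ⟪a, v⟫ :=
  ⟨‖a‖, 1, norm_nonneg _, fun v => (norm_inner_le_norm _ _).trans
    (mul_le_mul_of_nonneg_left (by linarith [norm_nonneg v]) (norm_nonneg _))⟩

theorem PolyBdd.const {V : Type*} [NormedAddCommGroup V] (c : ℝ) : PolyBdd fun _ : V => c :=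
  ⟨‖c‖, 0, norm_nonneg _, fun v => by simp⟩

variable [FiniteDimensional ℝ X] [MeasurableSpace X] [BorelSpace X]

theorem PolyBdd.integrable_mul_gauss {f : X → ℝ} (hf : PolyBdd f) (hc : Continuous f) :
    Integrable fun v => f v * Real.exp (-‖v‖ ^ 2) := by
  obtain ⟨C, k, hC, h⟩ := hf
  refine Integrable.mono' (g := fun v => C * (Real.exp (k ^ 2 / 2) *
    Real.exp (-((1 / 2) * ‖v‖ ^ 2)))) (((integrable_exp_neg_norm_sq (by norm_num)).const_mul _).const_mul _)
    (by fun_prop) (Eventually.of_forall fun v => ?_)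
  rw [norm_mul, Real.norm_of_nonneg (Real.exp_nonneg _)]
  refine (mul_le_mul_of_nonneg_right (h v) (Real.exp_nonneg _)).trans ?_
  rw [mul_assoc]
  refine mul_le_mul_of_nonneg_left ?_ hC
  have h1 : (1 + ‖v‖) ^ k ≤ Real.exp (k * ‖v‖) := by
    rw [Real.exp_nat_mul]
    exact pow_le_pow_left₀ (by positivity) (by linarith [Real.add_one_le_exp ‖v‖]) _
  refine (mul_le_mul_of_nonneg_right h1 (Real.exp_nonneg _)).trans ?_
  rw [← Real.exp_add, ← Real.exp_add, Real.exp_le_exp]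
  nlinarith [sq_nonneg ((k : ℝ) - ‖v‖)]

theorem hasFDerivAt_gauss (v : X) : HasFDerivAt (fun v : X => Real.exp (-‖v‖ ^ 2))
    ((-2 * Real.exp (-‖v‖ ^ 2)) • innerSL ℝ v) v := by
  have := ((hasStrictFDerivAt_norm_sq v).hasFDerivAt.neg).exp
  refine this.congr_fderiv ?_
  ext w
  simp; ring

/-- Gaussian integration by parts. -/
theorem integral_inner_mul_gauss {F : X → ℝ} {F' : X → X →L[ℝ] ℝ} (hF : PolyBdd F)
    (hFd : ∀ v, HasFDerivAt F (F' v) v) (a : X) (hF' : PolyBdd fun v => F' v a)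
    (hF'c : Continuous fun v => F' v a) :
    ∫ v, ⟪a, v⟫ * F v * Real.exp (-‖v‖ ^ 2) = 2⁻¹ * ∫ v, F' v a * Real.exp (-‖v‖ ^ 2) := by
  have hFc : Continuous F := continuous_iff_continuousAt.2 fun v => (hFd v).continuousAt
  have h1 : Integrable fun v => ⟪a, v⟫ * F v * Real.exp (-‖v‖ ^ 2) :=
    ((PolyBdd.inner a).mul hF).integrable_mul_gauss (by fun_prop)
  have := integral_bilinear_hasFDerivAt_right_eq_neg_left_of_integrable (μ := volume)
    (B := ContinuousLinearMap.mul ℝ ℝ) (f := F) (f' := F') (v := a)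
    (g := fun v : X => Real.exp (-‖v‖ ^ 2))
    (g' := fun v => (-2 * Real.exp (-‖v‖ ^ 2)) • innerSL ℝ v)
    (hF'.integrable_mul_gauss hF'c)
    ((h1.const_mul (-2)).congr (Eventually.of_forall fun v => by
      simp [real_inner_comm a v]; ring))
    (hF.integrable_mul_gauss hFc) (fun v _ => hFd v) (fun v _ => hasFDerivAt_gauss v)
  have h2 : ∀ v : X, (ContinuousLinearMap.mul ℝ ℝ) (F v)
      (((-2 * Real.exp (-‖v‖ ^ 2)) • innerSL ℝ v) a) = -2 * (⟪a, v⟫ * F v * Real.exp (-‖v‖ ^ 2)) :=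
    fun v => by simp [real_inner_comm a v]; ring
  simp only [h2, integral_const_mul, ContinuousLinearMap.mul_apply'] at this
  linarith

/-- The total mass of the Gaussian. -/
def gM (X : Type*) [NormedAddCommGroup X] [InnerProductSpace ℝ X] [MeasurableSpace X]
    [FiniteDimensional ℝ X] [BorelSpace X] : ℝ := ∫ v : X, Real.exp (-‖v‖ ^ 2)

theorem gM_pos : 0 < gM X :=
  integral_exp_pos (by simpa using (PolyBdd.const (V := X) 1).integrable_mul_gauss continuous_const)

theorem gauss_moment_two (a b : X) :
    ∫ v, ⟪a, v⟫ * ⟪b, v⟫ * Real.exp (-‖v‖ ^ 2) = 2⁻¹ * (⟪a, b⟫ * gM X) := by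
  rw [integral_inner_mul_gauss (F' := fun _ => innerSL ℝ b) (PolyBdd.inner b)
    (fun v => (innerSL ℝ b).hasFDerivAt) a (PolyBdd.const _) continuous_const, integral_const_mul,
    gM, innerSL_apply_apply, real_inner_comm]

theorem gauss_moment_four (u a b : X) :
    ∫ v, ⟪a, v⟫ * (⟪u, v⟫ ^ 2 * ⟪b, v⟫) * Real.exp (-‖v‖ ^ 2) =
      gM X * (2⁻¹ * (⟪u, a⟫ * ⟪u, b⟫) + 4⁻¹ * (‖u‖ ^ 2 * ⟪a, b⟫)) := by
  have hu : PolyBdd fun v : X => ⟪u, v⟫ := .inner u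
  have hb : PolyBdd fun v : X => ⟪b, v⟫ := .inner b
  obtain ⟨D, hd, hA⟩ : ∃ D : X → X →L[ℝ] ℝ,
      (∀ v, HasFDerivAt (fun v : X => ⟪u, v⟫ ^ 2 * ⟪b, v⟫) (D v) v) ∧
      ∀ v, D v a = 2 * ⟪u, a⟫ * (⟪u, v⟫ * ⟪b, v⟫) + ⟪b, a⟫ * (⟪u, v⟫ * ⟪u, v⟫) := by
    refine ⟨fun v => (2 * ⟪u, v⟫ * ⟪b, v⟫) • innerSL ℝ u + ⟪u, v⟫ ^ 2 • innerSL ℝ b,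
      fun v => ?_, fun v => by simp; ring⟩
    have h1 : HasFDerivAt (fun v : X => ⟪u, v⟫) (innerSL ℝ u) v := (innerSL ℝ u).hasFDerivAt
    have h2 : HasFDerivAt (fun v : X => ⟪b, v⟫) (innerSL ℝ b) v := (innerSL ℝ b).hasFDerivAt
    refine ((h1.pow 2).mul h2).congr_fderiv ?_
    ext w
    simp; ring
  have hp2 : PolyBdd fun v : X => ⟪u, v⟫ ^ 2 := by simpa only [sq] using hu.mul hu
  rw [integral_inner_mul_gauss (hp2.mul hb) hd a]
  · have h1 := gauss_moment_two u b
    have h2 := gauss_moment_two u u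
    have h3 : ∀ v, D v a * Real.exp (-‖v‖ ^ 2) = 2 * ⟪u, a⟫ * (⟪u, v⟫ * ⟪b, v⟫ * Real.exp (-‖v‖ ^ 2))
        + ⟪b, a⟫ * (⟪u, v⟫ * ⟪u, v⟫ * Real.exp (-‖v‖ ^ 2)) := fun v => by rw [hA]; ring
    simp only [h3]
    rw [integral_add, integral_const_mul, integral_const_mul, h1, h2, real_inner_self_eq_norm_sq,
      real_inner_comm a b]
    · ring
    · exact ((hu.mul hb).integrable_mul_gauss (by fun_prop)).const_mul _
    · exact ((hu.mul hu).integrable_mul_gauss (by fun_prop)).const_mul _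
  · simp only [hA]
    exact ((PolyBdd.const _).mul (hu.mul hb)).add ((PolyBdd.const _).mul (hu.mul hu))
  · simp only [hA]; fun_prop

/-- The polynomial reproducing quadratic forms at `u` under Gaussian integration. -/
def hq (u v : X) : ℝ := 2 / gM X * (⟪u, v⟫ ^ 2 - ‖u‖ ^ 2 / 2)

theorem integral_hq (u a b : X) :
    ∫ v, hq u v * (⟪a, v⟫ * ⟪b, v⟫) * Real.exp (-‖v‖ ^ 2) = ⟪u, a⟫ * ⟪u, b⟫ := by
  have hu : PolyBdd fun v : X => ⟪u, v⟫ := .inner u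
  have ha : PolyBdd fun v : X => ⟪a, v⟫ := .inner a
  have hb : PolyBdd fun v : X => ⟪b, v⟫ := .inner b
  have hp2 : PolyBdd fun v : X => ⟪u, v⟫ ^ 2 := by simpa only [sq] using hu.mul hu
  have h1 : ∀ v : X, hq u v * (⟪a, v⟫ * ⟪b, v⟫) * Real.exp (-‖v‖ ^ 2) =
      2 / gM X * (⟪a, v⟫ * (⟪u, v⟫ ^ 2 * ⟪b, v⟫) * Real.exp (-‖v‖ ^ 2)) -
      2 / gM X * (‖u‖ ^ 2 / 2) * (⟪a, v⟫ * ⟪b, v⟫ * Real.exp (-‖v‖ ^ 2)) := fun v => by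
    rw [hq]; ring
  simp only [h1]
  rw [integral_sub, integral_const_mul, integral_const_mul, gauss_moment_four, gauss_moment_two]
  · have := (gM_pos (X := X)).ne'
    field_simp; ring
  · exact ((ha.mul (hp2.mul hb)).integrable_mul_gauss (by fun_prop)).const_mul _
  · exact ((ha.mul hb).integrable_mul_gauss (by fun_prop)).const_mul _

end Gauss

section CapGeometry
variable {X : Type*} [NormedAddCommGroup X] [InnerProductSpace ℝ X]

theorem inner_pos_of_cap {e : Sph X} {s : ℝ} (hs : 0 ≤ s) {x : Sph X} (h : cap e s x ≠ 0) :
    0 < ⟪(e : X), (x : X)⟫ :=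
  pos_of_mul_pos_right (zero_lt_one.trans (lt_of_cap_ne_zero h)) (by linarith)

theorem inner_sq_le_of_cap {e : Sph X} {s : ℝ} (hs : 0 ≤ s) (hs1 : s ≤ 1) {x : Sph X}
    (h : cap e s x ≠ 0) (v : X) :
    ⟪prj e v, (x : X)⟫ ^ 2 ≤ 3 * s * ‖prj e v‖ ^ 2 * ⟪(e : X), (x : X)⟫ ^ 2 := by
  have h1 := lt_of_cap_ne_zero h
  have h0 := inner_pos_of_cap hs h
  have h2 : ‖prj e (x : X)‖ ^ 2 = 1 - ⟪(e : X), (x : X)⟫ ^ 2 := by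
    have := norm_sq_prj e (x : X)
    rw [norm_sph] at this
    linarith
  set τ := ⟪(e : X), (x : X)⟫
  have h3 : ⟪prj e v, (x : X)⟫ ^ 2 ≤ ‖prj e v‖ ^ 2 * ‖prj e (x : X)‖ ^ 2 := by
    rw [← prj_prj e v, inner_prj_prj, prj_prj, ← mul_pow, ← sq_abs]
    exact pow_le_pow_left₀ (abs_nonneg _) (abs_real_inner_le_norm _ _) 2
  have h4 : 1 - τ ^ 2 ≤ 3 * s * τ ^ 2 := by
    have : 1 ≤ ((1 + s) * τ) ^ 2 := by nlinarith
    have : s ^ 2 * τ ^ 2 ≤ s * τ ^ 2 := by gcongr; nlinarith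
    nlinarith
  calc _ ≤ _ := h3
    _ ≤ ‖prj e v‖ ^ 2 * (3 * s * τ ^ 2) := by rw [h2]; gcongr
    _ = _ := by ring

end CapGeometry

theorem integral_abs_affine {c τ R : ℝ} (hτ : 0 < τ) (hc : |c| ≤ R * τ) :
    ∫ a in (-R)..R, |c + a * τ| = (c ^ 2 + R ^ 2 * τ ^ 2) / τ := by
  have hc' := abs_le.1 hc
  have h1 : -R ≤ -c / τ := by rw [le_div_iff₀ hτ]; linarith
  have h2 : -c / τ ≤ R := by rw [div_le_iff₀ hτ]; linarith
  have hi : ∀ a b : ℝ, IntervalIntegrable (fun a => |c + a * τ|) volume a b := fun a b =>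
    Continuous.intervalIntegrable (by fun_prop) _ _
  rw [← intervalIntegral.integral_add_adjacent_intervals (hi (-R) (-c / τ)) (hi _ R)]
  have e1 : ∫ a in (-R)..(-c / τ), |c + a * τ| = ∫ a in (-R)..(-c / τ), (-c - a * τ) := by
    refine intervalIntegral.integral_congr fun a ha => ?_
    rw [Set.uIcc_of_le h1] at ha
    have := (le_div_iff₀ hτ).1 ha.2
    beta_reduce
    rw [abs_of_nonpos (by linarith)]; ring
  have e2 : ∫ a in (-c / τ)..R, |c + a * τ| = ∫ a in (-c / τ)..R, (c + a * τ) := by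
    refine intervalIntegral.integral_congr fun a ha => ?_
    rw [Set.uIcc_of_le h2] at ha
    have := (div_le_iff₀ hτ).1 ha.1
    beta_reduce
    rw [abs_of_nonneg (by linarith)]
  have hi' : ∀ a b : ℝ, IntervalIntegrable (fun a => a * τ) volume a b := fun a b =>
    Continuous.intervalIntegrable (by fun_prop) _ _
  rw [e1, e2, intervalIntegral.integral_sub (by simp) (hi' _ _),
    intervalIntegral.integral_add (by simp) (hi' _ _)]
  simp only [intervalIntegral.integral_const, intervalIntegral.integral_mul_const, integral_id,
    smul_eq_mul]
  field_simp
  ring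

section Line
variable {X : Type*} [NormedAddCommGroup X] [InnerProductSpace ℝ X] [FiniteDimensional ℝ X]
  {r : ℕ} {E : (X ≃ₗᵢ[ℝ] X) → ℂ → Prop} {T : (Fin r → CS X) → CS X →ₗ[ℝ] ℂ}

theorem Frame.update_affine (hT : Frame E T) {Z : Fin r → CS X} (hZ : ∀ i, Z i ∈ ZC X) (i : Fin r)
    {f : CS X} (hf : f ∈ HH X) : ∀ x ∈ (ZC X : Set (CS X)), ∀ y ∈ (ZC X : Set (CS X)), ∀ a b : ℝ,
      0 ≤ a → 0 ≤ b → a + b = 1 → T (Function.update Z i (a • x + b • y)) f =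
        a • T (Function.update Z i x) f + b • T (Function.update Z i y) f := by
  intro x hx y hy a b ha hb _
  rw [hT.update_add Z hZ i _ (smul_mem_ZC ha hx) _ (smul_mem_ZC hb hy) f hf,
    hT.update_smul hZ i ha hx hf, hT.update_smul hZ i hb hy hf, Complex.real_smul, Complex.real_smul]

theorem Frame.continuousOn_update (hT : Frame E T) {Z : Fin r → CS X} (hZ : ∀ i, Z i ∈ ZC X)
    (i : Fin r) {f : CS X} (hf : f ∈ HH X) :
    ContinuousOn (fun W => T (Function.update Z i W) f) (ZC X : Set (CS X)) :=
  (hT.cont f hf).comp (f := fun W => Function.update Z i W) (by fun_prop)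
    fun _ hW => update_mem_ZC hZ hW

theorem Frame.exists_slot_line (hT : Frame E T) {R : ℝ} (hR : 0 < R) (u e : X) :
    ∃ W ∈ ZC X, (∀ x : Sph X, W x = ∫ a in (-R)..R, |⟪u, (x : X)⟫ + a * ⟪e, (x : X)⟫|) ∧
      ∀ Z : Fin r → CS X, (∀ i, Z i ∈ ZC X) → ∀ i, ∀ f ∈ HH X, T (Function.update Z i W) f =
        ∫ a in (-R)..R, T (Function.update Z i (seg (u + a • e))) f := by
  have h2R : (0 : ℝ) < 2 * R := by linarith
  let m : Measure ℝ := ENNReal.ofReal (2 * R)⁻¹ • volume.restrict (Set.Ioc (-R) R)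
  have hm : IsProbabilityMeasure m := ⟨by
    simp only [m, Measure.smul_apply, Measure.restrict_apply_univ, Real.volume_Ioc, smul_eq_mul]
    rw [← ENNReal.ofReal_mul (by positivity), show R - -R = 2 * R by ring, inv_mul_cancel₀ h2R.ne',
      ENNReal.ofReal_one]⟩
  have hmi : ∀ {F : Type _} [NormedAddCommGroup F] [NormedSpace ℝ F] (φ : ℝ → F),
      ∫ a, φ a ∂m = (2 * R)⁻¹ • ∫ a in (-R)..R, φ a := by
    intro F _ _ φ
    rw [intervalIntegral.integral_of_le (by linarith), integral_smul_measure,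
      ENNReal.toReal_ofReal (by positivity)]
  have hint : ∀ φ : ℝ → CS X, Continuous φ → Integrable φ m := fun φ hφ =>
    Integrable.smul_measure ((hφ.integrableOn_Icc (μ := volume) (a := -R) (b := R)).mono_set
      Set.Ioc_subset_Icc_self) ENNReal.ofReal_ne_top
  have hintC : ∀ φ : ℝ → ℂ, Continuous φ → Integrable φ m := fun φ hφ =>
    Integrable.smul_measure ((hφ.integrableOn_Icc (μ := volume) (a := -R) (b := R)).mono_set
      Set.Ioc_subset_Icc_self) ENNReal.ofReal_ne_top
  have hcont : Continuous fun a : ℝ => seg (u + a • e) := continuous_seg.comp (by fun_prop)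
  have hmem : ∫ a, seg (u + a • e) ∂m ∈ ZC X := by
    have := integral_mem_of_affine (m := m) (C := (ZC X : Set (CS X))) (A := fun _ => (0 : ℂ))
      (F := fun a : ℝ => seg (u + a • e)) convex_ZC isClosed_ZC continuousOn_const (by simp)
      (hint _ hcont) (fun _ => seg_mem_ZC _) (by simp)
    exact this.1
  refine ⟨(2 * R) • ∫ a, seg (u + a • e) ∂m, smul_mem_ZC h2R.le hmem, fun x => ?_,
    fun Z hZ i f hf => ?_⟩
  · rw [ContinuousMap.smul_apply, integral_apply_CS (hint _ hcont), hmi, smul_smul,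
      mul_inv_cancel₀ h2R.ne', one_smul]
    simp only [seg_apply, inner_add_left, inner_smul_left, RCLike.conj_to_real]
  · rw [hT.update_smul hZ i h2R.le hmem hf]
    have hA := hT.continuousOn_update hZ i hf
    have := integral_mem_of_affine (m := m) (C := (ZC X : Set (CS X)))
      (A := fun W => T (Function.update Z i W) f) (F := fun a : ℝ => seg (u + a • e))
      convex_ZC isClosed_ZC hA (hT.update_affine hZ i hf)
      (hint _ hcont) (fun _ => seg_mem_ZC _)
      (hintC _ (hA.comp_continuous hcont fun _ => seg_mem_ZC _))
    rw [this.2, hmi, Complex.real_smul, ← mul_assoc, ← Complex.ofReal_mul,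
      mul_inv_cancel₀ h2R.ne', Complex.ofReal_one, one_mul]

theorem Frame.update_sum (hT : Frame E T) {Z : Fin r → CS X} (hZ : ∀ i, Z i ∈ ZC X) (i : Fin r)
    {f : CS X} (hf : f ∈ HH X) {K : Type*} (s : Finset K) {c : K → ℝ} (hc : ∀ k, 0 ≤ c k)
    {W : K → CS X} (hW : ∀ k, W k ∈ ZC X) :
    T (Function.update Z i (∑ k ∈ s, c k • W k)) f =
      ∑ k ∈ s, c k * T (Function.update Z i (W k)) f := by
  classical
  induction s using Finset.induction_on with
  | empty =>
    have := hT.update_smul hZ i le_rfl (zero_mem (ZC X)) hf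
    simpa using this
  | insert k s hk ih =>
    rw [Finset.sum_insert hk, Finset.sum_insert hk, hT.update_add Z hZ i _ (smul_mem_ZC (hc k) (hW k))
      _ (sum_mem fun j _ => smul_mem_ZC (hc j) (hW j)) f hf, hT.update_smul hZ i (hc k) (hW k) hf, ih]

theorem Frame.update_of_local (hT : Frame E T) {Z : Fin r → CS X} (hZ : ∀ i, Z i ∈ ZC X) (i : Fin r)
    {K : Type*} [Fintype K] (c : K → ℝ) {W : K → CS X} (hW : ∀ k, W k ∈ ZC X) {V : CS X}
    (hV : V ∈ ZC X) (a : X) {M M' : CS X} (hM : IsSupp M) (hM' : IsSupp M') (hle : M' ≤ M)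
    (h : ∀ x, M x ≠ M' x → V x = ∑ k, c k * W k x + ⟪a, (x : X)⟫) :
    T (Function.update Z i V) (M - M') = ∑ k, c k * T (Function.update Z i (W k)) (M - M') := by
  have hf : M - M' ∈ HH X := sub_mem hM.mem_HH hM'.mem_HH
  have hs : ∀ c : K → ℝ, (∀ k, 0 ≤ c k) → ∑ k, c k • W k ∈ ZC X := fun c hc =>
    sum_mem fun j _ => smul_mem_ZC (hc j) (hW j)
  have hp : ∀ k, 0 ≤ (c k)⁺ := fun k => posPart_nonneg _
  have hn : ∀ k, 0 ≤ (c k)⁻ := fun k => negPart_nonneg _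
  have key := hT.loc Z hZ i _ (add_mem hV (hs _ hn)) _ (hs _ hp) a M M' hM hM' hle (fun x hx => by
    rw [ContinuousMap.add_apply, h x hx, ContinuousMap.sum_apply, ContinuousMap.sum_apply]
    simp only [ContinuousMap.smul_apply, smul_eq_mul]
    have : ∀ k, c k * W k x = (c k)⁺ * W k x - (c k)⁻ * W k x := fun k => by
      rw [← sub_mul, posPart_sub_negPart]
    simp_rw [this, Finset.sum_sub_distrib]; ring)
  rw [hT.update_add Z hZ i _ hV _ (hs _ hn) _ hf, hT.update_sum hZ i hf _ hn hW,
    hT.update_sum hZ i hf _ hp hW] at key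
  rw [eq_sub_of_add_eq key, ← Finset.sum_sub_distrib]
  refine Finset.sum_congr rfl fun k _ => ?_
  rw [← sub_mul, ← Complex.ofReal_sub, posPart_sub_negPart]

theorem Frame.eq_zero_of_cap (hT : Frame E T) {Z : Fin r → CS X} (hZ : ∀ i, Z i ∈ ZC X) {i : Fin r}
    {v : X} (hv : Z i = seg v) (e : Sph X) {s : ℝ} (hs : 0 ≤ s) (hs1 : s ≤ 1)
    (h : 3 * s * ‖prj e v‖ ^ 2 < ⟪(e : X), v⟫ ^ 2) : T Z (cap e s) = 0 := by
  refine hT.perp Z hZ i v hv _ (cap_mem_HH e hs) fun x hx => ?_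
  by_contra hcap
  have h1 := inner_sq_le_of_cap hs hs1 hcap v
  have h0 := inner_pos_of_cap hs hcap
  have h2 : ⟪prj e v, (x : X)⟫ = -(⟪(e : X), v⟫ * ⟪(e : X), (x : X)⟫) := by
    rw [prj_apply, inner_sub_left, hx, inner_smul_left]; simp
  rw [h2, neg_sq, mul_pow] at h1
  exact absurd (le_of_mul_le_mul_right h1 (by positivity)) (not_le.2 h)

theorem Frame.eq_zero_of_cap' (hT : Frame E T) {Z : Fin r → CS X} (hZ : ∀ i, Z i ∈ ZC X) {i : Fin r}
    {v : X} (hv : Z i = seg v) (e : Sph X) {s : ℝ} (hs : 0 ≤ s) (hs1 : s ≤ 1)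
    (h : 2 * ‖prj e v‖ < |⟪(e : X), v⟫|) : T Z (cap e s) = 0 := by
  refine hT.eq_zero_of_cap hZ hv e hs hs1 ?_
  rw [← sq_abs ⟪(e : X), v⟫]
  have h0 := norm_nonneg (prj e v)
  nlinarith [mul_le_mul_of_nonneg_right hs1 (sq_nonneg ‖prj e v‖)]

theorem Frame.integral_line_eq (hT : Frame E T) {Z : Fin r → CS X} (hZ : ∀ i, Z i ∈ ZC X) (i : Fin r)
    (e : Sph X) {s : ℝ} (hs : 0 ≤ s) (hs1 : s ≤ 1) {u : X} (hu : ⟪(e : X), u⟫ = 0) {R : ℝ}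
    (hR : 0 < R) (huR : 2 * ‖u‖ ≤ R) :
    ∫ a : ℝ, T (Function.update Z i (seg (u + a • (e : X)))) (cap e s) =
      ∫ a in (-R)..R, T (Function.update Z i (seg (u + a • (e : X)))) (cap e s) := by
  rw [intervalIntegral.integral_of_le (by linarith), ← integral_Icc_eq_integral_Ioc]
  refine (setIntegral_eq_integral_of_forall_compl_eq_zero fun a ha => ?_).symm
  refine hT.eq_zero_of_cap' (update_mem_ZC hZ (seg_mem_ZC _)) (i := i) (v := u + a • (e : X))
    (by simp) e hs hs1 ?_
  rw [prj_add_smul, prj_eq_self hu, inner_add_right, hu, inner_smul_right, inner_self_sph, zero_add,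
    mul_one]
  refine lt_of_le_of_lt huR (not_le.1 fun h => ha ?_)
  exact abs_le.1 h

theorem Frame.integral_line_sum (hT : Frame E T) {Z : Fin r → CS X} (hZ : ∀ i, Z i ∈ ZC X)
    (i : Fin r) (e : Sph X) {s : ℝ} (hs : 0 ≤ s) (hs1 : s ≤ 1) {K : Type*} [Fintype K] (c : K → ℝ)
    {u : X} (hu : ⟪(e : X), u⟫ = 0) {y : K → X} (hy : ∀ k, ⟪(e : X), y k⟫ = 0)
    (h : ∀ x : X, ⟪u, x⟫ ^ 2 = ∑ k, c k * ⟪y k, x⟫ ^ 2) :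
    ∫ a : ℝ, T (Function.update Z i (seg (u + a • (e : X)))) (cap e s) =
      ∑ k, c k * ∫ a : ℝ, T (Function.update Z i (seg (y k + a • (e : X)))) (cap e s) := by
  obtain ⟨R, hR, huR, hyR⟩ : ∃ R : ℝ, 0 < R ∧ 2 * ‖u‖ ≤ R ∧ ∀ k, 2 * ‖y k‖ ≤ R := by
    refine ⟨1 + 2 * ‖u‖ + ∑ k, 2 * ‖y k‖, by positivity, ?_, fun k => ?_⟩
    · have : 0 ≤ ∑ k, 2 * ‖y k‖ := by positivity
      linarith
    · have := Finset.single_le_sum (f := fun k => 2 * ‖y k‖) (fun _ _ => by positivity)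
        (Finset.mem_univ k)
      have := norm_nonneg u
      linarith
  rw [hT.integral_line_eq hZ i e hs hs1 hu hR huR]
  simp_rw [fun k => hT.integral_line_eq hZ i e hs hs1 (hy k) hR (hyR k)]
  obtain ⟨V, hV, hVx, hVT⟩ := hT.exists_slot_line hR u (e : X)
  choose W hW hWx hWT using fun k => hT.exists_slot_line hR (y k) (e : X)
  rw [← hVT Z hZ i _ (cap_mem_HH e hs)]
  simp_rw [← fun k => hWT k Z hZ i _ (cap_mem_HH e hs)]
  have hval : ∀ w : X, ⟪(e : X), w⟫ = 0 → 2 * ‖w‖ ≤ R → ∀ x : Sph X, cap e s x ≠ 0 →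
      ∫ a in (-R)..R, |⟪w, (x : X)⟫ + a * ⟪(e : X), (x : X)⟫| =
        ⟪w, (x : X)⟫ ^ 2 / ⟪(e : X), (x : X)⟫ + R ^ 2 * ⟪(e : X), (x : X)⟫ := by
    intro w hw hwR x hx
    have h0 := inner_pos_of_cap hs hx
    rw [integral_abs_affine h0, add_div, pow_two ⟪(e : X), (x : X)⟫]
    · field_simp
    have h1 := inner_sq_le_of_cap hs hs1 hx w
    rw [prj_eq_self hw] at h1
    refine abs_le_of_sq_le_sq ?_ (by positivity)
    calc _ ≤ _ := h1
      _ ≤ R ^ 2 * ⟪(e : X), (x : X)⟫ ^ 2 := by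
        gcongr
        have := norm_nonneg w
        nlinarith [mul_le_mul_of_nonneg_right hs1 (sq_nonneg ‖w‖)]
      _ = _ := by ring
  refine hT.update_of_local hZ i c hW hV ((R ^ 2 * (1 - ∑ k, c k)) • (e : X))
    (isSupp_cap_fst e hs) isSupp_one le_sup_left fun x hx => ?_
  have hcap : cap e s x ≠ 0 := by
    rw [cap, ContinuousMap.sub_apply]; exact sub_ne_zero.2 hx
  simp_rw [hVx, hWx]
  rw [hval u hu huR x hcap, h, inner_smul_left]
  simp_rw [fun k => hval (y k) (hy k) (hyR k) x hcap, mul_add, Finset.sum_add_distrib,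
    ← Finset.sum_mul, mul_div_assoc', ← Finset.sum_div]
  simp only [RCLike.conj_to_real]
  ring

end Line

theorem integral_congr_update {r : ℕ} {F H : (Fin r → ℝ) → ℂ} (hF : Integrable F)
    (hH : Integrable H) (i : Fin r)
    (h : ∀ t, ∫ a, F (Function.update t i a) = ∫ a, H (Function.update t i a)) :
    ∫ t, F t = ∫ t, H t := by
  obtain _ | m := r
  · exact i.elim0
  have hm := (volume_preserving_piFinSuccAbove (fun _ : Fin (m + 1) => ℝ) i).symm
  have key : ∀ {F : (Fin (m + 1) → ℝ) → ℂ}, Integrable F → ∫ t, F t =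
      ∫ u : Fin m → ℝ, ∫ a : ℝ, F (Function.update (i.insertNth 0 u : Fin (m + 1) → ℝ) i a) := by
    intro F hF
    rw [← hm.integral_comp', Measure.volume_eq_prod, integral_prod_symm]
    · simp only [Fin.update_insertNth]
      rfl
    · rw [← Measure.volume_eq_prod]
      exact (hm.integrable_comp_emb (MeasurableEquiv.measurableEmbedding _)).2 hF
  rw [key hF, key hH]
  simp_rw [h]

section Slice
variable {X : Type*} [NormedAddCommGroup X] [InnerProductSpace ℝ X] [FiniteDimensional ℝ X]

theorem exists_quad (e : Sph X) : ∃ (K : Type) (_ : Fintype K) (c : K → ℝ) (a b y : K → X),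
    (∀ k, ⟪(e : X), a k⟫ = 0) ∧ (∀ k, ⟪(e : X), b k⟫ = 0) ∧ (∀ k, ⟪(e : X), y k⟫ = 0) ∧
    ∀ u x : X, ⟪prj e u, x⟫ ^ 2 = ∑ k, c k * (⟪a k, u⟫ * ⟪b k, u⟫) * ⟪y k, x⟫ ^ 2 := by
  let ε := stdOrthonormalBasis ℝ X
  refine ⟨Fin (Module.finrank ℝ X) × Fin (Module.finrank ℝ X) × Bool, inferInstance,
    fun k => if k.2.2 then 1 / 4 else -(1 / 4), fun k => prj e (ε k.1), fun k => prj e (ε k.2.1),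
    fun k => prj e (if k.2.2 then ε k.1 + ε k.2.1 else ε k.1 - ε k.2.1),
    fun k => inner_prj _ _, fun k => inner_prj _ _, fun k => inner_prj _ _, fun u x => ?_⟩
  have h : ⟪prj e u, x⟫ = ∑ j, ⟪prj e (ε j), u⟫ * ⟪prj e (ε j), x⟫ := by
    rw [← prj_prj e u, inner_prj_prj, ← ε.sum_inner_mul_inner]
    refine Finset.sum_congr rfl fun j _ => ?_
    rw [inner_prj_prj e (ε j) u, inner_prj_prj e (ε j) x, real_inner_comm (ε j) (prj e u)]
  rw [h, pow_two, Finset.sum_mul_sum]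
  simp only [Fintype.sum_prod_type, Fintype.sum_bool]
  refine Finset.sum_congr rfl fun i _ => Finset.sum_congr rfl fun j _ => ?_
  simp only [if_true, map_add, map_sub, inner_add_left, inner_sub_left, Bool.false_eq_true, if_false]
  ring

theorem multi_expand {X : Type*} {K : Type*} [Fintype K] (ω : K → X → ℝ) (y : K → X) :
    ∀ {r : ℕ} (Y : (Fin r → X) → ℂ),
      (∀ i v, Y v = ∑ k, ω k (v i) * Y (Function.update v i (y k))) → ∀ v,
      Y v = ∑ κ : Fin r → K, (∏ i, (ω (κ i) (v i) : ℂ)) * Y (y ∘ κ) := by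
  intro r
  induction r with
  | zero =>
    intro Y _ v
    simp only [Finset.univ_unique, Finset.univ_eq_empty, Finset.prod_empty, one_mul,
      Finset.sum_singleton]
    congr 1; exact Subsingleton.elim _ _
  | succ r ih =>
    intro Y hY v
    have h1 := ih (fun w => Y (Fin.cons (v 0) w)) (fun i w => by
      have := hY i.succ (Fin.cons (v 0) w)
      simpa only [Fin.cons_succ, Fin.cons_update] using this) (Fin.tail v)
    beta_reduce at h1
    rw [Fin.cons_self_tail] at h1
    rw [h1, ← (Fin.consEquiv fun _ => K).sum_comp, Fintype.sum_prod_type_right]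
    refine Finset.sum_congr rfl fun κ _ => ?_
    rw [hY 0 (Fin.cons (v 0) (y ∘ κ)), Finset.mul_sum]
    refine Finset.sum_congr rfl fun k _ => ?_
    rw [Fin.prod_univ_succ]
    simp only [Fin.cons_zero, Fin.update_cons_zero, Fin.consEquiv_apply, Fin.cons_succ, Fin.tail]
    have : (y ∘ Fin.cons k κ : Fin (r + 1) → X) = Fin.cons (y k) (y ∘ κ) := by
      rw [Fin.comp_cons]
    change _ = _ * Y (y ∘ Fin.cons k κ)
    rw [this]; ring

variable {r : ℕ} {E : (X ≃ₗᵢ[ℝ] X) → ℂ → Prop} {T : (Fin r → CS X) → CS X →ₗ[ℝ] ℂ}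

/-- The value of `T` on a small cap, integrated over the translations of the slots along `e`. -/
def slice (T : (Fin r → CS X) → CS X →ₗ[ℝ] ℂ) (e : Sph X) (s : ℝ) (v : Fin r → X) : ℂ :=
  ∫ t : Fin r → ℝ, T (fun i => seg (v i + t i • (e : X))) (cap e s)

variable (hT : Frame E T) (e : Sph X) {s : ℝ} (hs : 0 ≤ s) (hs1 : s ≤ 1)

include hT hs hs1 in
theorem Frame.integrable_slice (v : Fin r → X) :
    Integrable fun t : Fin r → ℝ => T (fun i => seg (v i + t i • (e : X))) (cap e s) := by
  have hc : Continuous fun t : Fin r → ℝ => T (fun i => seg (v i + t i • (e : X))) (cap e s) :=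
    (hT.continuous_left (cap_mem_HH e hs)).comp
      (f := fun (t : Fin r → ℝ) i => v i + t i • (e : X)) (by fun_prop)
  refine hc.integrable_of_hasCompactSupport (HasCompactSupport.intro
    (K := Set.univ.pi fun i => Set.Icc (-(2 * ‖prj e (v i)‖) - ⟪(e : X), v i⟫)
      (2 * ‖prj e (v i)‖ - ⟪(e : X), v i⟫)) (isCompact_univ_pi fun i => isCompact_Icc) ?_)
  intro t ht
  simp only [Set.mem_univ_pi, not_forall] at ht
  obtain ⟨i, hi⟩ := ht
  refine hT.eq_zero_of_cap' (Z := fun i => seg (v i + t i • (e : X))) (fun _ => seg_mem_ZC _)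
    (i := i) (v := v i + t i • (e : X)) rfl e hs hs1 ?_
  rw [prj_add_smul, inner_add_right, inner_smul_right, inner_self_sph, mul_one]
  refine not_le.1 fun h => hi ?_
  have := abs_le.1 h
  constructor <;> linarith

include hT hs hs1 in
theorem Frame.slice_update (i : Fin r) {K : Type*} [Fintype K] {c : K → ℝ} {y : K → X}
    (hy : ∀ k, ⟪(e : X), y k⟫ = 0) (v : Fin r → X)
    (h : ∀ x : X, ⟪prj e (v i), x⟫ ^ 2 = ∑ k, c k * ⟪y k, x⟫ ^ 2) :
    slice T e s v = ∑ k, c k * slice T e s (Function.update v i (y k)) := by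
  simp only [slice]
  have hint := fun k => hT.integrable_slice e hs hs1 (Function.update v i (y k))
  simp_rw [← integral_const_mul]
  rw [← integral_finset_sum _ fun k _ => (hint k).const_mul _]
  refine integral_congr_update (hT.integrable_slice e hs hs1 v)
    (integrable_finset_sum _ fun k _ => (hint k).const_mul _) i fun t => ?_
  have hupd : ∀ (w : X) (a : ℝ), (fun j => seg (Function.update v i w j +
      Function.update t i a j • (e : X))) = Function.update
        (fun j => seg (v j + t j • (e : X))) i (seg (w + a • (e : X))) := by
    intro w a
    ext1 j
    rcases eq_or_ne j i with rfl | hj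
    · simp
    · simp [hj]
  have hint' : ∀ k, Integrable fun a : ℝ => (c k : ℂ) * T (Function.update
        (fun j => seg (v j + t j • (e : X))) i (seg (y k + a • (e : X)))) (cap e s) := fun k => by
    refine Integrable.const_mul ?_ _
    have hc : Continuous fun a : ℝ => T (Function.update
        (fun j => seg (v j + t j • (e : X))) i (seg (y k + a • (e : X)))) (cap e s) :=
      (hT.continuousOn_update (fun _ => seg_mem_ZC _) i (cap_mem_HH e hs)).comp_continuous
        (continuous_seg.comp (by fun_prop)) fun _ => seg_mem_ZC _
    refine hc.integrable_of_hasCompactSupport (HasCompactSupport.intro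
      (K := Set.Icc (-(2 * ‖y k‖)) (2 * ‖y k‖)) isCompact_Icc fun a ha => ?_)
    refine hT.eq_zero_of_cap' (update_mem_ZC (fun _ => seg_mem_ZC _) (seg_mem_ZC _)) (i := i)
      (v := y k + a • (e : X)) (by simp) e hs hs1 ?_
    rw [prj_add_smul, prj_eq_self (hy k), inner_add_right, hy, inner_smul_right, inner_self_sph,
      zero_add, mul_one]
    exact not_le.1 fun h => ha (abs_le.1 h)
  have e1 : ∀ a : ℝ, (fun j => seg (v j + Function.update t i a j • (e : X))) =
      Function.update (fun j => seg (v j + t j • (e : X))) i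
        (seg (prj e (v i) + (a + ⟪(e : X), v i⟫) • (e : X))) := by
    intro a
    have := hupd (v i) a
    rw [Function.update_eq_self] at this
    rw [this]; congr 2
    rw [prj_apply, add_smul]; abel
  simp_rw [hupd, e1]
  rw [integral_add_right_eq_self fun a : ℝ => T (Function.update
    (fun j => seg (v j + t j • (e : X))) i (seg (prj e (v i) + a • (e : X)))) (cap e s),
    integral_finset_sum _ fun k _ => hint' k]
  simp_rw [integral_const_mul]
  exact hT.integral_line_sum (fun _ => seg_mem_ZC _) i e hs hs1 c (inner_prj _ _) hy h

include hT hs hs1 in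
theorem Frame.slice_shear {i j : Fin r} (hij : i ≠ j) (c : ℝ) (v : Fin r → X) :
    slice T e s (Function.update v j (v j + c • v i)) = slice T e s v := by
  refine integral_congr_update (hT.integrable_slice e hs hs1 _) (hT.integrable_slice e hs hs1 v) j
    fun t => ?_
  have h1 : ∀ a : ℝ, T (fun k => seg (Function.update v j (v j + c • v i) k +
      Function.update t j a k • (e : X))) (cap e s) =
        T (fun k => seg (v k + Function.update t j (a + -(c * t i)) k • (e : X))) (cap e s) := by
    intro a
    rw [← hT.shear (fun k => v k + Function.update t j (a + -(c * t i)) k • (e : X)) i j hij c _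
      (cap_mem_HH e hs)]
    congr 2
    ext1 k
    rcases eq_or_ne k j with rfl | hk
    · simp only [Function.update_self, Function.update_of_ne hij]
      congr 1
      module
    · simp [hk]
  simp_rw [h1]
  exact integral_add_right_eq_self (fun a : ℝ => T (fun k => seg (v k + Function.update t j a k •
    (e : X))) (cap e s)) _

end Slice

section GaussFubini
variable {X : Type*} [NormedAddCommGroup X] [InnerProductSpace ℝ X] [FiniteDimensional ℝ X]
  [MeasurableSpace X] [BorelSpace X] {r : ℕ}

theorem measurePreserving_line (e : Sph X) : MeasurePreserving
    (fun p : (Fin r → ℝ) × (Fin r → X) =>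
      ((fun i => p.2 i + p.1 i • (e : X), fun i => ⟪(e : X), p.2 i⟫) : (Fin r → X) × (Fin r → ℝ)))
    (volume.prod volume) (volume.prod volume) := by
  have h1 : MeasurePreserving (fun p : (Fin r → ℝ) × (Fin r → X) =>
      (p.1, fun i => p.2 i + p.1 i • (e : X))) (volume.prod volume) (volume.prod volume) := by
    refine (MeasurePreserving.id volume).skew_product
      (g := fun (t : Fin r → ℝ) (v : Fin r → X) i => v i + t i • (e : X))
      (Continuous.measurable (by fun_prop)) (ae_of_all _ fun t => ?_)
    exact (measurePreserving_add_right volume (fun i => t i • (e : X))).map_eq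
  have h2 : MeasurePreserving (fun p : (Fin r → X) × (Fin r → ℝ) =>
      (p.1, fun i => ⟪(e : X), p.1 i⟫ - p.2 i)) (volume.prod volume) (volume.prod volume) := by
    refine (MeasurePreserving.id volume).skew_product
      (g := fun (v : Fin r → X) (t : Fin r → ℝ) i => ⟪(e : X), v i⟫ - t i)
      (Continuous.measurable (by fun_prop)) (ae_of_all _ fun v => ?_)
    exact (Measure.measurePreserving_sub_left volume (fun i => ⟪(e : X), v i⟫)).map_eq
  convert h2.comp (Measure.measurePreserving_swap.comp h1) using 1
  ext p i
  · simp
  · simp [inner_add_right, inner_smul_right]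

theorem integral_exp_neg_sq_pi :
    ∫ t : Fin r → ℝ, Real.exp (-∑ i, t i ^ 2) = √Real.pi ^ r := by
  have := integral_fintype_prod_volume_eq_pow (ι := Fin r) fun t : ℝ => Real.exp (-(1 * t ^ 2))
  simp only [neg_mul_eq_neg_mul] at this
  rw [integral_gaussian, div_one, Fintype.card_fin] at this
  rw [← this]
  congr 1; ext t
  rw [← Real.exp_sum]
  simp

theorem integral_eq_integral_line (e : Sph X) {F : (Fin r → X) → ℂ} (hF : Integrable F) :
    (√Real.pi ^ r : ℝ) * ∫ v, F v = ∫ v : Fin r → X, (Real.exp (-∑ i, ⟪(e : X), v i⟫ ^ 2) : ℂ) *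
      ∫ t : Fin r → ℝ, F fun i => v i + t i • (e : X) := by
  have hg : Integrable fun t : Fin r → ℝ => ((Real.exp (-∑ i, t i ^ 2) : ℝ) : ℂ) := by
    have hgr : Integrable fun t : Fin r → ℝ => Real.exp (-∑ i, t i ^ 2) := by
      refine not_imp_comm.1 integral_undef ?_
      rw [integral_exp_neg_sq_pi]; positivity
    exact hgr.ofReal
  have hm := measurePreserving_line (r := r) e
  have hp := hF.mul_prod hg
  have h1 := hm.integrable_comp_of_integrable hp
  have h2 := integral_map hm.measurable.aemeasurable (hm.map_eq.symm ▸ hp.aestronglyMeasurable)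
  replace h2 := h2.trans (integral_prod_symm _ h1)
  rw [hm.map_eq, integral_prod_mul (μ := volume) (ν := volume) F
    (fun t : Fin r → ℝ => ((Real.exp (-∑ i, t i ^ 2) : ℝ) : ℂ)), integral_complex_ofReal,
    integral_exp_neg_sq_pi] at h2
  rw [mul_comm, h2]
  refine integral_congr_ae (ae_of_all _ fun v => ?_)
  simp only [Function.comp_apply]
  rw [integral_mul_const, mul_comm]

theorem integrable_one_add_pow_mul_exp (m : ℕ) {b : ℝ} (hb : 0 < b) :
    Integrable fun v : Fin r → X => (1 + ‖v‖) ^ m * Real.exp (-(b * ∑ i, ‖v i‖ ^ 2)) := by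
  have hsb : 0 < √b := Real.sqrt_pos.2 hb
  have hpb : PolyBdd fun v : Fin r → X => (((1 + ‖(√b)⁻¹ • v‖) ^ m : ℝ) : ℂ) := by
    refine PolyBdd.ofReal ⟨(1 + (√b)⁻¹) ^ m, m, by positivity, fun v => ?_⟩
    beta_reduce
    rw [Real.norm_of_nonneg (by positivity), ← mul_pow, norm_smul, Real.norm_of_nonneg (by positivity)]
    have : 0 ≤ (√b)⁻¹ := by positivity
    gcongr
    nlinarith [norm_nonneg v]
  have h := ((hpb.integrable_gw_mul (by fun_prop)).comp_smul hsb.ne').norm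
  refine h.congr (ae_of_all _ fun v => ?_)
  simp only [norm_mul, Complex.norm_real, Real.norm_of_nonneg (gw_pos _).le, smul_smul,
    inv_mul_cancel₀ hsb.ne', one_smul]
  rw [Real.norm_of_nonneg (by positivity), mul_comm]
  congr 2
  simp only [gw, Pi.smul_apply, norm_smul, mul_pow, Real.norm_of_nonneg hsb.le, Real.sq_sqrt hb.le,
    Finset.mul_sum]

end GaussFubini

/-- The truncated power series of `exp (t ^ 2)`. -/
def kap (R : ℕ) (t : ℝ) : ℝ := ∑ j ∈ Finset.range R, (t ^ 2) ^ j / (j.factorial : ℝ)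

theorem kap_nonneg (R : ℕ) (t : ℝ) : 0 ≤ kap R t := Finset.sum_nonneg fun _ _ => by positivity

theorem kap_mul_exp_le_one (R : ℕ) (t : ℝ) : kap R t * Real.exp (-t ^ 2) ≤ 1 := by
  have := Real.sum_le_exp_of_nonneg (sq_nonneg t) R
  calc _ ≤ Real.exp (t ^ 2) * Real.exp (-t ^ 2) := by gcongr; exact this
    _ = 1 := by rw [← Real.exp_add]; simp

theorem one_sub_kap_mul_exp_le (R : ℕ) (t : ℝ) : 1 - kap R t * Real.exp (-t ^ 2) ≤ (t ^ 2) ^ R := by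
  have h := Complex.norm_exp_sub_sum_le_norm_mul_exp ((t ^ 2 : ℝ) : ℂ) R
  have h1 : Complex.exp ((t ^ 2 : ℝ) : ℂ) - ∑ m ∈ Finset.range R, ((t ^ 2 : ℝ) : ℂ) ^ m / (m.factorial : ℂ) =
      ((Real.exp (t ^ 2) - kap R t : ℝ) : ℂ) := by
    simp [kap]
  rw [h1, Complex.norm_real, Complex.norm_real, Real.norm_of_nonneg (sq_nonneg t)] at h
  have h2 := (le_abs_self _).trans h
  have h3 := mul_le_mul_of_nonneg_right h2 (Real.exp_pos (-t ^ 2)).le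
  have h4 : Real.exp (t ^ 2) * Real.exp (-t ^ 2) = 1 := by rw [← Real.exp_add]; simp
  rw [sub_mul, h4, mul_assoc, h4, mul_one] at h3
  exact h3

theorem one_sub_prod_le {ι : Type*} (s : Finset ι) {a : ι → ℝ} (h0 : ∀ i, 0 ≤ a i) (h1 : ∀ i, a i ≤ 1) :
    1 - ∏ i ∈ s, a i ≤ ∑ i ∈ s, (1 - a i) := by
  classical
  induction s using Finset.induction_on with
  | empty => simp
  | insert i s hi ih =>
    rw [Finset.prod_insert hi, Finset.sum_insert hi]
    have h2 : ∏ i ∈ s, a i ≤ 1 := Finset.prod_le_one (fun i _ => h0 i) fun i _ => h1 i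
    nlinarith [h0 i, h1 i]

section Kap
variable {X : Type*} [NormedAddCommGroup X] [InnerProductSpace ℝ X] {r : ℕ}

theorem kap_succ (R : ℕ) (t : ℝ) :
    kap (R + 1) t = 1 + t * ∑ j ∈ Finset.range R, ((j + 1).factorial : ℝ)⁻¹ * t ^ (2 * j + 1) := by
  rw [kap, Finset.sum_range_succ', Finset.mul_sum, add_comm]
  simp only [pow_zero, Nat.factorial_zero, Nat.cast_one, div_one]
  congr 1
  refine Finset.sum_congr rfl fun j _ => ?_
  rw [← pow_mul, div_eq_mul_inv]; ring

theorem pow_inner_mem_PolyFn (e : X) (i : Fin r) (m : ℕ) :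
    (fun v : Fin r → X => ⟪e, v i⟫ ^ m) ∈ PolyFn r X :=
  pow_mem (inner_mem_PolyFn e i) m

theorem kap_tail_mem_PolyFn (e : X) (i : Fin r) (R : ℕ) :
    (fun v : Fin r → X => ∑ j ∈ Finset.range R, ((j + 1).factorial : ℝ)⁻¹ * ⟪e, v i⟫ ^ (2 * j + 1))
      ∈ PolyFn r X :=
  sum_mem_PolyFn _ fun _ _ => const_mul_mem_PolyFn (pow_inner_mem_PolyFn e i _) _

theorem kap_mem_PolyFn (e : X) (i : Fin r) (R : ℕ) :
    (fun v : Fin r → X => kap R ⟪e, v i⟫) ∈ PolyFn r X := by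
  simp only [kap, ← pow_mul, div_eq_inv_mul]
  exact sum_mem_PolyFn _ fun _ _ => const_mul_mem_PolyFn (pow_inner_mem_PolyFn e i _) _

theorem comp_prj_mem_PolyFn [FiniteDimensional ℝ X] (e : Sph X) {p : (Fin r → X) → ℝ} (hp : p ∈ PolyFn r X) :
    (fun v => p fun i => prj e (v i)) ∈ PolyFn r X := PolyFn_comp (prj e) hp

end Kap

section Slices
variable {X : Type*} [NormedAddCommGroup X] [InnerProductSpace ℝ X] [FiniteDimensional ℝ X]
  [Nontrivial X] [MeasurableSpace X] [BorelSpace X] {r : ℕ} {E : (X ≃ₗᵢ[ℝ] X) → ℂ → Prop}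
  {T : (Fin r → CS X) → CS X →ₗ[ℝ] ℂ}

theorem Frame.exists_cap_bound (hT : Frame E T) (e : Sph X) : ∃ C, 0 ≤ C ∧ ∀ s, 0 ≤ s → s ≤ 1 →
    ∀ v : Fin r → X, ‖T (fun k => seg (v k)) (cap e s)‖ ≤ C * ∏ i, ‖v i‖ := by
  obtain ⟨C, hC, h⟩ := hT.exists_bound
  refine ⟨C * 3, by positivity, fun s hs hs1 v => ?_⟩
  have hP : 0 ≤ C * ∏ i, ‖v i‖ := mul_nonneg hC (Finset.prod_nonneg fun _ _ => norm_nonneg _)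
  have h1 := h v _ (isSupp_cap_fst e hs)
  have h2 := h v _ isSupp_one
  have n1 : ‖(1 ⊔ (1 + s) • SUVal.lin (e : X) : CS X)‖ ≤ 2 := by
    refine (ContinuousMap.norm_le _ (by norm_num)).2 fun x => ?_
    have := cap_apply e s x
    have h3 := cap_nonneg e s x
    have h4 := inner_sph_le_one e x
    have h5 : (1 ⊔ (1 + s) • SUVal.lin (e : X) : CS X) x = max 1 ((1 + s) * ⟪(e : X), (x : X)⟫) := by simp
    rw [h5, Real.norm_of_nonneg (by positivity)]
    exact max_le (by norm_num) (by nlinarith)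
  have n2 : ‖(1 : CS X)‖ ≤ 1 := (ContinuousMap.norm_le _ (by norm_num)).2 fun x => by simp
  rw [cap, map_sub]
  calc _ ≤ _ := norm_sub_le _ _
    _ ≤ C * (∏ i, ‖v i‖) * 2 + C * (∏ i, ‖v i‖) * 1 := add_le_add
      (h1.trans (mul_le_mul_of_nonneg_left n1 hP)) (h2.trans (mul_le_mul_of_nonneg_left n2 hP))
    _ = _ := by ring

/-- The Gaussian weight of the components orthogonal to `e`. -/
def gp (e : Sph X) (v : Fin r → X) : ℝ := Real.exp (-∑ i, ‖prj e (v i)‖ ^ 2)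

theorem gw_eq_gp_mul (e : Sph X) (v : Fin r → X) :
    gw v = gp e v * ∏ i, Real.exp (-⟪(e : X), v i⟫ ^ 2) := by
  rw [gw, gp, ← Real.exp_sum, ← Real.exp_add]
  congr 1
  rw [Finset.sum_neg_distrib, ← neg_add, ← Finset.sum_add_distrib]
  simp only [← norm_sq_prj]

theorem Frame.cap_support (hT : Frame E T) (e : Sph X) {s : ℝ} (hs : 0 ≤ s) (hs1 : s ≤ 1)
    {v : Fin r → X} (h : T (fun k => seg (v k)) (cap e s) ≠ 0) (i : Fin r) :
    ⟪(e : X), v i⟫ ^ 2 ≤ 3 * s * ‖prj e (v i)‖ ^ 2 := by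
  by_contra hlt
  exact h (hT.eq_zero_of_cap (fun k => seg_mem_ZC (v k)) (i := i) rfl e hs hs1 (not_le.1 hlt))

theorem Frame.gp_le (hT : Frame E T) (e : Sph X) {s : ℝ} (hs : 0 ≤ s) (hs1 : s ≤ 1)
    {v : Fin r → X} (h : T (fun k => seg (v k)) (cap e s) ≠ 0) :
    gp e v ≤ Real.exp (-(1 / 4 * ∑ i, ‖v i‖ ^ 2)) := by
  refine Real.exp_le_exp.2 (neg_le_neg ?_)
  rw [Finset.mul_sum]
  refine Finset.sum_le_sum fun i _ => ?_
  have h1 := hT.cap_support e hs hs1 h i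
  have h2 := norm_sq_prj e (v i)
  nlinarith [mul_le_mul_of_nonneg_right hs1 (sq_nonneg ‖prj e (v i)‖)]

theorem continuous_gp (e : Sph X) : Continuous (gp e : (Fin r → X) → ℝ) := by
  have := (prj e).continuous_of_finiteDimensional
  unfold gp; fun_prop

theorem norm_prj_le (e : Sph X) (v : X) : ‖prj e v‖ ≤ ‖v‖ := by
  rw [← sq_le_sq₀ (norm_nonneg _) (norm_nonneg _), norm_sq_prj e v]
  nlinarith [sq_nonneg ⟪(e : X), v⟫]

theorem Frame.exists_gp_bound (hT : Frame E T) {p : (Fin r → X) → ℝ} (hp : p ∈ PolyFn r X) (e : Sph X)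
    (R : ℕ) : ∃ C : ℝ, ∃ m : ℕ, 0 ≤ C ∧ ∀ s, 0 ≤ s → s ≤ 1 → ∀ (v : Fin r → X) (a : ℝ), 0 ≤ a →
      (T (fun k => seg (v k)) (cap e s) ≠ 0 → a ≤ ∑ i, (⟪(e : X), v i⟫ ^ 2) ^ R) →
      ‖(p v : ℂ) * gp e v * a * T (fun k => seg (v k)) (cap e s)‖ ≤
        C * s ^ R * ((1 + ‖v‖) ^ m * Real.exp (-(1 / 4 * ∑ i, ‖v i‖ ^ 2))) := by
  obtain ⟨C₁, k, hC₁, h₁⟩ := polyBdd_of_mem_PolyFn hp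
  obtain ⟨C₂, hC₂, h₂⟩ := hT.exists_cap_bound e
  refine ⟨C₁ * C₂ * (r * 3 ^ R), k + r + 2 * R, by positivity, fun s hs hs1 v a ha hle => ?_⟩
  by_cases hF : T (fun k => seg (v k)) (cap e s) = 0
  · rw [hF, mul_zero, norm_zero]; positivity
  have hn : ∀ i, ‖v i‖ ≤ 1 + ‖v‖ := fun i => (norm_le_pi_norm v i).trans (by linarith)
  have h3 : a ≤ r * 3 ^ R * s ^ R * (1 + ‖v‖) ^ (2 * R) := by
    refine (hle hF).trans ?_
    calc ∑ i, (⟪(e : X), v i⟫ ^ 2) ^ R ≤ ∑ _i : Fin r, 3 ^ R * s ^ R * (1 + ‖v‖) ^ (2 * R) := by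
          refine Finset.sum_le_sum fun i _ => ?_
          rw [← mul_pow, pow_mul, ← mul_pow]
          refine pow_le_pow_left₀ (sq_nonneg _) ((hT.cap_support e hs hs1 hF i).trans ?_) R
          have := (norm_prj_le e (v i)).trans (hn i)
          gcongr
      _ = _ := by simp; ring
  have h4 := h₂ s hs hs1 v
  have h5 : ∏ i, ‖v i‖ ≤ (1 + ‖v‖) ^ r := by
    calc _ ≤ ∏ _i : Fin r, (1 + ‖v‖) := Finset.prod_le_prod (fun _ _ => norm_nonneg _) fun i _ => hn i
      _ = _ := by simp
  have h6 := hT.gp_le e hs hs1 hF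
  have h7 : 0 ≤ gp e v := (Real.exp_pos _).le
  rw [norm_mul, norm_mul, norm_mul, Complex.norm_real, Complex.norm_real, Complex.norm_real,
    Real.norm_of_nonneg h7, Real.norm_of_nonneg ha]
  calc _ ≤ (C₁ * (1 + ‖v‖) ^ k) * Real.exp (-(1 / 4 * ∑ i, ‖v i‖ ^ 2)) *
        (r * 3 ^ R * s ^ R * (1 + ‖v‖) ^ (2 * R)) * (C₂ * (1 + ‖v‖) ^ r) := by
        gcongr
        · exact h₁ v
        · exact h4.trans (by gcongr)
    _ = _ := by rw [pow_add, pow_add]; ring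

theorem Frame.integrable_gp (hT : Frame E T) {p : (Fin r → X) → ℝ} (hp : p ∈ PolyFn r X) (e : Sph X)
    {s : ℝ} (hs : 0 ≤ s) (hs1 : s ≤ 1) :
    Integrable fun v => (p v : ℂ) * gp e v * T (fun k => seg (v k)) (cap e s) := by
  obtain ⟨C₁, k, hC₁, h₁⟩ := polyBdd_of_mem_PolyFn hp
  obtain ⟨C₂, hC₂, h₂⟩ := hT.exists_cap_bound e
  refine Integrable.mono' ((integrable_one_add_pow_mul_exp (X := X) (r := r) (k + r)
    (b := 1 / 4) (by norm_num)).const_mul (C₁ * C₂)) (Continuous.aestronglyMeasurable ?_)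
    (ae_of_all _ fun v => ?_)
  · exact ((Complex.continuous_ofReal.comp (continuous_of_mem_PolyFn hp)).mul
      (Complex.continuous_ofReal.comp (continuous_gp e))).mul
      (hT.continuous_left (cap_mem_HH e hs))
  by_cases hF : T (fun k => seg (v k)) (cap e s) = 0
  · rw [hF, mul_zero, norm_zero]; positivity
  have h4 := h₂ s hs hs1 v
  have h5 : ∏ i, ‖v i‖ ≤ (1 + ‖v‖) ^ r := by
    calc _ ≤ ∏ _i : Fin r, (1 + ‖v‖) := Finset.prod_le_prod (fun _ _ => norm_nonneg _)
          fun i _ => (norm_le_pi_norm v i).trans (by linarith)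
      _ = _ := by simp
  have h6 := hT.gp_le e hs hs1 hF
  have h7 : 0 ≤ gp e v := (Real.exp_pos _).le
  rw [norm_mul, norm_mul, Complex.norm_real, Complex.norm_real, Real.norm_of_nonneg h7]
  calc _ ≤ (C₁ * (1 + ‖v‖) ^ k) * Real.exp (-(1 / 4 * ∑ i, ‖v i‖ ^ 2)) * (C₂ * (1 + ‖v‖) ^ r) := by
        gcongr
        · exact h₁ v
        · exact h4.trans (by gcongr)
    _ = _ := by rw [pow_add]; ring

theorem Frame.exists_Phi_approx (hT : Frame E T) {p : (Fin r → X) → ℝ} (hp : p ∈ PolyFn r X) (e : Sph X)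
    (R : ℕ) : ∃ C : ℝ, ∀ s, 0 ≤ s → s ≤ 1 →
      ‖(∫ v, (p v : ℂ) * gp e v * T (fun k => seg (v k)) (cap e s)) -
        Phi T (fun v => p v * ∏ i, kap R ⟪(e : X), v i⟫) (cap e s)‖ ≤ C * s ^ R := by
  obtain ⟨C, m, hC, h⟩ := hT.exists_gp_bound hp e R
  have hi := integrable_one_add_pow_mul_exp (X := X) (r := r) m (b := 1 / 4) (by norm_num)
  refine ⟨C * ∫ v : Fin r → X, (1 + ‖v‖) ^ m * Real.exp (-(1 / 4 * ∑ i, ‖v i‖ ^ 2)),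
    fun s hs hs1 => ?_⟩
  have hq : (fun v => p v * ∏ i, kap R ⟪(e : X), v i⟫) ∈ PolyFn r X :=
    mul_mem hp (prod_mem_PolyFn Finset.univ fun i _ => kap_mem_PolyFn (e : X) i R)
  rw [Phi, ← integral_sub (hT.integrable_gp hp e hs hs1) (hT.integrable hq (cap_mem_HH e hs)),
    mul_right_comm, ← integral_const_mul]
  refine norm_integral_le_of_norm_le (hi.const_mul _) (ae_of_all _ fun v => ?_)
  have hk0 : ∀ i, 0 ≤ kap R ⟪(e : X), v i⟫ * Real.exp (-⟪(e : X), v i⟫ ^ 2) := fun i =>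
    mul_nonneg (kap_nonneg _ _) (Real.exp_pos _).le
  have hk1 := fun i => kap_mul_exp_le_one R ⟪(e : X), v i⟫
  refine le_trans (le_of_eq ?_) (h s hs hs1 v
    (1 - ∏ i, (kap R ⟪(e : X), v i⟫ * Real.exp (-⟪(e : X), v i⟫ ^ 2)))
    (sub_nonneg.2 (Finset.prod_le_one (fun i _ => hk0 i) fun i _ => hk1 i)) fun _ =>
    (one_sub_prod_le _ hk0 hk1).trans (Finset.sum_le_sum fun i _ => one_sub_kap_mul_exp_le R _))
  congr 1
  rw [gw_eq_gp_mul e, Finset.prod_mul_distrib]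
  push_cast; ring

theorem Frame.integral_gp_eq_slice (hT : Frame E T) {p : (Fin r → X) → ℝ} (hp : p ∈ PolyFn r X)
    (e : Sph X) {s : ℝ} (hs : 0 ≤ s) (hs1 : s ≤ 1) :
    (√Real.pi ^ r : ℝ) * ∫ v, ((p fun i => prj e (v i) : ℝ) : ℂ) * gp e v *
        T (fun k => seg (v k)) (cap e s) =
      ∫ v, (gw v : ℂ) * ((p fun i => prj e (v i) : ℝ) * slice T e s v) := by
  rw [integral_eq_integral_line e (hT.integrable_gp (comp_prj_mem_PolyFn e hp) e hs hs1)]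
  refine integral_congr_ae (ae_of_all _ fun v => ?_)
  simp only [prj_add_smul, gp, slice]
  rw [integral_const_mul, gw_eq_gp_mul e, ← Real.exp_sum, Finset.sum_neg_distrib, gp]
  push_cast; ring

end Slices

section Limit
variable {X : Type*} [NormedAddCommGroup X] [InnerProductSpace ℝ X]
variable {G : Type*} [Group G] [TopologicalSpace G] [IsTopologicalGroup G] [CompactSpace G]
  [SecondCountableTopology G] [MeasurableSpace G] [BorelSpace G]
  [FiniteDimensional ℝ X] [Nontrivial X] [MeasurableSpace X] [BorelSpace X] [SphRep G X] {r : ℕ} {E : (X ≃ₗᵢ[ℝ] X) → ℂ → Prop}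
  {T : (Fin r → CS X) → CS X →ₗ[ℝ] ℂ}
  (hT : Frame E T) (hE : ∀ g : G, E (rho X g) 1)
include hT hE

theorem Frame.Gam_mul_kap {p : (Fin r → X) → ℝ} (hp : p ∈ PolyFn r X) (e : Sph X) (R : ℕ) :
    Gam G e T (fun v => p v * ∏ i, kap (R + 1) ⟪(e : X), v i⟫) = Gam G e T p := by
  classical
  suffices h : ∀ s : Finset (Fin r), Gam G e T (fun v => p v * ∏ i ∈ s, kap (R + 1) ⟪(e : X), v i⟫) =
      Gam G e T p from h Finset.univ
  intro s
  induction s using Finset.induction_on with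
  | empty => simp
  | insert i s hi ih =>
    have hq : (fun v => p v * ∏ i ∈ s, kap (R + 1) ⟪(e : X), v i⟫) ∈ PolyFn r X :=
      mul_mem hp (prod_mem_PolyFn s fun i _ => kap_mem_PolyFn (e : X) i _)
    have hq' := mul_mem (kap_tail_mem_PolyFn (e : X) i R) hq
    refine Eq.trans ?_ (((hT.Gam_add hE hq (mul_mem (inner_mem_PolyFn (e : X) i) hq') e)).trans
      ?_)
    · congr 1; ext v
      rw [Finset.prod_insert hi, kap_succ]
      simp only [Pi.mul_apply]
      ring
    · rw [ih]
      refine (congrArg _ (hT.Gam_inner_mul hE hq' e i)).trans (add_zero _)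

theorem Frame.tendsto_slice {p : (Fin r → X) → ℝ} (hp : p ∈ PolyFn r X) (e : Sph X) :
    Tendsto (fun k => (∫ v, (gw v : ℂ) * ((p fun i => prj e (v i) : ℝ) * slice T e (capS G e k) v)) /
      ci G e k) (hyperfilter ℕ : Filter ℕ) (𝓝 ((√Real.pi ^ r : ℝ) * Gam G e T p)) := by
  obtain ⟨R, hR⟩ := exists_tendsto_capS_pow G e
  have hpp := comp_prj_mem_PolyFn e hp
  obtain ⟨C, hC⟩ := hT.exists_Phi_approx hpp e (R + 1)
  have hq : (fun v => p (fun i => prj e (v i)) * ∏ i, kap (R + 1) ⟪(e : X), v i⟫) ∈ PolyFn r X :=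
    mul_mem hpp (prod_mem_PolyFn Finset.univ fun i _ => kap_mem_PolyFn (e : X) i _)
  have h1 := hT.tendsto_Gam hE hq e
  rw [hT.Gam_mul_kap hE hpp, ← hT.Gam_prj hE hp] at h1
  have h2 : Tendsto (fun k => ((∫ v, ((p fun i => prj e (v i) : ℝ) : ℂ) * gp e v *
      T (fun k => seg (v k)) (cap e (capS G e k))) -
        Phi T (fun v => p (fun i => prj e (v i)) * ∏ i, kap (R + 1) ⟪(e : X), v i⟫) (cp G e k)) /
      ci G e k) (hyperfilter ℕ : Filter ℕ) (𝓝 0) := by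
    have h3 : Tendsto (fun k => C * (capS G e k * (capS G e k ^ R / ci G e k))) atTop (𝓝 0) := by
      simpa using ((tendsto_capS G e).mul hR).const_mul C
    refine squeeze_zero_norm (fun k => ?_) (h3.mono_left Nat.hyperfilter_le_atTop)
    rw [norm_div, Complex.norm_real, Real.norm_of_nonneg (ci_pos G e k).le]
    refine (div_le_div_of_nonneg_right (hC _ (capS_pos G e k).le (capS_le_one G e k))
      (ci_pos G e k).le).trans (le_of_eq ?_)
    rw [pow_succ]; ring
  have h4 := (h1.add h2).const_mul ((√Real.pi ^ r : ℝ) : ℂ)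
  rw [add_zero] at h4
  refine h4.congr fun k => ?_
  rw [← add_div, add_sub_cancel, ← mul_div_assoc,
    hT.integral_gp_eq_slice hp e (capS_pos G e k).le (capS_le_one G e k)]

end Limit

section Moments
variable {X : Type*} [NormedAddCommGroup X] [InnerProductSpace ℝ X] [FiniteDimensional ℝ X]
  [Nontrivial X] [MeasurableSpace X] [BorelSpace X] {r : ℕ} {E : (X ≃ₗᵢ[ℝ] X) → ℂ → Prop}
  {T : (Fin r → CS X) → CS X →ₗ[ℝ] ℂ}

omit [Nontrivial X] in
theorem hq_mem_PolyFn (q : X) (i : Fin r) : (fun v : Fin r → X => hq q (v i)) ∈ PolyFn r X :=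
  const_mul_mem_PolyFn (sub_mem (pow_inner_mem_PolyFn q i 2) (const_mem_PolyFn _)) _

theorem Frame.integral_gw_mul_slice (hT : Frame E T) (e : Sph X) {s : ℝ} (hs : 0 ≤ s) (hs1 : s ≤ 1)
    {p : (Fin r → X) → ℝ} (hp : p ∈ PolyFn r X) {K : Type} [Fintype K] {c : K → ℝ} {a b y : K → X}
    (hy : ∀ k, ⟪(e : X), y k⟫ = 0)
    (h : ∀ u x : X, ⟪prj e u, x⟫ ^ 2 = ∑ k, c k * (⟪a k, u⟫ * ⟪b k, u⟫) * ⟪y k, x⟫ ^ 2) :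
    ∫ v, (gw v : ℂ) * (p v * slice T e s v) = ∑ κ : Fin r → K,
      ((∫ v : Fin r → X, gw v * (p v * ∏ i, c (κ i) * (⟪a (κ i), v i⟫ * ⟪b (κ i), v i⟫)) : ℝ) : ℂ) *
        slice T e s (y ∘ κ) := by
  have hexp := multi_expand (fun k u => c k * (⟪a k, u⟫ * ⟪b k, u⟫)) y (slice T e s)
    fun i v => hT.slice_update e hs hs1 i hy v (h (v i))
  have hq : ∀ κ : Fin r → K, (fun v : Fin r → X => p v * ∏ i, c (κ i) *
      (⟪a (κ i), v i⟫ * ⟪b (κ i), v i⟫)) ∈ PolyFn r X := fun κ =>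
    mul_mem hp (prod_mem_PolyFn Finset.univ fun i _ =>
      const_mul_mem_PolyFn (mul_mem (inner_mem_PolyFn _ i) (inner_mem_PolyFn _ i)) _)
  have hint : ∀ κ : Fin r → K, Integrable fun v : Fin r → X => (gw v : ℂ) *
      ((p v * ∏ i, c (κ i) * (⟪a (κ i), v i⟫ * ⟪b (κ i), v i⟫) : ℝ) : ℂ) := fun κ =>
    (polyBdd_of_mem_PolyFn (hq κ)).ofReal.integrable_gw_mul
      (Complex.continuous_ofReal.comp (continuous_of_mem_PolyFn (hq κ)))
  simp_rw [← integral_complex_ofReal, Complex.ofReal_mul (gw _), ← integral_mul_const]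
  rw [← integral_finsetSum _ fun κ _ => (hint κ).mul_const _]
  congr 1; ext v
  rw [hexp v, Finset.mul_sum, Finset.mul_sum]
  refine Finset.sum_congr rfl fun κ _ => ?_
  push_cast; ring

end Moments

section Form
variable {X : Type*} [NormedAddCommGroup X] [InnerProductSpace ℝ X]
variable {G : Type*} [Group G] [TopologicalSpace G] [IsTopologicalGroup G] [CompactSpace G]
  [SecondCountableTopology G] [MeasurableSpace G] [BorelSpace G]
  [FiniteDimensional ℝ X] [Nontrivial X] [MeasurableSpace X] [BorelSpace X] [SphRep G X] {r : ℕ} {E : (X ≃ₗᵢ[ℝ] X) → ℂ → Prop}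
  {T : (Fin r → CS X) → CS X →ₗ[ℝ] ℂ}
  (hT : Frame E T) (hE : ∀ g : G, E (rho X g) 1)
include hT hE

theorem Frame.Gam_prod_hq (e : Sph X) (q : Fin r → X) :
    Gam G e T (fun v => ∏ i, hq (q i) (v i)) =
      ((2 / gM X) ^ r : ℝ) * Gam G e T (fun v => ∏ i, ⟪q i, v i⟫ ^ 2) := by
  classical
  have hm : ∀ (s : Finset (Fin r)) i, (fun v : Fin r → X => if i ∈ s then ⟪q i, v i⟫ ^ 2 else
      ⟪q i, v i⟫ ^ 2 - ‖q i‖ ^ 2 / 2) ∈ PolyFn r X := fun s i => by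
    by_cases h : i ∈ s
    · simp only [h, if_true]; exact pow_inner_mem_PolyFn _ _ _
    · simp only [h, if_false]; exact sub_mem (pow_inner_mem_PolyFn _ _ _) (const_mem_PolyFn _)
  have key : ∀ s : Finset (Fin r), Gam G e T (fun v => ∏ i, if i ∈ s then ⟪q i, v i⟫ ^ 2 else
      ⟪q i, v i⟫ ^ 2 - ‖q i‖ ^ 2 / 2) = Gam G e T (fun v => ∏ i, (⟪q i, v i⟫ ^ 2 - ‖q i‖ ^ 2 / 2)) := by
    intro s
    induction s using Finset.induction_on with
    | empty => simp
    | insert i s hi ih =>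
      have h0 := prod_mem_PolyFn (Finset.univ.erase i) fun j _ => hm s j
      have h1 := prod_mem_PolyFn Finset.univ fun j _ => hm s j
      have h2 : Gam G e T (fun v => ∏ j ∈ Finset.univ.erase i, if j ∈ s then ⟪q j, v j⟫ ^ 2 else
          ⟪q j, v j⟫ ^ 2 - ‖q j‖ ^ 2 / 2) = 0 := by
        refine hT.Gam_radial hE h0 i (fun v A => ?_) e
        refine Finset.prod_congr rfl fun j hj => ?_
        rw [Function.update_of_ne (Finset.ne_of_mem_erase hj)]
      rw [← ih, ← add_zero (Gam G e T fun v => ∏ j, if j ∈ s then _ else _),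
        ← mul_zero ((‖q i‖ ^ 2 / 2 : ℝ) : ℂ), ← h2, ← hT.Gam_smul hE h0,
        ← hT.Gam_add hE h1 (const_mul_mem_PolyFn h0 _)]
      congr 1; ext v
      rw [← Finset.mul_prod_erase _ _ (Finset.mem_univ i),
        ← Finset.mul_prod_erase Finset.univ (fun j => if j ∈ s then _ else _) (Finset.mem_univ i)]
      have h3 : ∏ j ∈ Finset.univ.erase i, (if j ∈ insert i s then ⟪q j, v j⟫ ^ 2 else
          ⟪q j, v j⟫ ^ 2 - ‖q j‖ ^ 2 / 2) = ∏ j ∈ Finset.univ.erase i, (if j ∈ s then ⟪q j, v j⟫ ^ 2 else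
          ⟪q j, v j⟫ ^ 2 - ‖q j‖ ^ 2 / 2) := by
        refine Finset.prod_congr rfl fun j hj => ?_
        simp [Finset.ne_of_mem_erase hj]
      rw [h3]
      simp only [Finset.mem_insert_self, if_true, hi, if_false]
      ring
  have h1 := key Finset.univ
  simp only [Finset.mem_univ, if_true] at h1
  have hmem : (fun v : Fin r → X => ∏ i, (⟪q i, v i⟫ ^ 2 - ‖q i‖ ^ 2 / 2)) ∈ PolyFn r X :=
    prod_mem_PolyFn Finset.univ fun i _ => sub_mem (pow_inner_mem_PolyFn _ _ _) (const_mem_PolyFn _)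
  rw [h1, ← hT.Gam_smul hE hmem]
  congr 1; ext v
  simp [hq, Finset.prod_mul_distrib, div_pow]

theorem Frame.tendsto_slice_div (e : Sph X) {q : Fin r → X} (hq0 : ∀ i, ⟪(e : X), q i⟫ = 0) :
    Tendsto (fun k => slice T e (capS G e k) q / ci G e k) (hyperfilter ℕ : Filter ℕ)
      (𝓝 ((√Real.pi ^ r : ℝ) * (((2 / gM X) ^ r : ℝ) * Gam G e T (fun v => ∏ i, ⟪q i, v i⟫ ^ 2)))) := by
  obtain ⟨K, _, c, a, b, y, ha, hb, hy, h⟩ := exists_quad e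
  have hp : (fun v : Fin r → X => ∏ i, hq (q i) (v i)) ∈ PolyFn r X :=
    prod_mem_PolyFn Finset.univ fun i _ => hq_mem_PolyFn _ i
  rw [← hT.Gam_prod_hq hE]
  refine (hT.tendsto_slice hE hp e).congr fun k => ?_
  congr 1
  have hprj : ∀ v : Fin r → X, ∏ i, hq (q i) (prj e (v i)) = ∏ i, hq (q i) (v i) := fun v =>
    Finset.prod_congr rfl fun i _ => by rw [hq, hq, ← inner_prj_prj, prj_eq_self (hq0 i)]
  simp only [hprj]
  have hs := (capS_pos G e k).le
  have hs1 := capS_le_one G e k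
  rw [hT.integral_gw_mul_slice e hs hs1 hp hy h,
    multi_expand (fun k u => c k * (⟪a k, u⟫ * ⟪b k, u⟫)) y (slice T e (capS G e k))
      (fun i v => hT.slice_update e hs hs1 i hy v (h (v i))) q]
  refine Finset.sum_congr rfl fun κ _ => ?_
  congr 1
  rw [← Complex.ofReal_prod]
  congr 1
  have h1 : ∀ v : Fin r → X, gw v * ((∏ i, hq (q i) (v i)) * ∏ i, c (κ i) *
      (⟪a (κ i), v i⟫ * ⟪b (κ i), v i⟫)) = ∏ i, (c (κ i) * (hq (q i) (v i) *
      (⟪a (κ i), v i⟫ * ⟪b (κ i), v i⟫) * Real.exp (-‖v i‖ ^ 2))) := fun v => by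
    rw [gw, ← Finset.sum_neg_distrib, Real.exp_sum, ← Finset.prod_mul_distrib, ← Finset.prod_mul_distrib]
    exact Finset.prod_congr rfl fun i _ => by ring
  simp_rw [h1]
  rw [integral_fintype_prod_volume_eq_prod (fun i (u : X) => c (κ i) * (hq (q i) u *
      (⟪a (κ i), u⟫ * ⟪b (κ i), u⟫) * Real.exp (-‖u‖ ^ 2)))]
  refine Finset.prod_congr rfl fun i _ => ?_
  rw [integral_const_mul, integral_hq, real_inner_comm (a _), real_inner_comm (b _)]

theorem Frame.Gam_eq_zero (e : Sph X)
    (h0 : ∀ q : Fin r → X, (∀ i, ⟪(e : X), q i⟫ = 0) → Gam G e T (fun v => ∏ i, ⟪q i, v i⟫ ^ 2) = 0)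
    {p : (Fin r → X) → ℝ} (hp : p ∈ PolyFn r X) : Gam G e T p = 0 := by
  obtain ⟨K, _, c, a, b, y, ha, hb, hy, h⟩ := exists_quad e
  have hlim := hT.tendsto_slice hE hp e
  have hpp := comp_prj_mem_PolyFn e hp
  have h2 := tendsto_finsetSum (Finset.univ : Finset (Fin r → K)) fun κ _ =>
    (hT.tendsto_slice_div hE e (q := y ∘ κ) fun i => hy (κ i)).const_mul
      ((∫ v : Fin r → X, gw v * (p (fun i => prj e (v i)) * ∏ i, c (κ i) *
        (⟪a (κ i), v i⟫ * ⟪b (κ i), v i⟫)) : ℝ) : ℂ)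
  have h3 := tendsto_nhds_unique hlim (h2.congr fun k => ?_)
  · simp only [h0 _ fun i => hy _, Function.comp_apply, mul_zero, Finset.sum_const_zero] at h3
    refine (mul_eq_zero.1 h3).resolve_left (Complex.ofReal_ne_zero.2 ?_)
    positivity
  · rw [hT.integral_gw_mul_slice e (capS_pos G e k).le (capS_le_one G e k) hpp hy h, Finset.sum_div]
    exact Finset.sum_congr rfl fun κ _ => by rw [mul_div_assoc]

end Form

section QForm
variable {X : Type*} [NormedAddCommGroup X] [InnerProductSpace ℝ X] {r : ℕ}

/-- The multilinear map `F` of pairs of vectors is evaluated on the diagonal. -/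
def dg (q : Fin r → X) : Fin r × Bool → X := fun s => q s.1

variable (G : Type*) [Group G] [TopologicalSpace G] [IsTopologicalGroup G] [CompactSpace G]
  [SecondCountableTopology G] [MeasurableSpace G] [BorelSpace G]
  [FiniteDimensional ℝ X] [SphRep G X]

/-- The properties of the leading coefficient at `e` of the moments of a frame. -/
structure QForm (E : (X ≃ₗᵢ[ℝ] X) → ℂ → Prop) (e : Sph X)
    (F : MultilinearMap ℝ (fun _ : Fin r × Bool => X) ℂ) : Prop where
  prj_comp : ∀ q : Fin r × Bool → X, F (fun s => prj e (q s)) = F q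
  swap : ∀ (i : Fin r) (q : Fin r × Bool → X), F (fun s => if s.1 = i then q (s.1, !s.2) else q s) = F q
  equiv : ∀ (A : X ≃ₗᵢ[ℝ] X) (c : ℂ), A e = e → E A c → ∀ q : Fin r × Bool → X,
    F (fun s => A (q s)) = c * F q
  shear : ∀ i j : Fin r, i ≠ j → ∀ (c : ℝ) (q : Fin r → X),
    F (dg (Function.update q j (q j + c • q i))) = F (dg q)
  trace : ∀ {ι : Type} [Fintype ι] (b : OrthonormalBasis ι ℝ X) (i : Fin r) (q : Fin r → X),
    ∑ k, F (dg (Function.update q i (b k))) = 0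
  cont : ∀ q : Fin r × Bool → X, Continuous fun g : G => F (fun s => rho X g (q s))
  integral : ∀ (a : X) (q : Fin r × Bool → X),
    ∫ g : G, ((⟪a, ((sg g⁻¹ e : Sph X) : X)⟫ : ℝ) : ℂ) * F (fun s => rho X g (q s)) ∂hG G = 0

end QForm

section Form
variable {X : Type*} [NormedAddCommGroup X] [InnerProductSpace ℝ X]
variable {G : Type*} [Group G] [TopologicalSpace G] [IsTopologicalGroup G] [CompactSpace G]
  [SecondCountableTopology G] [MeasurableSpace G] [BorelSpace G]
  [FiniteDimensional ℝ X] [Nontrivial X] [MeasurableSpace X] [BorelSpace X] [SphRep G X] {r : ℕ} {E : (X ≃ₗᵢ[ℝ] X) → ℂ → Prop}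
  {T : (Fin r → CS X) → CS X →ₗ[ℝ] ℂ}
  (hT : Frame E T) (hE : ∀ g : G, E (rho X g) 1)

omit [FiniteDimensional ℝ X] [Nontrivial X] [MeasurableSpace X] [BorelSpace X] in
theorem inner_rho_inv (g : G) (x y : X) : ⟪x, rho X g⁻¹ y⟫ = ⟪rho X g x, y⟫ := by
  rw [← (rho X g).inner_map_map x]
  congr 1
  rw [map_inv]
  exact (rho X g).apply_symm_apply y

omit [FiniteDimensional ℝ X] [Nontrivial X] [MeasurableSpace X] [BorelSpace X] in
theorem prod_inner_mem_PolyFn (s : Finset (Fin r × Bool)) (q : Fin r × Bool → X) :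
    (fun v : Fin r → X => ∏ k ∈ s, ⟪q k, v k.1⟫) ∈ PolyFn r X :=
  prod_mem_PolyFn s fun k _ => inner_mem_PolyFn (q k) k.1

omit [FiniteDimensional ℝ X] [Nontrivial X] [MeasurableSpace X] [BorelSpace X] in
theorem prod_inner_update [DecidableEq (Fin r × Bool)] (q : Fin r × Bool → X) (k : Fin r × Bool) (x : X)
    (v : Fin r → X) : ∏ l, ⟪Function.update q k x l, v l.1⟫ =
      ⟪x, v k.1⟫ * ∏ l ∈ Finset.univ.erase k, ⟪q l, v l.1⟫ := by
  rw [← Finset.mul_prod_erase _ _ (Finset.mem_univ k), Function.update_self]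
  congr 1
  refine Finset.prod_congr rfl fun l hl => ?_
  rw [Function.update_of_ne (Finset.ne_of_mem_erase hl)]

include hT hE

/-- The leading coefficients at `e` of the moments of a frame, as a multilinear map. -/
def Frame.form (e : Sph X) : MultilinearMap ℝ (fun _ : Fin r × Bool => X) ℂ where
  toFun q := Gam G e T fun v => ∏ k, ⟪q k, v k.1⟫
  map_update_add' q k x y := by
    simp only [prod_inner_update, inner_add_left, add_mul]
    exact hT.Gam_add hE (mul_mem (inner_mem_PolyFn _ _) (prod_inner_mem_PolyFn _ q))
      (mul_mem (inner_mem_PolyFn _ _) (prod_inner_mem_PolyFn _ q)) e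
  map_update_smul' q k c x := by
    simp only [prod_inner_update, real_inner_smul_left, mul_assoc]
    refine (hT.Gam_smul hE (mul_mem (inner_mem_PolyFn x k.1)
      (prod_inner_mem_PolyFn (Finset.univ.erase k) q)) c e).trans ?_
    rw [Complex.real_smul]; rfl

theorem Frame.form_apply (e : Sph X) (q : Fin r × Bool → X) :
    hT.form hE e q = Gam G e T fun v => ∏ k, ⟪q k, v k.1⟫ := rfl

theorem Frame.form_dg (e : Sph X) (q : Fin r → X) :
    hT.form hE e (dg q) = Gam G e T fun v => ∏ i, ⟪q i, v i⟫ ^ 2 := by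
  rw [hT.form_apply hE]
  congr 1; ext v
  simp only [dg, Fintype.prod_prod_type, Fintype.prod_bool, pow_two]

theorem Frame.qform_form (e : Sph X) : QForm G E e (hT.form hE e) where
  prj_comp q := by
    rw [hT.form_apply hE, hT.form_apply hE, hT.Gam_prj hE (prod_inner_mem_PolyFn Finset.univ q)]
    simp only [inner_prj_prj]
  swap i q := by
    rw [hT.form_apply hE, hT.form_apply hE]
    congr 1; ext v
    simp only [Fintype.prod_prod_type, Fintype.prod_bool]
    refine Finset.prod_congr rfl fun j _ => ?_
    by_cases h : j = i <;> simp [h, mul_comm]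
  equiv A c hA hc q := by
    rw [hT.form_apply hE, hT.form_apply hE,
      hT.Gam_equiv hE (prod_inner_mem_PolyFn Finset.univ _) hA hc]
    simp only [LinearIsometryEquiv.inner_map_map]
  shear i j hij c q := by
    have hprj : ∀ q : Fin r → X, hT.form hE e (dg q) =
        hT.form hE e (dg fun i => prj e (q i)) := fun q => by
      rw [hT.form_apply hE, hT.form_apply hE, hT.Gam_prj hE (prod_inner_mem_PolyFn Finset.univ _)]
      simp only [dg, inner_prj_prj]
    rw [hprj, hprj q]
    have h1 : (fun k => prj e (Function.update q j (q j + c • q i) k)) =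
        Function.update (fun k => prj e (q k)) j (prj e (q j) + c • prj e (q i)) := by
      ext1 k
      rcases eq_or_ne k j with rfl | hk
      · simp
      · simp [hk]
    rw [h1]
    set w := fun k => prj e (q k) with hw
    have hw0 : ∀ k, ⟪(e : X), w k⟫ = 0 := fun k => inner_prj e _
    have hw1 : ∀ k, ⟪(e : X), Function.update w j (w j + c • w i) k⟫ = 0 := fun k => by
      rcases eq_or_ne k j with rfl | hk
      · simp [inner_add_right, inner_smul_right, hw0]
      · simp [hk, hw0]
    have h2 := hT.tendsto_slice_div hE e hw0
    have h3 := hT.tendsto_slice_div hE e hw1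
    have h4 := tendsto_nhds_unique h2 (h3.congr fun k => by
      rw [hT.slice_shear e (capS_pos G e k).le (capS_le_one G e k) hij])
    rw [hT.form_dg hE, hT.form_dg hE]
    have hg := gM_pos (X := X)
    refine (mul_left_cancel₀ (Complex.ofReal_ne_zero.2 ?_)
      (mul_left_cancel₀ (Complex.ofReal_ne_zero.2 ?_) h4)).symm
    · positivity
    · positivity
  trace b i q := by
    have hmem : ∀ k, (fun v : Fin r → X => ∏ j, ⟪Function.update q i (b k) j, v j⟫ ^ 2) ∈ PolyFn r X :=
      fun k => prod_mem_PolyFn Finset.univ fun j _ => pow_inner_mem_PolyFn _ _ _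
    simp only [hT.form_dg hE]
    rw [← hT.Gam_sum hE _ fun k _ => hmem k]
    refine hT.Gam_radial hE (sum_mem_PolyFn _ fun k _ => hmem k) i (fun v A => ?_) e
    have h1 : ∀ v : Fin r → X, ∑ k, ∏ j, ⟪Function.update q i (b k) j, v j⟫ ^ 2 =
        ‖v i‖ ^ 2 * ∏ j ∈ Finset.univ.erase i, ⟪q j, v j⟫ ^ 2 := fun v => by
      rw [← b.sum_sq_inner_right, Finset.sum_mul]
      refine Finset.sum_congr rfl fun k _ => ?_
      rw [← Finset.mul_prod_erase _ _ (Finset.mem_univ i), Function.update_self]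
      congr 1
      refine Finset.prod_congr rfl fun l hl => ?_
      rw [Function.update_of_ne (Finset.ne_of_mem_erase hl)]
    rw [h1, h1, Function.update_self, A.norm_map]
    congr 1
    refine Finset.prod_congr rfl fun l hl => ?_
    rw [Function.update_of_ne (Finset.ne_of_mem_erase hl)]
  cont q := by
    have h := (hT.Phi_eq_integral hE (prod_inner_mem_PolyFn Finset.univ q) e
      (zero_mem (HH X))).1
    refine h.congr fun g => ?_
    rw [hT.form_apply hE]
    congr 1; ext v
    refine Finset.prod_congr rfl fun k _ => ?_
    exact inner_rho_inv g _ _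
  integral a q := by
    have h := (hT.Phi_eq_integral hE (prod_inner_mem_PolyFn Finset.univ q) e
      (lin_mem_HH a)).2
    have h0 : Phi T (fun v : Fin r → X => ∏ k, ⟪q k, v k.1⟫) (SUVal.lin a) = 0 := by
      rw [Phi]
      simp only [hT.lin _ (fun k => seg_mem_ZC _) a, mul_zero, integral_zero]
    rw [h0] at h
    rw [h]
    congr 1; ext g
    rw [hT.form_apply hE, lin_apply]
    congr 2; ext v
    refine Finset.prod_congr rfl fun k _ => ?_
    exact (inner_rho_inv g _ _).symm

theorem Frame.Phi_eq_zero_of_qform (e : Sph X)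
    (h0 : ∀ F : MultilinearMap ℝ (fun _ : Fin r × Bool => X) ℂ, QForm G E e F →
      ∀ q : Fin r → X, F (dg q) = 0)
    {p : (Fin r → X) → ℝ} (hp : p ∈ PolyFn r X) {f : CS X} (hf : f ∈ HH X) : Phi T p f = 0 := by
  have h1 : ∀ p ∈ PolyFn r X, Gam G e T p = 0 := fun p hp => hT.Gam_eq_zero hE e
    (fun q _ => (hT.form_dg hE e q).symm.trans (h0 _ (hT.qform_form hE e) q)) hp
  rw [(hT.Phi_eq_integral hE hp e hf).2]
  have h2 : ∀ g : G, Gam G e T (fun v => p fun i => rho X g⁻¹ (v i)) = 0 := fun g =>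
    h1 _ (PolyFn_comp (rho X g⁻¹).toLinearEquiv.toLinearMap hp)
  simp only [h2, mul_zero, integral_zero]

end Form

section Fourier
variable {V : Type*} [NormedAddCommGroup V] [NormedSpace ℝ V] [FiniteDimensional ℝ V]
  [MeasureSpace V] [BorelSpace V] [(volume : Measure V).IsAddHaarMeasure]

theorem eq_zero_of_integral_cexp_eq_zero {f : V → ℝ} (hf : Continuous f) (hi : Integrable f)
    (h : ∀ L : StrongDual ℝ V, ∫ v, Complex.exp (L v * Complex.I) * f v = 0) : f = 0 := by
  have hfin : ∀ f : V → ℝ, Integrable f →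
      IsFiniteMeasure ((volume : Measure V).withDensity fun v => ENNReal.ofReal (f v)) :=
    fun f hi => isFiniteMeasure_withDensity_ofReal hi.2
  have := hfin f hi
  have := hfin (-f) hi.neg
  have hchar : ∀ f : V → ℝ, Continuous f → ∀ L : StrongDual ℝ V,
      charFunDual ((volume : Measure V).withDensity fun v => ENNReal.ofReal (f v)) L =
        ∫ v, Complex.exp (L v * Complex.I) * (max (f v) 0 : ℝ) := fun f hf L => by
    rw [charFunDual_apply, integral_withDensity_eq_integral_toReal_smul (by fun_prop)
      (Eventually.of_forall fun _ => ENNReal.ofReal_lt_top)]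
    congr 1; ext v
    rw [ENNReal.toReal_ofReal', Complex.real_smul, mul_comm]
  have hint : ∀ f : V → ℝ, Continuous f → Integrable f → ∀ L : StrongDual ℝ V,
      Integrable fun v => Complex.exp (L v * Complex.I) * (max (f v) 0 : ℝ) := fun f hf hi L => by
    refine hi.norm.mono' (by fun_prop) (Eventually.of_forall fun v => ?_)
    rw [norm_mul, Complex.norm_exp_ofReal_mul_I, one_mul, Complex.norm_real, Real.norm_eq_abs,
      Real.norm_eq_abs, abs_of_nonneg (le_max_right _ _)]
    exact max_le (le_abs_self _) (abs_nonneg _)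
  have heq : (volume : Measure V).withDensity (fun v => ENNReal.ofReal (f v)) =
      (volume : Measure V).withDensity fun v => ENNReal.ofReal ((-f) v) := by
    refine Measure.ext_of_charFunDual (funext fun L => ?_)
    rw [hchar f hf, hchar (-f) hf.neg, ← sub_eq_zero,
      ← integral_sub (hint f hf hi L) (hint (-f) hf.neg hi.neg L), ← h L]
    congr 1; ext v
    rw [← mul_sub, ← Complex.ofReal_sub]
    congr 2
    rcases le_total (f v) 0 with h | h
    · simp [h]
    · simp [h]
  rw [withDensity_eq_iff (by fun_prop) (by fun_prop)
    (lt_top_iff_ne_top.1 (by simpa using measure_lt_top ((volume : Measure V).withDensity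
      fun v => ENNReal.ofReal (f v)) Set.univ))] at heq
  have h0 := (Continuous.ae_eq_iff_eq volume (ENNReal.continuous_ofReal.comp hf)
    (ENNReal.continuous_ofReal.comp hf.neg)).1 heq
  funext v
  have h1 : ENNReal.ofReal (f v) = ENNReal.ofReal (-f v) := congrFun h0 v
  have h2 := congrArg ENNReal.toReal h1
  rw [ENNReal.toReal_ofReal', ENNReal.toReal_ofReal'] at h2
  rcases le_total (f v) 0 with h | h
  · rw [max_eq_right h, max_eq_left (by linarith)] at h2
    simp; linarith
  · rw [max_eq_left h, max_eq_right (by linarith)] at h2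
    simp; linarith

end Fourier

section Moments
variable {X : Type*} [NormedAddCommGroup X] [InnerProductSpace ℝ X] [FiniteDimensional ℝ X]
  [MeasurableSpace X] [BorelSpace X] {r : ℕ}

theorem exp_mul_gw_le (a : ℝ) (v : Fin r → X) : Real.exp (a * ‖v‖) * gw v ≤
    Real.exp (a ^ 2 / 2) * Real.exp (-((1 / 2) * ∑ i, ‖v i‖ ^ 2)) := by
  rw [gw, ← Real.exp_add, ← Real.exp_add]
  have := norm_sq_le_sum v
  refine Real.exp_le_exp.2 ?_
  nlinarith [sq_nonneg (a - ‖v‖)]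

theorem PolyBdd.integrable_exp_mul_gw {u : (Fin r → X) → ℂ} (hu : PolyBdd u) (hc : Continuous u)
    (a : ℝ) : Integrable fun v => Real.exp (a * ‖v‖) * (gw v * ‖u v‖) := by
  obtain ⟨C, k, hC, h⟩ := hu
  refine Integrable.mono' (g := fun v => C * (Real.exp ((a + k) ^ 2 / 2) *
    Real.exp (-((1 / 2) * ∑ i, ‖v i‖ ^ 2)))) ((integrable_gw_half.const_mul _).const_mul _)
    (by fun_prop) (Eventually.of_forall fun v => ?_)
  have h1 : (1 + ‖v‖) ^ k ≤ Real.exp (k * ‖v‖) := by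
    rw [Real.exp_nat_mul]
    have := Real.add_one_le_exp ‖v‖
    gcongr
    linarith
  have hg := (gw_pos v).le
  rw [Real.norm_of_nonneg (by positivity)]
  calc Real.exp (a * ‖v‖) * (gw v * ‖u v‖)
      ≤ Real.exp (a * ‖v‖) * (gw v * (C * Real.exp (k * ‖v‖))) := by
        gcongr
        exact (h v).trans (by gcongr)
    _ = C * (Real.exp ((a + k) * ‖v‖) * gw v) := by
        rw [add_mul, Real.exp_add]; ring
    _ ≤ _ := by
        exact mul_le_mul_of_nonneg_left (exp_mul_gw_le _ v) hC

omit [MeasurableSpace X] [BorelSpace X] in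
theorem dual_mem_PolyFn (L : StrongDual ℝ (Fin r → X)) : (fun v => L v) ∈ PolyFn r X := by
  have h : (fun v => L v) = fun v : Fin r → X => ∑ i,
      ⟪(InnerProductSpace.toDual ℝ X).symm (L.comp (ContinuousLinearMap.single ℝ (fun _ => X) i)),
        v i⟫ := by
    ext v
    simp only [InnerProductSpace.toDual_symm_apply]
    exact (ContinuousLinearMap.sum_comp_single ℝ (fun _ => X) L v).symm
  rw [h]
  exact sum_mem_PolyFn _ fun i _ => inner_mem_PolyFn _ i

theorem eq_zero_of_moments {u : (Fin r → X) → ℂ} (hu : PolyBdd u) (hc : Continuous u)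
    (h : ∀ p ∈ PolyFn r X, ∫ v, (gw v : ℂ) * (p v * u v) = 0) : u = 0 := by
  have hfour : ∀ L : StrongDual ℝ (Fin r → X),
      ∫ v, Complex.exp (L v * Complex.I) * (gw v * u v) = 0 := fun L => by
    have hs := hasSum_integral_of_dominated_convergence (μ := volume)
      (F := fun (k : ℕ) (v : Fin r → X) => (L v * Complex.I) ^ k / k.factorial * (gw v * u v))
      (f := fun v => Complex.exp (L v * Complex.I) * (gw v * u v))
      (fun k v => (‖L‖ * ‖v‖) ^ k / k.factorial * (gw v * ‖u v‖))
      (fun k => by fun_prop) (fun k => Eventually.of_forall fun v => ?_)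
      (Eventually.of_forall fun v => (Real.summable_pow_div_factorial _).mul_right _) ?_
      (Eventually.of_forall fun v => ?_)
    · refine hs.unique ?_
      have h0 : ∀ k : ℕ, ∫ v : Fin r → X, (L v * Complex.I) ^ k / k.factorial * (gw v * u v) = 0 :=
        fun k => by
        have h1 := h _ (pow_mem (dual_mem_PolyFn L) k)
        have h2 : ∀ v : Fin r → X, (L v * Complex.I) ^ k / k.factorial * (gw v * u v) =
            Complex.I ^ k / k.factorial * ((gw v : ℂ) * ((((fun v => L v) ^ k : (Fin r → X) → ℝ) v : ℝ) * u v)) :=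
          fun v => by simp only [Pi.pow_apply, Complex.ofReal_pow]; ring
        simp only [h2]
        rw [integral_const_mul, h1, mul_zero]
      simp only [h0]
      exact hasSum_zero
    · have hg := (gw_pos v).le
      rw [norm_mul, norm_mul, norm_div, norm_pow, norm_mul, Complex.norm_I, mul_one,
        Complex.norm_real, Complex.norm_real, Real.norm_of_nonneg hg, Complex.norm_natCast]
      gcongr
      exact L.le_opNorm v
    · have h1 : ∀ v : Fin r → X, ∑' k : ℕ, (‖L‖ * ‖v‖) ^ k / k.factorial * (gw v * ‖u v‖) =
          Real.exp (‖L‖ * ‖v‖) * (gw v * ‖u v‖) := fun v => by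
        rw [tsum_mul_right, Real.exp_eq_exp_ℝ, NormedSpace.exp_eq_tsum_div]
      simp only [h1]
      exact hu.integrable_exp_mul_gw hc _
    · refine HasSum.mul_right _ ?_
      rw [Complex.exp_eq_exp_ℂ]
      exact NormedSpace.expSeries_div_hasSum_exp _
  have hi := hu.integrable_gw_mul hc
  have hre : (fun v => gw v * (u v).re) = 0 ∧ (fun v => gw v * (u v).im) = 0 := by
    have hi1 : Integrable fun v => gw v * (u v).re := by simpa using hi.re
    have hi2 : Integrable fun v => gw v * (u v).im := by simpa using hi.im
    have hmul : ∀ (L : StrongDual ℝ (Fin r → X)) {f : (Fin r → X) → ℝ}, Continuous f → Integrable f →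
        Integrable fun v => Complex.exp (L v * Complex.I) * f v := fun L f hf hi => by
      refine hi.norm.mono' (by fun_prop) (Eventually.of_forall fun v => ?_)
      rw [norm_mul, Complex.norm_exp_ofReal_mul_I, one_mul, Complex.norm_real]
    have hsum : ∀ L : StrongDual ℝ (Fin r → X),
        (∫ v, Complex.exp (L v * Complex.I) * (gw v * (u v).re : ℝ)) +
          Complex.I * ∫ v, Complex.exp (L v * Complex.I) * (gw v * (u v).im : ℝ) = 0 := fun L => by
      rw [← integral_const_mul, ← integral_add (hmul L (by fun_prop) hi1)
        ((hmul L (by fun_prop) hi2).const_mul _), ← hfour L]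
      congr 1; ext v
      conv_rhs => rw [← Complex.re_add_im (u v)]
      push_cast; ring
    have hconj : ∀ (L : StrongDual ℝ (Fin r → X)) (f : (Fin r → X) → ℝ),
        ∫ v, Complex.exp ((-L) v * Complex.I) * f v =
          (starRingEnd ℂ) (∫ v, Complex.exp (L v * Complex.I) * f v) := fun L f => by
      rw [← integral_conj]
      congr 1; ext v
      rw [map_mul, ← Complex.exp_conj]
      simp
    have key : ∀ L : StrongDual ℝ (Fin r → X),
        (∫ v, Complex.exp (L v * Complex.I) * (gw v * (u v).re : ℝ)) = 0 ∧
          ∫ v, Complex.exp (L v * Complex.I) * (gw v * (u v).im : ℝ) = 0 := fun L => by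
      have h1 := hsum L
      have h2 := congrArg (starRingEnd ℂ) (hsum (-L))
      rw [hconj, hconj, map_add, map_mul, Complex.conj_conj, Complex.conj_conj, Complex.conj_I,
        map_zero] at h2
      constructor
      · linear_combination (h1 + h2) / 2
      · linear_combination (-Complex.I / 2) * (h1 - h2) + (∫ v, Complex.exp (L v * Complex.I) * (gw v * (u v).im : ℝ)) * Complex.I_sq
    exact ⟨eq_zero_of_integral_cexp_eq_zero (by fun_prop) hi1 fun L => (key L).1,
      eq_zero_of_integral_cexp_eq_zero (by fun_prop) hi2 fun L => (key L).2⟩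
  funext v
  have h1 := congrFun hre.1 v
  have h2 := congrFun hre.2 v
  simp only [Pi.zero_apply, mul_eq_zero, (gw_pos v).ne', false_or] at h1 h2
  exact Complex.ext h1 h2

theorem Frame.eq_zero_of_Phi {E : (X ≃ₗᵢ[ℝ] X) → ℂ → Prop} {T : (Fin r → CS X) → CS X →ₗ[ℝ] ℂ}
    (hT : Frame E T) {f : CS X} (hf : f ∈ HH X) (h : ∀ p ∈ PolyFn r X, Phi T p f = 0)
    (v : Fin r → X) : T (fun k => seg (v k)) f = 0 :=
  congrFun (eq_zero_of_moments (hT.polyBdd hf) (hT.continuous_left hf) h) v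

end Moments

section Multi
variable {X : Type*} [NormedAddCommGroup X] [InnerProductSpace ℝ X] {r : ℕ}
  {F : MultilinearMap ℝ (fun _ : Fin r × Bool => X) ℂ}

/-- A multilinear map which is symmetric in pairs of slots is determined on the diagonal. -/
theorem eq_zero_of_dg (hs : ∀ (i : Fin r) (q : Fin r × Bool → X),
    F (fun s => if s.1 = i then q (s.1, !s.2) else q s) = F q) (h : ∀ q, F (dg q) = 0)
    (q : Fin r × Bool → X) : F q = 0 := by
  have key : ∀ S : Finset (Fin r), ∀ q : Fin r × Bool → X,
      (∀ i ∉ S, q (i, true) = q (i, false)) → F q = 0 := fun S => by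
    induction S using Finset.induction_on with
    | empty =>
      intro q hq
      have h1 : q = dg fun i => q (i, true) := by
        ext ⟨i, b⟩
        cases b
        · exact (hq i (Finset.notMem_empty i)).symm
        · rfl
      rw [h1]; exact h _
    | insert i S hi ih =>
      intro q hq
      set U : X → X → Fin r × Bool → X := fun x y =>
        Function.update (Function.update q (i, true) x) (i, false) y with hU
      have hU0 : ∀ x, F (U x x) = 0 := fun x => by
        refine ih _ fun j hj => ?_
        by_cases hji : j = i
        · subst hji; simp [hU]
        · simp only [hU]
          rw [Function.update_of_ne (by simp [hji]), Function.update_of_ne (by simp [hji]),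
            Function.update_of_ne (by simp [hji]), Function.update_of_ne (by simp [hji])]
          exact hq j (by simp [hj, hji])
      have hadd1 : ∀ x x' y, F (U (x + x') y) = F (U x y) + F (U x' y) := fun x x' y => by
        have hU' : ∀ x, U x y = Function.update (Function.update q (i, false) y) (i, true) x :=
          fun x => Function.update_comm (by simp) _ _ _
        rw [hU', hU', hU', F.map_update_add]
      have hadd2 : ∀ x y y', F (U x (y + y')) = F (U x y) + F (U x y') := fun x y y' =>
        F.map_update_add _ _ _ _
      have hsw : ∀ x y, F (U y x) = F (U x y) := fun x y => by
        rw [← hs i (U x y)]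
        congr 1
        ext ⟨j, b⟩
        by_cases hji : j = i
        · subst hji; cases b <;> simp [hU]
        · simp [hU, hji]
      have hq0 : q = U (q (i, true)) (q (i, false)) := by simp [hU]
      have h1 := hU0 (q (i, true) + q (i, false))
      rw [hadd1, hadd2, hadd2, hU0, hU0,
        hsw (q (i, true)) (q (i, false)), zero_add, add_zero, ← two_mul] at h1
      rw [hq0]
      exact (mul_eq_zero.1 h1).resolve_left two_ne_zero
  exact key Finset.univ q fun i hi => absurd (Finset.mem_univ i) hi

theorem map_dg_smul (c : Fin r → ℝ) (q : Fin r → X) :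
    F (dg fun i => c i • q i) = ((∏ i, c i ^ 2 : ℝ) : ℂ) * F (dg q) := by
  have h := F.map_smul_univ (fun s => c s.1) (dg q)
  rw [Complex.real_smul, Fintype.prod_prod_type] at h
  simp only [Fintype.prod_bool, ← pow_two] at h
  exact h

theorem map_dg_matrix (hsh : ∀ i j : Fin r, i ≠ j → ∀ (c : ℝ) (q : Fin r → X),
    F (dg (Function.update q j (q j + c • q i))) = F (dg q)) (A : Matrix (Fin r) (Fin r) ℝ)
    (q : Fin r → X) : F (dg fun i => ∑ j, A i j • q j) = ((A.det ^ 2 : ℝ) : ℂ) * F (dg q) := by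
  revert q
  refine Matrix.diagonal_transvection_induction (fun A => ∀ q : Fin r → X,
    F (dg fun i => ∑ j, A i j • q j) = ((A.det ^ 2 : ℝ) : ℂ) * F (dg q)) A ?_ ?_ ?_
  · intro D _ q
    simp only [Matrix.diagonal_apply, ite_smul, zero_smul, Finset.sum_ite_eq, Finset.mem_univ,
      if_true, Matrix.det_diagonal]
    rw [map_dg_smul, Finset.prod_pow]
  · intro t q
    have h1 : (fun i => ∑ j, t.toMatrix i j • q j) =
        Function.update q t.i (q t.i + t.c • q t.j) := by
      ext1 i
      simp only [Matrix.TransvectionStruct.toMatrix, Matrix.transvection, Matrix.add_apply,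
        add_smul, Finset.sum_add_distrib, Matrix.one_apply, ite_smul, one_smul, zero_smul,
        Finset.sum_ite_eq, Finset.mem_univ, if_true, Matrix.single_apply]
      rcases eq_or_ne i t.i with rfl | hi
      · simp
      · simp [hi, hi.symm]
    rw [h1, hsh _ _ t.hij.symm, Matrix.TransvectionStruct.det]
    simp
  · intro A B hA hB q
    have h1 : (fun i => ∑ j, (A * B) i j • q j) = fun i => ∑ k, A i k • ∑ j, B k j • q j := by
      ext1 i
      simp only [Matrix.mul_apply, Finset.sum_smul, Finset.smul_sum, mul_smul]
      rw [Finset.sum_comm]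
    rw [h1, hA, hB, Matrix.det_mul]
    push_cast; ring

theorem map_dg_eq_zero_of_eq (hsh : ∀ i j : Fin r, i ≠ j → ∀ (c : ℝ) (q : Fin r → X),
    F (dg (Function.update q j (q j + c • q i))) = F (dg q)) {q : Fin r → X} {i j : Fin r}
    (hij : i ≠ j) (h : q i = q j) : F (dg q) = 0 := by
  rw [← hsh i j hij (-1)]
  exact F.map_coord_zero (j, true) (by simp [dg, h])

theorem map_dg_eq_zero_of_dependent (hsh : ∀ i j : Fin r, i ≠ j → ∀ (c : ℝ) (q : Fin r → X),
    F (dg (Function.update q j (q j + c • q i))) = F (dg q)) {q : Fin r → X}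
    (h : ¬ LinearIndependent ℝ q) : F (dg q) = 0 := by
  rw [Fintype.not_linearIndependent_iff] at h
  obtain ⟨c, hc, i, hi⟩ := h
  set A : Matrix (Fin r) (Fin r) ℝ := 1 - Matrix.of fun k l => if k = i then c l / c i else 0 with hA
  have h1 : (fun k => ∑ j, A k j • q j) = q := by
    ext1 k
    simp only [hA, Matrix.sub_apply, sub_smul, Finset.sum_sub_distrib, Matrix.one_apply, ite_smul,
      one_smul, zero_smul, Finset.sum_ite_eq, Finset.mem_univ, if_true, Matrix.of_apply]
    by_cases hk : k = i
    · simp only [hk, if_true, div_eq_inv_mul, mul_smul]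
      rw [← Finset.smul_sum, hc, smul_zero, sub_zero]
    · simp [hk]
  rw [← h1, map_dg_matrix hsh, Matrix.det_eq_zero_of_column_eq_zero i]
  · simp
  · intro k
    by_cases hk : k = i
    · simp [hA, hk, hi]
    · simp [hA, hk, Matrix.one_apply]

end Multi

section Trace
variable {X : Type*} [NormedAddCommGroup X] [InnerProductSpace ℝ X]
variable {G : Type*} [Group G] [TopologicalSpace G] [IsTopologicalGroup G] [CompactSpace G]
  [SecondCountableTopology G] [MeasurableSpace G] [BorelSpace G]
  [FiniteDimensional ℝ X] [SphRep G X] {r : ℕ} {E : (X ≃ₗᵢ[ℝ] X) → ℂ → Prop} {e : Sph X}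
  {F : MultilinearMap ℝ (fun _ : Fin r × Bool => X) ℂ}

theorem QForm.map_dg_eq_zero (hF : QForm G E e F) {q : Fin r → X} {i : Fin r}
    (h : q i = (e : X)) : F (dg q) = 0 := by
  rw [← hF.prj_comp]
  refine F.map_coord_zero (i, true) ?_
  have : dg q (i, true) = e := h
  rw [this, prj_apply, inner_self_sph, one_smul, sub_self]

omit [FiniteDimensional ℝ X] [SphRep G X] in
theorem sum_pi_eq_zero {ι κ : Type*} [Fintype ι] [DecidableEq ι] [Fintype κ] (i : ι)
    (f : (ι → κ) → ℂ) (h : ∀ k, ∑ x, f (Function.update k i x) = 0) : ∑ k, f k = 0 := by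
  rcases isEmpty_or_nonempty κ with hκ | ⟨⟨x0⟩⟩
  · exact Finset.sum_eq_zero fun k _ => (hκ.false (k i)).elim
  rw [← (Equiv.funSplitAt i κ).symm.sum_comp, Fintype.sum_prod_type_right]
  refine Finset.sum_eq_zero fun k _ => ?_
  rw [← h ((Equiv.funSplitAt i κ).symm (x0, k))]
  refine Finset.sum_congr rfl fun x _ => congrArg f ?_
  ext1 j
  by_cases hj : j = i
  · subst hj; simp [Equiv.funSplitAt]
  · simp [Equiv.funSplitAt, hj]

theorem QForm.sum_weight (hF : QForm G E e F) {κ : Type} [Fintype κ] (b : OrthonormalBasis κ ℝ X)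
    (χ : κ → ℂ) : ∑ k : Fin r → κ, (∏ i, χ (k i)) * F (dg fun i => b (k i)) =
      ∑ k : Fin r → κ, (∏ i, (χ (k i) - 1)) * F (dg fun i => b (k i)) := by
  classical
  have key : ∀ S : Finset (Fin r), ∑ k : Fin r → κ, (∏ i, χ (k i)) * F (dg fun i => b (k i)) =
      ∑ k : Fin r → κ, (∏ i, (χ (k i) - if i ∈ S then 1 else 0)) * F (dg fun i => b (k i)) :=
    fun S => by
    induction S using Finset.induction_on with
    | empty => simp
    | insert i S hi ih =>
      rw [ih, ← sub_eq_zero, ← Finset.sum_sub_distrib]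
      refine sum_pi_eq_zero i _ fun k => ?_
      have h1 : ∀ x, (∏ j, (χ (Function.update k i x j) - if j ∈ S then 1 else 0)) *
          F (dg fun j => b (Function.update k i x j)) -
          (∏ j, (χ (Function.update k i x j) - if j ∈ insert i S then 1 else 0)) *
          F (dg fun j => b (Function.update k i x j)) =
          (∏ j ∈ Finset.univ.erase i, (χ (k j) - if j ∈ S then 1 else 0)) *
          F (dg (Function.update (fun j => b (k j)) i (b x))) := fun x => by
        rw [← sub_mul]
        congr 1
        · rw [← Finset.mul_prod_erase _ _ (Finset.mem_univ i),
            ← Finset.mul_prod_erase Finset.univ (fun j => χ (Function.update k i x j) -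
              if j ∈ insert i S then 1 else 0) (Finset.mem_univ i)]
          have h2 : ∀ j ∈ Finset.univ.erase i, (χ (Function.update k i x j) -
              if j ∈ insert i S then 1 else 0) = χ (k j) - if j ∈ S then 1 else 0 := fun j hj => by
            have := Finset.ne_of_mem_erase hj
            simp [this]
          have h3 : ∀ j ∈ Finset.univ.erase i, (χ (Function.update k i x j) -
              if j ∈ S then 1 else 0) = χ (k j) - if j ∈ S then 1 else 0 := fun j hj => by
            have := Finset.ne_of_mem_erase hj
            simp [this]
          rw [Finset.prod_congr rfl h2, Finset.prod_congr rfl h3]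
          simp [hi]
          ring
        · congr 2
          ext1 j
          rcases eq_or_ne j i with rfl | hj
          · simp
          · simp [hj]
      rw [Finset.sum_congr rfl fun x _ => h1 x, ← Finset.mul_sum, hF.trace b i, mul_zero]
  rw [key Finset.univ]
  simp

theorem QForm.eq_zero_of_orthonormal (hF : QForm G E e F) (hd : Module.finrank ℝ X ≤ 2 * r)
    {p : Fin r → X} (hp : Orthonormal ℝ fun o : Option (Fin r) => o.elim (e : X) p) :
    F (dg p) = 0 := by
  have hcard := hp.linearIndependent.fintype_card_le_finrank
  rw [Fintype.card_option, Fintype.card_fin] at hcard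
  set m := Module.finrank ℝ X - (r + 1) with hm
  obtain ⟨b, hb⟩ := Orthonormal.exists_orthonormalBasis_extension_of_card_eq
    (ι := Option (Fin r) ⊕ Fin m) (𝕜 := ℝ) (E := X) (by simp; omega)
    (v := Sum.elim (fun o : Option (Fin r) => o.elim (e : X) p) 0) (s := Set.range Sum.inl) (by
      constructor
      · rintro ⟨_, o, rfl⟩; exact hp.1 o
      · rintro ⟨_, i, rfl⟩ ⟨_, j, rfl⟩ hij
        exact hp.2 fun h => hij (by subst h; rfl))
  have hb1 : ∀ i, b (Sum.inl (some i)) = p i := fun i => hb _ ⟨some i, rfl⟩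
  have hb0 : b (Sum.inl none) = e := hb _ ⟨none, rfl⟩
  set χ : Option (Fin r) ⊕ Fin m → ℂ := Sum.elim (fun o => o.elim 0 fun _ => 1) 0 with hχ
  have h1 := hF.sum_weight b χ
  have h2 : ∑ k : Fin r → Option (Fin r) ⊕ Fin m,
      (∏ i, (χ (k i) - 1)) * F (dg fun i => b (k i)) = 0 := by
    refine Finset.sum_eq_zero fun k _ => ?_
    by_cases h3 : ∃ i o, k i = Sum.inl o
    · obtain ⟨i, o, h4⟩ := h3
      cases o with
      | none => rw [hF.map_dg_eq_zero (i := i) (by rw [h4, hb0]), mul_zero]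
      | some o => rw [Finset.prod_eq_zero (Finset.mem_univ i) (by simp [h4, hχ]), zero_mul]
    · have h4 : ∀ i, ∃ t, k i = Sum.inr t := fun i => by
        cases h5 : k i with
        | inl o => exact (h3 ⟨i, o, h5⟩).elim
        | inr t => exact ⟨t, rfl⟩
      choose t ht using h4
      obtain ⟨i, j, hij, h6⟩ := Fintype.exists_ne_map_eq_of_card_lt t (by simp; omega)
      rw [map_dg_eq_zero_of_eq hF.shear hij (by rw [ht, ht, h6]), mul_zero]
  rw [h2] at h1
  have h3 : ∑ k : Fin r → Option (Fin r) ⊕ Fin m,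
      (∏ i, χ (k i)) * F (dg fun i => b (k i)) =
      ∑ k : Fin r → Fin r, F (dg fun i => p (k i)) := by
    rw [← Finset.sum_filter_add_sum_filter_not Finset.univ (fun k => ∃ l : Fin r → Fin r, k = fun i =>
      Sum.inl (some (l i)))]
    rw [Finset.sum_eq_zero (s := Finset.univ.filter fun k => ¬ _), add_zero]
    · symm
      refine Finset.sum_bij (fun l _ i => Sum.inl (some (l i)))
        (fun l _ => Finset.mem_filter.2 ⟨Finset.mem_univ _, l, rfl⟩) (fun l _ l' _ h => ?_)
        (fun k hk => ?_) fun l _ => ?_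
      · ext1 i; simpa using congrFun h i
      · obtain ⟨l, hl⟩ := (Finset.mem_filter.1 hk).2
        exact ⟨l, Finset.mem_univ _, hl.symm⟩
      · simp [hχ, hb1]
    · intro k hk
      have hk' := (Finset.mem_filter.1 hk).2
      have : ∃ i, χ (k i) = 0 := by
        by_contra! hne
        refine hk' ?_
        have h4 : ∀ i, ∃ l, k i = Sum.inl (some l) := fun i => by
          have := hne i
          rcases h5 : k i with (_ | l) | t
          · simp [h5, hχ] at this
          · exact ⟨l, rfl⟩
          · simp [h5, hχ] at this
        choose l hl using h4
        exact ⟨l, funext hl⟩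
      obtain ⟨i, hi⟩ := this
      rw [Finset.prod_eq_zero (Finset.mem_univ i) hi, zero_mul]
  rw [h3] at h1
  have h4 : ∀ k : Fin r → Fin r, F (dg fun i => p (k i)) =
      (((Matrix.of fun i j => if k i = j then (1 : ℝ) else 0).det ^ 2 : ℝ) : ℂ) * F (dg p) := fun k => by
    rw [← map_dg_matrix hF.shear]
    congr 2; ext1 i
    simp
  rw [Finset.sum_congr rfl fun k _ => h4 k, ← Finset.sum_mul, ← Complex.ofReal_sum] at h1
  refine (mul_eq_zero.1 h1).resolve_left (Complex.ofReal_ne_zero.2 (ne_of_gt ?_))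
  refine Finset.sum_pos' (fun k _ => sq_nonneg _) ⟨id, Finset.mem_univ _, ?_⟩
  have : (Matrix.of fun i j : Fin r => if id i = j then (1 : ℝ) else 0) = 1 := by
    ext i j; simp [Matrix.one_apply]
  rw [this]; simp

theorem QForm.eq_zero_of_finrank_le (hF : QForm G E e F) (hd : Module.finrank ℝ X ≤ 2 * r)
    (q : Fin r → X) : F (dg q) = 0 := by
  rw [← hF.prj_comp]
  change F (dg fun i => prj e (q i)) = 0
  by_cases hli : LinearIndependent ℝ fun i => prj e (q i)
  · have hfr := finrank_span_eq_card hli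
    rw [Fintype.card_fin] at hfr
    set b := (stdOrthonormalBasis ℝ (Submodule.span ℝ (Set.range fun i => prj e (q i)))).reindex
      (finCongr hfr) with hb
    have h1 : ∀ i, prj e (q i) = ∑ j, ⟪(b j : X), prj e (q i)⟫ • (b j : X) := fun i => by
      have h2 := congrArg Subtype.val (b.sum_repr' ⟨prj e (q i), Submodule.subset_span ⟨i, rfl⟩⟩)
      exact h2.symm.trans (by simp)
    have h3 : ∀ v ∈ Submodule.span ℝ (Set.range fun i => prj e (q i)), ⟪(e : X), v⟫ = 0 := fun v hv => by
      induction hv using Submodule.span_induction with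
      | mem x hx => obtain ⟨i, rfl⟩ := hx; exact inner_prj e _
      | zero => exact inner_zero_right _
      | add x y _ _ hx hy => rw [inner_add_right, hx, hy, add_zero]
      | smul c x _ hx => rw [inner_smul_right, hx, mul_zero]
    have h4 : (fun i => prj e (q i)) = fun i => ∑ j, (Matrix.of fun i j => ⟪(b j : X), prj e (q i)⟫) i j • (b j : X) :=
      funext h1
    rw [h4, map_dg_matrix hF.shear, hF.eq_zero_of_orthonormal hd (p := fun j => (b j : X)), mul_zero]
    rw [orthonormal_iff_ite]
    rintro (_ | i) (_ | j)
    · simp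
    · simpa using h3 _ (b j).2
    · rw [real_inner_comm]; simpa using h3 _ (b i).2
    · have := orthonormal_iff_ite.1 b.orthonormal i j
      simpa using this
  · exact map_dg_eq_zero_of_dependent hF.shear hli

end Trace

section Complex
variable {n : ℕ}

theorem real_inner_eq_re (x y : Cn n) : ⟪x, y⟫ = (inner ℂ x y).re := by
  simp [PiLp.inner_apply, Complex.inner]

theorem complex_inner_self (x : Cn n) : inner ℂ x x = ((‖x‖ ^ 2 : ℝ) : ℂ) := by
  rw [inner_self_eq_norm_sq_to_K]; norm_cast

/-- A complex linear isometry, regarded as a real linear one. -/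
def cl (B : Cn n ≃ₗᵢ[ℂ] Cn n) : Cn n ≃ₗᵢ[ℝ] Cn n where
  toLinearEquiv := B.toLinearEquiv.restrictScalars ℝ
  norm_map' x := B.norm_map x

@[simp] theorem cl_apply (B : Cn n ≃ₗᵢ[ℂ] Cn n) (x : Cn n) : cl B x = B x := rfl

/-- The complex determinant of a complex linear isometry. -/
def cdet (B : Cn n ≃ₗᵢ[ℂ] Cn n) : ℂ := LinearMap.det (B.toLinearEquiv : Cn n →ₗ[ℂ] Cn n)

theorem cdet_trans (A B : Cn n ≃ₗᵢ[ℂ] Cn n) : cdet (A.trans B) = cdet A * cdet B := by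
  rw [mul_comm]
  exact LinearMap.det_comp (B.toLinearEquiv : Cn n →ₗ[ℂ] Cn n) (A.toLinearEquiv : Cn n →ₗ[ℂ] Cn n)

theorem cdet_mul_symm (A : Cn n ≃ₗᵢ[ℂ] Cn n) : cdet A * cdet A.symm = 1 := by
  rw [← cdet_trans, LinearIsometryEquiv.self_trans_symm]
  exact LinearMap.det_id

/-- A norm preserving complex linear endomorphism is an isometry. -/
def ofNorm (f : Cn n →ₗ[ℂ] Cn n) (h : ∀ x, ‖f x‖ = ‖x‖) : Cn n ≃ₗᵢ[ℂ] Cn n :=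
  LinearIsometry.toLinearIsometryEquiv ⟨f, h⟩ rfl

theorem ofNorm_apply (f : Cn n →ₗ[ℂ] Cn n) (h : ∀ x, ‖f x‖ = ‖x‖) (x : Cn n) :
    ofNorm f h x = f x := rfl

theorem cdet_ofNorm (f : Cn n →ₗ[ℂ] Cn n) (h : ∀ x, ‖f x‖ = ‖x‖) :
    cdet (ofNorm f h) = LinearMap.det f := by
  unfold cdet
  congr 1

theorem norm_add_smul_inner {w : Cn n} (hw : ‖w‖ = 1) {a : ℂ} (ha : ‖a‖ = 1) (x : Cn n) :
    ‖x + ((a - 1) * inner ℂ w x) • w‖ = ‖x‖ := by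
  have h1 : ‖x + ((a - 1) * inner ℂ w x) • w‖ ^ 2 = ‖x‖ ^ 2 := by
    rw [norm_add_sq (𝕜 := ℂ), norm_smul, hw, mul_one, inner_smul_right, norm_mul, mul_pow,
      ← inner_conj_symm x w, mul_assoc, Complex.mul_conj, Complex.normSq_eq_norm_sq]
    have h2 : ‖a - 1‖ ^ 2 = 2 - 2 * a.re := by
      have := Complex.normSq_eq_norm_sq a
      rw [ha, Complex.normSq_apply] at this
      rw [← Complex.normSq_eq_norm_sq, Complex.normSq_apply]
      simp; nlinarith
    rw [h2]
    have h3 : RCLike.re ((a - 1) * ((‖(inner ℂ w x : ℂ)‖ ^ 2 : ℝ) : ℂ)) =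
        (a.re - 1) * ‖(inner ℂ w x : ℂ)‖ ^ 2 := by
      simp only [RCLike.re_to_complex, Complex.re_mul_ofReal, Complex.sub_re, Complex.one_re]
    rw [h3]; ring
  exact (sq_eq_sq₀ (norm_nonneg _) (norm_nonneg _)).1 h1

/-- The complex reflection with axis `w` and eigenvalue `a`. -/
def rk (w : Cn n) (hw : ‖w‖ = 1) (a : ℂ) (ha : ‖a‖ = 1) : Cn n ≃ₗᵢ[ℂ] Cn n :=
  ofNorm (LinearMap.transvection ((a - 1) • (innerSL ℂ w : Cn n →ₗ[ℂ] ℂ)) w) fun x => by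
    simpa [LinearMap.transvection.apply] using norm_add_smul_inner hw ha x

theorem rk_apply (w : Cn n) (hw : ‖w‖ = 1) (a : ℂ) (ha : ‖a‖ = 1) (x : Cn n) :
    rk w hw a ha x = x + ((a - 1) * inner ℂ w x) • w := by
  rw [rk, ofNorm_apply, LinearMap.transvection.apply]; simp

theorem cdet_rk (w : Cn n) (hw : ‖w‖ = 1) (a : ℂ) (ha : ‖a‖ = 1) : cdet (rk w hw a ha) = a := by
  rw [rk, cdet_ofNorm, LinearMap.transvection.det]
  simp [complex_inner_self, hw]

/-- Multiplication with a complex number of modulus one. -/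
def sc (n : ℕ) (a : ℂ) (ha : ‖a‖ = 1) : Cn n ≃ₗᵢ[ℂ] Cn n :=
  ofNorm (a • LinearMap.id) fun x => by simp [norm_smul, ha]

theorem sc_apply (a : ℂ) (ha : ‖a‖ = 1) (x : Cn n) : sc n a ha x = a • x := rfl

theorem cdet_sc (a : ℂ) (ha : ‖a‖ = 1) : cdet (sc n a ha) = a ^ n := by
  rw [sc, cdet_ofNorm, LinearMap.det_smul]; simp

theorem exists_unit_perp {k : ℕ} (hk : k < n) (v : Fin k → Cn n) :
    ∃ w : Cn n, ‖w‖ = 1 ∧ ∀ i, inner ℂ w (v i) = 0 := by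
  set S := Submodule.span ℂ (Set.range v)
  have h1 : Module.finrank ℂ S < Module.finrank ℂ (Cn n) := by
    refine (finrank_range_le_card v).trans_lt ?_
    simpa using hk
  have h2 : Sᗮ ≠ ⊥ := by
    rw [Ne, Submodule.orthogonal_eq_bot_iff]
    intro h
    rw [h, finrank_top] at h1
    exact lt_irrefl _ h1
  obtain ⟨w, hw, hw0⟩ := Submodule.exists_mem_ne_zero_of_ne_bot h2
  refine ⟨((‖w‖⁻¹ : ℝ) : ℂ) • w, ?_, fun i => ?_⟩
  · rw [norm_smul]; simp [norm_ne_zero_iff.2 hw0]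
  · rw [inner_smul_left, (Submodule.mem_orthogonal' S w).1 hw _
      (Submodule.subset_span ⟨i, rfl⟩), mul_zero]

/-- Real isometries which are complex linear with determinant `c`, where `c ^ 4 = 1`. -/
def EE (n : ℕ) (A : Cn n ≃ₗᵢ[ℝ] Cn n) (c : ℂ) : Prop :=
  c ^ 4 = 1 ∧ ∃ B : Cn n ≃ₗᵢ[ℂ] Cn n, A = cl B ∧ cdet B = c

end Complex

section Kill
variable {n r : ℕ} {G : Type*} [Group G] [TopologicalSpace G] [IsTopologicalGroup G] [CompactSpace G]
  [SecondCountableTopology G] [MeasurableSpace G] [BorelSpace G] [SphRep G (Cn n)]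
  {e : Sph (Cn n)} {F : MultilinearMap ℝ (fun _ : Fin r × Bool => Cn n) ℂ}

theorem QForm.cequiv (hF : QForm G (EE n) e F) {B : Cn n ≃ₗᵢ[ℂ] Cn n} (hB : B e = e)
    {c : ℂ} (hc : cdet B = c) (h4 : c ^ 4 = 1) (q : Fin r × Bool → Cn n) :
    F (fun s => B (q s)) = c * F q :=
  hF.equiv (cl B) c hB ⟨h4, B, rfl, hc⟩ q

/-- If some complex line is orthogonal to `e` and all arguments, the form vanishes. -/
theorem QForm.eq_zero_of_perp (hF : QForm G (EE n) e F) {w : Cn n} (hw : ‖w‖ = 1)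
    (he : inner ℂ w (e : Cn n) = 0) {q : Fin r × Bool → Cn n} (hq : ∀ s, inner ℂ w (q s) = 0) :
    F q = 0 := by
  have h := hF.cequiv (B := rk w hw (-1) (by simp)) (by rw [rk_apply, he]; simp)
    (cdet_rk _ _ _ _) (by norm_num) q
  simp only [rk_apply, hq, mul_zero, zero_smul, add_zero] at h
  linear_combination h / 2

theorem QForm.dg_eq_zero_of_lt (hF : QForm G (EE n) e F) (hr : r + 1 < n) (q : Fin r → Cn n) :
    F (dg q) = 0 := by
  obtain ⟨w, hw, h⟩ := exists_unit_perp hr (Fin.cons (e : Cn n) q)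
  refine hF.eq_zero_of_perp hw (by simpa using h 0) fun s => ?_
  simpa [dg] using h s.1.succ

end Kill

section Kill
variable {n r : ℕ} {e : Sph (Cn n)}

/-- The projection along the complex line through `e`. -/
def pH (e : Sph (Cn n)) : Cn n →ₗ[ℂ] Cn n :=
  LinearMap.transvection (-(innerSL ℂ (e : Cn n) : Cn n →ₗ[ℂ] ℂ)) (e : Cn n)

theorem pH_apply (e : Sph (Cn n)) (v : Cn n) :
    pH e v = v - (inner ℂ (e : Cn n) v : ℂ) • (e : Cn n) := by
  rw [pH, LinearMap.transvection.apply]; simp [sub_eq_add_neg]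

theorem cinner_self_sph (e : Sph (Cn n)) : inner ℂ (e : Cn n) (e : Cn n) = (1 : ℂ) := by
  rw [complex_inner_self, norm_sph]; simp

theorem cinner_pH (e : Sph (Cn n)) (v : Cn n) : inner ℂ (e : Cn n) (pH e v) = (0 : ℂ) := by
  rw [pH_apply, inner_sub_right, inner_smul_right, cinner_self_sph]; ring

theorem pH_eq_self {v : Cn n} (h : inner ℂ (e : Cn n) v = (0 : ℂ)) : pH e v = v := by
  rw [pH_apply, h]; simp

theorem pH_self (e : Sph (Cn n)) : pH e e = 0 := by
  rw [pH_apply, cinner_self_sph]; simp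

theorem prj_eq_pH_add (e : Sph (Cn n)) (v : Cn n) :
    prj e v = pH e v + (inner ℂ (e : Cn n) v : ℂ).im • (Complex.I • (e : Cn n)) := by
  rw [prj_apply, pH_apply, real_inner_eq_re]
  have h : ∀ z : ℂ, z • (e : Cn n) = z.re • (e : Cn n) + z.im • (Complex.I • (e : Cn n)) :=
    fun z => by
      nth_rewrite 1 [← Complex.re_add_im z]
      simp only [add_smul, mul_smul, Complex.coe_smul]
  rw [h (inner ℂ (e : Cn n) v)]
  abel

theorem map_dg_update_parallelogram {X : Type*} [NormedAddCommGroup X] [InnerProductSpace ℝ X]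
    (F : MultilinearMap ℝ (fun _ : Fin r × Bool => X) ℂ) (q : Fin r → X) (i : Fin r) (a b : X) :
    F (dg (Function.update q i (a + b))) + F (dg (Function.update q i (-a + b))) =
      2 * F (dg (Function.update q i a)) + 2 * F (dg (Function.update q i b)) := by
  have h1 : ∀ x, dg (Function.update q i x) =
      Function.update (Function.update (dg q) (i, true) x) (i, false) x := fun x => by
    ext1 ⟨j, c⟩
    by_cases hj : j = i
    · subst hj; cases c <;> simp [dg]
    · simp [dg, hj]
  have h2 : ∀ x y z, F (Function.update (Function.update (dg q) (i, true) (x + y)) (i, false) z) =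
      F (Function.update (Function.update (dg q) (i, true) x) (i, false) z) +
      F (Function.update (Function.update (dg q) (i, true) y) (i, false) z) := fun x y z => by
    have hU' : ∀ x, Function.update (Function.update (dg q) (i, true) x) (i, false) z =
        Function.update (Function.update (dg q) (i, false) z) (i, true) x :=
      fun x => Function.update_comm (by simp) _ _ _
    rw [hU', hU', hU', F.map_update_add]
  have h3 : ∀ x z, F (Function.update (Function.update (dg q) (i, true) (-x)) (i, false) z) =
      -F (Function.update (Function.update (dg q) (i, true) x) (i, false) z) := fun x z => by
    have hU' : ∀ x, Function.update (Function.update (dg q) (i, true) x) (i, false) z =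
        Function.update (Function.update (dg q) (i, false) z) (i, true) x :=
      fun x => Function.update_comm (by simp) _ _ _
    rw [hU', hU', F.map_update_neg]
  simp only [h1, h2, h3, F.map_update_add, F.map_update_neg]
  ring

variable {G : Type*} [Group G] [TopologicalSpace G] [IsTopologicalGroup G] [CompactSpace G]
  [SecondCountableTopology G] [MeasurableSpace G] [BorelSpace G] [SphRep G (Cn n)]
  {F : MultilinearMap ℝ (fun _ : Fin r × Bool => Cn n) ℂ}

theorem QForm.map_dg_update_add (hF : QForm G (EE n) e F) (hr : r < n) (hn : Odd n)
    {q : Fin r → Cn n} (hq : ∀ j, inner ℂ (e : Cn n) (q j) = (0 : ℂ)) (i : Fin r) (t : ℝ) :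
    F (dg (Function.update q i (q i + t • (Complex.I • (e : Cn n))))) = F (dg q) := by
  set y := t • (Complex.I • (e : Cn n)) with hy
  have h1 : F (dg (Function.update q i y)) = 0 := by
    obtain ⟨w, hw, h⟩ := exists_unit_perp hr (Function.update q i (e : Cn n))
    have he : inner ℂ w (e : Cn n) = 0 := by simpa using h i
    refine hF.eq_zero_of_perp hw he fun s => ?_
    rcases eq_or_ne s.1 i with hs | hs
    · simp only [dg, hs, Function.update_self, hy]
      rw [← Complex.coe_smul, inner_smul_right, inner_smul_right, he]; simp
    · simpa [dg, hs] using h s.1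
  have h2 : F (dg (Function.update q i (-q i + y))) = F (dg (Function.update q i (q i + y))) := by
    have h3 := hF.cequiv (B := (sc n (-1) (by simp)).trans (rk e (norm_sph e) (-1) (by simp)))
      (c := 1) ?_ ?_ (by norm_num) (dg (Function.update q i (q i + y)))
    · rw [one_mul] at h3
      rw [← h3]
      have h4 := map_dg_smul (F := F) (fun j => if j = i then 1 else -1)
        (Function.update q i (-q i + y))
      have h5 : ∏ j : Fin r, (if j = i then (1 : ℝ) else -1) ^ 2 = 1 :=
        Finset.prod_eq_one fun j _ => by split_ifs <;> norm_num
      rw [h5, Complex.ofReal_one, one_mul] at h4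
      rw [← h4]
      congr 1
      ext1 s
      simp only [LinearIsometryEquiv.trans_apply, sc_apply, rk_apply, dg]
      rcases eq_or_ne s.1 i with hs | hs
      · rw [hs]
        simp only [Function.update_self, if_true, one_smul, inner_smul_right, inner_add_right,
          hq i, hy]
        rw [← Complex.coe_smul]
        simp only [inner_smul_right, cinner_self_sph]
        module
      · simp only [hs, if_false, ne_eq, not_false_eq_true, Function.update_of_ne,
          inner_smul_right, hq]
        simp
    · simp only [LinearIsometryEquiv.trans_apply, sc_apply, rk_apply, inner_smul_right,
        cinner_self_sph]
      module
    · rw [cdet_trans, cdet_sc, cdet_rk, hn.neg_one_pow]; norm_num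
  have h6 := map_dg_update_parallelogram F q i (q i) y
  rw [h2, h1, Function.update_eq_self] at h6
  linear_combination h6 / 2

theorem QForm.map_dg_pH (hF : QForm G (EE n) e F) (hr : r < n) (hn : Odd n)
    (q : Fin r → Cn n) : F (dg fun j => pH e (q j)) = F (dg q) := by
  set τ : Fin r → ℝ := fun j => (inner ℂ (e : Cn n) (q j) : ℂ).im with hτ
  have h0 : F (dg q) = F (dg fun j => pH e (q j) + τ j • (Complex.I • (e : Cn n))) := by
    rw [← hF.prj_comp]
    simp only [prj_eq_pH_add, dg, hτ]
    rfl
  rw [h0]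
  by_cases hz : ∀ j, τ j = 0
  · simp [hz]
  push Not at hz
  obtain ⟨i, hi⟩ := hz
  set u : Fin r → ℝ := fun j => if j = i then 0 else -(τ j / τ i) with hu
  set A : Matrix (Fin r) (Fin r) ℝ :=
    1 + Matrix.replicateCol Unit u * Matrix.replicateRow Unit (Pi.single i (1 : ℝ)) with hA
  have hdet : A.det = 1 := by
    rw [hA, Matrix.det_one_add_replicateCol_mul_replicateRow]; simp [hu]
  have hAq : ∀ p : Fin r → Cn n, (fun j => ∑ k, A j k • p k) = fun j => p j + u j • p i := by
    intro p
    ext1 j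
    simp only [hA, Matrix.add_apply, Matrix.mul_apply, Matrix.replicateCol_apply,
      Matrix.replicateRow_apply, Finset.univ_unique, Finset.sum_const, Finset.card_singleton,
      one_smul, add_smul, Finset.sum_add_distrib, Matrix.one_apply, ite_smul, zero_smul,
      Finset.sum_ite_eq, Finset.mem_univ, if_true, Pi.single_apply, mul_ite, mul_one, mul_zero,
      Finset.sum_ite_eq']
  have hm : ∀ p : Fin r → Cn n, F (dg fun j => p j + u j • p i) = F (dg p) := fun p => by
    rw [← hAq, map_dg_matrix hF.shear, hdet]; simp
  rw [← hm, ← hm fun j => pH e (q j) + τ j • (Complex.I • (e : Cn n))]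
  rw [← hF.map_dg_update_add hr hn (fun j => ?_) i (τ i)]
  · congr 2
    ext1 j
    rcases eq_or_ne j i with rfl | hj
    · simp [hu]
    · rw [Function.update_of_ne hj]
      simp only [hu, hj, if_false]
      have : τ j = τ j / τ i * τ i := by field_simp
      nth_rewrite 2 [this]
      module
  · rw [← Complex.coe_smul, inner_add_right, inner_smul_right, cinner_pH, cinner_pH]; simp

theorem QForm.map_pH (hF : QForm G (EE n) e F) (hr : r < n) (hn : Odd n)
    (q : Fin r × Bool → Cn n) : F (fun s => pH e (q s)) = F q := by
  have h := eq_zero_of_dg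
    (F := F.compLinearMap (fun _ => (pH e).restrictScalars ℝ) - F) (fun i q => ?_) (fun q => ?_) q
  · exact sub_eq_zero.1 h
  · simp only [MultilinearMap.sub_apply, MultilinearMap.compLinearMap_apply]
    rw [hF.swap i q, ← hF.swap i fun s => (pH e).restrictScalars ℝ (q s)]
    congr 3
    ext1 s
    split_ifs <;> rfl
  · simp only [MultilinearMap.sub_apply, MultilinearMap.compLinearMap_apply]
    rw [sub_eq_zero]
    exact hF.map_dg_pH hr hn q

end Kill

section Weight

theorem infinite_unit_circle : {z : ℂ | ‖z‖ = 1}.Infinite := by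
  have h1 : IsPreconnected (Metric.sphere (0 : ℂ) 1) :=
    isPreconnected_sphere (by rw [Complex.rank_real_complex]; norm_num) 0 1
  have h2 : Metric.sphere (0 : ℂ) 1 = {z : ℂ | ‖z‖ = 1} := by ext z; simp
  rw [← h2]
  exact h1.infinite_of_nontrivial ⟨1, by simp, -1, by simp, by norm_num⟩

/-- A polynomial of degree at most `4 r` with weight `3 r` under a primitive `4 r`-th root of unity
is a monomial. -/
theorem eval_eq_of_weight {r : ℕ} (hr : 0 < r) {p : Polynomial ℂ} (hp : p.natDegree ≤ 4 * r) {ω : ℂ}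
    (hω : IsPrimitiveRoot ω (4 * r))
    (h : ∀ z : ℂ, ‖z‖ = 1 → p.eval (ω * z) = ω ^ (3 * r) * p.eval z) (z : ℂ) :
    p.eval z = z ^ (3 * r) * p.eval 1 := by
  have h1 : p.comp (Polynomial.C ω * Polynomial.X) = Polynomial.C (ω ^ (3 * r)) * p := by
    refine Polynomial.eq_of_infinite_eval_eq _ _ (infinite_unit_circle.mono fun z hz => ?_)
    simpa using h z hz
  have h2 : ∀ k, k ≠ 3 * r → p.coeff k = 0 := fun k hk => by
    by_contra h0
    have h3 : k ≤ 4 * r := (Polynomial.le_natDegree_of_ne_zero h0).trans hp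
    have h4 := congrArg (fun p => Polynomial.coeff p k) h1
    simp only [Polynomial.comp_C_mul_X_coeff, Polynomial.coeff_C_mul] at h4
    have h5 : ω ^ k = ω ^ (3 * r) := mul_left_cancel₀ h0 (by rw [h4]; ring)
    rcases h3.lt_or_eq with h6 | h6
    · exact hk (hω.pow_inj h6 (by omega) h5)
    · rw [h6, hω.pow_eq_one, ← pow_zero ω] at h5
      have := hω.pow_inj (by omega) (by omega) h5
      omega
  have h3 : p = Polynomial.monomial (3 * r) (p.coeff (3 * r)) := by
    ext k
    rw [Polynomial.coeff_monomial]
    split_ifs with hk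
    · rw [hk]
    · exact h2 k (Ne.symm hk)
  rw [h3]; simp [mul_comm]

theorem natDegree_mul_pow_le {a b : ℂ} {p q : Polynomial ℂ} (hp : p.natDegree ≤ 2)
    (hq : q.natDegree ≤ 2) (c : ℂ) (k l : ℕ) :
    (Polynomial.C c * ((Polynomial.C a * p) ^ k * (Polynomial.C b * q) ^ l)).natDegree ≤
      2 * (k + l) := by
  have h : ∀ (a : ℂ) (p : Polynomial ℂ) (k : ℕ), p.natDegree ≤ 2 →
      ((Polynomial.C a * p) ^ k).natDegree ≤ 2 * k := fun a p k hp =>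
    Polynomial.natDegree_pow_le.trans (by
      rw [mul_comm]
      exact Nat.mul_le_mul_right _ ((Polynomial.natDegree_C_mul_le _ _).trans hp))
  refine (Polynomial.natDegree_C_mul_le _ _).trans (Polynomial.natDegree_mul_le.trans ?_)
  have := h a p k hp
  have := h b q l hq
  omega

theorem exists_poly_smul {n r : ℕ} (F : MultilinearMap ℝ (fun _ : Fin r × Bool => Cn n) ℂ)
    (q : Fin r × Bool → Cn n) : ∃ p : Polynomial ℂ, p.natDegree ≤ 4 * r ∧
      ∀ z : ℂ, ‖z‖ = 1 → p.eval z = z ^ (2 * r) * F fun s => z • q s := by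
  classical
  set y : Fin r × Bool → Cn n := fun s => Complex.I • q s with hy
  refine ⟨∑ S : Finset (Fin r × Bool), Polynomial.C (F (S.piecewise q y)) *
    ((Polynomial.C (1 / 2) * (Polynomial.X ^ 2 + 1)) ^ S.card *
      (Polynomial.C (1 / (2 * Complex.I)) * (Polynomial.X ^ 2 - 1)) ^ Sᶜ.card), ?_, fun z hz => ?_⟩
  · refine Polynomial.natDegree_sum_le_of_forall_le _ _ fun S _ => ?_
    refine (natDegree_mul_pow_le (by compute_degree) (by compute_degree) _ _ _).trans ?_
    rw [Finset.card_add_card_compl, Fintype.card_prod, Fintype.card_bool, Fintype.card_fin]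
    omega
  · have h1 : (fun s => z • q s) = (fun s => z.re • q s) + fun s => z.im • y s := by
      ext1 s
      simp only [Pi.add_apply, hy]
      nth_rewrite 1 [← Complex.re_add_im z]
      simp only [add_smul, mul_smul, Complex.coe_smul]
    have h2 : ∀ S : Finset (Fin r × Bool),
        F (S.piecewise (fun s => z.re • q s) fun s => z.im • y s) =
          (z.re : ℂ) ^ S.card * (z.im : ℂ) ^ Sᶜ.card * F (S.piecewise q y) := fun S => by
      have h3 : S.piecewise (fun s => z.re • q s) (fun s => z.im • y s) =
          fun s => (if s ∈ S then z.re else z.im) • S.piecewise q y s := by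
        ext1 s
        by_cases hs : s ∈ S <;> simp [hs]
      rw [h3, F.map_smul_univ, Finset.prod_ite, Complex.real_smul]
      simp only [Finset.prod_const, Complex.ofReal_mul, Complex.ofReal_pow]
      congr 4
      · simp
      · congr 1; ext; simp
    have hz0 : z ≠ 0 := fun h => by rw [h, norm_zero] at hz; exact zero_ne_one hz
    have hzc : z * (starRingEnd ℂ) z = 1 := by rw [Complex.mul_conj, Complex.normSq_eq_norm_sq, hz]; simp
    have hre : z * z.re = 1 / 2 * (z ^ 2 + 1) := by
      rw [Complex.re_eq_add_conj]; linear_combination (1 / 2) * hzc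
    have him : z * z.im = 1 / (2 * Complex.I) * (z ^ 2 - 1) := by
      rw [Complex.im_eq_sub_conj]
      field_simp
      linear_combination -hzc
    rw [h1, F.map_add_univ, Finset.mul_sum, Polynomial.eval_finsetSum]
    refine Finset.sum_congr rfl fun S _ => ?_
    rw [h2]
    have hc : 2 * r = S.card + Sᶜ.card := by
      rw [Finset.card_add_card_compl, Fintype.card_prod, Fintype.card_bool, Fintype.card_fin]
      omega
    simp only [Polynomial.eval_mul, Polynomial.eval_C, Polynomial.eval_pow, Polynomial.eval_add,
      Polynomial.eval_X, Polynomial.eval_one, Polynomial.eval_sub]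
    rw [← hre, ← him, hc, pow_add]
    ring

variable {n r : ℕ} {e : Sph (Cn n)}
variable {G : Type*} [Group G] [TopologicalSpace G] [IsTopologicalGroup G] [CompactSpace G]
  [SecondCountableTopology G] [MeasurableSpace G] [BorelSpace G] [SphRep G (Cn n)]
  {F : MultilinearMap ℝ (fun _ : Fin r × Bool => Cn n) ℂ}

theorem pH_rk (e : Sph (Cn n)) {a : ℂ} (ha : ‖a‖ = 1) (x : Cn n) :
    pH e (rk (e : Cn n) (norm_sph e) a ha x) = pH e x := by
  rw [pH_apply, pH_apply, rk_apply, inner_add_right, inner_smul_right, cinner_self_sph]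
  module

theorem QForm.map_root_smul (hF : QForm G (EE n) e F) (hr : n = r + 1) (hn : Odd n) {z : ℂ}
    (hz : z ^ (4 * r) = 1) (hz1 : ‖z‖ = 1) (q : Fin r × Bool → Cn n) :
    F (fun s => z • q s) = z ^ r * F q := by
  have hz0 : z ≠ 0 := fun h => by rw [h, norm_zero] at hz1; exact zero_ne_one hz1
  have h := hF.cequiv (B := (sc n z hz1).trans (rk e (norm_sph e) z⁻¹ (by simp [hz1])))
    (c := z ^ r) ?_ ?_ (by rw [← pow_mul, mul_comm, hz]) q
  · rw [← h, ← hF.map_pH (by omega) hn fun s => z • q s,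
      ← hF.map_pH (by omega) hn fun s => (_ : Cn n ≃ₗᵢ[ℂ] Cn n) (q s)]
    simp only [LinearIsometryEquiv.trans_apply, pH_rk, sc_apply]
  · simp only [LinearIsometryEquiv.trans_apply, sc_apply, rk_apply, inner_smul_right,
        cinner_self_sph, mul_one, sub_mul, one_mul, sub_smul, inv_mul_cancel₀ hz0, one_smul]
    abel
  · rw [cdet_trans, cdet_sc, cdet_rk, hr, pow_succ, mul_assoc, mul_inv_cancel₀ hz0, mul_one]

theorem QForm.map_smul (hF : QForm G (EE n) e F) (hr : n = r + 1) (h0 : 0 < r) (hn : Odd n) {z : ℂ}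
    (hz : ‖z‖ = 1) (q : Fin r × Bool → Cn n) : F (fun s => z • q s) = z ^ r * F q := by
  obtain ⟨p, hp, hpz⟩ := exists_poly_smul F q
  have hω := Complex.isPrimitiveRoot_exp (4 * r) (by omega)
  set ω := Complex.exp (2 * Real.pi * Complex.I / (4 * r : ℕ))
  have hω1 : ‖ω‖ = 1 := hω.norm'_eq_one (by omega)
  have h := eval_eq_of_weight h0 hp hω (fun z hz => ?_) z
  · have hz0 : z ≠ 0 := fun h => by rw [h, norm_zero] at hz; exact zero_ne_one hz
    rw [hpz z hz, hpz 1 (by simp)] at h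
    simp only [one_smul, one_pow, one_mul] at h
    refine mul_left_cancel₀ (pow_ne_zero (2 * r) hz0) (h.trans ?_)
    ring
  · rw [hpz z hz, hpz (ω * z) (by simp [hω1, hz])]
    have := hF.map_root_smul hr hn hω.pow_eq_one hω1 fun s => z • q s
    simp only [smul_smul] at this
    rw [this]; ring

end Weight

section Align
variable {n r : ℕ} {e : Sph (Cn n)}

/-- The reflection in the hyperplane orthogonal to a nonzero vector. -/
theorem exists_reflection {v : Cn n} (hv : v ≠ 0) : ∃ B : Cn n ≃ₗᵢ[ℂ] Cn n, cdet B = -1 ∧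
    ∀ x, B x = x - ((2 / ‖v‖ ^ 2 : ℝ) * inner ℂ v x : ℂ) • v := by
  have h0 : ‖v‖ ≠ 0 := norm_ne_zero_iff.2 hv
  refine ⟨rk (((‖v‖⁻¹ : ℝ) : ℂ) • v) (by rw [norm_smul]; simp [h0]) (-1) (by simp),
    cdet_rk _ _ _ _, fun x => ?_⟩
  rw [rk_apply, inner_smul_left, smul_smul, sub_eq_add_neg x,
    ← neg_smul]
  congr 2
  have h1 : (‖v‖ : ℂ) ≠ 0 := by exact_mod_cast h0
  simp only [Complex.conj_ofReal]
  push_cast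
  field_simp
  ring

theorem exists_phase (z : ℂ) : ∃ a : ℂ, ‖a‖ = 1 ∧ z = ‖z‖ * a := by
  rcases eq_or_ne z 0 with rfl | hz
  · exact ⟨1, by simp⟩
  · have h0 : (‖z‖ : ℂ) ≠ 0 := by exact_mod_cast norm_ne_zero_iff.2 hz
    exact ⟨z / ‖z‖, by simp [hz], by field_simp⟩

theorem cinner_pH_left (e : Sph (Cn n)) (u x : Cn n) :
    (inner ℂ (pH e u) (pH e x) : ℂ) = inner ℂ (pH e u) x := by
  rw [pH_apply e x, inner_sub_right, inner_smul_right, ← inner_conj_symm _ (e : Cn n), cinner_pH]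
  simp

theorem exists_align (hn : n = r + 1) (hr : 0 < r) {u : Cn n} (hu : ‖u‖ = 1) :
    ∃ (A : Cn n ≃ₗᵢ[ℂ] Cn n) (c a : ℂ), ‖c‖ = 1 ∧ c ^ r = a ∧
      (inner ℂ (e : Cn n) u : ℂ) = ‖(inner ℂ (e : Cn n) u : ℂ)‖ * a ∧ cdet A = 1 ∧ A u = e ∧
      ∀ q, pH e (A (pH e q)) = c • pH e (q - (((1 + ‖(inner ℂ (e : Cn n) u : ℂ)‖)⁻¹ : ℝ) *
        inner ℂ (pH e u) q : ℂ) • pH e u) := by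
  set z : ℂ := inner ℂ (e : Cn n) u with hz
  obtain ⟨a, ha, hza⟩ := exists_phase z
  set s := ‖z‖ with hs
  have hs0 : 0 ≤ s := norm_nonneg z
  obtain ⟨c, hc⟩ := IsAlgClosed.exists_pow_nat_eq a hr
  have hc1 : ‖c‖ = 1 := by
    rw [← pow_eq_one_iff_of_nonneg (norm_nonneg c) hr.ne', ← norm_pow, hc, ha]
  have hc0 : c ≠ 0 := fun h => by rw [h, norm_zero] at hc1; exact zero_ne_one hc1
  have haa : a * (starRingEnd ℂ) a = 1 := by
    rw [Complex.mul_conj, Complex.normSq_eq_norm_sq, ha]; simp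
  set v : Cn n := (e : Cn n) + (starRingEnd ℂ) a • u with hv
  have hvx : ∀ x, (inner ℂ v x : ℂ) = inner ℂ (e : Cn n) x + a * inner ℂ u x := fun x => by
    rw [hv, inner_add_left, inner_smul_left]; simp
  have hvu : (inner ℂ v u : ℂ) = a * (1 + s) := by
    rw [hvx, complex_inner_self, hu, ← hz]; nth_rewrite 1 [hza]; push_cast; ring
  have hve : (inner ℂ v (e : Cn n) : ℂ) = 1 + s := by
    rw [hvx, cinner_self_sph, ← inner_conj_symm, ← hz, hza]
    simp only [map_mul, Complex.conj_ofReal]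
    linear_combination (s : ℂ) * haa
  have hvv : ‖v‖ ^ 2 = 2 * (1 + s) := by
    have h1 : ((‖v‖ ^ 2 : ℝ) : ℂ) = ((2 * (1 + s) : ℝ) : ℂ) := by
      rw [← complex_inner_self]
      nth_rewrite 2 [hv]
      rw [inner_add_right, inner_smul_right, hvu, hve]
      push_cast
      linear_combination (1 + s : ℂ) * haa
    exact_mod_cast h1
  have hv0 : v ≠ 0 := fun h => by
    rw [h, norm_zero] at hvv; nlinarith
  obtain ⟨R, hR, hRx⟩ := exists_reflection hv0
  have hs1 : (1 + s : ℂ) ≠ 0 := by exact_mod_cast (by positivity : (1 + s) ≠ 0)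
  have h2 : (2 / ‖v‖ ^ 2 : ℝ) = (1 + s)⁻¹ := by rw [hvv]; field_simp
  rw [h2] at hRx
  have hk : ‖-(c⁻¹ * (starRingEnd ℂ) a)‖ = 1 := by simp [hc1, ha]
  refine ⟨(R.trans (rk e (norm_sph e) _ hk)).trans (sc n c hc1), c, a, hc1, hc, hza, ?_, ?_,
    fun q => ?_⟩
  · rw [cdet_trans, cdet_trans, hR, cdet_rk, cdet_sc, hn, pow_succ, hc]
    field_simp
    linear_combination haa
  · have hRu : R u = -(a • (e : Cn n)) := by
      rw [hRx, hvu, hv]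
      have h3 : (((1 + s)⁻¹ : ℝ) : ℂ) * (a * (1 + s)) = a := by push_cast; field_simp
      rw [h3, smul_add, smul_smul, haa, one_smul]; abel
    simp only [LinearIsometryEquiv.trans_apply, hRu, rk_apply, sc_apply, inner_neg_right,
      inner_smul_right, cinner_self_sph]
    have h4 : c * (-a + (-(c⁻¹ * (starRingEnd ℂ) a) - 1) * -(a * 1)) = 1 := by
      field_simp
      linear_combination haa
    rw [← neg_smul, ← add_smul, smul_smul, h4, one_smul]
  · simp only [LinearIsometryEquiv.trans_apply, sc_apply, map_smul, pH_rk]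
    congr 1
    rw [hRx, hvx, cinner_pH, zero_add]
    have h5 : pH e v = (starRingEnd ℂ) a • pH e u := by
      rw [hv, (pH e).map_add, pH_self, (pH e).map_smul, zero_add]
    have h6 : pH e (pH e u) = pH e u := pH_eq_self (cinner_pH e u)
    have h7 : (inner ℂ u (pH e q) : ℂ) = inner ℂ (pH e u) q := by
      rw [← cinner_pH_left, pH_apply e u, inner_sub_left, inner_smul_left, cinner_pH]; simp
    have h8 : pH e (pH e q) = pH e q := pH_eq_self (cinner_pH e q)
    rw [(pH e).map_sub, (pH e).map_sub, (pH e).map_smul, (pH e).map_smul, h5, h6, h7, h8, smul_smul]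
    congr 2
    linear_combination (((1 + s)⁻¹ : ℝ) : ℂ) * inner ℂ (pH e u) q * haa

end Align

section Kill
variable {n r : ℕ} {e : Sph (Cn n)}
variable {G : Type*} [Group G] [TopologicalSpace G] [IsTopologicalGroup G] [CompactSpace G]
  [SecondCountableTopology G] [MeasurableSpace G] [BorelSpace G] [SphRep G (Cn n)]
  {F : MultilinearMap ℝ (fun _ : Fin r × Bool => Cn n) ℂ}

theorem QForm.exists_phase_mul (hF : QForm G (EE n) e F) (hE : ∀ g : G, EE n (rho (Cn n) g) 1)
    (hr : n = r + 1) (h0 : 0 < r) (hn : Odd n) (g : G) :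
    ∃ a : ℂ, (inner ℂ (e : Cn n) (sg g⁻¹ e : Sph (Cn n)).1 : ℂ) =
        ‖(inner ℂ (e : Cn n) (sg g⁻¹ e : Sph (Cn n)).1 : ℂ)‖ * a ∧ a * (starRingEnd ℂ) a = 1 ∧
      ∀ q : Fin r × Bool → Cn n, F (fun s => rho (Cn n) g (pH e (q s))) =
        a * F fun s => q s - (((1 + ‖(inner ℂ (e : Cn n) (sg g⁻¹ e : Sph (Cn n)).1 : ℂ)‖)⁻¹ : ℝ) *
        inner ℂ (pH e (sg g⁻¹ e : Sph (Cn n)).1) (q s) : ℂ) • pH e (sg g⁻¹ e : Sph (Cn n)).1 := by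
  obtain ⟨A, c, a, hc, hca, hz, hA, hAu, hAq⟩ := exists_align (e := e) hr h0
    (norm_sph (sg g⁻¹ e : Sph (Cn n)))
  refine ⟨a, hz, ?_, fun q => ?_⟩
  · rw [Complex.mul_conj, Complex.normSq_eq_norm_sq, ← hca, norm_pow, hc]; simp
  obtain ⟨-, B, hB, hB1⟩ := hE g
  have hu : rho (Cn n) g (sg g⁻¹ e : Sph (Cn n)).1 = e := by
    rw [coe_sg, map_inv]
    exact (rho (Cn n) g).apply_symm_apply _
  have hk : (A.symm.trans B) e = e := by
    rw [LinearIsometryEquiv.trans_apply]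
    nth_rewrite 1 [← hAu]
    rw [A.symm_apply_apply, ← cl_apply, ← hB, hu]
  have hd : cdet (A.symm.trans B) = 1 := by
    have := cdet_mul_symm A
    rw [hA, one_mul] at this
    rw [cdet_trans, this, hB1, mul_one]
  have h1 := hF.cequiv hk hd (by norm_num) fun s => A (pH e (q s))
  simp only [LinearIsometryEquiv.trans_apply, A.symm_apply_apply, one_mul] at h1
  rw [hB]
  simp only [cl_apply]
  rw [h1, ← hF.map_pH (by omega) hn]
  simp only [hAq]
  rw [hF.map_smul hr h0 hn hc, hca, hF.map_pH (by omega) hn]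

end Kill

section Positive

theorem sum_map_map_mul_conj {X : Type*} [NormedAddCommGroup X] [InnerProductSpace ℝ X] {κ ι : Type*}
    [Fintype κ] [DecidableEq κ] [Fintype ι] (F : MultilinearMap ℝ (fun _ : κ => X) ℂ)
    (b : OrthonormalBasis ι ℝ X) (N : X →ₗ[ℝ] X) (hN : ∀ x y, ⟪N x, y⟫ = ⟪x, N y⟫) :
    ∑ I : κ → ι, F (fun s => N (N (b (I s)))) * (starRingEnd ℂ) (F fun s => b (I s)) =
      ((∑ I : κ → ι, ‖F fun s => N (b (I s))‖ ^ 2 : ℝ) : ℂ) := by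
  have h1 : ∀ (L : X →ₗ[ℝ] X) (I : κ → ι), F (fun s => L (N (b (I s)))) =
      ∑ J : κ → ι, ((∏ s, ⟪b (J s), N (b (I s))⟫ : ℝ) : ℂ) * F fun s => L (b (J s)) := fun L I => by
    have h2 : (fun s => L (N (b (I s)))) = fun s => ∑ j, ⟪b j, N (b (I s))⟫ • L (b j) := by
      ext1 s
      nth_rewrite 1 [← b.sum_repr' (N (b (I s)))]
      rw [map_sum]
      simp only [map_smul]
    rw [h2, F.map_sum]
    refine Finset.sum_congr rfl fun J _ => ?_
    rw [F.map_smul_univ (fun s => ⟪b (J s), N (b (I s))⟫) fun s => L (b (J s)), Complex.real_smul]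
  simp only [h1 N, Finset.sum_mul]
  rw [Finset.sum_comm, Complex.ofReal_sum]
  refine Finset.sum_congr rfl fun J _ => ?_
  have h3 := h1 LinearMap.id J
  simp only [LinearMap.id_apply] at h3
  rw [← Complex.normSq_eq_norm_sq, ← Complex.mul_conj]
  conv_rhs => arg 2; rw [h3]
  rw [map_sum, Finset.mul_sum]
  refine Finset.sum_congr rfl fun I _ => ?_
  simp only [map_mul, Complex.conj_ofReal]
  have h4 : ∏ s, ⟪b (I s), N (b (J s))⟫ = ∏ s, ⟪b (J s), N (b (I s))⟫ :=
    Finset.prod_congr rfl fun s _ => by rw [← hN, real_inner_comm]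
  rw [h4]; ring

/-- The rank one perturbation of the identity in the direction `w`. -/
def pt {n : ℕ} (t : ℝ) (w : Cn n) : Cn n →ₗ[ℝ] Cn n :=
  (LinearMap.transvection ((-t : ℂ) • (innerSL ℂ w : Cn n →ₗ[ℂ] ℂ)) w).restrictScalars ℝ

theorem pt_apply {n : ℕ} (t : ℝ) (w x : Cn n) : pt t w x = x - ((t : ℂ) * inner ℂ w x) • w := by
  rw [pt, LinearMap.restrictScalars_apply, LinearMap.transvection.apply]
  simp [sub_eq_add_neg]

theorem pt_symm {n : ℕ} (t : ℝ) (w x y : Cn n) : ⟪pt t w x, y⟫ = ⟪x, pt t w y⟫ := by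
  rw [real_inner_eq_re, real_inner_eq_re, pt_apply, pt_apply, inner_sub_left, inner_sub_right,
    inner_smul_left, inner_smul_right]
  simp only [map_mul, Complex.conj_ofReal, inner_conj_symm]
  congr 1
  ring

theorem pt_pt {n : ℕ} {s : ℝ} (hs : 0 ≤ s) {w : Cn n} (hw : ‖w‖ ^ 2 = 1 - s ^ 2) (x : Cn n) :
    pt ((1 + √s) * (1 + s))⁻¹ w (pt ((1 + √s) * (1 + s))⁻¹ w x) = pt (1 + s)⁻¹ w x := by
  set p := √s with hp
  have hp0 : 0 ≤ p := Real.sqrt_nonneg s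
  have hps : s = p ^ 2 := (Real.sq_sqrt hs).symm
  rw [hps] at hw ⊢
  simp only [pt_apply, inner_sub_right, inner_smul_right, complex_inner_self, hw]
  rw [sub_sub, ← add_smul]
  congr 2
  have h1 : (1 + (p : ℂ)) ≠ 0 := by exact_mod_cast (by positivity : (1 + p) ≠ 0)
  have h2 : (1 + (p : ℂ) ^ 2) ≠ 0 := by exact_mod_cast (by positivity : (1 + p ^ 2) ≠ 0)
  push_cast
  field_simp
  ring

theorem norm_pH_sq {n : ℕ} (e : Sph (Cn n)) {u : Cn n} (hu : ‖u‖ = 1) :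
    ‖pH e u‖ ^ 2 = 1 - ‖(inner ℂ (e : Cn n) u : ℂ)‖ ^ 2 := by
  have h : ((‖pH e u‖ ^ 2 : ℝ) : ℂ) = ((1 - ‖(inner ℂ (e : Cn n) u : ℂ)‖ ^ 2 : ℝ) : ℂ) := by
    rw [← complex_inner_self, cinner_pH_left, pH_apply, inner_sub_left, inner_smul_left,
      complex_inner_self, hu, ← Complex.normSq_eq_norm_sq]
    push_cast
    rw [← Complex.mul_conj]; ring
  exact_mod_cast h

variable {n r : ℕ} {e : Sph (Cn n)}
variable {G : Type*} [Group G] [TopologicalSpace G] [IsTopologicalGroup G] [CompactSpace G]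
  [SecondCountableTopology G] [MeasurableSpace G] [BorelSpace G] [SphRep G (Cn n)]
  {F : MultilinearMap ℝ (fun _ : Fin r × Bool => Cn n) ℂ}

theorem QForm.integral_conj (hF : QForm G (EE n) e F) (q : Fin r × Bool → Cn n) :
    ∫ g : G, (starRingEnd ℂ) (inner ℂ (e : Cn n) (sg g⁻¹ e : Sph (Cn n)).1 : ℂ) *
      F (fun s => rho (Cn n) g (q s)) ∂hG G = 0 := by
  have h1 : ∀ a : Cn n, Continuous fun g : G => ((⟪a, ((sg g⁻¹ e : Sph (Cn n)) : Cn n)⟫ : ℝ) : ℂ) *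
      F (fun s => rho (Cn n) g (q s)) := fun a => by
    have := hF.cont q
    refine Continuous.mul ?_ this
    fun_prop
  have h2 : ∀ g : G, (starRingEnd ℂ) (inner ℂ (e : Cn n) (sg g⁻¹ e : Sph (Cn n)).1 : ℂ) *
      F (fun s => rho (Cn n) g (q s)) =
      ((⟪(e : Cn n), ((sg g⁻¹ e : Sph (Cn n)) : Cn n)⟫ : ℝ) : ℂ) * F (fun s => rho (Cn n) g (q s)) -
      Complex.I * (((⟪Complex.I • (e : Cn n), ((sg g⁻¹ e : Sph (Cn n)) : Cn n)⟫ : ℝ) : ℂ) *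
        F (fun s => rho (Cn n) g (q s))) := fun g => by
    rw [real_inner_eq_re, real_inner_eq_re, inner_smul_left]
    have h3 : ∀ z : ℂ, (starRingEnd ℂ) z =
        (z.re : ℂ) - Complex.I * (((starRingEnd ℂ) Complex.I * z).re : ℂ) := fun z => by
      apply Complex.ext <;> simp
    rw [h3]; ring
  simp only [h2]
  rw [integral_sub (integrable_hG (h1 _)) ((integrable_hG (h1 _)).const_mul _),
    integral_const_mul, hF.integral, hF.integral]
  simp

theorem QForm.eq_zero (hF : QForm G (EE n) e F) (hE : ∀ g : G, EE n (rho (Cn n) g) 1)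
    (hr : n = r + 1) (h0 : 0 < r) (hn : Odd n) : F = 0 := by
  set b := stdOrthonormalBasis ℝ (Cn n) with hb
  set u : G → Cn n := fun g => (sg g⁻¹ e : Sph (Cn n)).1 with hu
  set Ψ : G → ℂ := fun g => ∑ I : Fin r × Bool → Fin _,
    ((starRingEnd ℂ) (inner ℂ (e : Cn n) (u g) : ℂ) *
      F (fun s => rho (Cn n) g (pH e (b (I s))))) * (starRingEnd ℂ) (F fun s => b (I s)) with hΨ
  set t : ℝ → ℝ := fun s => ((1 + √s) * (1 + s))⁻¹
  set σ : G → ℝ := fun g => ‖(inner ℂ (e : Cn n) (u g) : ℂ)‖ with hσ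
  set Φ : G → ℝ := fun g => σ g * ∑ I : Fin r × Bool → Fin _,
      ‖F fun s => pt (t (σ g)) (pH e (u g)) (b (I s))‖ ^ 2 with hΦ
  have hmul : ∀ s a' a y c : ℂ, a * a' = 1 → s * a' * (a * y) * c = s * (y * c) :=
    fun s a' a y c h => by linear_combination s * y * c * h
  have hΨΦ : ∀ g, Ψ g = Φ g := fun g => by
    obtain ⟨a, hz, ha, hq⟩ := hF.exists_phase_mul hE hr h0 hn g
    have hN := sum_map_map_mul_conj F b (pt (t (σ g)) (pH e (u g))) (pt_symm _ _)
    simp only [t, pt_pt (norm_nonneg _) (norm_pH_sq e (norm_sph (sg g⁻¹ e : Sph (Cn n)))), hσ,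
      hu] at hN
    simp only [hΨ, hΦ]
    rw [Complex.ofReal_mul]
    simp only [t, hσ, hu]
    rw [← hN, Finset.mul_sum]
    refine Finset.sum_congr rfl fun I _ => ?_
    simp only [pt_apply]
    rw [hq fun s => b (I s)]
    have hz' := congrArg (starRingEnd ℂ) hz
    simp only [map_mul, Complex.conj_ofReal] at hz'
    rw [hz']
    exact hmul _ _ _ _ _ ha
  have hc : ∀ q : Fin r × Bool → Cn n, Continuous fun g : G =>
      (starRingEnd ℂ) (inner ℂ (e : Cn n) (u g) : ℂ) * F (fun s => rho (Cn n) g (q s)) :=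
    fun q => by
      refine Continuous.mul ?_ (hF.cont q)
      refine Complex.continuous_conj.comp ?_
      fun_prop
  have hΨc : Continuous Ψ := continuous_finsetSum _ fun I _ => (hc _).mul continuous_const
  have hΨ0 : ∫ g : G, Ψ g ∂hG G = 0 := by
    rw [hΨ, integral_finsetSum _ fun I _ => (integrable_hG (hc _)).mul_const _]
    refine Finset.sum_eq_zero fun I _ => ?_
    rw [integral_mul_const, hF.integral_conj, zero_mul]
  have hΦc : Continuous Φ := by
    have : Φ = fun g => (Ψ g).re := funext fun g => by rw [hΨΦ, Complex.ofReal_re]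
    rw [this]; exact Complex.continuous_re.comp hΨc
  have hΦ0 : ∫ g : G, Φ g ∂hG G = 0 := by
    simp only [hΨΦ] at hΨ0
    rw [integral_complex_ofReal] at hΨ0
    exact_mod_cast hΨ0
  have h1 : Φ = 0 := by
    refine (hΦc.ae_eq_iff_eq (hG G) continuous_zero).1 ?_
    exact (integral_eq_zero_iff_of_nonneg (fun g => mul_nonneg (norm_nonneg _)
      (Finset.sum_nonneg fun I _ => sq_nonneg _)) (integrable_hG hΦc)).1 hΦ0
  have h2 := congrFun h1 1
  have hu1 : u 1 = e := by simp only [hu, inv_one, sg_one]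
  have hσ1 : σ 1 = 1 := by simp only [hσ, hu1, cinner_self_sph, norm_one]
  simp only [hΦ, hσ1, hu1, pH_self, one_mul, Pi.zero_apply] at h2
  refine Module.Basis.ext_multilinear (fun _ => b.toBasis) fun I => ?_
  have h3 := (Finset.sum_eq_zero_iff_of_nonneg fun I _ => sq_nonneg _).1 h2 I (Finset.mem_univ I)
  simpa [pt_apply] using h3

theorem QForm.map_dg_eq_zero_of_odd (hF : QForm G (EE n) e F) (hE : ∀ g : G, EE n (rho (Cn n) g) 1)
    (h1 : 1 < n) (hn : Odd n) (q : Fin r → Cn n) : F (dg q) = 0 := by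
  haveI : Nontrivial (Cn n) := by
    haveI : Nonempty (Fin n) := ⟨⟨0, hn.pos⟩⟩
    infer_instance
  rcases lt_trichotomy (r + 1) n with h | h | h
  · exact hF.dg_eq_zero_of_lt h q
  · rw [hF.eq_zero hE h.symm (by omega) hn]; rfl
  · refine hF.eq_zero_of_finrank_le ?_ q
    rw [finrank_real_of_complex, finrank_euclideanSpace_fin]
    omega

end Positive

section Vanish
variable {n : ℕ}
variable (G : Type*) [Group G] [TopologicalSpace G] [IsTopologicalGroup G] [CompactSpace G]
  [T2Space G] [SecondCountableTopology G] [MeasurableSpace G] [BorelSpace G] [SphRep G (Cn n)]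

theorem EE_neg (hn : Odd n) : EE n (LinearIsometryEquiv.neg ℝ) (-1) :=
  ⟨by norm_num, sc n (-1) (by simp), by ext1 x; simp [sc_apply], by
    rw [cdet_sc, hn.neg_one_pow]⟩

theorem act_add_one {X : Type*} [NormedAddCommGroup X] [InnerProductSpace ℝ X] (A : X ≃ₗᵢ[ℝ] X)
    (h : CS X) : act A (h + 1) = act A h + 1 := by
  ext x; simp [act]

theorem act_inf {X : Type*} [NormedAddCommGroup X] [InnerProductSpace ℝ X] (A : X ≃ₗᵢ[ℝ] X)
    (h k : CS X) : act A (h ⊓ k) = act A h ⊓ act A k := rfl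

include G in
/-- A continuous translation invariant valuation which is multiplied with `c` by unitary maps of
determinant `c`, `c ^ 4 = 1`, vanishes if sufficiently high differences vanish. -/
theorem IsVal.eq_zero_of_ann (hE : ∀ g : G, EE n (rho (Cn n) g) 1) (h1 : 1 < n) (hn : Odd n) (r : ℕ) :
    ∀ {ν : CS (Cn n) → ℂ}, IsVal ν → (∀ A c, EE n A c → ∀ h, IsSupp h → ν (act A h) = c * ν h) →
      Ann ν r → ∀ h, IsSupp h → ν h = 0 := by
  haveI : Nonempty (Fin n) := ⟨⟨0, hn.pos⟩⟩
  haveI : Nontrivial (Cn n) := inferInstance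
  obtain ⟨x, hx⟩ := exists_norm_eq (Cn n) zero_le_one
  have e : Sph (Cn n) := ⟨x, by simpa using hx⟩
  induction r with
  | zero =>
    intro ν hν _ h0 h hh
    simpa [Td_empty] using h0 Fin.elim0 h hh
  | succ r ih =>
    intro ν hν heq h0 h hh
    have hone : ∀ h, IsSupp h → SUVal.dl 1 ν h = 0 := by
      refine ih (hν.dl isSupp_one) (fun A c hA h hh => ?_) fun v h hh => ?_
      · simp only [SUVal.dl]
        rw [← act_add_one, heq A c hA _ (hh.add isSupp_one), heq A c hA _ hh]; ring
      · rw [Td_dl]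
        exact h0.dl_td_eq_zero hν (fun i => seg_mem_ZC _) (one_mem_ZC G) hh
    have hT := hν.frame G h0 heq (EE_neg hn) hone
    refine ih hν heq (fun v h hh => ?_) h hh
    rw [← TL_apply G hν h0 (heq _ _ (EE_neg hn)) (fun i => seg_mem_ZC _) hh]
    exact hT.eq_zero_of_Phi hh.mem_HH (fun p hp => hT.Phi_eq_zero_of_qform hE e
      (fun F hF q => hF.map_dg_eq_zero_of_odd hE h1 hn q) hp hh.mem_HH) v

include G in
theorem IsVal.eq_zero_of_equivariant (hE : ∀ g : G, EE n (rho (Cn n) g) 1) (h1 : 1 < n) (hn : Odd n)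
    {ν : CS (Cn n) → ℂ} (hν : IsVal ν)
    (heq : ∀ A c, EE n A c → ∀ h, IsSupp h → ν (act A h) = c * ν h) {h : CS (Cn n)}
    (hh : IsSupp h) : ν h = 0 := by
  refine hν.eq_zero_of_ann G hE h1 hn (2 * n + 1) heq (fun v h hh => ?_) h hh
  refine hν.td_eq_zero_of_dependent (fun hl => ?_) hh
  have := hl.fintype_card_le_finrank
  rw [finrank_real_of_complex, finrank_euclideanSpace_fin, Fintype.card_fin] at this
  omega

theorem act_trans {X : Type*} [NormedAddCommGroup X] [InnerProductSpace ℝ X] (A B : X ≃ₗᵢ[ℝ] X)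
    (h : CS X) : act (A.trans B) h = act B (act A h) := by
  ext x; simp [act, sAct]

theorem cl_trans (A B : Cn n ≃ₗᵢ[ℂ] Cn n) : cl (A.trans B) = (cl A).trans (cl B) := rfl

include G in
theorem IsVal.sub_act_eq_zero (hE : ∀ g : G, EE n (rho (Cn n) g) 1) (h1 : 1 < n) (hn : Odd n)
    {ν : CS (Cn n) → ℂ} (hν : IsVal ν)
    (hsu : ∀ B : Cn n ≃ₗᵢ[ℂ] Cn n, cdet B = 1 → ∀ h, IsSupp h → ν (act (cl B) h) = ν h)
    (hodd : ∀ h, IsSupp h → ν (act (LinearIsometryEquiv.neg ℝ) h) = -ν h)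
    {D : Cn n ≃ₗᵢ[ℂ] Cn n} (hD : cdet D = Complex.I) {h : CS (Cn n)} (hh : IsSupp h) :
    ν h - Complex.I * ν (act (cl D) h) = 0 := by
  have hdet : ∀ A B : Cn n ≃ₗᵢ[ℂ] Cn n, cdet A = cdet B → ∀ h, IsSupp h →
      ν (act (cl A) h) = ν (act (cl B) h) := fun A B hAB h hh => by
    have h2 : cl A = (cl B).trans (cl (B.symm.trans A)) := by
      ext1 x; simp
    rw [h2, act_trans, hsu _ _ _ (hh.act _)]
    rw [cdet_trans, hAB, mul_comm, cdet_mul_symm]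
  have hneg : ∀ A : Cn n ≃ₗᵢ[ℂ] Cn n, cdet A = -1 → ∀ h, IsSupp h → ν (act (cl A) h) = -ν h :=
    fun A hA h hh => by
      obtain ⟨-, B, hB, hB1⟩ := EE_neg hn
      rw [hdet A B (hA.trans hB1.symm) h hh, ← hB, hodd h hh]
  refine IsVal.eq_zero_of_equivariant G hE h1 hn
    (ν := fun h => ν h - Complex.I * ν (act (cl D) h)) ⟨?_, ?_, ?_⟩ ?_ hh
  · exact hν.cont.sub (continuousOn_const.mul
      (hν.cont.comp (continuous_act _).continuousOn fun h hh => IsSupp.act hh _))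
  · intro h a hh
    rw [hν.trans h a hh, act_add, act_lin, hν.trans _ _ (hh.act _)]
  · intro h k hh hk hhk
    have h3 := hν.val h k hh hk hhk
    have h4 := hν.val _ _ (hh.act (cl D)) (hk.act (cl D)) (by rw [← act_inf]; exact hhk.act _)
    rw [← act_inf, ← act_sup] at h4
    linear_combination h3 - Complex.I * h4
  · rintro _ c ⟨hc, B, rfl, hB⟩ h hh
    rw [← act_trans, ← cl_trans]
    have hI : (c - 1) * (c + 1) * ((c - Complex.I) * (c + Complex.I)) = 0 := by
      linear_combination hc + (1 - c ^ 2) * Complex.I_sq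
    have hBD := cdet_trans B D
    rw [hB, hD] at hBD
    rcases mul_eq_zero.1 hI with h3 | h3 <;> rcases mul_eq_zero.1 h3 with h4 | h4
    · have hc : c = 1 := by linear_combination h4
      subst hc
      rw [hsu B hB h hh, hdet (B.trans D) D (by rw [hBD, hD, one_mul]) h hh, one_mul]
    · have hc : c = -1 := by linear_combination h4
      subst hc
      have h5 : ν (act (cl (B.trans D)) h) = -ν (act (cl D) h) := by
        rw [hdet (B.trans D) (D.trans B) (by rw [cdet_trans, cdet_trans, mul_comm]) h hh, cl_trans,
          act_trans, hneg B hB _ (hh.act _)]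
      rw [hneg B hB h hh, h5]; ring
    · have hc : c = Complex.I := by linear_combination h4
      subst hc
      rw [hdet B D (hB.trans hD.symm) h hh, hneg (B.trans D) (by rw [hBD, Complex.I_mul_I]) h hh]
      linear_combination ν (act (cl D) h) * Complex.I_sq
    · have hc : c = -Complex.I := by linear_combination h4
      subst hc
      obtain ⟨-, N, hN, hN1⟩ := EE_neg hn
      have h5 : ν (act (cl B) h) = -ν (act (cl D) h) := by
        rw [hdet B (D.trans N) (by rw [cdet_trans, hB, hD, hN1]; ring) h hh, cl_trans,
          act_trans, hneg N hN1 _ (hh.act _)]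
      rw [h5, hsu (B.trans D) (by rw [hBD]; linear_combination -Complex.I_sq) h hh]
      linear_combination -ν (act (cl D) h) * Complex.I_sq

include G in
/-- An odd, continuous, translation and `SU(n)` invariant valuation vanishes, if `n` is odd. -/
theorem IsVal.eq_zero_of_odd (hE : ∀ g : G, EE n (rho (Cn n) g) 1) (h1 : 1 < n) (hn : Odd n)
    {ν : CS (Cn n) → ℂ} (hν : IsVal ν)
    (hsu : ∀ B : Cn n ≃ₗᵢ[ℂ] Cn n, cdet B = 1 → ∀ h, IsSupp h → ν (act (cl B) h) = ν h)
    (hodd : ∀ h, IsSupp h → ν (act (LinearIsometryEquiv.neg ℝ) h) = -ν h)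
    {h : CS (Cn n)} (hh : IsSupp h) : ν h = 0 := by
  obtain ⟨w, hw, -⟩ := exists_unit_perp (n := n) hn.pos Fin.elim0
  have hD := cdet_rk w hw Complex.I (by simp)
  have h2 := hν.sub_act_eq_zero G hE h1 hn hsu hodd hD hh
  have hν' : IsVal fun h => (starRingEnd ℂ) (ν h) := by
    refine ⟨Complex.continuous_conj.comp_continuousOn hν.cont, fun h a hh => ?_,
      fun h k hh hk hhk => ?_⟩
    · rw [hν.trans h a hh]
    · simp only [← map_add]
      rw [hν.val h k hh hk hhk]
  have h3 := hν'.sub_act_eq_zero G hE h1 hn (fun B hB h hh => by rw [hsu B hB h hh])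
    (fun h hh => by rw [hodd h hh, map_neg]) hD hh
  have h4 := congrArg (starRingEnd ℂ) h3
  simp only [map_sub, map_mul, Complex.conj_conj, Complex.conj_I, map_zero] at h4
  linear_combination (h2 + h4) / 2

end Vanish

section SU
variable {n : ℕ}

instance : T2Space (Matrix.specialUnitaryGroup (Fin n) ℂ) :=
  inferInstanceAs (T2Space {g : Fin n → Fin n → ℂ // g ∈ Matrix.specialUnitaryGroup (Fin n) ℂ})

instance : SecondCountableTopology (Matrix.specialUnitaryGroup (Fin n) ℂ) :=
  inferInstanceAs (SecondCountableTopology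
    {g : Fin n → Fin n → ℂ // g ∈ Matrix.specialUnitaryGroup (Fin n) ℂ})

instance : MeasurableSpace (Matrix.specialUnitaryGroup (Fin n) ℂ) := borel _

instance : BorelSpace (Matrix.specialUnitaryGroup (Fin n) ℂ) := ⟨rfl⟩

instance : IsTopologicalGroup (Matrix.specialUnitaryGroup (Fin n) ℂ) where
  continuous_inv := (continuous_subtype_val.matrix_conjTranspose).subtype_mk _

instance : CompactSpace (Matrix.specialUnitaryGroup (Fin n) ℂ) := by
  refine isCompact_iff_compactSpace.1 ?_
  have hK : IsCompact (Set.univ.pi fun _ => Set.univ.pi fun _ => Metric.closedBall 0 1 :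
      Set (Fin n → Fin n → ℂ)) :=
    isCompact_univ_pi fun _ => isCompact_univ_pi fun _ => isCompact_closedBall 0 1
  refine hK.of_isClosed_subset (s := {g : Matrix (Fin n) (Fin n) ℂ | _}) ?_ fun g hg => ?_
  · have h : ((Matrix.specialUnitaryGroup (Fin n) ℂ : Set (Matrix (Fin n) (Fin n) ℂ))) =
        {g | g * star g = 1} ∩ {g | g.det = 1} := by
      ext g
      simp [Matrix.mem_specialUnitaryGroup_iff, Matrix.mem_unitaryGroup_iff]
    change IsClosed (Matrix.specialUnitaryGroup (Fin n) ℂ : Set (Matrix (Fin n) (Fin n) ℂ))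
    rw [h]
    exact (isClosed_eq (continuous_id.matrix_mul continuous_id.matrix_conjTranspose)
      continuous_const).inter (isClosed_eq continuous_id.matrix_det continuous_const)
  · intro i _ j _
    rw [mem_closedBall_zero_iff]
    exact entry_norm_bound_of_unitary (Matrix.specialUnitaryGroup_le_unitaryGroup hg) i j

theorem norm_toEuclideanLin {g : Matrix (Fin n) (Fin n) ℂ} (hg : g ∈ Matrix.unitaryGroup (Fin n) ℂ)
    (x : Cn n) : ‖Matrix.toEuclideanLin g x‖ = ‖x‖ := by
  have h : inner ℂ (Matrix.toEuclideanLin g x) (Matrix.toEuclideanLin g x) = inner ℂ x x := by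
    rw [← LinearMap.adjoint_inner_right, ← Matrix.toEuclideanLin_conjTranspose_eq_adjoint,
      ← LinearMap.comp_apply, ← Matrix.toLpLin_mul_same, ← Matrix.star_eq_conjTranspose,
      Matrix.mem_unitaryGroup_iff'.1 hg]
    simp
  rw [complex_inner_self, complex_inner_self] at h
  exact (sq_eq_sq₀ (norm_nonneg _) (norm_nonneg _)).1 (by exact_mod_cast h)

/-- The complex isometry given by a unitary matrix. -/
def ofUnitary (g : Matrix (Fin n) (Fin n) ℂ) (hg : g ∈ Matrix.unitaryGroup (Fin n) ℂ) :
    Cn n ≃ₗᵢ[ℂ] Cn n :=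
  ofNorm (Matrix.toEuclideanLin g) (norm_toEuclideanLin hg)

theorem det_toEuclideanLin (g : Matrix (Fin n) (Fin n) ℂ) :
    LinearMap.det (Matrix.toEuclideanLin g) = g.det := by
  rw [Matrix.toEuclideanLin, Matrix.toLpLin_eq_toLin, LinearMap.det_toLin]

theorem cdet_ofUnitary (g : Matrix (Fin n) (Fin n) ℂ) (hg : g ∈ Matrix.unitaryGroup (Fin n) ℂ) :
    cdet (ofUnitary g hg) = g.det := by
  rw [ofUnitary, cdet_ofNorm, det_toEuclideanLin]

theorem exists_matrix (B : Cn n ≃ₗᵢ[ℂ] Cn n) :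
    ∃ g ∈ Matrix.unitaryGroup (Fin n) ℂ, g.det = cdet B ∧ ∀ x, Matrix.toEuclideanLin g x = B x := by
  obtain ⟨g, hg⟩ := Matrix.toEuclideanLin.surjective (B.toLinearEquiv : Cn n →ₗ[ℂ] Cn n)
  have hgx : ∀ x, Matrix.toEuclideanLin g x = B x := fun x => by rw [hg]; rfl
  refine ⟨g, ?_, by rw [← det_toEuclideanLin, hg]; rfl, hgx⟩
  rw [Matrix.mem_unitaryGroup_iff', Matrix.star_eq_conjTranspose]
  apply Matrix.toEuclideanLin.injective
  rw [Matrix.toLpLin_mul_same, Matrix.toEuclideanLin_conjTranspose_eq_adjoint]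
  refine LinearMap.ext fun x => ext_inner_left ℂ fun y => ?_
  rw [LinearMap.comp_apply, LinearMap.adjoint_inner_right, hgx, hgx, B.inner_map_map]
  simp

theorem norm_cdet (B : Cn n ≃ₗᵢ[ℂ] Cn n) : ‖cdet B‖ = 1 := by
  obtain ⟨g, hg, hd, -⟩ := exists_matrix B
  rw [← hd]
  exact CStarRing.norm_of_mem_unitary (Matrix.det_of_mem_unitary hg)

theorem exists_cdet_one (hn : 2 ≤ n) (x y : Sph (Cn n)) :
    ∃ B : Cn n ≃ₗᵢ[ℂ] Cn n, cdet B = 1 ∧ B x = y := by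
  have hb : ∀ x : Sph (Cn n), ∃ b : OrthonormalBasis (Fin n) ℂ (Cn n), b ⟨0, by omega⟩ = x := by
    intro x
    have h : Orthonormal ℂ (({⟨0, by omega⟩} : Set (Fin n)).domRestrict fun _ => (x : Cn n)) :=
      ⟨fun _ => norm_sph x, fun i j hij => (hij (Subsingleton.elim i j)).elim⟩
    obtain ⟨b, hb⟩ := h.exists_orthonormalBasis_extension_of_card_eq (by simp)
    exact ⟨b, hb _ rfl⟩
  obtain ⟨b, hbx⟩ := hb x
  obtain ⟨c, hcy⟩ := hb y
  set A := b.equiv c (Equiv.refl _)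
  have hA : A x = y := by rw [← hbx, ← hcy]; simp [A]
  obtain ⟨w, hw, hwy⟩ := exists_unit_perp (n := n) (k := 1) (by omega) fun _ => (y : Cn n)
  have hd : ‖(cdet A)⁻¹‖ = 1 := by rw [norm_inv, norm_cdet, inv_one]
  refine ⟨A.trans (rk w hw _ hd), ?_, ?_⟩
  · rw [cdet_trans, cdet_rk, mul_inv_cancel₀ (norm_ne_zero_iff.1 (by simp [norm_cdet]))]
  · rw [LinearIsometryEquiv.trans_apply, hA, rk_apply, hwy 0]; simp

/-- The defining representation of the special unitary group. -/
@[reducible] def suRep (hn : 2 ≤ n) : SphRep (Matrix.specialUnitaryGroup (Fin n) ℂ) (Cn n) where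
  hom :=
    { toFun := fun g => cl (ofUnitary g.1 (Matrix.specialUnitaryGroup_le_unitaryGroup g.2))
      map_one' := by ext1 x; simp [ofUnitary, ofNorm_apply]
      map_mul' := fun g h => by ext1 x; simp [ofUnitary, ofNorm_apply, Matrix.toLpLin_mul_same] }
  cont := by
    have h : Continuous fun p : Matrix.specialUnitaryGroup (Fin n) ℂ × Cn n =>
        (WithLp.toLp 2 (p.1.1.mulVec p.2.ofLp) : Cn n) := by
      refine (PiLp.continuous_toLp 2 _).comp
        ((continuous_subtype_val.comp continuous_fst).matrix_mulVec
        ((PiLp.continuous_ofLp 2 _).comp continuous_snd))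
    exact h
  trans x y := by
    obtain ⟨B, hB, hxy⟩ := exists_cdet_one hn x y
    obtain ⟨g, hg, hd, hgB⟩ := exists_matrix B
    exact ⟨⟨g, Matrix.mem_specialUnitaryGroup_iff.2 ⟨hg, hd.trans hB⟩⟩, (hgB x).trans hxy⟩
  inj g h hgh := by
    refine Subtype.ext (Matrix.toEuclideanLin.injective (LinearMap.ext fun x => ?_))
    exact congrArg (fun A : Cn n ≃ₗᵢ[ℝ] Cn n => A x) hgh

end SU

section Body
variable {X : Type*} [NormedAddCommGroup X] [InnerProductSpace ℝ X] [FiniteDimensional ℝ X]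
  [Nontrivial X]

theorem coe_body_act (A : X ≃ₗᵢ[ℝ] X) {h : CS X} (hh : IsSupp h) :
    (body (act A h) : Set X) = A '' (body h : Set X) := by
  rw [coe_body (hh.act A), coe_body hh]
  ext y
  constructor
  · intro hy
    refine ⟨A.symm y, fun u => ?_, A.apply_symm_apply y⟩
    have := hy (sAct A u)
    rw [act_apply] at this
    rw [← A.inner_map_map, A.apply_symm_apply]
    refine this.trans_eq (congrArg h (Subtype.ext (A.symm_apply_apply _)))
  · rintro ⟨z, hz, rfl⟩ u
    rw [act_apply]
    have h1 : ⟪A z, (u : X)⟫ = ⟪z, A.symm u⟫ := by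
      rw [← A.inner_map_map z, A.apply_symm_apply]
    rw [h1]
    exact hz (sAct A.symm u)

end Body

section Odd
variable {n : ℕ}

theorem eq_act_neg_of_odd (h2 : 2 ≤ n) (hn : Odd n) {ν : CS (Cn n) → ℂ} (hν : IsVal ν)
    (hsu : ∀ B : Cn n ≃ₗᵢ[ℂ] Cn n, cdet B = 1 → ∀ h, IsSupp h → ν (act (cl B) h) = ν h)
    {h : CS (Cn n)} (hh : IsSupp h) : ν (act (LinearIsometryEquiv.neg ℝ) h) = ν h := by
  let := suRep h2
  have hnn : ∀ h : CS (Cn n), act (LinearIsometryEquiv.neg ℝ)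
      (act (LinearIsometryEquiv.neg ℝ) h) = h := fun h => by
    rw [← act_trans]; ext x; simp [act_apply, sAct]
  have hν' : IsVal fun h => ν (act (LinearIsometryEquiv.neg ℝ) h) - ν h := by
    refine ⟨(hν.cont.comp (continuous_act _).continuousOn fun h hh => IsSupp.act hh _).sub hν.cont,
      fun h a hh => ?_, fun h k hh hk hhk => ?_⟩
    · rw [hν.trans h a hh, act_add, act_lin, hν.trans _ _ (hh.act _)]
    · have h3 := hν.val h k hh hk hhk
      have h4 := hν.val _ _ (hh.act (LinearIsometryEquiv.neg ℝ)) (hk.act (LinearIsometryEquiv.neg ℝ))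
        (by rw [← act_inf]; exact hhk.act _)
      rw [← act_inf, ← act_sup] at h4
      linear_combination h4 - h3
  refine sub_eq_zero.1 (hν'.eq_zero_of_odd (Matrix.specialUnitaryGroup (Fin n) ℂ) (fun g => ?_)
    (by omega) hn (fun B hB h hh => ?_) (fun h hh => ?_) hh)
  · exact ⟨by norm_num, _, rfl, (cdet_ofUnitary _ _).trans
      (Matrix.mem_specialUnitaryGroup_iff.1 g.2).2⟩
  · have h3 : act (LinearIsometryEquiv.neg ℝ) (act (cl B) h) =
        act (cl B) (act (LinearIsometryEquiv.neg ℝ) h) := by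
      rw [← act_trans, ← act_trans]
      congr 1
      ext1 x; simp
    simp only [h3, hsu B hB _ (hh.act _), hsu B hB _ hh]
  · simp only [hnn]; ring

end Odd

end SUVal

/-- Every continuous, translation invariant, `SU(n)`-invariant valuation on `ℂⁿ` is even:
`μ (-K) = μ K`. -/
theorem suValuation_even (n : ℕ) (hn : 2 ≤ n) (μ : ConvexBody (Cn n) → ℂ)
    (h1 : IsValuation μ) (h2 : Continuous μ) (h3 : TranslationInvariant μ)
    (h4 : SUInvariant μ) :
    ∀ K L : ConvexBody (Cn n),
      (L : Set (Cn n)) = (fun y => -y) '' (K : Set (Cn n)) → μ L = μ K := by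
  intro K L hL
  have : NeZero n := ⟨by omega⟩
  have : Nontrivial (Cn n) := inferInstance
  rcases Nat.even_or_odd n with he | ho
  · refine h4 (-1) (Matrix.mem_specialUnitaryGroup_iff.2 ⟨?_, ?_⟩) K L ?_
    · rw [Matrix.mem_unitaryGroup_iff]; simp
    · rw [Matrix.det_neg]; simp [he.neg_one_pow]
    · rw [hL]; simp [map_neg]
  · have hν := SUVal.isVal_comp_body h1 h2 h3
    have h := SUVal.eq_act_neg_of_odd hn ho hν (fun B hB h hh => ?_) (SUVal.isSupp_suppFn K)
    · rw [SUVal.body_suppFn] at h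
      rw [← h]
      congr 1
      refine ConvexBody.ext ?_
      rw [SUVal.coe_body_act _ (SUVal.isSupp_suppFn K), SUVal.body_suppFn, hL]
      rfl
    · obtain ⟨g, hg, hd, hgB⟩ := SUVal.exists_matrix B
      refine h4 g (Matrix.mem_specialUnitaryGroup_iff.2 ⟨hg, hd.trans hB⟩) _ _ ?_
      rw [SUVal.coe_body_act _ hh]
      exact Set.image_congr fun x _ => (hgB x).symm

end
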